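/- For every integer t there exists an integer Ψ = Ψ(t) such that the following holds: if G ∈ C_tt, (T,χ) is a structured tree decomposition of G, v is a node of T, and Y ⊆ χ(v) ∖ Hub(G) is a stable set, then |Y| ≤ Ψ. -/

import Mathlib

open Set

/-- `f` enumerates an induced path on `n` vertices in `G`. -/
def IsPathEmb {α : Type} (G : SimpleGraph α) (n : ℕ) (f : Fin n → α) : Prop :=
  Function.Injective f ∧
    ∀ i j : Fin n, G.Adj (f i) (f j) ↔ (i.val = j.val + 1 ∨ j.val = i.val + 1)

/-- `f` enumerates an induced path from `a` to `b`. -/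
def IsPathFromTo {α : Type} (G : SimpleGraph α) (n : ℕ) (f : Fin n → α) (a b : α) : Prop :=
  IsPathEmb G n f ∧ ∃ h : 1 ≤ n, f ⟨0, h⟩ = a ∧ f ⟨n - 1, by omega⟩ = b

/-- The interior (internal vertices) of the path enumerated by `f`. -/
def pathInterior {α : Type} (n : ℕ) (f : Fin n → α) : Set α :=
  {v | ∃ j : Fin n, 0 < j.val ∧ j.val < n - 1 ∧ f j = v}

/-- `k` pairwise internally vertex-disjoint induced paths from `a` to `b` in `G`. -/
def KDisjointPaths {α : Type} (G : SimpleGraph α) (k : ℕ) (a b : α) : Prop :=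
  ∃ (n : Fin k → ℕ) (f : ∀ i, Fin (n i) → α),
    (∀ i, IsPathFromTo G (n i) (f i) a b) ∧
    (∀ i j, i ≠ j → Disjoint (pathInterior (n i) (f i)) (pathInterior (n j) (f j)))

/-- `f` enumerates an induced cycle on `n` vertices. -/
def IsHoleEmb {α : Type} (G : SimpleGraph α) (n : ℕ) (f : ZMod n → α) : Prop :=
  Function.Injective f ∧ ∀ i j : ZMod n, G.Adj (f i) (f j) ↔ (i = j + 1 ∨ j = i + 1)

/-- `H` is the vertex set of a hole of `G` (an induced cycle with at least 4 vertices). -/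
def IsHole {α : Type} (G : SimpleGraph α) (H : Set α) : Prop :=
  ∃ (n : ℕ) (f : ZMod n → α), 4 ≤ n ∧ IsHoleEmb G n f ∧ Set.range f = H

/-- `G` has no even hole. -/
def EvenHoleFree {α : Type} (G : SimpleGraph α) : Prop :=
  ∀ H : Set α, IsHole G H → ¬ Even H.ncard

def Anticomplete {α : Type} (G : SimpleGraph α) (A B : Set α) : Prop :=
  ∀ a ∈ A, ∀ b ∈ B, ¬ G.Adj a b

/-- `X` is a stable (independent) set of `G`. -/
def StableSet {α : Type} (G : SimpleGraph α) (X : Set α) : Prop :=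
  ∀ a ∈ X, ∀ b ∈ X, a ≠ b → ¬ G.Adj a b

/-- The open neighborhood of the set `A`. -/
def setNbhd {α : Type} (G : SimpleGraph α) (A : Set α) : Set α :=
  {v | v ∉ A ∧ ∃ a ∈ A, G.Adj v a}

/-- The set `A` induces a connected (nonempty) subgraph of `G`. -/
def ConnSet {α : Type} (G : SimpleGraph α) (A : Set α) : Prop :=
  (G.induce A).Connected

/-- `D` is a connected component of the subgraph of `G` induced by `S`. -/
def IsCompOf {α : Type} (G : SimpleGraph α) (S D : Set α) : Prop :=
  D ⊆ S ∧ ConnSet G D ∧ ∀ D', D ⊆ D' → D' ⊆ S → ConnSet G D' → D' = D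

/-- `G` contains an (induced) theta. -/
def HasTheta {α : Type} (G : SimpleGraph α) : Prop :=
  ∃ (a b : α) (n : Fin 3 → ℕ) (f : ∀ i, Fin (n i) → α),
    a ≠ b ∧ ¬ G.Adj a b ∧ (∀ i, 3 ≤ n i) ∧
    (∀ i, IsPathFromTo G (n i) (f i) a b) ∧
    (∀ i j : Fin 3, i ≠ j → ∀ (u : Fin (n i)) (v : Fin (n j)),
      0 < u.val → u.val < n i - 1 → 0 < v.val → v.val < n j - 1 →
      f i u ≠ f j v ∧ ¬ G.Adj (f i u) (f j v))

/-- `G` contains an (induced) prism. -/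
def HasPrism {α : Type} (G : SimpleGraph α) : Prop :=
  ∃ (n : Fin 3 → ℕ) (f : ∀ i, Fin (n i) → α),
    (∀ i, 2 ≤ n i) ∧ (∀ i, IsPathEmb G (n i) (f i)) ∧
    (∀ i j : Fin 3, i ≠ j → ∀ u v, f i u ≠ f j v) ∧
    (∀ i j : Fin 3, i ≠ j → ∀ (u : Fin (n i)) (v : Fin (n j)),
      G.Adj (f i u) (f j v) ↔
        ((u.val = 0 ∧ v.val = 0) ∨ (u.val = n i - 1 ∧ v.val = n j - 1)))

/-- The neighbors of `x` in the hole `H`. -/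
def holeNbrs {α : Type} (G : SimpleGraph α) (H : Set α) (x : α) : Set α :=
  {v ∈ H | G.Adj x v}

def IsWheel {α : Type} (G : SimpleGraph α) (H : Set α) (x : α) : Prop :=
  IsHole G H ∧ x ∉ H ∧ 3 ≤ (holeNbrs G H x).ncard

def IsTwinWheel {α : Type} (G : SimpleGraph α) (H : Set α) (x : α) : Prop :=
  IsWheel G H x ∧ ∃ p q r : α, p ≠ q ∧ q ≠ r ∧ p ≠ r ∧
    holeNbrs G H x = {p, q, r} ∧ G.Adj p q ∧ G.Adj q r ∧ ¬ G.Adj p r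

def IsShortPyramid {α : Type} (G : SimpleGraph α) (H : Set α) (x : α) : Prop :=
  IsWheel G H x ∧ ∃ p q r : α, p ≠ q ∧ q ≠ r ∧ p ≠ r ∧
    holeNbrs G H x = {p, q, r} ∧ G.Adj p q ∧ ¬ G.Adj q r ∧ ¬ G.Adj p r

def IsProperWheel {α : Type} (G : SimpleGraph α) (H : Set α) (x : α) : Prop :=
  IsWheel G H x ∧ ¬ IsTwinWheel G H x ∧ ¬ IsShortPyramid G H x

/-- `x` is a hub of the induced subgraph `G[W]`. -/
def IsHubIn {α : Type} (G : SimpleGraph α) (W : Set α) (x : α) : Prop :=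
  x ∈ W ∧ ∃ H : Set α, H ⊆ W ∧ IsProperWheel G H x

/-- `x` is a hub of `G`: the center of some proper wheel. -/
def IsHub {α : Type} (G : SimpleGraph α) (x : α) : Prop :=
  ∃ H : Set α, IsProperWheel G H x

/-- membership in the class `𝒞` of (C₄, theta, prism, even wheel)-free graphs. -/
def MemC {α : Type} (G : SimpleGraph α) : Prop :=
  (∀ H : Set α, IsHole G H → H.ncard ≠ 4) ∧ ¬ HasTheta G ∧ ¬ HasPrism G ∧
    (∀ (H : Set α) (x : α), IsWheel G H x → ¬ Even (holeNbrs G H x).ncard)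

/-- membership in the class `𝒞ₜ`: graphs in `𝒞` with no clique of size `t`. -/
def MemCt {α : Type} (t : ℕ) (G : SimpleGraph α) : Prop :=
  MemC G ∧ G.CliqueFree t

/-- `G` contains a generalized `k`-pyramid as an induced subgraph. -/
def ContainsGenPyramid {α : Type} (G : SimpleGraph α) (k : ℕ) : Prop :=
  ∃ (nP nQ : ℕ) (P : Fin nP → α) (Q : Fin nQ → α)
    (m : Fin k → ℕ) (R : ∀ i, Fin (m i) → α) (xI zI : Fin k → ℕ),
    4 ≤ nP + nQ ∧ 1 ≤ nP ∧ 1 ≤ nQ ∧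
    IsPathEmb G nP P ∧ IsPathEmb G nQ Q ∧
    (∀ i j, P i ≠ Q j) ∧
    (∀ (i : Fin nP) (j : Fin nQ), G.Adj (P i) (Q j) ↔
      ((i.val = 0 ∧ j.val = 0) ∨ (i.val = nP - 1 ∧ j.val = nQ - 1))) ∧
    (∀ i, 1 ≤ m i) ∧ (∀ i, IsPathEmb G (m i) (R i)) ∧
    (∀ i u j, R i u ≠ P j) ∧ (∀ i u j, R i u ≠ Q j) ∧
    (∀ i i', i ≠ i' → ∀ u u', R i u ≠ R i' u' ∧ ¬ G.Adj (R i u) (R i' u')) ∧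
    (∀ i, 0 < xI i ∧ xI i + 1 < nP - 1) ∧
    (∀ (i : Fin k) (u : Fin (m i)) (j : Fin nP), G.Adj (R i u) (P j) ↔
      (u.val = 0 ∧ (j.val = xI i ∨ j.val = xI i + 1))) ∧
    (∀ i, zI i < nQ) ∧
    (∀ (i : Fin k) (u : Fin (m i)) (j : Fin nQ), G.Adj (R i u) (Q j) ↔
      (u.val = m i - 1 ∧ j.val = zI i)) ∧
    (∀ i i' : Fin k, i < i' → xI i + 1 < xI i') ∧
    (∀ i i' : Fin k, i ≤ i' → zI i ≤ zI i')

/-- membership in the class `𝒞ₜₜ`: graphs in `𝒞ₜ` with no induced generalized `t`-pyramid. -/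
def MemCtt {α : Type} (t : ℕ) (G : SimpleGraph α) : Prop :=
  MemCt t G ∧ ¬ ContainsGenPyramid G t

/-- `(T, χ)` is a tree decomposition of `G`. -/
structure IsTD {α ι : Type} (G : SimpleGraph α) (T : SimpleGraph ι) (χ : ι → Set α) : Prop where
  finite : Finite ι
  isTree : T.IsTree
  memBag : ∀ v : α, ∃ t, v ∈ χ t
  edgeBag : ∀ ⦃u v : α⦄, G.Adj u v → ∃ t, u ∈ χ t ∧ v ∈ χ t
  subtree : ∀ v : α, (T.induce {t | v ∈ χ t}).Connected

/-- `G` has a tree decomposition of width at most `w`. -/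
def TwLE {α : Type} (G : SimpleGraph α) (w : ℕ) : Prop :=
  ∃ (ι : Type) (T : SimpleGraph ι) (χ : ι → Set α),
    IsTD G T χ ∧ ∀ t, (χ t).ncard ≤ w + 1

/-- The treewidth of `G`. -/
noncomputable def treeWidth {α : Type} (G : SimpleGraph α) : ℕ :=
  sInf {w | TwLE G w}

/-- For adjacent `t, t'` in a tree `T`, the vertex set of the component of `T - t`
containing `t'`. -/
def branchSet {ι : Type} (T : SimpleGraph ι) (t t' : ι) : Set ι :=
  {s | ∀ w : T.Walk s t, t' ∈ w.support}

/-- The vertex set of `G_{t → t'}`: the union of the bags over the component of `T - t`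
containing `t'`. -/
def sideSet {α ι : Type} (T : SimpleGraph ι) (χ : ι → Set α) (t t' : ι) : Set α :=
  ⋃ s ∈ branchSet T t t', χ s

/-- `(T, χ)` is a tight tree decomposition of `G`. -/
def TightTD {α ι : Type} (G : SimpleGraph α) (T : SimpleGraph ι) (χ : ι → Set α) : Prop :=
  IsTD G T χ ∧ ∀ ⦃t t' : ι⦄, T.Adj t t' →
    ∃ D, IsCompOf G (sideSet T χ t t' \ χ t) D ∧ setNbhd G D = χ t ∩ χ t'

/-- `G` admits a clique cutset. -/
def HasCliqueCutset {α : Type} (G : SimpleGraph α) : Prop :=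
  ∃ C : Set α, G.IsClique C ∧ ¬ (G.induce (Set.univ \ C)).Preconnected

/-- `G` is chordal: it has no hole. -/
def ChordalG {α : Type} (G : SimpleGraph α) : Prop := ∀ H : Set α, ¬ IsHole G H

/-- `G'` is a minimal chordal completion of `G`. -/
def IsMinChordalCompletion {α : Type} (G G' : SimpleGraph α) : Prop :=
  G ≤ G' ∧ ChordalG G' ∧ ∀ G'', G ≤ G'' → G'' ≤ G' → ChordalG G'' → G'' = G'

/-- `Ω` is a potential maximal clique of `G` : a maximal clique of some minimal chordal
completion of `G`. -/
def IsPMC {α : Type} (G : SimpleGraph α) (Ω : Set α) : Prop :=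
  ∃ G' : SimpleGraph α, IsMinChordalCompletion G G' ∧ G'.IsClique Ω ∧
    ∀ Ω' : Set α, G'.IsClique Ω' → Ω ⊆ Ω' → Ω' = Ω

/-- `(T, χ)` is a structured tree decomposition: every bag is a PMC of `G`. -/
def StructuredTD {α ι : Type} (G : SimpleGraph α) (T : SimpleGraph ι) (χ : ι → Set α) : Prop :=
  IsTD G T χ ∧ ∀ t, IsPMC G (χ t)

/-- the decomposition has adhesion less than `m`. -/
def AdhLT {α ι : Type} (T : SimpleGraph ι) (χ : ι → Set α) (m : ℕ) : Prop :=
  ∀ ⦃t t' : ι⦄, T.Adj t t' → (χ t ∩ χ t').ncard < m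

/-- `fatness χ i` is the number of bags of size `i`. -/
noncomputable def fatness {α ι : Type} (χ : ι → Set α) (i : ℕ) : ℕ :=
  {t : ι | (χ t).ncard = i}.ncard

/-- Lexicographic comparison of fatness vectors `(aₙ, …, a₀)` (larger sizes more
significant). -/
def FatLexLE (f g : ℕ → ℕ) : Prop :=
  (∀ i, f i = g i) ∨ ∃ j, f j < g j ∧ ∀ i, j < i → f i = g i

/-- `(T, χ)` is an `m`-atomic tree decomposition of `G`: its adhesion is less than `m` and its
fatness is lexicographically minimum among all tree decompositions with adhesion less than `m`. -/
def IsAtomicTD {α ι : Type} (m : ℕ) (G : SimpleGraph α) (T : SimpleGraph ι)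
    (χ : ι → Set α) : Prop :=
  IsTD G T χ ∧ AdhLT T χ m ∧
    ∀ (ι' : Type) (T' : SimpleGraph ι') (χ' : ι' → Set α),
      IsTD G T' χ' → AdhLT T' χ' m → FatLexLE (fatness χ) (fatness χ')

/-- Adjacency in the torso at the node `x` of the tree decomposition. -/
def torsoAdj {α ι : Type} (G : SimpleGraph α) (T : SimpleGraph ι) (χ : ι → Set α)
    (x : ι) (u v : α) : Prop :=
  u ∈ χ x ∧ v ∈ χ x ∧ u ≠ v ∧
    (G.Adj u v ∨ ∃ y, T.Adj x y ∧ u ∈ χ y ∧ v ∈ χ y)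

/-- The degree of `u` in the torso at `x`. -/
noncomputable def torsoDeg {α ι : Type} (G : SimpleGraph α) (T : SimpleGraph ι)
    (χ : ι → Set α) (x : ι) (u : α) : ℕ :=
  {v | torsoAdj G T χ x u v}.ncard

/-- `u` and `v` lie in the same component of `G[S]`. -/
def SameComp {α : Type} (G : SimpleGraph α) (S : Set α) (u v : α) : Prop :=
  ∃ (hu : u ∈ S) (hv : v ∈ S), (G.induce S).Reachable ⟨u, hu⟩ ⟨v, hv⟩

/-- `X` is a minimal separator of `G`. -/
def IsMinimalSeparator {α : Type} (G : SimpleGraph α) (X : Set α) : Prop :=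
  ∃ u v : α, u ∉ X ∧ v ∉ X ∧ ¬ SameComp G (Set.univ \ X) u v ∧
    ∀ Y : Set α, Y ⊂ X → SameComp G (Set.univ \ Y) u v
/-- The degree of `v` in `H` (as the cardinality of its neighbor set). -/
noncomputable def degreeSet {α : Type} (H : SimpleGraph α) (v : α) : ℕ :=
  (H.neighborSet v).ncard

/-- `H` is a path (as a graph). -/
def IsPathGraph {α : Type} (H : SimpleGraph α) : Prop :=
  ∃ (n : ℕ) (f : Fin n → α), Function.Bijective f ∧
    ∀ i j, H.Adj (f i) (f j) ↔ (i.val = j.val + 1 ∨ j.val = i.val + 1)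

/-- `H` is a caterpillar: a tree of maximum degree three having a path containing all
branch vertices. -/
def IsCaterpillar {α : Type} (H : SimpleGraph α) : Prop :=
  H.IsTree ∧ (∀ v, degreeSet H v ≤ 3) ∧
    ∃ (n : ℕ) (f : Fin n → α), IsPathEmb H n f ∧
      ∀ v, 2 < degreeSet H v → v ∈ Set.range f

/-- `H` is a subdivided star: a tree with exactly one branch vertex (its root), of degree
at least 3. -/
def IsSubdividedStar {α : Type} (H : SimpleGraph α) : Prop :=
  H.IsTree ∧ ∃! r, 2 < degreeSet H r

/-- `H` is (isomorphic to) the line graph of a caterpillar. -/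
def IsLineGraphOfCaterpillar {α : Type} (H : SimpleGraph α) : Prop :=
  ∃ (β : Type) (C : SimpleGraph β), IsCaterpillar C ∧
    Nonempty (SimpleGraph.Iso H C.lineGraph)

/-- `w` is a simplicial vertex of the induced subgraph `G[W]`. -/
def SimplicialIn {α : Type} (G : SimpleGraph α) (W : Set α) (w : α) : Prop :=
  w ∈ W ∧ G.IsClique {u | u ∈ W ∧ G.Adj w u}

/-- `(p, x)` is an alignment: `p` enumerates an induced path, `x` enumerates the set `X`
in the order given by the alignment. -/
structure IsAlignment {α : Type} (G : SimpleGraph α) (n : ℕ) (p : Fin n → α)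
    (k : ℕ) (x : Fin k → α) : Prop where
  hn : 1 ≤ n
  hk : 2 ≤ k
  path : IsPathEmb G n p
  injx : Function.Injective x
  disj : ∀ i j, x i ≠ p j
  cover : ∀ i, ∃ j, G.Adj (x i) (p j)
  first : ∀ j : Fin n, G.Adj (x ⟨0, by omega⟩) (p j) ↔ j.val = 0
  last : ∀ j : Fin n, G.Adj (x ⟨k - 1, by omega⟩) (p j) ↔ j.val = n - 1
  ordered : ∀ (i i' : Fin k) (j j' : Fin n),
    i < i' → G.Adj (x i) (p j) → G.Adj (x i') (p j') → j < j'

/-- A wide alignment: every middle vertex of `X` has two non-adjacent neighbors in `P`. -/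
def IsWideAlignment {α : Type} (G : SimpleGraph α) (n : ℕ) (p : Fin n → α)
    (k : ℕ) (x : Fin k → α) : Prop :=
  IsAlignment G n p k x ∧ ∀ i : Fin k, 0 < i.val → i.val < k - 1 →
    ∃ j j' : Fin n, j.val + 1 < j'.val ∧ G.Adj (x i) (p j) ∧ G.Adj (x i) (p j')

/-- A spiky alignment: every middle vertex of `X` has a unique neighbor in `P`. -/
def IsSpikyAlignment {α : Type} (G : SimpleGraph α) (n : ℕ) (p : Fin n → α)
    (k : ℕ) (x : Fin k → α) : Prop :=
  IsAlignment G n p k x ∧ ∀ i : Fin k, 0 < i.val → i.val < k - 1 →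
    ∃! j : Fin n, G.Adj (x i) (p j)

/-- A triangular alignment: every middle vertex of `X` has exactly two neighbors in `P`,
and they are adjacent. -/
def IsTriangularAlignment {α : Type} (G : SimpleGraph α) (n : ℕ) (p : Fin n → α)
    (k : ℕ) (x : Fin k → α) : Prop :=
  IsAlignment G n p k x ∧ ∀ i : Fin k, 0 < i.val → i.val < k - 1 →
    ∃ j : Fin n, j.val + 1 < n ∧
      ∀ j' : Fin n, G.Adj (x i) (p j') ↔ (j'.val = j.val ∨ j'.val = j.val + 1)

/-- `(H, x)` is a spiky connectifier: `H` is an induced caterpillar with spine `p` and legs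
`ℓ`, and `x` enumerates `X` in the order given by the connectifier (`x 0` and `x (k-1)`
attached at the ends of the spine, the others to the tips of the legs, in the order in which
the legs attach along the spine). -/
def IsSpikyConnectifier {α : Type} (G : SimpleGraph α) (H : Set α)
    (k : ℕ) (x : Fin k → α) : Prop :=
  ∃ (hk : 2 ≤ k) (n : ℕ) (_ : 2 ≤ n) (p : Fin n → α)
    (m : Fin (k - 2) → ℕ) (ℓ : ∀ i, Fin (m i) → α) (a : Fin (k - 2) → ℕ),
    IsPathEmb G n p ∧ (∀ i, 1 ≤ m i) ∧ (∀ i, IsPathEmb G (m i) (ℓ i)) ∧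
    H = Set.range p ∪ ⋃ i, Set.range (ℓ i) ∧
    Function.Injective x ∧ (∀ i, x i ∉ H) ∧
    (∀ i j j', ℓ i j ≠ p j') ∧
    (∀ i i', i ≠ i' → ∀ j j', ℓ i j ≠ ℓ i' j' ∧ ¬ G.Adj (ℓ i j) (ℓ i' j')) ∧
    (∀ i, 0 < a i ∧ a i < n - 1) ∧
    (∀ i i', i < i' → a i < a i') ∧
    (∀ (i : Fin (k - 2)) (j : Fin (m i)) (j' : Fin n),
      G.Adj (ℓ i j) (p j') ↔ (j.val = 0 ∧ j'.val = a i)) ∧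
    (∀ j : Fin n, G.Adj (x ⟨0, by omega⟩) (p j) ↔ j.val = 0) ∧
    (∀ (i : Fin (k - 2)) (j : Fin (m i)), ¬ G.Adj (x ⟨0, by omega⟩) (ℓ i j)) ∧
    (∀ j : Fin n, G.Adj (x ⟨k - 1, by omega⟩) (p j) ↔ j.val = n - 1) ∧
    (∀ (i : Fin (k - 2)) (j : Fin (m i)), ¬ G.Adj (x ⟨k - 1, by omega⟩) (ℓ i j)) ∧
    (∀ (i : Fin (k - 2)) (j : Fin n),
      ¬ G.Adj (x ⟨i.val + 1, by have := i.isLt; omega⟩) (p j)) ∧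
    (∀ (i i' : Fin (k - 2)) (j : Fin (m i')),
      G.Adj (x ⟨i.val + 1, by have := i.isLt; omega⟩) (ℓ i' j) ↔ (i' = i ∧ j.val = m i' - 1))

/-- `(H, x)` is a triangular connectifier: `H` is the line graph of a caterpillar, with
spine `p` and legs `ℓ` attached along triangles, and `x` enumerates `X` in the order given
by the connectifier. -/
def IsTriangularConnectifier {α : Type} (G : SimpleGraph α) (H : Set α)
    (k : ℕ) (x : Fin k → α) : Prop :=
  ∃ (hk : 2 ≤ k) (n : ℕ) (_ : 2 ≤ n) (p : Fin n → α)
    (m : Fin (k - 2) → ℕ) (ℓ : ∀ i, Fin (m i) → α) (a : Fin (k - 2) → ℕ),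
    IsPathEmb G n p ∧ (∀ i, 1 ≤ m i) ∧ (∀ i, IsPathEmb G (m i) (ℓ i)) ∧
    H = Set.range p ∪ ⋃ i, Set.range (ℓ i) ∧
    Function.Injective x ∧ (∀ i, x i ∉ H) ∧
    (∀ i j j', ℓ i j ≠ p j') ∧
    (∀ i i', i ≠ i' → ∀ j j', ℓ i j ≠ ℓ i' j' ∧ ¬ G.Adj (ℓ i j) (ℓ i' j')) ∧
    (∀ i, a i + 1 ≤ n - 1) ∧
    (∀ i i', i < i' → a i < a i') ∧
    (∀ (i : Fin (k - 2)) (j : Fin (m i)) (j' : Fin n),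
      G.Adj (ℓ i j) (p j') ↔ (j.val = 0 ∧ (j'.val = a i ∨ j'.val = a i + 1))) ∧
    (∀ j : Fin n, G.Adj (x ⟨0, by omega⟩) (p j) ↔ j.val = 0) ∧
    (∀ (i : Fin (k - 2)) (j : Fin (m i)), ¬ G.Adj (x ⟨0, by omega⟩) (ℓ i j)) ∧
    (∀ j : Fin n, G.Adj (x ⟨k - 1, by omega⟩) (p j) ↔ j.val = n - 1) ∧
    (∀ (i : Fin (k - 2)) (j : Fin (m i)), ¬ G.Adj (x ⟨k - 1, by omega⟩) (ℓ i j)) ∧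
    (∀ (i : Fin (k - 2)) (j : Fin n),
      ¬ G.Adj (x ⟨i.val + 1, by have := i.isLt; omega⟩) (p j)) ∧
    (∀ (i i' : Fin (k - 2)) (j : Fin (m i')),
      G.Adj (x ⟨i.val + 1, by have := i.isLt; omega⟩) (ℓ i' j) ↔ (i' = i ∧ j.val = m i' - 1))

/-- `(H, x)` is a stellar connectifier: `H` is an induced subdivided star with root `r` and
legs `ℓ`, and the vertices of `X` are attached to the tips of the legs. -/
def IsStellarConnectifier {α : Type} (G : SimpleGraph α) (H : Set α)
    (k : ℕ) (x : Fin k → α) : Prop :=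
  ∃ (_ : 3 ≤ k) (r : α) (m : Fin k → ℕ) (ℓ : ∀ i, Fin (m i) → α),
    (∀ i, 1 ≤ m i) ∧ (∀ i, IsPathEmb G (m i) (ℓ i)) ∧
    H = {r} ∪ ⋃ i, Set.range (ℓ i) ∧
    Function.Injective x ∧ (∀ i, x i ∉ H) ∧
    (∀ i j, ℓ i j ≠ r) ∧
    (∀ i i', i ≠ i' → ∀ j j', ℓ i j ≠ ℓ i' j' ∧ ¬ G.Adj (ℓ i j) (ℓ i' j')) ∧
    (∀ (i : Fin k) (j : Fin (m i)), G.Adj r (ℓ i j) ↔ j.val = 0) ∧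
    (∀ i, ¬ G.Adj (x i) r) ∧
    (∀ (i i' : Fin k) (j : Fin (m i')),
      G.Adj (x i) (ℓ i' j) ↔ (i' = i ∧ j.val = m i' - 1))

/-- `(H, X)` is a wide alignment (set version). -/
def IsWideAlignSet {α : Type} (G : SimpleGraph α) (H X : Set α) : Prop :=
  ∃ (n k : ℕ) (p : Fin n → α) (e : Fin k → α),
    H = Set.range p ∧ X = Set.range e ∧ IsWideAlignment G n p k e

/-- `(H, X)` is a spiky alignment (set version). -/
def IsSpikyAlignSet {α : Type} (G : SimpleGraph α) (H X : Set α) : Prop :=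
  ∃ (n k : ℕ) (p : Fin n → α) (e : Fin k → α),
    H = Set.range p ∧ X = Set.range e ∧ IsSpikyAlignment G n p k e

/-- `(H, X)` is a triangular alignment (set version). -/
def IsTriAlignSet {α : Type} (G : SimpleGraph α) (H X : Set α) : Prop :=
  ∃ (n k : ℕ) (p : Fin n → α) (e : Fin k → α),
    H = Set.range p ∧ X = Set.range e ∧ IsTriangularAlignment G n p k e

/-- `(H, X)` is a spiky connectifier (set version). -/
def IsSpikyConnSet {α : Type} (G : SimpleGraph α) (H X : Set α) : Prop :=
  ∃ (k : ℕ) (e : Fin k → α), X = Set.range e ∧ IsSpikyConnectifier G H k e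

/-- `(H, X)` is a triangular connectifier (set version). -/
def IsTriConnSet {α : Type} (G : SimpleGraph α) (H X : Set α) : Prop :=
  ∃ (k : ℕ) (e : Fin k → α), X = Set.range e ∧ IsTriangularConnectifier G H k e

/-- `(H, X)` is a stellar connectifier (set version). -/
def IsStellarConnSet {α : Type} (G : SimpleGraph α) (H X : Set α) : Prop :=
  ∃ (k : ℕ) (e : Fin k → α), X = Set.range e ∧ IsStellarConnectifier G H k e

/-- `(H, X)` (with order `e` on `X`) is a consistent alignment or consistent connectifier. -/
def IsConsistentWith {α : Type} (G : SimpleGraph α) (H : Set α)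
    (k : ℕ) (e : Fin k → α) : Prop :=
  (∃ (n : ℕ) (p : Fin n → α), H = Set.range p ∧
    (IsWideAlignment G n p k e ∨ IsSpikyAlignment G n p k e ∨ IsTriangularAlignment G n p k e)) ∨
  IsSpikyConnectifier G H k e ∨ IsTriangularConnectifier G H k e ∨
    IsStellarConnectifier G H k e

namespace NonHub

section Basics

variable {V : Type} {G : SimpleGraph V}

/-- The list enumerates an induced path. -/
def IP (G : SimpleGraph V) : List V → Prop
  | [] => True
  | a :: l => a ∉ l ∧ (∀ b ∈ l, G.Adj a b ↔ l.head? = some b) ∧ IP G l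

/-- `u` and `v` are joined by a walk inside `S`. -/
def Reach (G : SimpleGraph V) (S : Set V) (u v : V) : Prop :=
  Relation.ReflTransGen (fun a b => G.Adj a b ∧ a ∈ S ∧ b ∈ S) u v

/-- `S` is nonempty and induces a connected subgraph. -/
def Conn (G : SimpleGraph V) (S : Set V) : Prop :=
  S.Nonempty ∧ ∀ u ∈ S, ∀ v ∈ S, Reach G S u v

/-- The component of `u` in `S`. -/
def comp (G : SimpleGraph V) (S : Set V) (u : V) : Set V := {v | Reach G S u v}

/-- `x` has a neighbour in `A`. -/
def Sees (G : SimpleGraph V) (x : V) (A : Set V) : Prop := ∃ a ∈ A, G.Adj x a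

/-- `A` and `B` are disjoint and anticomplete. -/
def Apart (G : SimpleGraph V) (A B : Set V) : Prop := ∀ a ∈ A, ∀ b ∈ B, a ≠ b ∧ ¬ G.Adj a b

/-- There is an induced path from `a` to `b` with interior in `S`. -/
def Lk (G : SimpleGraph V) (S : Set V) (a b : V) : Prop :=
  ∃ l : List V, IP G (a :: (l ++ [b])) ∧ ∀ x ∈ l, x ∈ S

theorem ip_cons {a : V} {l : List V} :
    IP G (a :: l) ↔ a ∉ l ∧ (∀ b ∈ l, G.Adj a b ↔ l.head? = some b) ∧ IP G l := Iff.rfl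

@[simp] theorem ip_nil : IP G [] := trivial

@[simp] theorem ip_singleton (a : V) : IP G [a] := by simp [IP]

theorem IP.nodup {l : List V} (h : IP G l) : l.Nodup := by
  induction l with
  | nil => simp
  | cons a l ih => exact List.nodup_cons.2 ⟨h.1, ih h.2.2⟩

theorem ip_append {l₁ l₂ : List V} : IP G (l₁ ++ l₂) ↔ IP G l₁ ∧ IP G l₂ ∧
    ∀ a ∈ l₁, ∀ b ∈ l₂, a ≠ b ∧ (G.Adj a b ↔ l₁.getLast? = some a ∧ l₂.head? = some b) := by
  induction l₁ with
  | nil => simp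
  | cons a l ih =>
    rw [List.cons_append, ip_cons, ih, ip_cons]
    cases l with
    | nil =>
      simp only [List.nil_append, List.mem_cons, List.not_mem_nil]
      constructor
      · rintro ⟨h1, h2, -, h3, -⟩
        refine ⟨by simp, h3, ?_⟩
        rintro x (rfl | h) b hb
        · exact ⟨fun h => h1 (h ▸ hb), by simp [h2 b hb]⟩
        · exact h.elim
      · rintro ⟨-, h1, h2⟩
        refine ⟨fun h => (h2 a (Or.inl rfl) a h).1 rfl, fun b hb => ?_, trivial, h1, by simp⟩
        simp [(h2 a (Or.inl rfl) b hb).2]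
    | cons c l =>
      have e : (a :: c :: l).getLast? = (c :: l).getLast? := by simp
      rw [e]
      constructor
      · rintro ⟨h1, h2, h3, h4, h5⟩
        refine ⟨⟨fun h => h1 (List.mem_append_left _ h), fun b hb => ?_, h3⟩, h4, ?_⟩
        · simpa using h2 b (List.mem_append_left _ hb)
        · intro x hx b hb
          rcases List.mem_cons.1 hx with rfl | hx
          · refine ⟨fun h => h1 (List.mem_append_right _ (h ▸ hb)), ?_⟩
            rw [h2 b (List.mem_append_right _ hb)]
            constructor
            · intro h
              simp at h
              subst h
              exact absurd rfl (h5 c (by simp) c hb).1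
            · intro h
              exact absurd (List.mem_append_left _ (List.mem_of_getLast? h.1)) h1
          · exact h5 x hx b hb
      · rintro ⟨⟨h1, h2, h3⟩, h4, h5⟩
        refine ⟨fun h => ?_, fun b hb => ?_, h3, h4, fun x hx => h5 x (List.mem_cons_of_mem _ hx)⟩
        · rcases List.mem_append.1 h with h | h
          · exact h1 h
          · exact (h5 a (by simp) a h).1 rfl
        · rcases List.mem_append.1 hb with h | h
          · simpa using h2 b h
          · rw [(h5 a (by simp) b h).2]
            constructor
            · intro h
              exact absurd (List.mem_of_getLast? h.1) h1
            · intro h'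
              simp at h'
              subst h'
              exact absurd rfl (h5 c (by simp) c h).1

theorem IP.left {l₁ l₂ : List V} (h : IP G (l₁ ++ l₂)) : IP G l₁ := (ip_append.1 h).1
theorem IP.right {l₁ l₂ : List V} (h : IP G (l₁ ++ l₂)) : IP G l₂ := (ip_append.1 h).2.1

theorem IP.reverse {l : List V} (h : IP G l) : IP G l.reverse := by
  induction l with
  | nil => simp
  | cons a l ih =>
    rw [List.reverse_cons, ip_append]
    refine ⟨ih h.2.2, ip_singleton a, ?_⟩
    intro x hx b hb
    simp only [List.mem_singleton] at hb
    subst hb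
    rw [List.mem_reverse] at hx
    refine ⟨fun e => h.1 (e ▸ hx), ?_⟩
    rw [G.adj_comm, h.2.1 x hx]
    simp

theorem ip_reverse {l : List V} : IP G l.reverse ↔ IP G l :=
  ⟨fun h => by simpa using h.reverse, IP.reverse⟩

/-- Positional form of adjacency in an induced path. -/
theorem IP.adj_get {l : List V} (h : IP G l) {i j : ℕ} {a b : V} (hi : l[i]? = some a)
    (hj : l[j]? = some b) : G.Adj a b ↔ (i = j + 1 ∨ j = i + 1) := by
  induction l generalizing i j with
  | nil => simp at hi
  | cons c l ih =>
    cases i with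
    | zero =>
      simp at hi
      subst hi
      cases j with
      | zero => simp at hj; subst hj; simp
      | succ j =>
        simp only [List.getElem?_cons_succ] at hj
        rw [h.2.1 b (List.mem_of_getElem? hj)]
        constructor
        · intro hh
          right
          rw [List.head?_eq_getElem?] at hh
          have := (List.getElem?_inj (List.getElem?_eq_some_iff.1 hj).1 h.2.2.nodup).1 (hj.trans hh.symm)
          omega
        · intro hh
          have : j = 0 := by omega
          subst this
          rw [List.head?_eq_getElem?]; exact hj
    | succ i =>
      simp only [List.getElem?_cons_succ] at hi
      cases j with
      | zero =>
        simp at hj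
        subst hj
        rw [G.adj_comm, h.2.1 a (List.mem_of_getElem? hi)]
        constructor
        · intro hh
          left
          rw [List.head?_eq_getElem?] at hh
          have := (List.getElem?_inj (List.getElem?_eq_some_iff.1 hi).1 h.2.2.nodup).1 (hi.trans hh.symm)
          omega
        · intro hh
          have : i = 0 := by omega
          subst this
          rw [List.head?_eq_getElem?]; exact hi
      | succ j =>
        simp only [List.getElem?_cons_succ] at hj
        rw [ih h.2.2 hi hj]
        omega

theorem IP.get_inj {l : List V} (h : IP G l) {i j : ℕ} {a : V} (hi : l[i]? = some a)
    (hj : l[j]? = some a) : i = j :=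
  (List.getElem?_inj (List.getElem?_eq_some_iff.1 hi).1 h.nodup).1 (hi.trans hj.symm)

theorem IP.emb {l : List V} (h : IP G l) : IsPathEmb G l.length l.get := by
  refine ⟨List.nodup_iff_injective_get.1 h.nodup, fun i j => ?_⟩
  exact h.adj_get (by simp) (by simp)

/-- A list satisfying positional adjacency is an induced path. -/
theorem ip_of_get {l : List V} (hn : l.Nodup) (h : ∀ i j a b, l[i]? = some a → l[j]? = some b →
    i < j → (G.Adj a b ↔ j = i + 1)) : IP G l := by
  induction l with
  | nil => simp
  | cons c l ih =>
    rw [List.nodup_cons] at hn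
    refine ⟨hn.1, fun b hb => ?_, ih hn.2 fun i j a b hi hj hij => ?_⟩
    · obtain ⟨j, hj⟩ := List.getElem?_of_mem hb
      rw [h 0 (j + 1) c b (by simp) (by simpa using hj) (by omega), List.head?_eq_getElem?]
      constructor
      · intro e
        have : j = 0 := by omega
        subst this; exact hj
      · intro e
        have := (List.getElem?_inj (List.getElem?_eq_some_iff.1 hj).1 hn.2).1 (hj.trans e.symm)
        omega
    · rw [h (i + 1) (j + 1) a b (by simpa using hi) (by simpa using hj) (by omega)]
      omega

/-! ### Connectivity -/

theorem Sees.mono {x : V} {A B : Set V} (h : Sees G x A) (hAB : A ⊆ B) : Sees G x B := by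
  obtain ⟨a, ha, h⟩ := h
  exact ⟨a, hAB ha, h⟩

theorem Apart.symm {A B : Set V} (h : Apart G A B) : Apart G B A := fun b hb a ha =>
  ⟨(h a ha b hb).1.symm, fun e => (h a ha b hb).2 e.symm⟩

theorem Apart.mono {A B A' B' : Set V} (h : Apart G A B) (hA : A' ⊆ A) (hB : B' ⊆ B) :
    Apart G A' B' := fun a ha b hb => h a (hA ha) b (hB hb)

theorem Reach.refl (S : Set V) (u : V) : Reach G S u u := Relation.ReflTransGen.refl

theorem Reach.trans {S : Set V} {u v w : V} (h : Reach G S u v) (h' : Reach G S v w) :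
    Reach G S u w := Relation.ReflTransGen.trans h h'

theorem Reach.symm {S : Set V} {u v : V} (h : Reach G S u v) : Reach G S v u := by
  induction h with
  | refl => exact Reach.refl _ _
  | tail _ h ih => exact Relation.ReflTransGen.head ⟨h.1.symm, h.2.2, h.2.1⟩ ih

theorem Reach.mono {S T : Set V} {u v : V} (h : Reach G S u v) (hST : S ⊆ T) : Reach G T u v :=
  Relation.ReflTransGen.mono (fun _ _ h => ⟨h.1, hST h.2.1, hST h.2.2⟩) _ _ h

theorem Reach.step {S : Set V} {u v : V} (hu : u ∈ S) (hv : v ∈ S) (h : G.Adj u v) :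
    Reach G S u v := Relation.ReflTransGen.single ⟨h, hu, hv⟩

theorem Reach.mem {S : Set V} {u v : V} (h : Reach G S u v) (hu : u ∈ S) : v ∈ S := by
  cases h with
  | refl => exact hu
  | tail _ h => exact h.2.2

/-- Walks inside `S` from a set closed in `S` stay in that set. -/
theorem Reach.closed {S T : Set V} {u v : V} (h : Reach G S u v) (hu : u ∈ T)
    (hT : ∀ a ∈ T, ∀ b ∈ S, G.Adj a b → b ∈ T) : v ∈ T := by
  induction h with
  | refl => exact hu
  | tail _ h ih => exact hT _ ih _ h.2.2 h.1

theorem Reach.inside {S : Set V} {u v : V} (h : Reach G S u v) :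
    Reach G (comp G S u) u v := by
  induction h with
  | refl => exact Reach.refl _ _
  | tail h1 h ih => exact ih.tail ⟨h.1, h1, Relation.ReflTransGen.tail h1 h⟩

theorem mem_comp (S : Set V) (u : V) : u ∈ comp G S u := Reach.refl _ _

theorem comp_conn (S : Set V) (u : V) : Conn G (comp G S u) :=
  ⟨⟨u, mem_comp S u⟩, fun _ ha _ hb => ha.inside.symm.trans hb.inside⟩

theorem comp_subset {S : Set V} {u : V} (hu : u ∈ S) : comp G S u ⊆ S := fun _ h => h.mem hu

theorem comp_closed {S : Set V} {u a b : V} (hu : u ∈ S) (ha : a ∈ comp G S u) (hb : b ∈ S)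
    (h : G.Adj a b) : b ∈ comp G S u :=
  Reach.trans ha (Reach.step (comp_subset hu ha) hb h)

theorem Conn.subset_comp {A S : Set V} (h : Conn G A) (hAS : A ⊆ S) {u : V} (hu : u ∈ A) :
    A ⊆ comp G S u := fun _ hv => (h.2 u hu _ hv).mono hAS

theorem comp_eq {S : Set V} {u v : V} (h : v ∈ comp G S u) : comp G S v = comp G S u := by
  ext w
  exact ⟨fun h' => Reach.trans h h', fun h' => Reach.trans (Reach.symm h) h'⟩

theorem Conn.singleton (a : V) : Conn G {a} :=
  ⟨⟨a, rfl⟩, by rintro u rfl v rfl; exact Reach.refl _ _⟩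

theorem Conn.of_root {S : Set V} {r : V} (hr : r ∈ S)
    (h : ∀ v ∈ S, ∃ T ⊆ S, Conn G T ∧ r ∈ T ∧ v ∈ T) : Conn G S := by
  have key : ∀ v ∈ S, Reach G S r v := fun v hv => by
    obtain ⟨T, hT, hc, h1, h2⟩ := h v hv
    exact (hc.2 r h1 v h2).mono hT
  exact ⟨⟨r, hr⟩, fun u hu v hv => (key u hu).symm.trans (key v hv)⟩

theorem Conn.union {A B : Set V} (hA : Conn G A) (hB : Conn G B)
    (h : ∃ a ∈ A, ∃ b ∈ B, a = b ∨ G.Adj a b) : Conn G (A ∪ B) := by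
  obtain ⟨a, ha, b, hb, h⟩ := h
  have hab : Reach G (A ∪ B) a b := by
    rcases h with rfl | h
    · exact Reach.refl _ _
    · exact Reach.step (Or.inl ha) (Or.inr hb) h
  have key : ∀ v ∈ A ∪ B, Reach G (A ∪ B) a v := by
    rintro v (hv | hv)
    · exact (hA.2 a ha v hv).mono subset_union_left
    · exact hab.trans ((hB.2 b hb v hv).mono subset_union_right)
  exact ⟨⟨a, Or.inl ha⟩, fun u hu v hv => (key u hu).symm.trans (key v hv)⟩

theorem Conn.union_sees {A B : Set V} (hA : Conn G A) (hB : Conn G B)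
    (h : ∃ a ∈ A, Sees G a B) : Conn G (A ∪ B) := by
  obtain ⟨a, ha, b, hb, h⟩ := h
  exact hA.union hB ⟨a, ha, b, hb, Or.inr h⟩

theorem Conn.insert {A : Set V} {x : V} (hA : Conn G A) (h : Sees G x A) :
    Conn G (insert x A) := by
  rw [Set.insert_eq]
  exact (Conn.singleton x).union_sees hA ⟨x, rfl, h⟩

/-- A connected set meeting `T` but not inside `T` has an edge leaving `T`. -/
theorem Conn.cross {S T : Set V} (h : Conn G S) {u v : V} (hu : u ∈ S) (huT : u ∈ T)
    (hv : v ∈ S) (hvT : v ∉ T) : ∃ a ∈ S, a ∈ T ∧ ∃ b ∈ S, b ∉ T ∧ G.Adj a b := by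
  by_contra hc
  push Not at hc
  have := (h.2 u hu v hv).closed (T := S ∩ T) ⟨hu, huT⟩
    (fun a ha b hb hab => ⟨hb, by_contra fun hn => hc a ha.1 ha.2 b hb hn hab⟩)
  exact hvT this.2

theorem IP.conn {l : List V} (h : IP G l) (hl : l ≠ []) : Conn G {x | x ∈ l} := by
  induction l with
  | nil => exact absurd rfl hl
  | cons a l ih =>
    cases l with
    | nil => simpa using Conn.singleton (G := G) a
    | cons b l =>
      have e : {x | x ∈ a :: b :: l} = insert a {x | x ∈ b :: l} := by
        ext x; simp
      rw [e]
      exact (ih h.2.2 (by simp)).insert ⟨b, by simp, (h.2.1 b (by simp)).2 (by simp)⟩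

/-! ### Induced paths from connectivity -/

theorem IP.extend {u : V} {m : List V} (h : IP G m) (hu : u ∈ m ∨ Sees G u {x | x ∈ m}) :
    ∃ m₂, m₂ <:+ m ∧ m₂ ≠ [] ∧ (m₂.head? = some u ∨ IP G (u :: m₂)) := by
  induction m with
  | nil => rcases hu with h | ⟨x, h, -⟩ <;> simp at h
  | cons b m ih =>
    by_cases hm : u ∈ m ∨ Sees G u {x | x ∈ m}
    · obtain ⟨m₂, h1, h2⟩ := ih h.2.2 hm
      exact ⟨m₂, h1.trans (List.suffix_cons b m), h2⟩
    · refine ⟨b :: m, List.suffix_refl _, by simp, ?_⟩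
      push Not at hm
      by_cases hub : u = b
      · left; simp [hub]
      · right
        have hs : ∀ x ∈ m, ¬ G.Adj u x := fun x hx hux => hm.2 ⟨x, hx, hux⟩
        have hadj : G.Adj u b := by
          rcases hu with h | ⟨x, h, hx⟩
          · rcases List.mem_cons.1 h with h | h
            · exact absurd h hub
            · exact absurd h hm.1
          · rcases List.mem_cons.1 h with h | h
            · exact h ▸ hx
            · exact absurd hx (hs x h)
        refine ⟨by simp [hub, hm.1], fun x hx => ?_, h⟩
        rcases List.mem_cons.1 hx with rfl | hx
        · simp [hadj]
        · refine ⟨fun h => absurd h (hs x hx), fun e => ?_⟩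
          simp at e
          exact absurd (e ▸ hx) h.1

/-- An induced path inside `S` from `u` to the first vertex satisfying `P`. -/
theorem Reach.path {S : Set V} {u v : V} (h : Reach G S u v) (hu : u ∈ S) {P : V → Prop}
    (hP : P v) : ∃ l w, IP G (l ++ [w]) ∧ (l ++ [w]).head? = some u ∧ P w ∧ (∀ x ∈ l, ¬ P x) ∧
      ∀ x ∈ l ++ [w], x ∈ S := by
  induction h using Relation.ReflTransGen.head_induction_on with
  | refl => exact ⟨[], v, by simp, by simp, hP, by simp, by simpa using hu⟩
  | head h _ ih =>
    rename_i a c _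
    obtain ⟨l, w, h1, h2, h3, h4, h5⟩ := ih h.2.2
    by_cases ha : P a
    · exact ⟨[], a, by simp, by simp, ha, by simp, by simpa using hu⟩
    obtain ⟨m, ⟨p, hm⟩, hm0, hm1⟩ := h1.extend (u := a)
      (Or.inr ⟨c, List.mem_of_mem_head? h2, h.1⟩)
    obtain ⟨m', w', rfl⟩ : ∃ m' w', m = m' ++ [w'] :=
      ⟨m.dropLast, m.getLast hm0, (List.dropLast_append_getLast hm0).symm⟩
    rw [← List.append_assoc] at hm
    obtain ⟨hm2, hm3⟩ := List.append_inj' hm rfl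
    simp only [List.cons.injEq, and_true] at hm3
    subst hm3
    have hsub : ∀ x ∈ m' ++ [w'], x ∈ S := fun x hx => h5 x (by
      rw [← hm, List.append_assoc]; exact List.mem_append_right _ hx)
    have hnP : ∀ x ∈ m', ¬ P x := fun x hx => h4 x (by rw [← hm2]; simp [hx])
    rcases hm1 with hm1 | hm1
    · exact ⟨m', w', (hm.symm ▸ h1 : IP G _) |> fun h => by
        rw [List.append_assoc] at h; exact h.right, hm1, h3, hnP, hsub⟩
    · refine ⟨a :: m', w', hm1, by simp, h3, ?_, ?_⟩
      · intro x hx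
        rcases List.mem_cons.1 hx with rfl | hx
        · exact ha
        · exact hnP x hx
      · intro x hx
        rw [List.cons_append] at hx
        rcases List.mem_cons.1 hx with rfl | hx
        · exact hu
        · exact hsub x hx

theorem Conn.path {S : Set V} (h : Conn G S) {u v : V} (hu : u ∈ S) (hv : v ∈ S) {P : V → Prop}
    (hP : P v) : ∃ l w, IP G (l ++ [w]) ∧ (l ++ [w]).head? = some u ∧ P w ∧ (∀ x ∈ l, ¬ P x) ∧
      ∀ x ∈ l ++ [w], x ∈ S := (h.2 u hu v hv).path hu hP

theorem Conn.path' {S : Set V} (h : Conn G S) {u v : V} (hu : u ∈ S) (hv : v ∈ S) :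
    ∃ l, IP G l ∧ l.head? = some u ∧ l.getLast? = some v ∧ ∀ x ∈ l, x ∈ S := by
  obtain ⟨l, w, h1, h2, rfl, -, h5⟩ := h.path hu hv (P := fun x => x = v) rfl
  exact ⟨l ++ [w], h1, h2, by simp, h5⟩

theorem Lk.mono {S T : Set V} {a b : V} (h : Lk G S a b) (hST : S ⊆ T) : Lk G T a b := by
  obtain ⟨l, h1, h2⟩ := h
  exact ⟨l, h1, fun x hx => hST (h2 x hx)⟩

theorem Lk.symm {S : Set V} {a b : V} (h : Lk G S a b) : Lk G S b a := by
  obtain ⟨l, h1, h2⟩ := h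
  refine ⟨l.reverse, ?_, by simpa using h2⟩
  have := h1.reverse
  simpa using this

theorem Conn.lk {S : Set V} (h : Conn G S) {a b : V} (hab : a ≠ b)
    (hn : ¬ G.Adj a b) (hsa : Sees G a S) (hsb : Sees G b S) : Lk G (S \ {a, b}) a b := by
  have hc : Conn G (Insert.insert a (Insert.insert b S)) := by
    have h1 := h.insert hsb
    exact h1.insert (hsa.mono (subset_insert _ _))
  obtain ⟨m, h1, h2, h3, h4⟩ := hc.path' (mem_insert a _)
    (mem_insert_of_mem _ (mem_insert b _) : b ∈ _)
  obtain ⟨l, rfl⟩ : ∃ l, m = a :: l := by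
    cases m with
    | nil => simp at h2
    | cons c l => simp at h2; exact ⟨l, by rw [h2]⟩
  have hl : l ≠ [] := by
    rintro rfl
    simp at h3; exact hab h3
  obtain ⟨l', c, rfl⟩ : ∃ m' w', l = m' ++ [w'] :=
    ⟨l.dropLast, l.getLast hl, (List.dropLast_append_getLast hl).symm⟩
  rw [← List.cons_append, List.getLast?_append] at h3
  simp at h3
  subst h3
  refine ⟨l', h1, fun x hx => ?_⟩
  have hxa : x ≠ a := by
    rintro rfl
    exact h1.1 (by simp [hx])
  have hxb : x ≠ c := by
    rintro rfl
    have := (ip_append.1 h1.2.2).2.2 x hx x (by simp)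
    exact this.1 rfl
  have := h4 x (by simp [hx])
  simp only [mem_insert_iff, hxa, hxb, false_or] at this
  exact ⟨this, by simp [hxa, hxb]⟩

/-- Position of the elements of a list satisfying a predicate. -/
theorem list_first {P : V → Prop} {l : List V} (h : ∃ x ∈ l, P x) :
    ∃ p c s, l = p ++ c :: s ∧ P c ∧ ∀ x ∈ p, ¬ P x := by
  induction l with
  | nil => simp at h
  | cons a l ih =>
    by_cases ha : P a
    · exact ⟨[], a, l, by simp, ha, by simp⟩
    · obtain ⟨x, hx, hP⟩ := h
      rcases List.mem_cons.1 hx with rfl | hx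
      · exact absurd hP ha
      obtain ⟨p, c, s, rfl, h1, h2⟩ := ih ⟨x, hx, hP⟩
      exact ⟨a :: p, c, s, by simp, h1, by simpa [ha] using h2⟩

theorem list_last {P : V → Prop} {l : List V} (h : ∃ x ∈ l, P x) :
    ∃ p c s, l = p ++ c :: s ∧ P c ∧ ∀ x ∈ s, ¬ P x := by
  obtain ⟨p, c, s, h1, h2, h3⟩ := list_first (l := l.reverse) (P := P) (by simpa using h)
  refine ⟨s.reverse, c, p.reverse, ?_, h2, by simpa using h3⟩
  have := congrArg List.reverse h1
  simpa using this

/-- A vertex with neighbours on a path has either one, or a first and a last one. -/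
theorem list_ends {P : V → Prop} {l : List V} (h : ∃ x ∈ l, P x) :
    (∃ p c s, l = p ++ c :: s ∧ P c ∧ (∀ x ∈ p, ¬ P x) ∧ ∀ x ∈ s, ¬ P x) ∨
    ∃ p c m d s, l = p ++ c :: (m ++ d :: s) ∧ P c ∧ P d ∧ (∀ x ∈ p, ¬ P x) ∧
      ∀ x ∈ s, ¬ P x := by
  obtain ⟨p, c, s, rfl, h1, h2⟩ := list_first h
  by_cases hs : ∃ x ∈ s, P x
  · right
    obtain ⟨m, d, s, rfl, h3, h4⟩ := list_last hs
    exact ⟨p, c, m, d, s, rfl, h1, h3, h2, h4⟩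
  · left
    push Not at hs
    exact ⟨p, c, s, rfl, h1, h2, hs⟩

/-! ### Non-cut vertices and pieces of connected sets -/

theorem Conn.sees_diff {A : Set V} (hA : Conn G A) {v : V} (hv : v ∈ A) (hne : A ≠ {v}) :
    ∃ u ∈ A, u ≠ v ∧ G.Adj v u := by
  obtain ⟨w, hw, hwv⟩ : ∃ w ∈ A, w ≠ v := by
    by_contra h
    push Not at h
    exact hne (Subset.antisymm h (by simpa using hv))
  obtain ⟨a, _, ha, b, hb, hb', hab⟩ := hA.cross (T := {v}) hv rfl hw (by simpa using hwv)
  rw [mem_singleton_iff] at ha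
  subst ha
  exact ⟨b, hb, by simpa using hb', hab⟩

/-- Removing a set attached to the rest only at one vertex keeps the rest connected. -/
theorem Conn.diff_of_gate {A U : Set V} (hA : Conn G A) {a : V} (ha : a ∈ A) (haU : a ∉ U)
    (h : ∀ u ∈ U, ∀ w ∈ A, w ∉ U → G.Adj u w → w = a) : Conn G (A \ U) := by
  have key : ∀ v ∈ A \ U, Reach G (A \ U) a v := by
    intro v hv
    by_contra hc
    have hcl := (hA.2 v hv.1 a ha).closed (T := {w | w ∈ A ∧ w ∉ U ∧ ¬ Reach G (A \ U) a w})
      ⟨hv.1, hv.2, hc⟩ ?_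
    · exact hcl.2.2 (Reach.refl _ _)
    · rintro x ⟨hx, hxU, hxr⟩ y hy hxy
      have hyU : y ∉ U := by
        intro hyU
        have := h y hyU x hx hxU hxy.symm
        subst this
        exact hxr (Reach.refl _ _)
      exact ⟨hy, hyU, fun hr => hxr (hr.trans (Reach.step ⟨hy, hyU⟩ ⟨hx, hxU⟩ hxy.symm))⟩
  exact ⟨⟨a, ha, haU⟩, fun u hu v hv => (key u hu).symm.trans (key v hv)⟩

/-- The rest of a connected set after removing a component of its complement of a vertex. -/
theorem Conn.exists_noncut [Finite V] {A : Set V} (hA : Conn G A) {v : V} (hv : v ∈ A)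
    (hne : A ≠ {v}) : ∃ d ∈ A, d ≠ v ∧ Conn G (A \ {d}) := by
  classical
  have hfin : {B : Set V | B ⊂ A ∧ v ∈ B ∧ Conn G B}.Finite := Set.toFinite _
  obtain ⟨B, ⟨hBA, hvB, hB⟩, hmax⟩ := hfin.exists_maximal
    ⟨{v}, ⟨by simpa using hv, fun h => hne (Subset.antisymm h (by simpa using hv))⟩, rfl,
      Conn.singleton v⟩
  obtain ⟨w, hw, hwB⟩ := exists_of_ssubset hBA
  obtain ⟨a, ha, haB, b, hb, hbB, hab⟩ := hA.cross (hBA.1 hvB) hvB hw hwB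
  have hins : Conn G (Insert.insert b B) := hB.insert ⟨a, haB, hab.symm⟩
  have hall : Insert.insert b B = A := by
    by_contra hne'
    have hss : Insert.insert b B ⊂ A := (insert_subset hb hBA.1).ssubset_of_ne hne'
    have := hmax (y := Insert.insert b B) ⟨hss, mem_insert_of_mem _ hvB, hins⟩ (subset_insert _ _)
    exact hbB (this (mem_insert b B))
  refine ⟨b, hb, fun e => hbB (e ▸ hvB), ?_⟩
  have : A \ {b} = B := by
    rw [← hall]
    ext x
    simp only [mem_sdiff, mem_insert_iff, mem_singleton_iff]
    constructor
    · rintro ⟨h | h, h'⟩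
      · exact absurd h h'
      · exact h
    · intro h
      exact ⟨Or.inr h, fun e => hbB (e ▸ h)⟩
  rw [this]; exact hB

end Basics

section Constructors

variable {V : Type} {G : SimpleGraph V}

theorem hasTheta_of_links {a b : V} (hab : a ≠ b) (h : ¬ G.Adj a b) (S : Fin 3 → Set V)
    (hS : ∀ i j, i ≠ j → Apart G (S i) (S j)) (hl : ∀ i, Lk G (S i) a b) : HasTheta G := by
  choose l hl hlS using hl
  have hlen : ∀ i, 3 ≤ (a :: (l i ++ [b])).length := by
    intro i
    rcases hli : l i with _ | ⟨c, m⟩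
    · have := hl i
      rw [hli] at this
      exact absurd ((this.2.1 b (by simp)).2 (by simp)) h
    · simp
  have hinner : ∀ i (u : Fin (a :: (l i ++ [b])).length), 0 < u.val →
      u.val < (a :: (l i ++ [b])).length - 1 → (a :: (l i ++ [b])).get u ∈ S i := by
    intro i u h0 h1
    apply hlS i
    obtain ⟨u, hu⟩ := u
    obtain ⟨u, rfl⟩ : ∃ w, u = w + 1 := ⟨u - 1, by simp at h0; omega⟩
    simp only [List.length_cons, List.length_append] at h1 hu
    simp only [List.get_eq_getElem, List.getElem_cons_succ]
    rw [List.getElem_append_left (by simp at h1; omega)]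
    exact List.getElem_mem _
  refine ⟨a, b, fun i => (a :: (l i ++ [b])).length, fun i => (a :: (l i ++ [b])).get, hab, h,
    hlen, fun i => ⟨(hl i).emb, by simp, by simp, ?_⟩, ?_⟩
  · simp
  · intro i j hij u v h1 h2 h3 h4
    exact hS i j hij _ (hinner i u h1 h2) _ (hinner j v h3 h4)

theorem theta3 {a b : V} (hab : a ≠ b) (h : ¬ G.Adj a b) {S₀ S₁ S₂ : Set V}
    (h01 : Apart G S₀ S₁) (h02 : Apart G S₀ S₂) (h12 : Apart G S₁ S₂)
    (l0 : Lk G S₀ a b) (l1 : Lk G S₁ a b) (l2 : Lk G S₂ a b) : HasTheta G := by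
  refine hasTheta_of_links hab h ![S₀, S₁, S₂] ?_ ?_
  · intro i j hij
    fin_cases i <;> fin_cases j <;> simp_all [Apart.symm]
  · intro i
    fin_cases i <;> simp_all

theorem hasPrism_of_sets (S : Fin 3 → Set V) (a b : Fin 3 → V) (hS : ∀ i, Conn G (S i))
    (ha : ∀ i, a i ∈ S i) (hb : ∀ i, b i ∈ S i) (hab : ∀ i, a i ≠ b i)
    (h : ∀ i j, i ≠ j → ∀ u ∈ S i, ∀ v ∈ S j, u ≠ v ∧
      (G.Adj u v ↔ (u = a i ∧ v = a j) ∨ (u = b i ∧ v = b j))) : HasPrism G := by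
  choose l hl hl0 hl1 hlS using fun i => (hS i).path' (ha i) (hb i)
  have hlen : ∀ i, 2 ≤ (l i).length := by
    intro i
    have h0 := hl0 i
    have h1 := hl1 i
    rcases hli : l i with _ | ⟨c, _ | ⟨d, m⟩⟩
    · simp [hli] at h0
    · simp [hli] at h0 h1
      exact absurd (h0.symm.trans h1) (hab i)
    · simp
  have hfirst : ∀ i (u : Fin (l i).length), (l i).get u = a i ↔ u.val = 0 := by
    intro i u
    have h0 := hl0 i
    rw [List.head?_eq_getElem?] at h0
    constructor
    · intro e
      exact (hl i).get_inj (i := u.val) (a := a i) (by rw [← e]; simp) h0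
    · intro e
      have : (l i)[u.val]? = some ((l i).get u) := by simp
      rw [e, h0] at this
      exact (Option.some.inj this).symm
  have hlast : ∀ i (u : Fin (l i).length), (l i).get u = b i ↔ u.val = (l i).length - 1 := by
    intro i u
    have h0 := hl1 i
    rw [List.getLast?_eq_getElem?] at h0
    constructor
    · intro e
      exact (hl i).get_inj (i := u.val) (a := b i) (by rw [← e]; simp) h0
    · intro e
      have : (l i)[u.val]? = some ((l i).get u) := by simp
      rw [e, h0] at this
      exact (Option.some.inj this).symm
  refine ⟨fun i => (l i).length, fun i => (l i).get, hlen, fun i => (hl i).emb, ?_, ?_⟩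
  · intro i j hij u v
    exact (h i j hij _ (hlS i _ (List.get_mem _ _)) _ (hlS j _ (List.get_mem _ _))).1
  · intro i j hij u v
    rw [(h i j hij _ (hlS i _ (List.get_mem _ _)) _ (hlS j _ (List.get_mem _ _))).2, hfirst,
      hfirst, hlast, hlast]

/-- A cyclic list is a hole. -/
theorem isHole_of_cycle {L : List V} (hn : 4 ≤ L.length) (hnd : L.Nodup)
    (h : ∀ (i j : ℕ) (a b : V), L[i]? = some a → L[j]? = some b → i < j →
      (G.Adj a b ↔ j = i + 1 ∨ (i = 0 ∧ j = L.length - 1))) : IsHole G {x | x ∈ L} := by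
  obtain ⟨m, hm⟩ : ∃ m, L.length = m + 1 := ⟨L.length - 1, by omega⟩
  have hm4 : 3 ≤ m := by omega
  let f : Fin (m + 1) → V := fun i => L.get (i.cast hm.symm)
  have hf : ∀ i : Fin (m + 1), L[i.val]? = some (f i) := fun i => by simp [f]
  have hinj : Function.Injective f := by
    intro i j hij
    have := List.nodup_iff_injective_get.1 hnd hij
    simpa [Fin.ext_iff] using this
  have hadj : ∀ i j : Fin (m + 1), i.val < j.val →
      (G.Adj (f i) (f j) ↔ (i = j + 1 ∨ j = i + 1)) := by
    intro i j hij
    rw [h i.val j.val _ _ (hf i) (hf j) hij, Fin.ext_iff, Fin.ext_iff, Fin.val_add, Fin.val_add]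
    have hi := i.isLt
    have hj := j.isLt
    have h1 : ((1 : Fin (m + 1)) : ℕ) = 1 := by
      rw [Fin.val_one']; exact Nat.mod_eq_of_lt (by omega)
    rw [h1, Nat.mod_eq_of_lt (show i.val + 1 < m + 1 by omega)]
    rcases Nat.lt_or_ge (j.val + 1) (m + 1) with h2 | h2
    · rw [Nat.mod_eq_of_lt h2]; omega
    · have : j.val + 1 = m + 1 := by omega
      rw [this, Nat.mod_self]; omega
  have hadj' : ∀ i j : Fin (m + 1), G.Adj (f i) (f j) ↔ (i = j + 1 ∨ j = i + 1) := by
    intro i j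
    rcases lt_trichotomy i.val j.val with hij | hij | hij
    · exact hadj i j hij
    · have : i = j := Fin.ext hij
      subst this
      simp only [SimpleGraph.irrefl, or_self, false_iff]
      intro e
      have e' := congrArg Fin.val e
      rw [Fin.val_add, Fin.val_one', Nat.mod_eq_of_lt (show 1 < m + 1 by omega)] at e'
      have hi := i.isLt
      rcases Nat.lt_or_ge (i.val + 1) (m + 1) with h2 | h2
      · rw [Nat.mod_eq_of_lt h2] at e'; omega
      · have : i.val + 1 = m + 1 := by omega
        rw [this, Nat.mod_self] at e'; omega
    · rw [G.adj_comm, or_comm]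
      exact hadj j i hij
  refine ⟨m + 1, f, by omega, ⟨hinj, hadj'⟩, ?_⟩
  ext x
  constructor
  · rintro ⟨i, rfl⟩
    exact List.get_mem _ _
  · intro hx
    obtain ⟨i, rfl⟩ := List.get_of_mem hx
    exact ⟨(⟨i.val, by omega⟩ : Fin (m + 1)), rfl⟩

theorem isHole_of_paths {L₁ L₂ : List V} (h1 : IP G L₁) (h2 : IP G L₂) (n1 : L₁ ≠ [])
    (n2 : L₂ ≠ []) (hn : 4 ≤ L₁.length + L₂.length)
    (h : ∀ x ∈ L₁, ∀ y ∈ L₂, x ≠ y ∧ (G.Adj x y ↔ (L₁.head? = some x ∧ L₂.head? = some y) ∨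
      (L₁.getLast? = some x ∧ L₂.getLast? = some y))) : IsHole G {x | x ∈ L₁ ∨ x ∈ L₂} := by
  have l1 : 0 < L₁.length := List.length_pos_iff.2 n1
  have l2 : 0 < L₂.length := List.length_pos_iff.2 n2
  have e : {x | x ∈ L₁ ∨ x ∈ L₂} = {x | x ∈ L₁ ++ L₂.reverse} := by ext x; simp
  rw [e]
  refine isHole_of_cycle (by simpa using hn) ?_ ?_
  · rw [List.nodup_append]
    exact ⟨h1.nodup, List.nodup_reverse.2 h2.nodup, fun a ha b hb =>
      (h a ha b (List.mem_reverse.1 hb)).1⟩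
  · intro i j a b hi hj hij
    have hjl := (List.getElem?_eq_some_iff.1 hj).1
    simp only [List.length_append, List.length_reverse] at hjl ⊢
    rcases Nat.lt_or_ge j L₁.length with hj1 | hj1
    · rw [List.getElem?_append_left hj1] at hj
      rw [List.getElem?_append_left (by omega)] at hi
      rw [h1.adj_get hi hj]; omega
    · rw [List.getElem?_append_right hj1, List.getElem?_reverse (by omega)] at hj
      rcases Nat.lt_or_ge i L₁.length with hi1 | hi1
      · rw [List.getElem?_append_left hi1] at hi
        rw [(h a (List.mem_of_getElem? hi) b (List.mem_of_getElem? hj)).2]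
        have e1 : L₁.head? = some a ↔ i = 0 := by
          rw [List.head?_eq_getElem?]
          exact ⟨fun e => h1.get_inj hi e, fun e => by rw [← e]; exact hi⟩
        have e2 : L₁.getLast? = some a ↔ i = L₁.length - 1 := by
          rw [List.getLast?_eq_getElem?]
          exact ⟨fun e => h1.get_inj hi e, fun e => by rw [← e]; exact hi⟩
        have e3 : L₂.head? = some b ↔ L₂.length - 1 - (j - L₁.length) = 0 := by
          rw [List.head?_eq_getElem?]
          exact ⟨fun e => h2.get_inj hj e, fun e => by rw [← e]; exact hj⟩
        have e4 : L₂.getLast? = some b ↔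
            L₂.length - 1 - (j - L₁.length) = L₂.length - 1 := by
          rw [List.getLast?_eq_getElem?]
          exact ⟨fun e => h2.get_inj hj e, fun e => by rw [← e]; exact hj⟩
        rw [e1, e2, e3, e4]; omega
      · rw [List.getElem?_append_right hi1, List.getElem?_reverse (by omega)] at hi
        rw [h2.adj_get hi hj]; omega

theorem hub_of_four [Finite V] {H : Set V} {x : V} (hH : IsHole G H) (hx : x ∉ H)
    (h : 4 ≤ (holeNbrs G H x).ncard) : IsHub G x := by
  refine ⟨H, ⟨hH, hx, by omega⟩, ?_, ?_⟩
  · rintro ⟨-, p, q, r, -, -, -, e, -⟩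
    rw [e] at h
    have := Set.ncard_insert_le p {q, r}
    have := Set.ncard_insert_le q {r}
    simp at this
    omega
  · rintro ⟨-, p, q, r, -, -, -, e, -⟩
    rw [e] at h
    have := Set.ncard_insert_le p {q, r}
    have := Set.ncard_insert_le q {r}
    simp at this
    omega

theorem four_le_ncard [Finite V] {S : Set V} {a b c d : V} (ha : a ∈ S) (hb : b ∈ S) (hc : c ∈ S)
    (hd : d ∈ S) (h1 : a ≠ b) (h2 : a ≠ c) (h3 : a ≠ d) (h4 : b ≠ c) (h5 : b ≠ d) (h6 : c ≠ d) :
    4 ≤ S.ncard := by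
  have : ({a, b, c, d} : Set V).ncard = 4 := by
    rw [Set.ncard_insert_of_notMem (by simp [h1, h2, h3]),
      Set.ncard_insert_of_notMem (by simp [h4, h5]), Set.ncard_pair h6]
  rw [← this]
  exact Set.ncard_le_ncard (by
    intro x hx
    rcases hx with rfl | rfl | rfl | rfl <;> assumption)

theorem hub_of_stable_triple [Finite V] {H : Set V} {x : V} (hH : IsHole G H) (hx : x ∉ H)
    {p q r : V} (hp : p ∈ holeNbrs G H x) (hq : q ∈ holeNbrs G H x) (hr : r ∈ holeNbrs G H x)
    (hpq : p ≠ q) (hpr : p ≠ r) (hqr : q ≠ r) (npq : ¬ G.Adj p q) (npr : ¬ G.Adj p r)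
    (nqr : ¬ G.Adj q r) : IsHub G x := by
  have h3 : 3 ≤ (holeNbrs G H x).ncard := by
    have : ({p, q, r} : Set V).ncard = 3 := by
      rw [Set.ncard_insert_of_notMem (by simp [hpq, hpr]), Set.ncard_pair hqr]
    rw [← this]
    exact Set.ncard_le_ncard (by
      intro x hx
      rcases hx with rfl | rfl | rfl <;> assumption)
  rcases Nat.lt_or_ge 3 (holeNbrs G H x).ncard with h4 | h4
  · exact hub_of_four hH hx h4
  · have key : ∀ u ∈ holeNbrs G H x, ∀ v ∈ holeNbrs G H x, ¬ G.Adj u v := by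
      have e : {p, q, r} = holeNbrs G H x := by
        apply Set.eq_of_subset_of_ncard_le
        · intro x hx
          rcases hx with rfl | rfl | rfl <;> assumption
        · have : ({p, q, r} : Set V).ncard = 3 := by
            rw [Set.ncard_insert_of_notMem (by simp [hpq, hpr]), Set.ncard_pair hqr]
          omega
        · exact Set.toFinite _
      rw [← e]
      rintro u (rfl | rfl | rfl) v (rfl | rfl | rfl) <;> simp_all [G.adj_comm]
    refine ⟨H, ⟨hH, hx, h3⟩, ?_, ?_⟩
    · rintro ⟨-, a, b, c, -, -, -, e, hab, -⟩
      exact key a (by rw [e]; simp) b (by rw [e]; simp) hab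
    · rintro ⟨-, a, b, c, -, -, -, e, hab, -⟩
      exact key a (by rw [e]; simp) b (by rw [e]; simp) hab

end Constructors

section Types

variable {V : Type} {G : SimpleGraph V}

/-- A subdivided claw in `D` with tips attached to the three terminals. -/
def HasClaw (G : SimpleGraph V) (D : Set V) (x : Fin 3 → V) : Prop :=
  ∃ c ∈ D, ∃ S : Fin 3 → Set V,
    (∀ i, Conn G (S i) ∧ x i ∈ S i ∧ S i ⊆ insert (x i) D ∧ c ∉ S i ∧ Sees G c (S i)) ∧
    ∀ i j, i ≠ j → Apart G (S i) (S j)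

/-- A triangle in `D` with three connected arms to the three terminals. -/
def HasTri (G : SimpleGraph V) (D : Set V) (x : Fin 3 → V) : Prop :=
  ∃ (a : Fin 3 → V) (S : Fin 3 → Set V),
    (∀ i, Conn G (S i) ∧ x i ∈ S i ∧ a i ∈ S i ∧ S i ⊆ insert (x i) D) ∧
    ∀ i j, i ≠ j → ∀ u ∈ S i, ∀ v ∈ S j, u ≠ v ∧ (G.Adj u v ↔ u = a i ∧ v = a j)

/-- An induced path from `y` to `z` through `D` on which `x` has two nonadjacent neighbours. -/
def HasWide (G : SimpleGraph V) (D : Set V) (x y z : V) : Prop :=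
  ∃ l : List V, IP G (y :: (l ++ [z])) ∧ (∀ u ∈ l, u ∈ D) ∧
    ∃ a ∈ l, ∃ b ∈ l, a ≠ b ∧ ¬ G.Adj a b ∧ G.Adj x a ∧ G.Adj x b

/-- Three pairwise distinct nonadjacent vertices outside two anticomplete sets. -/
structure Two (G : SimpleGraph V) (D₁ D₂ : Set V) (x : Fin 3 → V) : Prop where
  apart : Apart G D₁ D₂
  out₁ : ∀ i, x i ∉ D₁
  out₂ : ∀ i, x i ∉ D₂
  stable : ∀ i j, i ≠ j → x i ≠ x j ∧ ¬ G.Adj (x i) (x j)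

theorem Two.symm {D₁ D₂ : Set V} {x : Fin 3 → V} (h : Two G D₁ D₂ x) : Two G D₂ D₁ x :=
  ⟨h.apart.symm, h.out₂, h.out₁, h.stable⟩

theorem HasClaw.mono {D D' : Set V} {x : Fin 3 → V} (h : HasClaw G D x) (hD : D ⊆ D') :
    HasClaw G D' x := by
  obtain ⟨c, hc, S, h1, h2⟩ := h
  exact ⟨c, hD hc, S, fun i => ⟨(h1 i).1, (h1 i).2.1, (h1 i).2.2.1.trans (insert_subset_insert hD),
    (h1 i).2.2.2⟩, h2⟩

theorem HasTri.mono {D D' : Set V} {x : Fin 3 → V} (h : HasTri G D x) (hD : D ⊆ D') :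
    HasTri G D' x := by
  obtain ⟨a, S, h1, h2⟩ := h
  exact ⟨a, S, fun i => ⟨(h1 i).1, (h1 i).2.1, (h1 i).2.2.1,
    (h1 i).2.2.2.trans (insert_subset_insert hD)⟩, h2⟩

theorem HasWide.mono {D D' : Set V} {x y z : V} (h : HasWide G D x y z) (hD : D ⊆ D') :
    HasWide G D' x y z := by
  obtain ⟨l, h1, h2, h3⟩ := h
  exact ⟨l, h1, fun u hu => hD (h2 u hu), h3⟩

theorem HasWide.symm {D : Set V} {x y z : V} (h : HasWide G D x y z) : HasWide G D x z y := by
  obtain ⟨l, h1, h2, a, ha, b, hb, h3⟩ := h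
  refine ⟨l.reverse, ?_, by simpa using h2, a, by simpa using ha, b, by simpa using hb, h3⟩
  simpa using h1.reverse

theorem HasClaw.perm {D : Set V} {x : Fin 3 → V} (σ : Equiv.Perm (Fin 3))
    (h : HasClaw G D (x ∘ σ)) : HasClaw G D x := by
  obtain ⟨c, hc, S, h1, h2⟩ := h
  refine ⟨c, hc, S ∘ σ.symm, fun i => ?_, fun i j hij => ?_⟩
  · simpa using h1 (σ.symm i)
  · exact h2 _ _ (by simpa using hij)

theorem HasTri.perm {D : Set V} {x : Fin 3 → V} (σ : Equiv.Perm (Fin 3))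
    (h : HasTri G D (x ∘ σ)) : HasTri G D x := by
  obtain ⟨a, S, h1, h2⟩ := h
  refine ⟨a ∘ σ.symm, S ∘ σ.symm, fun i => ?_, fun i j hij => ?_⟩
  · simpa using h1 (σ.symm i)
  · exact h2 _ _ (by simpa using hij)

theorem IP.apart {l₁ m l₂ : List V} (h : IP G (l₁ ++ (m ++ l₂))) (hm : m ≠ []) :
    Apart G {x | x ∈ l₁} {x | x ∈ l₂} := by
  intro a ha b hb
  have ha' : a ∈ l₁ := ha
  have hb' : b ∈ l₂ := hb
  have h1 := (ip_append.1 h).2.2 a ha' b (by simp [hb'])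
  refine ⟨h1.1, fun hab => ?_⟩
  have h2 := (h1.2.1 hab).2
  obtain ⟨c, m, rfl⟩ := List.exists_cons_of_ne_nil hm
  simp at h2
  subst h2
  have h3 := (ip_append.1 h).2.1
  exact ((ip_append.1 h3).2.2 c (by simp) c hb').1 rfl

theorem IP.head_adj {a : V} {l : List V} (h : IP G (a :: l)) (hl : l ≠ []) :
    Sees G a {x | x ∈ l} := by
  obtain ⟨c, m, rfl⟩ := List.exists_cons_of_ne_nil hl
  exact ⟨c, by simp, (h.2.1 c (by simp)).2 (by simp)⟩

theorem IP.last_adj {a : V} {l : List V} (h : IP G (l ++ [a])) (hl : l ≠ []) :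
    Sees G a {x | x ∈ l} := by
  have := h.reverse
  rw [List.reverse_append] at this
  simpa using this.head_adj (by simpa using hl)

theorem apart_glue {D₁ D₂ S₁ S₂ S₁' S₂' : Set V} {p q : V} (h : Apart G D₁ D₂)
    (h1 : S₁ ⊆ insert p D₁) (h2 : S₂' ⊆ insert q D₂) (hp : p ∈ S₁') (hq : q ∈ S₂)
    (a1 : Apart G S₁ S₂) (a2 : Apart G S₁' S₂') : Apart G S₁ S₂' := by
  intro u hu v hv
  rcases h1 hu with rfl | hu'
  · exact a2 _ hp v hv
  · rcases h2 hv with rfl | hv'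
    · exact a1 u hu _ hq
    · exact h u hu' v hv'

theorem Apart.union_left {A B C : Set V} (h1 : Apart G A C) (h2 : Apart G B C) :
    Apart G (A ∪ B) C := by
  rintro u (hu | hu) v hv
  · exact h1 u hu v hv
  · exact h2 u hu v hv

theorem Apart.union_right {A B C : Set V} (h1 : Apart G A B) (h2 : Apart G A C) :
    Apart G A (B ∪ C) := (Apart.union_left h1.symm h2.symm).symm

theorem Conn.sees_of_mem {S : Set V} (h : Conn G S) {c x : V} (hx : x ∈ S) (hc : Sees G c S)
    (hcx : ¬ G.Adj c x) : Sees G x S := by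
  obtain ⟨a, ha, hca⟩ := hc
  have : S ≠ {x} := by
    rintro rfl
    rw [mem_singleton_iff] at ha
    exact hcx (ha ▸ hca)
  obtain ⟨u, hu, -, hxu⟩ := h.sees_diff hx this
  exact ⟨u, hu, hxu⟩

/-- The two end pieces of a path on which `x` has nonadjacent neighbours. -/
theorem HasWide.split {D : Set V} {x y z : V} (h : HasWide G D x y z) :
    ∃ T₁ T₂ : Set V, Conn G T₁ ∧ Conn G T₂ ∧ y ∈ T₁ ∧ z ∈ T₂ ∧ T₁ ⊆ insert y D ∧
      T₂ ⊆ insert z D ∧ Sees G x T₁ ∧ Sees G x T₂ ∧ Apart G T₁ T₂ := by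
  obtain ⟨l, hl, hlD, a, ha, b, hb, hab, hnab, hxa, hxb⟩ := h
  rcases list_ends (P := G.Adj x) (l := l) ⟨a, ha, hxa⟩ with
    ⟨p, c, s, rfl, h1, h2, h3⟩ | ⟨p, c, m, d, s, rfl, h1, h2, h3, h4⟩
  · exfalso
    have key : ∀ w ∈ p ++ c :: s, G.Adj x w → w = c := by
      intro w hw hxw
      rcases List.mem_append.1 hw with hw | hw
      · exact absurd hxw (h2 w hw)
      · rcases List.mem_cons.1 hw with hw | hw
        · exact hw
        · exact absurd hxw (h3 w hw)
    exact hab ((key a ha hxa).trans (key b hb hxb).symm)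
  · have hm : m ≠ [] := by
      rintro rfl
      have key : ∀ w ∈ p ++ c :: ([] ++ d :: s), G.Adj x w → w = c ∨ w = d := by
        intro w hw hxw
        simp only [List.nil_append, List.mem_append, List.mem_cons] at hw
        rcases hw with hw | hw | hw | hw
        · exact absurd hxw (h3 w hw)
        · exact Or.inl hw
        · exact Or.inr hw
        · exact absurd hxw (h4 w hw)
      have hcd : G.Adj c d := by
        have : IP G ((y :: p) ++ (c :: (d :: (s ++ [z])))) := by simpa using hl
        exact (this.right.2.1 d (by simp)).2 (by simp)
      rcases key a ha hxa with rfl | rfl <;> rcases key b hb hxb with rfl | rfl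
      · exact hab rfl
      · exact hnab hcd
      · exact hnab hcd.symm
      · exact hab rfl
    have hl' : IP G ((y :: (p ++ [c])) ++ (m ++ (d :: (s ++ [z])))) := by simpa using hl
    refine ⟨{w | w ∈ y :: (p ++ [c])}, {w | w ∈ d :: (s ++ [z])}, hl'.left.conn (by simp),
      hl'.right.right.conn (by simp), by simp, by simp, ?_, ?_, ⟨c, by simp, h1⟩,
      ⟨d, by simp, h2⟩, hl'.apart hm⟩
    · intro w hw
      simp only [mem_ofPred_eq, List.mem_cons, List.mem_append, List.not_mem_nil, or_false] at hw
      rcases hw with hw | hw | hw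
      · exact Or.inl hw
      · exact Or.inr (hlD w (by simp [hw]))
      · exact Or.inr (hlD w (by simp [hw]))
    · intro w hw
      simp only [mem_ofPred_eq, List.mem_cons, List.mem_append, List.not_mem_nil, or_false] at hw
      rcases hw with hw | hw | hw
      · exact Or.inr (hlD w (by simp [hw]))
      · exact Or.inr (hlD w (by simp [hw]))
      · exact Or.inl hw

theorem theta_of_claw_claw {D₁ D₂ : Set V} {x : Fin 3 → V} (h : Two G D₁ D₂ x)
    (h1 : HasClaw G D₁ x) (h2 : HasClaw G D₂ x) : HasTheta G := by
  obtain ⟨c, hc, S, hS, hSS⟩ := h1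
  obtain ⟨d, hd, T, hT, hTT⟩ := h2
  have hcd := h.apart c hc d hd
  have hcT : ∀ i, c ∉ T i := fun i hi => by
    rcases (hT i).2.2.1 hi with rfl | h'
    · exact h.out₁ i hc
    · exact (h.apart c hc c h').1 rfl
  have hdS : ∀ i, d ∉ S i := fun i hi => by
    rcases (hS i).2.2.1 hi with rfl | h'
    · exact h.out₂ i hd
    · exact (h.apart d h' d hd).1 rfl
  refine hasTheta_of_links hcd.1 hcd.2 (fun i => S i ∪ T i) ?_ ?_
  · intro i j hij
    have g1 := apart_glue h.apart (hS i).2.2.1 (hT j).2.2.1 (hT i).2.1 (hS j).2.1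
      (hSS i j hij) (hTT i j hij)
    have g2 := apart_glue h.apart.symm (hT i).2.2.1 (hS j).2.2.1 (hS i).2.1 (hT j).2.1
      (hTT i j hij) (hSS i j hij)
    exact ((hSS i j hij).union_right g1).union_left (g2.union_right (hTT i j hij))
  · intro i
    refine (((hS i).1.union (hT i).1 ⟨x i, (hS i).2.1, x i, (hT i).2.1, Or.inl rfl⟩).lk hcd.1
      hcd.2 ((hS i).2.2.2.2.mono subset_union_left)
      ((hT i).2.2.2.2.mono subset_union_right)).mono sdiff_subset

/-- A hole made of an induced path from `y` to `z` with interior in `B` and an induced path from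
`y` to `z` elsewhere. -/
theorem hole_of_path_pair {y z : V} {l m : List V} {E B : Set V} (hl : IP G (y :: (l ++ [z])))
    (hlB : ∀ u ∈ l, u ∈ B) (hm : IP G m) (h0 : m.head? = some y) (h1 : m.getLast? = some z)
    (hmE : ∀ u ∈ m, u = y ∨ u = z ∨ u ∈ E) (hEB : Apart G E B) (hn : ¬ G.Adj y z) :
    IsHole G {w | w ∈ m ∨ w ∈ l} := by
  have hl0 : l ≠ [] := by
    rintro rfl
    exact hn ((hl.2.1 z (by simp)).2 (by simp))
  have hyz : y ≠ z := by
    rintro rfl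
    exact hl.1 (by simp)
  obtain ⟨m', rfl⟩ : ∃ m', m = y :: m' := by
    cases m with
    | nil => simp at h0
    | cons c l => simp at h0; exact ⟨l, by rw [h0]⟩
  have hm0 : m' ≠ [] := by
    rintro rfl
    simp at h1
    exact hyz h1
  obtain ⟨m, c, rfl⟩ : ∃ p w', m' = p ++ [w'] :=
    ⟨m'.dropLast, m'.getLast hm0, (List.dropLast_append_getLast hm0).symm⟩
  rw [← List.cons_append, List.getLast?_append] at h1
  simp at h1
  subst h1
  have hm1 : m ≠ [] := by
    rintro rfl
    exact hn ((hm.2.1 c (by simp)).2 (by simp))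
  refine isHole_of_paths hm hl.2.2.left (by simp) hl0 ?_ ?_
  · have := List.length_pos_iff.2 hl0
    have := List.length_pos_iff.2 hm1
    simp; omega
  · intro u hu v hv
    have hlz := (ip_append.1 hl.2.2).2.2 v hv c (by simp)
    have e2 : (y :: (m ++ [c])).getLast? = some u ↔ u = c := by
      rw [← List.cons_append, List.getLast?_append]; simp [eq_comm]
    have e1 : (y :: (m ++ [c])).head? = some u ↔ u = y := by simp [eq_comm]
    rw [e1, e2]
    have hly := hl.2.1 v (by simp [hv])
    have e3 : (l ++ [c]).head? = l.head? := by
      cases l with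
      | nil => exact absurd rfl hl0
      | cons => simp
    rw [e3] at hly
    by_cases huy : u = y
    · subst huy
      refine ⟨fun e => hl.1 (by simp [e, hv]), ?_⟩
      simp [hly, hyz]
    by_cases huc : u = c
    · subst huc
      refine ⟨hlz.1.symm, ?_⟩
      rw [G.adj_comm, hlz.2]
      simp [huy]
    · have := hEB u (((hmE u hu).resolve_left huy).resolve_left huc) v (hlB v hv)
      simp [this.1, this.2, huy, huc]

/-- A path from `A` to `B` inside a union of two sets with a single edge between them. -/
theorem mem_of_crossing {m : List V} (hm : IP G m) {A B : Set V} {y z a b : V}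
    (h0 : y ∈ m) (h1 : z ∈ m) (hy : y ∈ A) (hz : z ∉ A)
    (hmAB : ∀ u ∈ m, u ∈ A ∨ u ∈ B) (h : ∀ u ∈ A, ∀ v ∈ B, G.Adj u v → u = a ∧ v = b) :
    a ∈ m ∧ b ∈ m := by
  obtain ⟨u, hu, huA, v, hv, hvA, huv⟩ :=
    (hm.conn (List.ne_nil_of_mem h0)).cross (T := A) h0 hy h1 hz
  obtain ⟨rfl, rfl⟩ := h u huA v ((hmAB v hv).resolve_left hvA) huv
  exact ⟨hu, hv⟩

theorem hub_of_claw_wide [Finite V] {D₁ D₂ : Set V} {x : Fin 3 → V} (h : Two G D₁ D₂ x)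
    (h1 : HasClaw G D₁ x) {i j k : Fin 3} (hij : i ≠ j) (hik : i ≠ k) (hjk : j ≠ k)
    (h2 : HasWide G D₂ (x i) (x j) (x k)) : HasTheta G ∨ IsHub G (x i) := by
  obtain ⟨c, hc, S, hS, hSS⟩ := h1
  have hx : ∀ i, c ≠ x i := fun i e => h.out₁ i (e ▸ hc)
  by_cases hcx : G.Adj c (x i)
  · right
    obtain ⟨l, hl, hlD, a, ha, b, hb, hab, hnab, hxa, hxb⟩ := h2
    have hconn : Conn G (insert c (S j) ∪ insert c (S k)) :=
      ((hS j).1.insert (hS j).2.2.2.2).union ((hS k).1.insert (hS k).2.2.2.2)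
        ⟨c, by simp, c, by simp, Or.inl rfl⟩
    obtain ⟨m, hm, hm0, hm1, hmS⟩ := hconn.path' (Or.inl (mem_insert_of_mem _ (hS j).2.1))
      (Or.inr (mem_insert_of_mem _ (hS k).2.1))
    have hmc : c ∈ m := by
      by_contra hcm
      have hmm : ∀ u ∈ m, u ∈ S j ∨ u ∈ S k := by
        intro u hu
        rcases hmS u hu with (rfl | h) | (rfl | h)
        · exact absurd hu hcm
        · exact Or.inl h
        · exact absurd hu hcm
        · exact Or.inr h
      have hxj : x j ∈ m := List.mem_of_mem_head? hm0
      have hxk : x k ∈ m := List.mem_of_getLast? hm1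
      obtain ⟨u, hu, huA, v, hv, hvA, huv⟩ := (hm.conn (List.ne_nil_of_mem hxj)).cross (T := S j)
        hxj (hS j).2.1 hxk (fun h' => (hSS j k hjk _ h' _ (hS k).2.1).1 rfl)
      exact (hSS j k hjk u huA v ((hmm v hv).resolve_left hvA)).2 huv
    have hmD : ∀ u ∈ m, u = x j ∨ u = x k ∨ u ∈ D₁ := by
      intro u hu
      rcases hmS u hu with (rfl | h) | (rfl | h)
      · exact Or.inr (Or.inr hc)
      · rcases (hS j).2.2.1 h with h | h
        · exact Or.inl h
        · exact Or.inr (Or.inr h)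
      · exact Or.inr (Or.inr hc)
      · rcases (hS k).2.2.1 h with h | h
        · exact Or.inr (Or.inl h)
        · exact Or.inr (Or.inr h)
    have hH := hole_of_path_pair hl hlD hm hm0 hm1 hmD h.apart (h.stable j k hjk).2
    have hca := h.apart c hc a (hlD a ha)
    have hcb := h.apart c hc b (hlD b hb)
    refine hub_of_stable_triple hH ?_ (p := c) (q := a) (r := b) ⟨Or.inl hmc, hcx.symm⟩
      ⟨Or.inr ha, hxa⟩ ⟨Or.inr hb, hxb⟩ hca.1 hcb.1 hab hca.2 hcb.2 hnab
    rintro (hm | hl)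
    · rcases hmD _ hm with h' | h' | h'
      · exact (h.stable i j hij).1 h'
      · exact (h.stable i k hik).1 h'
      · exact h.out₁ i h'
    · exact h.out₂ i (hlD _ hl)
  · left
    obtain ⟨T₁, T₂, c1, c2, y1, z2, s1, s2, x1, x2, ap⟩ := h2.split
    have cT : ∀ j, ∀ T : Set V, T ⊆ insert (x j) D₂ → c ∉ T := fun j T hT hcT => by
      rcases hT hcT with h' | h'
      · exact hx j h'
      · exact (h.apart c hc c h').1 rfl
    have side : ∀ j, i ≠ j → ∀ T : Set V, T ⊆ insert (x j) D₂ →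
        Apart G (S i \ {x i, c}) (S j ∪ T) := by
      intro j hij T hT
      refine Apart.union_right ((hSS i j hij).mono sdiff_subset subset_rfl) ?_
      rintro u ⟨hu, hux⟩ v hv
      rw [mem_insert_iff, mem_singleton_iff, not_or] at hux
      rcases hT hv with rfl | hv
      · exact hSS i j hij u hu _ (hS j).2.1
      · exact h.apart u (((hS i).2.2.1 hu).resolve_left hux.1) v hv
    refine theta3 (S₀ := S i \ {x i, c}) (S₁ := S j ∪ T₁) (S₂ := S k ∪ T₂) (hx i).symm
      (fun e => hcx e.symm) (side j hij T₁ s1) (side k hik T₂ s2) ?_ ?_ ?_ ?_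
    · have g1 := apart_glue h.apart (hS j).2.2.1 s2 y1 (hS k).2.1 (hSS j k hjk) ap
      have g2 := apart_glue h.apart.symm s1 (hS k).2.2.1 (hS j).2.1 z2 ap (hSS j k hjk)
      exact ((hSS j k hjk).union_right g1).union_left (g2.union_right ap)
    · exact (hS i).1.lk (hx i).symm (fun e => hcx e.symm)
        ((hS i).1.sees_of_mem (hS i).2.1 (hS i).2.2.2.2 hcx) (hS i).2.2.2.2
    · exact (((hS j).1.union c1 ⟨x j, (hS j).2.1, x j, y1, Or.inl rfl⟩).lk (hx i).symm
        (fun e => hcx e.symm) (x1.mono subset_union_right)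
        ((hS j).2.2.2.2.mono subset_union_left)).mono sdiff_subset
    · exact (((hS k).1.union c2 ⟨x k, (hS k).2.1, x k, z2, Or.inl rfl⟩).lk (hx i).symm
        (fun e => hcx e.symm) (x2.mono subset_union_right)
        ((hS k).2.2.2.2.mono subset_union_left)).mono sdiff_subset

theorem hub_of_wide_wide [Finite V] {D₁ D₂ : Set V} {x y z : V} (h : Apart G D₁ D₂)
    (hx1 : x ∉ D₁) (hx2 : x ∉ D₂) (hxy : x ≠ y) (hxz : x ≠ z) (hyz : ¬ G.Adj y z)
    (h1 : HasWide G D₁ x y z) (h2 : HasWide G D₂ x y z) : IsHub G x := by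
  obtain ⟨l, hl, hlD, a, ha, b, hb, hab, hnab, hxa, hxb⟩ := h1
  obtain ⟨m, hm, hmD, a', ha', b', hb', hab', hnab', hxa', hxb'⟩ := h2
  have hH := hole_of_path_pair hm hmD hl (by simp) (by rw [← List.cons_append, List.getLast?_append]; simp)
    (E := D₁) (fun u hu => by
      simp only [List.mem_cons, List.mem_append, List.not_mem_nil, or_false] at hu
      rcases hu with h | h | h
      · exact Or.inl h
      · exact Or.inr (Or.inr (hlD u h))
      · exact Or.inr (Or.inl h)) h hyz
  refine hub_of_four hH ?_ (four_le_ncard (a := a) (b := b) (c := a') (d := b')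
    ⟨Or.inl (by simp [ha]), hxa⟩ ⟨Or.inl (by simp [hb]), hxb⟩ ⟨Or.inr ha', hxa'⟩
    ⟨Or.inr hb', hxb'⟩ hab (h a (hlD a ha) a' (hmD a' ha')).1 (h a (hlD a ha) b' (hmD b' hb')).1
    (h b (hlD b hb) a' (hmD a' ha')).1 (h b (hlD b hb) b' (hmD b' hb')).1 hab')
  rintro (hu | hu)
  · simp only [List.mem_cons, List.mem_append, List.not_mem_nil, or_false] at hu
    rcases hu with h | h | h
    · exact hxy h
    · exact hx1 (hlD x h)
    · exact hxz h
  · exact hx2 (hmD x hu)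

theorem theta_of_wide_wide {D₁ D₂ : Set V} {x y z : V} (h : Apart G D₁ D₂)
    (hxy : x ≠ y) (nxy : ¬ G.Adj x y)
    (h1 : HasWide G D₁ x y z) (h2 : HasWide G D₂ y x z) : HasTheta G := by
  obtain ⟨T₁, T₂, c1, c2, y1, z2, s1, s2, x1, x2, ap⟩ := h1.split
  obtain ⟨R₁, R₂, d1, d2, u1, w2, r1, r2, v1, v2, aq⟩ := h2.split
  have nyx : ¬ G.Adj y x := fun e => nxy e.symm
  have t1 : T₁ \ {x, y} ⊆ D₁ := by
    rintro u ⟨hu, hux⟩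
    rw [mem_insert_iff, mem_singleton_iff, not_or] at hux
    exact (s1 hu).resolve_left hux.2
  have t2 : R₁ \ {x, y} ⊆ D₂ := by
    rintro u ⟨hu, hux⟩
    rw [mem_insert_iff, mem_singleton_iff, not_or] at hux
    exact (r1 hu).resolve_left hux.1
  refine theta3 (S₀ := T₁ \ {x, y}) (S₁ := R₁ \ {x, y}) (S₂ := (T₂ ∪ R₂)) hxy nxy
    (h.mono t1 t2) ?_ ?_ ?_ ?_ ?_
  · refine Apart.union_right (ap.mono sdiff_subset subset_rfl) ?_
    intro u hu v hv
    rcases r2 hv with rfl | hv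
    · exact ap u hu.1 _ z2
    · exact h u (t1 hu) v hv
  · refine Apart.union_right ?_ (aq.mono sdiff_subset subset_rfl)
    intro u hu v hv
    rcases s2 hv with rfl | hv
    · exact aq u hu.1 _ w2
    · exact h.symm u (t2 hu) v hv
  · exact c1.lk hxy nxy x1 (c1.sees_of_mem y1 x1 nxy)
  · exact d1.lk hxy nxy (d1.sees_of_mem u1 v1 nyx) v1
  · exact ((c2.union d2 ⟨z, z2, z, w2, Or.inl rfl⟩).lk hxy nxy (x2.mono subset_union_left)
      (v2.mono subset_union_right)).mono sdiff_subset

end Types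

section ThreeWay

variable {V : Type} {G : SimpleGraph V}

theorem even_wheel_of_four [Finite V] {H : Set V} {x a b c d : V} (hH : IsHole G H) (hx : x ∉ H)
    (h : holeNbrs G H x = {a, b, c, d}) (h1 : a ≠ b) (h2 : a ≠ c) (h3 : a ≠ d) (h4 : b ≠ c)
    (h5 : b ≠ d) (h6 : c ≠ d) :
    ∃ (H : Set V) (x : V), IsWheel G H x ∧ Even (holeNbrs G H x).ncard := by
  have e : (holeNbrs G H x).ncard = 4 := by
    rw [h, Set.ncard_insert_of_notMem (by simp [h1, h2, h3]),
      Set.ncard_insert_of_notMem (by simp [h4, h5]), Set.ncard_pair h6]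
  exact ⟨H, x, ⟨hH, hx, by omega⟩, by rw [e]; decide⟩

theorem false_of_tri_tri [Finite V] (hC : MemC G) {D₁ D₂ : Set V} {x : Fin 3 → V}
    (h : Two G D₁ D₂ x) (h1 : HasTri G D₁ x) (h2 : HasTri G D₂ x) : False := by
  obtain ⟨a, S, hS, hSS⟩ := h1
  obtain ⟨b, T, hT, hTT⟩ := h2
  have haa : ∀ i j, i ≠ j → G.Adj (a i) (a j) := fun i j hij =>
    (hSS i j hij _ (hS i).2.2.1 _ (hS j).2.2.1).2.2 ⟨rfl, rfl⟩
  have hbb : ∀ i j, i ≠ j → G.Adj (b i) (b j) := fun i j hij =>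
    (hTT i j hij _ (hT i).2.2.1 _ (hT j).2.2.1).2.2 ⟨rfl, rfl⟩
  have hconn : ∀ i, Conn G (S i ∪ T i) := fun i =>
    (hS i).1.union (hT i).1 ⟨x i, (hS i).2.1, x i, (hT i).2.1, Or.inl rfl⟩
  have key : ∀ i j, i ≠ j → ∀ u ∈ S i ∪ T i, ∀ v ∈ S j ∪ T j, u ≠ v ∧
      (G.Adj u v ↔ (u = a i ∧ v = a j) ∨ (u = b i ∧ v = b j)) := by
    intro i j hij u hu v hv
    have hr : (u = a i ∧ v = a j) ∨ (u = b i ∧ v = b j) → G.Adj u v := by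
      rintro (⟨rfl, rfl⟩ | ⟨rfl, rfl⟩)
      · exact haa i j hij
      · exact hbb i j hij
    have case1 : u ∈ S i → v ∈ S j → u ≠ v ∧
        (G.Adj u v ↔ (u = a i ∧ v = a j) ∨ (u = b i ∧ v = b j)) := fun hu hv =>
      ⟨(hSS i j hij u hu v hv).1, fun e => Or.inl ((hSS i j hij u hu v hv).2.1 e), hr⟩
    have case2 : u ∈ T i → v ∈ T j → u ≠ v ∧
        (G.Adj u v ↔ (u = a i ∧ v = a j) ∨ (u = b i ∧ v = b j)) := fun hu hv =>
      ⟨(hTT i j hij u hu v hv).1, fun e => Or.inr ((hTT i j hij u hu v hv).2.1 e), hr⟩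
    rcases hu with hu | hu <;> rcases hv with hv | hv
    · exact case1 hu hv
    · rcases (hS i).2.2.2 hu with rfl | hu'
      · exact case2 (hT i).2.1 hv
      rcases (hT j).2.2.2 hv with rfl | hv'
      · exact case1 hu (hS j).2.1
      have := h.apart u hu' v hv'
      exact ⟨this.1, fun e => absurd e this.2, hr⟩
    · rcases (hT i).2.2.2 hu with rfl | hu'
      · exact case1 (hS i).2.1 hv
      rcases (hS j).2.2.2 hv with rfl | hv'
      · exact case2 hu (hT j).2.1
      have := h.apart.symm u hu' v hv'
      exact ⟨this.1, fun e => absurd e this.2, hr⟩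
    · exact case2 hu hv
  have hax : ∀ i, a i = b i → a i = x i := by
    intro i hi
    rcases (hS i).2.2.2 (hS i).2.2.1 with h' | h'
    · exact h'
    · rcases (hT i).2.2.2 (hT i).2.2.1 with h'' | h''
      · exact hi.trans h''
      · exact absurd hi (h.apart _ h' _ h'').1
  have hne : ∀ i j, i ≠ j → a i = b i → a j ≠ b j := by
    intro i j hij hi hj
    have := haa i j hij
    rw [hax i hi, hax j hj] at this
    exact (h.stable i j hij).2 this
  by_cases hall : ∀ i, a i ≠ b i
  · exact hC.2.2.1 (hasPrism_of_sets (fun i => S i ∪ T i) a b hconn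
      (fun i => Or.inl (hS i).2.2.1) (fun i => Or.inr (hT i).2.2.1) hall key)
  · push Not at hall
    obtain ⟨i, hi⟩ := hall
    obtain ⟨j, k, hij, hik, hjk⟩ : ∃ j k : Fin 3, i ≠ j ∧ i ≠ k ∧ j ≠ k := by
      fin_cases i
      · exact ⟨1, 2, by decide, by decide, by decide⟩
      · exact ⟨0, 2, by decide, by decide, by decide⟩
      · exact ⟨0, 1, by decide, by decide, by decide⟩
    have hj := hne i j hij hi
    have hk := hne i k hik hi
    obtain ⟨l, hl, l0, l1, lS⟩ := (hconn j).path' (Or.inl (hS j).2.2.1) (Or.inr (hT j).2.2.1)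
    obtain ⟨m, hm, m0, m1, mS⟩ := (hconn k).path' (Or.inl (hS k).2.2.1) (Or.inr (hT k).2.2.1)
    have len : ∀ (l : List V) (p q : V), l.head? = some p → l.getLast? = some q → p ≠ q →
        2 ≤ l.length := by
      intro l p q h0 h1 hpq
      rcases l with _ | ⟨c, _ | ⟨d, m⟩⟩
      · simp at h0
      · simp at h0 h1
        exact absurd (h0.symm.trans h1) hpq
      · simp
    have l2 := len l _ _ l0 l1 hj
    have m2 := len m _ _ m0 m1 hk
    have hH := isHole_of_paths hl hm (by rintro rfl; simp at l0) (by rintro rfl; simp at m0)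
      (by omega) (fun u hu v hv => by
        rw [l0, l1, m0, m1, Option.some.injEq, Option.some.injEq, Option.some.injEq,
          Option.some.injEq, eq_comm, @eq_comm _ (a k), @eq_comm _ (b j), @eq_comm _ (b k)]
        have := key j k hjk u (lS u hu) v (mS v hv)
        exact this)
    have hxi : x i ∈ S i ∪ T i := Or.inl (hS i).2.1
    have hai := hax i hi
    have aj : a j ∈ l := List.mem_of_mem_head? l0
    have bj : b j ∈ l := List.mem_of_getLast? l1
    have ak : a k ∈ m := List.mem_of_mem_head? m0
    have bk : b k ∈ m := List.mem_of_getLast? m1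
    have hN : holeNbrs G {w | w ∈ l ∨ w ∈ m} (x i) = {a j, b j, a k, b k} := by
      ext w
      constructor
      · rintro ⟨hw | hw, hxw⟩
        · rcases (key i j hij _ hxi w (lS w hw)).2.1 hxw with h' | h' <;> simp [h'.2]
        · rcases (key i k hik _ hxi w (mS w hw)).2.1 hxw with h' | h' <;> simp [h'.2]
      · rintro (rfl | rfl | rfl | rfl)
        · exact ⟨Or.inl aj, hai ▸ haa i j hij⟩
        · exact ⟨Or.inl bj, by rw [← hai, hi]; exact hbb i j hij⟩
        · exact ⟨Or.inr ak, hai ▸ haa i k hik⟩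
        · exact ⟨Or.inr bk, by rw [← hai, hi]; exact hbb i k hik⟩
    have hjk' := fun u hu v hv => (key j k hjk u (lS u hu) v (mS v hv)).1
    obtain ⟨H, y, hw, he⟩ := even_wheel_of_four hH (by
      rintro (hw | hw)
      · exact (key i j hij _ hxi _ (lS _ hw)).1 rfl
      · exact (key i k hik _ hxi _ (mS _ hw)).1 rfl) hN hj (hjk' _ aj _ ak) (hjk' _ aj _ bk)
      (hjk' _ bj _ ak) (hjk' _ bj _ bk) hk
    exact hC.2.2.2 H y hw he

/-- A terminal adjacent to both triangle vertices of the other two arms and wide on the other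
side is a hub. -/
theorem hub_of_tri_wide [Finite V] {E B S T : Set V} {x y z a b : V} (h : Apart G E B)
    (hS : Conn G S) (hT : Conn G T) (hy : y ∈ S) (hz : z ∈ T) (hSE : S ⊆ insert y E)
    (hTE : T ⊆ insert z E) (haS : a ∈ S) (hbT : b ∈ T)
    (hST : ∀ u ∈ S, ∀ v ∈ T, u ≠ v ∧ (G.Adj u v ↔ u = a ∧ v = b)) (hxa : G.Adj x a)
    (hxb : G.Adj x b) (hxE : x ∉ E) (hxB : x ∉ B) (hyB : y ∉ B) (hzB : z ∉ B) (hxy : x ≠ y)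
    (hxz : x ≠ z)
    (hyz : ¬ G.Adj y z) (hw : HasWide G B x y z) : IsHub G x := by
  obtain ⟨l, hl, hlB, c, hc, d, hd, hcd, -, hxc, hxd⟩ := hw
  have hconn : Conn G (S ∪ T) := hS.union hT
    ⟨a, haS, b, hbT, Or.inr ((hST a haS b hbT).2.2 ⟨rfl, rfl⟩)⟩
  obtain ⟨m, hm, m0, m1, mS⟩ := hconn.path' (Or.inl hy) (Or.inr hz)
  obtain ⟨ham, hbm⟩ := mem_of_crossing hm (A := S) (B := T) (a := a) (b := b)
    (List.mem_of_mem_head? m0) (List.mem_of_getLast? m1) hy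
    (fun h' => (hST _ h' _ hz).1 rfl) mS (fun u hu v hv e => (hST u hu v hv).2.1 e)
  have hmE : ∀ u ∈ m, u = y ∨ u = z ∨ u ∈ E := by
    intro u hu
    rcases mS u hu with h | h
    · rcases hSE h with h | h
      · exact Or.inl h
      · exact Or.inr (Or.inr h)
    · rcases hTE h with h | h
      · exact Or.inr (Or.inl h)
      · exact Or.inr (Or.inr h)
  have hmB : ∀ u ∈ m, u ∉ B := by
    intro u hu hB
    rcases hmE u hu with rfl | rfl | h'
    · exact hyB hB
    · exact hzB hB
    · exact (h u h' u hB).1 rfl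
  have hH := hole_of_path_pair hl hlB hm m0 m1 hmE h hyz
  have hne : ∀ u ∈ m, ∀ v ∈ l, u ≠ v := fun u hu v hv e => hmB u hu (e ▸ hlB v hv)
  refine hub_of_four hH ?_ (four_le_ncard (a := a) (b := b) (c := c) (d := d)
    ⟨Or.inl ham, hxa⟩ ⟨Or.inl hbm, hxb⟩ ⟨Or.inr hc, hxc⟩ ⟨Or.inr hd, hxd⟩ (hST a haS b hbT).1
    (hne a ham c hc) (hne a ham d hd) (hne b hbm c hc) (hne b hbm d hd) hcd)
  rintro (hw | hw)
  · rcases hmE x hw with h | h | h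
    · exact hxy h
    · exact hxz h
    · exact hxE h
  · exact hxB (hlB x hw)

/-- The three-way attachment for a minimal connected set with two private terminals. -/
theorem types_of_private {A : Set V} (hA : Conn G A) {x : Fin 3 → V}
    (hout : ∀ i, x i ∉ A) (hst : ∀ i j, i ≠ j → x i ≠ x j ∧ ¬ G.Adj (x i) (x j))
    (hsee : Sees G (x 0) A) {d₁ d₂ : V} (hd : d₁ ≠ d₂)
    (h1 : d₁ ∈ A) (h2 : d₂ ∈ A) (p1 : ∀ u ∈ A, G.Adj (x 1) u ↔ u = d₁)
    (p2 : ∀ u ∈ A, G.Adj (x 2) u ↔ u = d₂) :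
    HasClaw G A x ∨ HasTri G A x ∨ HasWide G A (x 0) (x 1) (x 2) := by
  obtain ⟨M, hM, M0, M1, MA⟩ := hA.path' h1 h2
  have hMne : M ≠ [] := by rintro rfl; simp at M0
  have hMc := hM.conn hMne
  have d1M : d₁ ∈ M := List.mem_of_mem_head? M0
  have d2M : d₂ ∈ M := List.mem_of_getLast? M1
  have hMs : ∀ u ∈ M, Sees G u {w | w ∈ M} := by
    intro u hu
    obtain ⟨v, hv, -, huv⟩ := hMc.sees_diff hu (by
      intro e
      have e1 : d₁ ∈ ({u} : Set V) := e ▸ d1M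
      have e2 : d₂ ∈ ({u} : Set V) := e ▸ d2M
      rw [mem_singleton_iff] at e1 e2
      exact hd (e1.trans e2.symm))
    exact ⟨v, hv, huv⟩
  have hfull : IP G (x 1 :: (M ++ [x 2])) := by
    rw [ip_cons, ip_append]
    refine ⟨?_, ?_, hM, ip_singleton _, ?_⟩
    · simp only [List.mem_append, List.mem_singleton, not_or]
      exact ⟨fun h => hout 1 (MA _ h), (hst 1 2 (by decide)).1⟩
    · intro b hb
      have e : (M ++ [x 2]).head? = some d₁ := by rw [List.head?_append, M0]; rfl
      rw [e, Option.some.injEq]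
      rcases List.mem_append.1 hb with hb | hb
      · rw [p1 b (MA b hb), eq_comm]
      · rw [List.mem_singleton] at hb
        subst hb
        simp only [(hst 1 2 (by decide)).2, false_iff]
        exact fun e => hout 2 (e ▸ h1)
    · intro u hu b hb
      rw [List.mem_singleton] at hb
      subst hb
      refine ⟨fun e => hout 2 (MA _ (e ▸ hu)), ?_⟩
      rw [G.adj_comm, p2 u (MA u hu), M1]
      simp [eq_comm]
  obtain ⟨l, w, hR, R0, hw, hl, hRA⟩ := (hA.insert hsee).path (mem_insert (x 0) A)
    (mem_insert_of_mem _ h1) (P := fun u => Sees G u {w | w ∈ M}) (hMs d₁ d1M)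
  have hlM : ∀ u ∈ l, u ∉ M := fun u hu h => hl u hu (hMs u h)
  have hx0 : x 0 ∈ l ++ [w] := List.mem_of_mem_head? R0
  have hwM : w ∉ M := by
    intro h
    by_cases hl0 : l = []
    · subst hl0
      simp at hx0
      exact hout 0 (MA _ (hx0 ▸ h))
    · obtain ⟨u, hu, hwu⟩ := hR.last_adj hl0
      exact hl u hu ⟨w, h, hwu.symm⟩
  have hRM : ∀ u ∈ l ++ [w], u ∉ M := by
    intro u hu
    rcases List.mem_append.1 hu with h | h
    · exact hlM u h
    · rw [List.mem_singleton] at h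
      exact h ▸ hwM
  have hR1 : ∀ u ∈ l ++ [w], u ≠ x 1 ∧ u ≠ x 2 ∧ ¬ G.Adj u (x 1) ∧ ¬ G.Adj u (x 2) := by
    intro u hu
    rcases hRA u hu with rfl | huA
    · exact ⟨(hst 0 1 (by decide)).1, (hst 0 2 (by decide)).1, (hst 0 1 (by decide)).2,
        (hst 0 2 (by decide)).2⟩
    · refine ⟨fun e => hout 1 (e ▸ huA), fun e => hout 2 (e ▸ huA), fun e => ?_, fun e => ?_⟩
      · exact hRM u hu (((p1 u huA).1 e.symm) ▸ d1M)
      · exact hRM u hu (((p2 u huA).1 e.symm) ▸ d2M)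
  -- apartness of parts of the attaching path from parts of the long path
  have hRap : ∀ Z : Set V, Z ⊆ {u | u ∈ l ++ [w]} → ∀ Y : Set V,
      (∀ v ∈ Y, v = x 1 ∨ v = x 2 ∨ (v ∈ M ∧ ¬ G.Adj w v) ∨ (v ∈ M ∧ w ∉ Z)) → Apart G Z Y := by
    intro Z hZ Y hY u hu v hv
    have := hR1 u (hZ hu)
    rcases hY v hv with rfl | rfl | ⟨h, h'⟩ | ⟨h, h'⟩
    · exact ⟨this.1, this.2.2.1⟩
    · exact ⟨this.2.1, this.2.2.2⟩
    · refine ⟨fun e => hRM u (hZ hu) (e ▸ h), fun e => ?_⟩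
      rcases List.mem_append.1 (hZ hu) with h'' | h''
      · exact hl u h'' ⟨v, h, e⟩
      · rw [List.mem_singleton] at h''
        exact h' (h'' ▸ e)
    · refine ⟨fun e => hRM u (hZ hu) (e ▸ h), fun e => ?_⟩
      rcases List.mem_append.1 (hZ hu) with h'' | h''
      · exact hl u h'' ⟨v, h, e⟩
      · rw [List.mem_singleton] at h''
        exact h' (h'' ▸ hu)
  have three : ∀ {S : Fin 3 → Set V}, Apart G (S 0) (S 1) → Apart G (S 0) (S 2) →
      Apart G (S 1) (S 2) → ∀ i j, i ≠ j → Apart G (S i) (S j) := by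
    intro S h01 h02 h12 i j hij
    fin_cases i <;> fin_cases j <;> simp_all [Apart.symm]
  rcases list_ends (P := G.Adj w) (l := M) hw with
    ⟨p, c, s, rfl, c1, c2, c3⟩ | ⟨p, c, m, d, s, rfl, c1, c2, c3, c4⟩
  · left
    have hp : IP G ((x 1 :: p) ++ ([c] ++ (s ++ [x 2]))) := by simpa using hfull
    refine ⟨c, MA c (by simp), ![{u | u ∈ l ++ [w]}, {u | u ∈ x 1 :: p}, {u | u ∈ s ++ [x 2]}],
      ?_, three ?_ ?_ ?_⟩
    · intro i
      fin_cases i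
      · exact ⟨hR.conn (by simp), hx0, hRA, fun h => hRM c h (by simp), w, by simp, c1.symm⟩
      · refine ⟨hp.left.conn (by simp), by simp, ?_, ?_, ?_⟩
        · intro u hu
          rcases List.mem_cons.1 hu with h | h
          · exact Or.inl h
          · exact Or.inr (MA u (by simp [h]))
        · intro h
          exact ((ip_append.1 hp).2.2 c h c (by simp)).1 rfl
        · have := hp
          rw [← List.append_assoc] at this
          exact this.left.last_adj (by simp)
      · refine ⟨hp.right.right.conn (by simp), by simp, ?_, ?_, ?_⟩
        · intro u hu
          rcases List.mem_append.1 hu with h | h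
          · exact Or.inr (MA u (by simp [h]))
          · exact Or.inl (List.mem_singleton.1 h)
        · intro h
          exact ((ip_append.1 hp.right).2.2 c (by simp) c h).1 rfl
        · exact hp.right.head_adj (by simp)
    · refine hRap _ subset_rfl _ ?_
      intro v hv
      rcases List.mem_cons.1 hv with h | h
      · exact Or.inl h
      · exact Or.inr (Or.inr (Or.inl ⟨by simp [h], c2 v h⟩))
    · refine hRap _ subset_rfl _ ?_
      intro v hv
      rcases List.mem_append.1 hv with h | h
      · exact Or.inr (Or.inr (Or.inl ⟨by simp [h], c3 v h⟩))
      · exact Or.inr (Or.inl (List.mem_singleton.1 h))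
    · exact hp.apart (by simp)
  · have hp : IP G ((x 1 :: (p ++ [c])) ++ (m ++ (d :: (s ++ [x 2])))) := by simpa using hfull
    have hS1 : {u | u ∈ x 1 :: (p ++ [c])} ⊆ insert (x 1) A := by
      intro u hu
      simp only [mem_ofPred_eq, List.mem_cons, List.mem_append, List.not_mem_nil, or_false] at hu
      rcases hu with h | h | h
      · exact Or.inl h
      · exact Or.inr (MA u (by simp [h]))
      · exact Or.inr (MA u (by simp [h]))
    have hS2 : {u | u ∈ d :: (s ++ [x 2])} ⊆ insert (x 2) A := by
      intro u hu
      simp only [mem_ofPred_eq, List.mem_cons, List.mem_append, List.not_mem_nil, or_false] at hu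
      rcases hu with h | h | h
      · exact Or.inr (MA u (by simp [h]))
      · exact Or.inr (MA u (by simp [h]))
      · exact Or.inl h
    by_cases hm : m = []
    · subst hm
      right; left
      have two : ∀ {S : Fin 3 → Set V} {a : Fin 3 → V},
          (∀ u ∈ S 0, ∀ v ∈ S 1, u ≠ v ∧ (G.Adj u v ↔ u = a 0 ∧ v = a 1)) →
          (∀ u ∈ S 0, ∀ v ∈ S 2, u ≠ v ∧ (G.Adj u v ↔ u = a 0 ∧ v = a 2)) →
          (∀ u ∈ S 1, ∀ v ∈ S 2, u ≠ v ∧ (G.Adj u v ↔ u = a 1 ∧ v = a 2)) →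
          ∀ i j, i ≠ j → ∀ u ∈ S i, ∀ v ∈ S j, u ≠ v ∧ (G.Adj u v ↔ u = a i ∧ v = a j) := by
        intro S a h01 h02 h12 i j hij
        have sw : ∀ i j, (∀ u ∈ S i, ∀ v ∈ S j, u ≠ v ∧ (G.Adj u v ↔ u = a i ∧ v = a j)) →
            ∀ u ∈ S j, ∀ v ∈ S i, u ≠ v ∧ (G.Adj u v ↔ u = a j ∧ v = a i) := by
          intro i j h u hu v hv
          refine ⟨(h v hv u hu).1.symm, ?_⟩
          rw [G.adj_comm, (h v hv u hu).2, and_comm]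
        fin_cases i <;> fin_cases j
        · exact absurd rfl hij
        · exact h01
        · exact h02
        · exact sw _ _ h01
        · exact absurd rfl hij
        · exact h12
        · exact sw _ _ h02
        · exact sw _ _ h12
        · exact absurd rfl hij
      have e1 : (x 1 :: (p ++ [c])).getLast? = some c := by
        rw [← List.cons_append, List.getLast?_append]; rfl
      have adjR : ∀ u ∈ l ++ [w], ∀ v ∈ p ++ c :: ([] ++ d :: s), G.Adj u v →
          u = w ∧ (v = c ∨ v = d) := by
        intro u hu v hv huv
        have huw : u = w := by
          rcases List.mem_append.1 hu with h | h
          · exact absurd ⟨v, hv, huv⟩ (hl u h)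
          · simpa using h
        subst huw
        refine ⟨rfl, ?_⟩
        simp only [List.nil_append, List.mem_append, List.mem_cons] at hv
        rcases hv with h | h | h | h
        · exact absurd huv (c3 v h)
        · exact Or.inl h
        · exact Or.inr h
        · exact absurd huv (c4 v h)
      refine ⟨![w, c, d], ![{u | u ∈ l ++ [w]}, {u | u ∈ x 1 :: (p ++ [c])},
        {u | u ∈ d :: (s ++ [x 2])}], ?_, two ?_ ?_ ?_⟩
      · intro i
        fin_cases i
        · exact ⟨hR.conn (by simp), hx0, by simp, hRA⟩
        · exact ⟨hp.left.conn (by simp), by simp, by simp, hS1⟩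
        · exact ⟨hp.right.right.conn (by simp), by simp, by simp, hS2⟩
      · intro u hu v hv
        have hu' : u ∈ l ++ [w] := hu
        have hv' : v ∈ x 1 :: (p ++ [c]) := hv
        rcases List.mem_cons.1 hv' with rfl | hv'
        · refine ⟨(hR1 u hu').1, fun e => absurd e (hR1 u hu').2.2.1, ?_⟩
          rintro ⟨-, e⟩
          have e' : x 1 = c := e
          exact absurd (MA c (by simp)) (e' ▸ hout 1)
        · have hvM : v ∈ p ++ c :: ([] ++ d :: s) := by
            rcases List.mem_append.1 hv' with h | h
            · simp [h]
            · simp at h; simp [h]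
          refine ⟨fun e => hRM u hu' (e ▸ hvM), fun e => ?_, ?_⟩
          · obtain ⟨h3, h4⟩ := adjR u hu' v hvM e
            refine ⟨h3, ?_⟩
            rcases h4 with h4 | rfl
            · exact h4
            · exact absurd rfl ((ip_append.1 hp).2.2 v hv v (by simp)).1
          · rintro ⟨h3, h4⟩
            change u = w at h3
            change v = c at h4
            subst h3 h4; exact c1
      · intro u hu v hv
        have hu' : u ∈ l ++ [w] := hu
        have hv' : v ∈ (d :: s) ++ [x 2] := by simpa using hv
        rcases List.mem_append.1 hv' with hv' | hv'
        · have hvM : v ∈ p ++ c :: ([] ++ d :: s) := by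
            rcases List.mem_cons.1 hv' with h | h <;> simp [h]
          refine ⟨fun e => hRM u hu' (e ▸ hvM), fun e => ?_, ?_⟩
          · obtain ⟨h3, h4⟩ := adjR u hu' v hvM e
            refine ⟨h3, ?_⟩
            rcases h4 with rfl | h4
            · exact absurd rfl ((ip_append.1 hp).2.2 v (by simp) v hv).1
            · exact h4
          · rintro ⟨h3, h4⟩
            change u = w at h3
            change v = d at h4
            subst h3 h4; exact c2
        · rw [List.mem_singleton] at hv'
          subst hv'
          refine ⟨(hR1 u hu').2.1, fun e => absurd e (hR1 u hu').2.2.2, ?_⟩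
          rintro ⟨-, e⟩
          have e' : x 2 = d := e
          exact absurd (MA d (by simp)) (e' ▸ hout 2)
      · intro u hu v hv
        have := (ip_append.1 hp).2.2 u hu v hv
        refine ⟨this.1, ?_⟩
        rw [this.2, e1]
        simp [eq_comm]
    · have hcd := hp.apart hm c (by simp) d (by simp)
      by_cases hwx : w = x 0
      · right; right
        subst hwx
        exact ⟨_, hfull, MA, c, by simp, d, by simp, hcd.1, hcd.2, c1, c2⟩
      · left
        have hl0 : l ≠ [] := by
          rintro rfl
          simp at hx0
          exact hwx hx0.symm
        have hx0l : x 0 ∈ l := by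
          rcases List.mem_append.1 hx0 with h | h
          · exact h
          · exact absurd (List.mem_singleton.1 h).symm hwx
        have hwA : w ∈ A := (hRA w (by simp)).resolve_left hwx
        have hwl : w ∉ l := fun h => ((ip_append.1 hR).2.2 w h w (by simp)).1 rfl
        refine ⟨w, hwA, ![{u | u ∈ l}, {u | u ∈ x 1 :: (p ++ [c])},
          {u | u ∈ d :: (s ++ [x 2])}], ?_, three ?_ ?_ ?_⟩
        · have hwS1 : w ∉ {u | u ∈ x 1 :: (p ++ [c])} := by
            intro h
            simp only [mem_ofPred_eq, List.mem_cons, List.mem_append, List.not_mem_nil,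
              or_false] at h
            rcases h with h | h | h
            · exact hout 1 (h ▸ hwA)
            · exact hwM (by simp [h])
            · exact hwM (by simp [h])
          have hwS2 : w ∉ {u | u ∈ d :: (s ++ [x 2])} := by
            intro h
            simp only [mem_ofPred_eq, List.mem_cons, List.mem_append, List.not_mem_nil,
              or_false] at h
            rcases h with h | h | h
            · exact hwM (by simp [h])
            · exact hwM (by simp [h])
            · exact hout 2 (h ▸ hwA)
          intro i
          fin_cases i
          · exact ⟨hR.left.conn hl0, hx0l, fun u hu => hRA u (List.mem_append_left _ hu), hwl,
              hR.last_adj hl0⟩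
          · exact ⟨hp.left.conn (by simp), by simp, hS1, hwS1, c, by simp, c1⟩
          · exact ⟨hp.right.right.conn (by simp), by simp, hS2, hwS2, d, by simp, c2⟩
        · refine hRap _ (fun u hu => List.mem_append_left _ hu) _ ?_
          intro v hv
          simp only [Matrix.cons_val_one, Matrix.cons_val_zero, mem_ofPred_eq, List.mem_cons,
            List.mem_append, List.not_mem_nil, or_false] at hv
          rcases hv with h | h | h
          · exact Or.inl h
          · exact Or.inr (Or.inr (Or.inr ⟨by simp [h], hwl⟩))
          · exact Or.inr (Or.inr (Or.inr ⟨by simp [h], hwl⟩))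
        · refine hRap _ (fun u hu => List.mem_append_left _ hu) _ ?_
          intro v hv
          have hv' : v ∈ d :: (s ++ [x 2]) := hv
          simp only [List.mem_cons,
            List.mem_append, List.not_mem_nil, or_false] at hv'
          rcases hv' with h | h | h
          · exact Or.inr (Or.inr (Or.inr ⟨by simp [h], hwl⟩))
          · exact Or.inr (Or.inr (Or.inr ⟨by simp [h], hwl⟩))
          · exact Or.inr (Or.inl h)
        · exact hp.apart hm

theorem types_of_conn [Finite V] {A : Set V} (hA : Conn G A) {x : Fin 3 → V}
    (hout : ∀ i, x i ∉ A) (hst : ∀ i j, i ≠ j → x i ≠ x j ∧ ¬ G.Adj (x i) (x j))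
    (hsee : ∀ i, Sees G (x i) A) :
    HasClaw G A x ∨ HasTri G A x ∨
      ∃ i j k : Fin 3, i ≠ j ∧ i ≠ k ∧ j ≠ k ∧ HasWide G A (x i) (x j) (x k) := by
  obtain ⟨B, ⟨hBA, hB, hBs⟩, hmin⟩ :=
    (Set.toFinite {B : Set V | B ⊆ A ∧ Conn G B ∧ ∀ i, Sees G (x i) B}).exists_minimal
    ⟨A, subset_rfl, hA, hsee⟩
  have hout' : ∀ i, x i ∉ B := fun i h => hout i (hBA h)
  obtain ⟨v, hv⟩ := hB.1
  by_cases hB1 : B = {v}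
  · left
    have hvx : ∀ i, G.Adj v (x i) := by
      intro i
      obtain ⟨u, hu, h⟩ := hBs i
      rw [hB1, mem_singleton_iff] at hu
      exact hu ▸ h.symm
    refine ⟨v, hBA hv, fun i => {x i}, fun i => ⟨Conn.singleton _, rfl, by simp, ?_, x i, rfl,
      hvx i⟩, ?_⟩
    · intro h
      exact hout' i (h ▸ hv)
    · rintro i j hij u rfl w rfl
      exact hst i j hij
  · have nonsing : ∀ d, B ≠ {d} := by
      rintro d rfl
      exact hB1 (by rw [mem_singleton_iff.1 hv])
    obtain ⟨d₁, hd₁, -, hc₁⟩ := hB.exists_noncut hv hB1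
    obtain ⟨d₂, hd₂, hd, hc₂⟩ := hB.exists_noncut hd₁ (nonsing d₁)
    have priv : ∀ d ∈ B, Conn G (B \ {d}) → ∃ i, ∀ u ∈ B, G.Adj (x i) u ↔ u = d := by
      intro d hd hc
      by_contra hno
      push Not at hno
      have hall : ∀ i, Sees G (x i) (B \ {d}) := by
        intro i
        by_contra hns
        have hns' : ∀ u ∈ B, G.Adj (x i) u → u = d := fun u hu h => by
          by_contra hud
          exact hns ⟨u, ⟨hu, hud⟩, h⟩
        obtain ⟨u, hu, h⟩ := hBs i
        have := hns' u hu h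
        subst this
        obtain ⟨w, hw, h' | h'⟩ := hno i
        · exact h'.2 (hns' w hw h'.1)
        · exact h'.1 (h'.2 ▸ h)
      have := hmin (y := B \ {d}) ⟨sdiff_subset.trans hBA, hc, hall⟩ sdiff_subset hd
      exact this.2 rfl
    obtain ⟨i₁, p1⟩ := priv d₁ hd₁ hc₁
    obtain ⟨i₂, p2⟩ := priv d₂ hd₂ hc₂
    have h12 : i₁ ≠ i₂ := by
      rintro rfl
      exact hd (((p1 d₂ hd₂).1 ((p2 d₂ hd₂).2 rfl)))
    have perm : ∀ i j : Fin 3, i ≠ j → ∃ σ : Equiv.Perm (Fin 3), σ 1 = i ∧ σ 2 = j := by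
      decide
    obtain ⟨σ, s1, s2⟩ := perm i₁ i₂ h12
    have := types_of_private hB (x := x ∘ σ) (fun i => hout' _)
      (fun i j hij => hst _ _ (by simpa using hij)) (hBs _) hd.symm hd₁ hd₂
      (by simpa [s1] using p1) (by simpa [s2] using p2)
    rcases this with h | h | h
    · exact Or.inl (h.mono hBA).perm
    · exact Or.inr (Or.inl (h.mono hBA).perm)
    · exact Or.inr (Or.inr ⟨σ 0, σ 1, σ 2, by simp, by simp, by simp, h.mono hBA⟩)

end ThreeWay

section Sides

variable {V : Type} {G : SimpleGraph V}

/-- The finite two-colour Ramsey theorem for `k`-uniform hypergraphs. -/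
theorem ramsey (k m n : ℕ) : ∃ N, ∀ (V : Type) (X : Finset V) (P : Set (Finset V)), N ≤ X.card →
    (∃ Y ⊆ X, m ≤ Y.card ∧ ∀ T ⊆ Y, T.card = k → T ∈ P) ∨
    (∃ Y ⊆ X, n ≤ Y.card ∧ ∀ T ⊆ Y, T.card = k → T ∉ P) := by
  classical
  induction k generalizing m n with
  | zero =>
    refine ⟨max m n, fun V X P hX => ?_⟩
    by_cases h : ∅ ∈ P
    · refine Or.inl ⟨X, subset_rfl, by omega, fun T _ hT => ?_⟩
      rwa [Finset.card_eq_zero.1 hT]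
    · refine Or.inr ⟨X, subset_rfl, by omega, fun T _ hT => ?_⟩
      rwa [Finset.card_eq_zero.1 hT]
  | succ k ih =>
    induction m generalizing n with
    | zero =>
      refine ⟨0, fun V X P hX => Or.inl ⟨∅, by simp, by simp, fun T hT h => ?_⟩⟩
      rw [Finset.subset_empty.1 hT] at h
      simp at h
    | succ m ihm =>
      induction n with
      | zero =>
        refine ⟨0, fun V X P hX => Or.inr ⟨∅, by simp, by simp, fun T hT h => ?_⟩⟩
        rw [Finset.subset_empty.1 hT] at h
        simp at h
      | succ n ihn =>
        obtain ⟨N₁, h1⟩ := ihm (n + 1)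
        obtain ⟨N₂, h2⟩ := ihn
        obtain ⟨N, h⟩ := ih N₁ N₂
        refine ⟨N + 1, fun V X P hX => ?_⟩
        obtain ⟨v, hv⟩ : X.Nonempty := by
          rw [← Finset.card_pos]; omega
        have hc := Finset.card_erase_of_mem hv
        have key : ∀ (Q : Set (Finset V)) (l : ℕ) (Y : Finset V), Y ⊆ X.erase v →
            (∀ T ⊆ Y, T.card = k → insert v T ∈ Q) → ∀ Z ⊆ Y, l ≤ Z.card →
            (∀ T ⊆ Z, T.card = k + 1 → T ∈ Q) →
            ∃ Y ⊆ X, l + 1 ≤ Y.card ∧ ∀ T ⊆ Y, T.card = k + 1 → T ∈ Q := by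
          intro Q l Y hY hYQ Z hZ hl hZQ
          have hvZ : v ∉ Z := fun h => by simpa using hY (hZ h)
          refine ⟨insert v Z, ?_, by rw [Finset.card_insert_of_notMem hvZ]; omega, ?_⟩
          · exact Finset.insert_subset hv ((hZ.trans hY).trans (Finset.erase_subset _ _))
          · intro T hT hTc
            by_cases hvT : v ∈ T
            · rw [← Finset.insert_erase hvT]
              refine hYQ _ (fun x hx => hZ ?_) (by rw [Finset.card_erase_of_mem hvT]; omega)
              rw [Finset.mem_erase] at hx
              exact (Finset.mem_insert.1 (hT hx.2)).resolve_left hx.1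
            · refine hZQ _ (fun x hx => ?_) hTc
              exact (Finset.mem_insert.1 (hT hx)).resolve_left fun e => hvT (e ▸ hx)
        rcases h V (X.erase v) {T | insert v T ∈ P} (by omega) with
          ⟨Y, hY, hYc, hYP⟩ | ⟨Y, hY, hYc, hYP⟩
        · rcases h1 V Y P hYc with ⟨Z, hZ, hZc, hZP⟩ | ⟨Z, hZ, hZc, hZP⟩
          · exact Or.inl (key P m Y hY hYP Z hZ hZc hZP)
          · exact Or.inr ⟨Z, (hZ.trans hY).trans (Finset.erase_subset _ _), hZc, hZP⟩
        · rcases h2 V Y P hYc with ⟨Z, hZ, hZc, hZP⟩ | ⟨Z, hZ, hZc, hZP⟩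
          · exact Or.inl ⟨Z, (hZ.trans hY).trans (Finset.erase_subset _ _), hZc, hZP⟩
          · exact Or.inr (key Pᶜ n Y hY hYP Z hZ hZc hZP)

/-- A claw or a wide path for some ordering of the three terminals. -/
def Loose (G : SimpleGraph V) (D : Set V) (x : Fin 3 → V) : Prop :=
  HasClaw G D x ∨ ∃ i j k : Fin 3, i ≠ j ∧ i ≠ k ∧ j ≠ k ∧ HasWide G D (x i) (x j) (x k)

theorem Loose.perm {D : Set V} {x : Fin 3 → V} (σ : Equiv.Perm (Fin 3))
    (h : Loose G D (x ∘ σ)) : Loose G D x := by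
  rcases h with h | ⟨i, j, k, h1, h2, h3, h⟩
  · exact Or.inl h.perm
  · exact Or.inr ⟨σ i, σ j, σ k, by simpa using h1, by simpa using h2, by simpa using h3, h⟩

theorem not_loose_loose [Finite V] (hC : MemC G) {D₁ D₂ : Set V} {x : Fin 3 → V}
    (h : Two G D₁ D₂ x) (hx : ∀ i, ¬ IsHub G (x i)) (h1 : Loose G D₁ x) (h2 : Loose G D₂ x) :
    False := by
  rcases h1 with h1 | ⟨i, j, k, hij, hik, hjk, h1⟩
  · rcases h2 with h2 | ⟨i, j, k, hij, hik, hjk, h2⟩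
    · exact hC.2.1 (theta_of_claw_claw h h1 h2)
    · exact (hub_of_claw_wide h h1 hij hik hjk h2).elim hC.2.1 (hx _)
  · rcases h2 with h2 | ⟨i', j', k', hij', hik', hjk', h2⟩
    · exact (hub_of_claw_wide h.symm h2 hij hik hjk h1).elim hC.2.1 (hx _)
    · by_cases e : i = i'
      · subst e
        have : (j' = j ∧ k' = k) ∨ (j' = k ∧ k' = j) := by omega
        have h2' : HasWide G D₂ (x i) (x j) (x k) := by
          rcases this with ⟨rfl, rfl⟩ | ⟨rfl, rfl⟩
          · exact h2
          · exact h2.symm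
        exact hx _ (hub_of_wide_wide h.apart (h.out₁ i) (h.out₂ i) (h.stable _ _ hij).1
          (h.stable _ _ hik).1 (h.stable _ _ hjk).2 h1 h2')
      · obtain ⟨l, hl, hl', g1, g2⟩ : ∃ l, l ≠ i ∧ l ≠ i' ∧ HasWide G D₁ (x i) (x i') (x l) ∧
            HasWide G D₂ (x i') (x i) (x l) := by
          have a1 : (j = i' ∨ k = i') := by omega
          have a2 : (j' = i ∨ k' = i) := by omega
          rcases a1 with rfl | rfl <;> rcases a2 with rfl | rfl
          · have : k' = k := by omega
            subst this
            exact ⟨k', hik.symm, hik'.symm, h1, h2⟩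
          · have : j' = k := by omega
            subst this
            exact ⟨j', hik.symm, hij'.symm, h1, h2.symm⟩
          · have : k' = j := by omega
            subst this
            exact ⟨k', hij.symm, hik'.symm, h1.symm, h2⟩
          · have : j' = j := by omega
            subst this
            exact ⟨j', hij.symm, hij'.symm, h1.symm, h2.symm⟩
        exact hC.2.1 (theta_of_wide_wide h.apart (h.stable _ _ e).1 (h.stable _ _ e).2 g1 g2)

/-- Two anticomplete connected sets, both seen by every vertex of a stable set of non-hubs. -/
structure Sides (G : SimpleGraph V) (D₁ D₂ X : Set V) : Prop where
  apart : Apart G D₁ D₂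
  conn₁ : Conn G D₁
  conn₂ : Conn G D₂
  out₁ : ∀ x ∈ X, x ∉ D₁
  out₂ : ∀ x ∈ X, x ∉ D₂
  sees₁ : ∀ x ∈ X, Sees G x D₁
  sees₂ : ∀ x ∈ X, Sees G x D₂
  stable : ∀ x ∈ X, ∀ y ∈ X, ¬ G.Adj x y
  nonhub : ∀ x ∈ X, ¬ IsHub G x

theorem Sides.symm {D₁ D₂ X : Set V} (h : Sides G D₁ D₂ X) : Sides G D₂ D₁ X :=
  ⟨h.apart.symm, h.conn₂, h.conn₁, h.out₂, h.out₁, h.sees₂, h.sees₁, h.stable, h.nonhub⟩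

theorem Sides.mono {D₁ D₂ X Y : Set V} (h : Sides G D₁ D₂ X) (hY : Y ⊆ X) : Sides G D₁ D₂ Y :=
  ⟨h.apart, h.conn₁, h.conn₂, fun x hx => h.out₁ x (hY hx), fun x hx => h.out₂ x (hY hx),
    fun x hx => h.sees₁ x (hY hx), fun x hx => h.sees₂ x (hY hx),
    fun x hx y hy => h.stable x (hY hx) y (hY hy), fun x hx => h.nonhub x (hY hx)⟩

theorem Sides.two {D₁ D₂ X : Set V} (h : Sides G D₁ D₂ X) {x : Fin 3 → V}
    (hx : Function.Injective x) (hX : ∀ i, x i ∈ X) : Two G D₁ D₂ x :=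
  ⟨h.apart, fun i => h.out₁ _ (hX i), fun i => h.out₂ _ (hX i),
    fun i j hij => ⟨fun e => hij (hx e), h.stable _ (hX i) _ (hX j)⟩⟩

/-- Every triple of `X` is loose on at most one side; on the other one it spans a triangle. -/
theorem Sides.cases [Finite V] {D₁ D₂ X : Set V} (h : Sides G D₁ D₂ X) (hC : MemC G)
    {x : Fin 3 → V} (hx : Function.Injective x) (hX : ∀ i, x i ∈ X) (h1 : Loose G D₁ x) :
    ¬ Loose G D₂ x :=
  not_loose_loose hC (h.two hx hX) (fun i => h.nonhub _ (hX i)) h1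

/-- A large `X` contains a large subset none of whose triples is loose on a suitable side. -/
theorem exists_tight (n : ℕ) : ∃ N, ∀ (V : Type) [Finite V] (G : SimpleGraph V)
    (D₁ D₂ X : Set V), MemC G → Sides G D₁ D₂ X → N ≤ X.ncard →
    ∃ E₁ E₂ Y, Sides G E₁ E₂ Y ∧ n ≤ Y.ncard ∧
      ∀ x : Fin 3 → V, Function.Injective x → (∀ i, x i ∈ Y) → ¬ Loose G E₁ x := by
  classical
  obtain ⟨N, hN⟩ := ramsey 3 n n
  refine ⟨N, fun V _ G D₁ D₂ X hC h hX => ?_⟩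
  have hfin := Set.toFinite X
  have im : ∀ (x : Fin 3 → V) (Y : Finset V), Function.Injective x → (∀ i, x i ∈ (Y : Set V)) →
      Finset.univ.image x ⊆ Y ∧ (Finset.univ.image x).card = 3 := by
    intro x Y hx hY
    refine ⟨fun y hy => ?_, by rw [Finset.card_image_of_injective _ hx]; simp⟩
    obtain ⟨i, -, rfl⟩ := Finset.mem_image.1 hy
    exact hY i
  have sub : ∀ Y ⊆ hfin.toFinset, (Y : Set V) ⊆ X := fun Y hY y hy => by simpa using hY hy
  rcases hN V hfin.toFinset {T | ∃ x : Fin 3 → V, Function.Injective x ∧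
      Finset.univ.image x = T ∧ Loose G D₁ x} (by rwa [← Set.ncard_eq_toFinset_card X])
    with ⟨Y, hY, hYn, hYP⟩ | ⟨Y, hY, hYn, hYP⟩
  · refine ⟨D₂, D₁, Y, (h.mono (sub Y hY)).symm, by rwa [Set.ncard_coe_finset], ?_⟩
    intro x hx hxY hl
    obtain ⟨h1, h2⟩ := im x Y hx hxY
    obtain ⟨y, hy, he, hl'⟩ := hYP _ h1 h2
    have hex : ∀ i, ∃ j, x j = y i := fun i => by
      have : y i ∈ Finset.univ.image x := he ▸ Finset.mem_image_of_mem _ (Finset.mem_univ i)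
      obtain ⟨j, -, hj⟩ := Finset.mem_image.1 this
      exact ⟨j, hj⟩
    choose f hf using hex
    have hfi : Function.Injective f := fun i j hij => hy (by rw [← hf, ← hf, hij])
    have e : y = x ∘ Equiv.ofBijective f (Finite.injective_iff_bijective.1 hfi) := by
      funext i; simp [hf]
    rw [e] at hl'
    exact (h.mono (sub Y hY)).cases hC hx hxY hl'.perm hl
  · refine ⟨D₁, D₂, Y, h.mono (sub Y hY), by rwa [Set.ncard_coe_finset], ?_⟩
    intro x hx hxY hl
    obtain ⟨h1, h2⟩ := im x Y hx hxY
    exact hYP _ h1 h2 ⟨x, hx, rfl, hl⟩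

end Sides

section Minimal

variable {V : Type} {G : SimpleGraph V}

/-- `A` is minimal among the connected sets seen by every vertex of the stable set `X`. -/
structure MinConn (G : SimpleGraph V) (A X : Set V) : Prop where
  conn : Conn G A
  sees : ∀ x ∈ X, Sees G x A
  out : ∀ x ∈ X, x ∉ A
  stable : ∀ x ∈ X, ∀ y ∈ X, ¬ G.Adj x y
  min : ∀ B ⊆ A, Conn G B → (∀ x ∈ X, Sees G x B) → A ⊆ B

theorem exists_minConn [Finite V] {D X : Set V} (hD : Conn G D) (hs : ∀ x ∈ X, Sees G x D)
    (ho : ∀ x ∈ X, x ∉ D) (hX : ∀ x ∈ X, ∀ y ∈ X, ¬ G.Adj x y) : ∃ A ⊆ D, MinConn G A X := by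
  obtain ⟨A, ⟨hA, hc, hs'⟩, hmin⟩ := (Set.toFinite {B : Set V | B ⊆ D ∧ Conn G B ∧
    ∀ x ∈ X, Sees G x B}).exists_minimal ⟨D, subset_rfl, hD, hs⟩
  exact ⟨A, hA, hc, hs', fun x hx h => ho x hx (hA h), hX, fun B hB h1 h2 =>
    hmin (y := B) ⟨hB.trans hA, h1, h2⟩ hB⟩

/-- A part `L` of `A` hanging at `a` away from `b`, with a private terminal `y`. -/
structure Leg (G : SimpleGraph V) (A : Set V) (a b : V) (L : Set V) (y : V) : Prop where
  sub : L ⊆ A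
  conn : Conn G L
  mem : a ∈ L
  away : b ∉ L
  rest : Conn G (A \ L)
  gate : ∀ u ∈ L, ∀ v ∈ A, v ∉ L → G.Adj u v → u = a
  sees : Sees G y L
  priv : ¬ Sees G y (A \ L)

theorem MinConn.leg {A X : Set V} (h : MinConn G A X) {a b : V} (ha : a ∈ A) (hb : b ∈ A)
    (hab : a ≠ b) : ∃ L, ∃ y ∈ X, Leg G A a b L y := by
  have hbS : b ∈ A \ {a} := ⟨hb, hab.symm⟩
  have hsub := comp_subset (G := G) hbS
  have haC : a ∉ comp G (A \ {a}) b := fun h' => (hsub h').2 rfl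
  have hgate : ∀ u ∈ comp G (A \ {a}) b, ∀ w ∈ A, w ∉ comp G (A \ {a}) b → G.Adj u w → w = a := by
    intro u hu w hw hwC huw
    by_contra hwa
    exact hwC (comp_closed hbS hu ⟨hw, hwa⟩ huw)
  have hdd : A \ (A \ comp G (A \ {a}) b) = comp G (A \ {a}) b := by
    rw [sdiff_sdiff_right_self]; exact inter_eq_right.2 (hsub.trans sdiff_subset)
  obtain ⟨y, hy, hyC⟩ : ∃ y ∈ X, ¬ Sees G y (comp G (A \ {a}) b) := by
    by_contra hcon
    push Not at hcon
    exact haC (h.min _ (hsub.trans sdiff_subset) (comp_conn _ _) hcon ha)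
  refine ⟨A \ comp G (A \ {a}) b, y, hy, sdiff_subset, h.conn.diff_of_gate ha haC hgate,
    ⟨ha, haC⟩, fun h' => h'.2 (mem_comp _ _), by rw [hdd]; exact comp_conn _ _, ?_, ?_,
    by rwa [hdd]⟩
  · intro u hu v hv hvL huv
    have hvC : v ∈ comp G (A \ {a}) b := by
      by_contra h'; exact hvL ⟨hv, h'⟩
    exact hgate v hvC u hu.1 hu.2 huv.symm
  · obtain ⟨u, hu, hyu⟩ := h.sees y hy
    exact ⟨u, ⟨hu, fun h' => hyC ⟨u, h', hyu⟩⟩, hyu⟩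

theorem Leg.disjoint {A : Set V} {a b y z : V} {L M : Set V} (h : Leg G A a b L y)
    (h' : Leg G A b a M z) : ∀ u ∈ L, u ∉ M := by
  intro u hu huM
  obtain ⟨w, hw, hwM, v, hv, hvM, hwv⟩ := h.conn.cross hu huM h.mem h'.away
  have := h'.gate w hwM v (h.sub hv) hvM hwv
  subst this
  exact h.away hw

theorem Leg.adj {A : Set V} {a b y z : V} {L M : Set V} (h : Leg G A a b L y)
    (h' : Leg G A b a M z) : ∀ u ∈ L, ∀ v ∈ M, u ≠ v ∧ (G.Adj u v → u = a ∧ v = b) := by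
  intro u hu v hv
  have hvL := h'.disjoint h v hv
  refine ⟨fun e => hvL (e ▸ hu), fun huv => ⟨h.gate u hu v (h'.sub hv) hvL huv,
    h'.gate v hv u (h.sub hu) (h.disjoint h' u hu) huv.symm⟩⟩

theorem Leg.ne {A : Set V} {a b y z : V} {L M : Set V} (h : Leg G A a b L y)
    (h' : Leg G A b a M z) : y ≠ z := by
  rintro rfl
  obtain ⟨u, hu, hyu⟩ := h'.sees
  exact h.priv ⟨u, ⟨h'.sub hu, h'.disjoint h u hu⟩, hyu⟩

/-- A connected set leaving `L` from its private terminal passes through the gate. -/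
theorem Leg.mem_of_conn {A : Set V} {a b y w : V} {L T : Set V} (h : Leg G A a b L y)
    (hT : Conn G T) (hy : y ∈ T) (hw : w ∈ T) (hwL : w ∉ L) (hwy : w ≠ y)
    (hTA : ∀ u ∈ T, u = y ∨ u ∈ A ∨ (¬ Sees G u L ∧ ¬ G.Adj u y)) : a ∈ T := by
  obtain ⟨u, hu, huL, v, hv, hvL, huv⟩ := hT.cross (T := insert y L) hy (mem_insert _ _) hw
    (by simp [hwL, hwy])
  rw [mem_insert_iff, not_or] at hvL
  rcases hTA v hv with h1 | h1 | ⟨h1, h2⟩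
  · exact absurd h1 hvL.1
  · rcases huL with rfl | huL
    · exact absurd ⟨v, ⟨h1, hvL.2⟩, huv⟩ h.priv
    · exact h.gate u huL v h1 hvL.2 huv ▸ hu
  · rcases huL with rfl | huL
    · exact absurd huv.symm h2
    · exact absurd ⟨u, huL, huv.symm⟩ h1

/-- An induced path between the private terminals of two opposite legs uses both gates. -/
theorem Leg.path {A : Set V} {a b y z : V} {L M : Set V} (h : Leg G A a b L y)
    (h' : Leg G A b a M z) (hyz : ¬ G.Adj y z) (hz : z ∉ A) {l : List V}
    (hl : IP G (y :: (l ++ [z]))) (hlA : ∀ u ∈ l, u ∈ A) (hy : y ∉ A) : a ∈ l ∧ b ∈ l := by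
  have hT := hl.conn (by simp)
  have hzL : ¬ Sees G z L := fun ⟨u, hu, hzu⟩ => h'.priv ⟨u, ⟨h.sub hu, h.disjoint h' u hu⟩, hzu⟩
  have hyM : ¬ Sees G y M := fun ⟨u, hu, hyu⟩ => h.priv ⟨u, ⟨h'.sub hu, h'.disjoint h u hu⟩, hyu⟩
  have hA := h.sub h.mem
  have hB := h'.sub h'.mem
  have ha : a ∈ {x | x ∈ y :: (l ++ [z])} := by
    refine h.mem_of_conn hT (by simp) (w := z) (by simp) (fun h1 => hz (h.sub h1))
      (h.ne h').symm (fun u hu => ?_)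
    simp only [mem_ofPred_eq, List.mem_cons, List.mem_append,
      List.not_mem_nil, or_false] at hu
    rcases hu with rfl | hu | rfl
    · exact Or.inl rfl
    · exact Or.inr (Or.inl (hlA u hu))
    · exact Or.inr (Or.inr ⟨hzL, fun e => hyz e.symm⟩)
  have hb : b ∈ {x | x ∈ y :: (l ++ [z])} := by
    refine h'.mem_of_conn hT (by simp) (w := y) (by simp) (fun h1 => hy (h'.sub h1))
      (h.ne h') (fun u hu => ?_)
    simp only [mem_ofPred_eq, List.mem_cons, List.mem_append,
      List.not_mem_nil, or_false] at hu
    rcases hu with rfl | hu | rfl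
    · exact Or.inr (Or.inr ⟨hyM, hyz⟩)
    · exact Or.inr (Or.inl (hlA u hu))
    · exact Or.inl rfl
  simp only [mem_ofPred_eq, List.mem_cons, List.mem_append,
    List.not_mem_nil, or_false] at ha hb
  exact ⟨(ha.resolve_left fun e => hy (e ▸ hA)).resolve_right fun e => hz (e ▸ hA),
    (hb.resolve_left fun e => hy (e ▸ hB)).resolve_right fun e => hz (e ▸ hB)⟩

/-- Two nonadjacent neighbours of a terminal in a minimal set give a wide path. -/
theorem MinConn.wide {A X : Set V} (h : MinConn G A X) {x a b : V} (ha : a ∈ A)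
    (hb : b ∈ A) (hab : a ≠ b) (nab : ¬ G.Adj a b) (hxa : G.Adj x a) (hxb : G.Adj x b) :
    ∃ y ∈ X, ∃ z ∈ X, x ≠ y ∧ x ≠ z ∧ y ≠ z ∧ HasWide G A x y z := by
  obtain ⟨L, y, hy, hL⟩ := h.leg ha hb hab
  obtain ⟨M, z, hz, hM⟩ := h.leg hb ha hab.symm
  have hyz := hL.ne hM
  obtain ⟨l, hl, hlA⟩ := h.conn.lk hyz (h.stable y hy z hz) (h.sees y hy) (h.sees z hz)
  have hlA' : ∀ u ∈ l, u ∈ A := fun u hu => (hlA u hu).1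
  obtain ⟨h1, h2⟩ := hL.path hM (h.stable y hy z hz) (h.out z hz) hl hlA' (h.out y hy)
  refine ⟨y, hy, z, hz, ?_, ?_, hyz, l, hl, hlA', a, h1, b, h2, hab, nab, hxa, hxb⟩
  · rintro rfl; exact hL.priv ⟨b, ⟨hb, hL.away⟩, hxb⟩
  · rintro rfl; exact hM.priv ⟨a, ⟨ha, hM.away⟩, hxa⟩

/-- `U` is closed under taking neighbours in `W` other than `a`. -/
def Closed (G : SimpleGraph V) (W U : Set V) (a : V) : Prop :=
  ∀ u ∈ U, ∀ w ∈ W, G.Adj u w → w ∈ U ∨ w = a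

theorem Closed.disjoint {W U T : Set V} {a p : V} (h : Closed G W U a) (hT : Conn G T)
    (hTW : T ⊆ W) (ha : a ∉ T) (hp : p ∈ T) (hpU : p ∉ U) : ∀ u ∈ U, u ∉ T := by
  intro u hu huT
  obtain ⟨v, hv, hvU, w, hw, hwU, hvw⟩ := hT.cross huT hu hp hpU
  rcases h v hvU w (hTW hw) hvw with h' | rfl
  · exact hwU h'
  · exact ha hw

theorem closed_comp {W : Set V} {a u : V} (hu : u ∈ W \ {a}) :
    Closed G W (comp G (W \ {a}) u) a := by
  intro v hv w hw hvw
  by_cases e : w = a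
  · exact Or.inr e
  · exact Or.inl (comp_closed hu hv ⟨hw, e⟩ hvw)

/-- The standing assumptions used to grow combs inside `W`. -/
structure CombHyp (G : SimpleGraph V) (W X : Set V) : Prop where
  sub : X ⊆ W
  leg : ∀ a ∈ W, a ∉ X → ∀ p ∈ W, p ≠ a → ∃ U ⊆ W, Conn G U ∧ a ∉ U ∧ p ∉ U ∧ Sees G a U ∧
    Closed G W U a
  hasX : ∀ a ∈ W, ∀ U ⊆ W, U.Nonempty → a ∉ U → Closed G W U a → ∃ x ∈ X, x ∈ U
  simp : ∀ x ∈ X, ∀ n ∈ W, ∀ m ∈ W, G.Adj x n → G.Adj x m → n ≠ m → G.Adj n m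

theorem MinConn.combHyp {A X : Set V} (h : MinConn G A X) (hX : ∀ x, ∃ y ∈ X, y ≠ x)
    (hN : ∀ x ∈ X, ∀ n ∈ A, ∀ m ∈ A, G.Adj x n → G.Adj x m → n ≠ m → G.Adj n m) :
    CombHyp G (A ∪ X) X := by
  have hW : Conn G (A ∪ X) := by
    obtain ⟨r, hr⟩ := h.conn.1
    refine Conn.of_root (Or.inl hr) fun v hv => ?_
    rcases hv with hv | hv
    · exact ⟨A, subset_union_left, h.conn, hr, hv⟩
    · refine ⟨insert v A, insert_subset (Or.inr hv) subset_union_left, ?_,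
        mem_insert_of_mem _ hr, mem_insert _ _⟩
      exact h.conn.insert (h.sees v hv)
  have nbr : ∀ x ∈ X, ∀ w ∈ A ∪ X, G.Adj x w → w ∈ A := fun x hx w hw hxw =>
    hw.resolve_right fun h' => h.stable x hx w h' hxw
  have seesc : ∀ a ∈ A ∪ X, ∀ u ∈ (A ∪ X) \ {a}, Sees G a (comp G ((A ∪ X) \ {a}) u) := by
    intro a ha u hu
    obtain ⟨v, hv, hvC, w, hw, hwC, hvw⟩ := hW.cross hu.1 (mem_comp (G := G) _ u) ha
      (fun h' => (comp_subset hu h').2 rfl)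
    rcases closed_comp hu v hvC w hw hvw with h' | rfl
    · exact absurd h' hwC
    · exact ⟨v, hvC, hvw.symm⟩
  have leg1 : ∀ a ∈ A, ∀ p ∈ A, p ≠ a → ∃ U ⊆ A ∪ X, Conn G U ∧ a ∉ U ∧ p ∉ U ∧ Sees G a U ∧
      Closed G (A ∪ X) U a := by
    intro a ha p hp hpa
    obtain ⟨L, y, hy, hL⟩ := h.leg ha hp hpa.symm
    have hyS : y ∈ (A ∪ X) \ {a} := ⟨Or.inr hy, fun e => h.out y hy (e ▸ ha)⟩
    refine ⟨comp G ((A ∪ X) \ {a}) y, (comp_subset hyS).trans sdiff_subset, comp_conn _ _,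
      fun h' => (comp_subset hyS h').2 rfl, ?_, seesc a (Or.inl ha) y hyS, closed_comp hyS⟩
    intro hpC
    have := Reach.closed (T := (L \ {a}) ∪ {x | x ∈ X ∧ ¬ Sees G x (A \ L)}) hpC
      (Or.inr ⟨hy, hL.priv⟩) (by
        rintro u (⟨huL, hua⟩ | ⟨huX, huS⟩) w ⟨hw, hwa⟩ huw
        · rcases hw with hw | hw
          · refine Or.inl ⟨?_, hwa⟩
            by_contra hwL
            exact hua (hL.gate u huL w hw hwL huw)
          · refine Or.inr ⟨hw, ?_⟩
            rintro ⟨v, ⟨hv, hvL⟩, hwv⟩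
            exact hua (hL.gate u huL v hv hvL (hN w hw u (hL.sub huL) v hv huw.symm hwv
              fun e => hvL (e ▸ huL)))
        · have hwA := nbr u huX w hw huw
          refine Or.inl ⟨?_, hwa⟩
          by_contra hwL
          exact huS ⟨w, ⟨hwA, hwL⟩, huw⟩)
    rcases this with h' | h'
    · exact hL.away h'.1
    · exact h.out p h'.1 hp
  refine ⟨subset_union_right, ?_, ?_, ?_⟩
  · intro a ha haX p hp hpa
    replace ha := ha.resolve_right haX
    by_cases hpA : p ∈ A
    · exact leg1 a ha p hpA hpa
    replace hp := hp.resolve_left hpA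
    by_cases hb : ∃ b ∈ A, b ≠ a ∧ G.Adj p b
    · obtain ⟨b, hb, hba, hpb⟩ := hb
      obtain ⟨U, hU, hc, haU, hbU, hs, hcl⟩ := leg1 a ha b hb hba
      refine ⟨U, hU, hc, haU, fun hpU => ?_, hs, hcl⟩
      rcases hcl p hpU b (Or.inl hb) hpb with h' | h'
      · exact hbU h'
      · exact hba h'
    · push Not at hb
      obtain ⟨y, hy, hyp⟩ := hX p
      have hyS : y ∈ (A ∪ X) \ {a} := ⟨Or.inr hy, fun e => h.out y hy (e ▸ ha)⟩
      refine ⟨comp G ((A ∪ X) \ {a}) y, (comp_subset hyS).trans sdiff_subset, comp_conn _ _,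
        fun h' => (comp_subset hyS h').2 rfl, ?_, seesc a (Or.inl ha) y hyS, closed_comp hyS⟩
      intro hpC
      have hr : Reach G ((A ∪ X) \ {a}) p y := Reach.symm hpC
      refine hyp (Reach.closed (T := {p}) hr rfl ?_)
      rintro u rfl w ⟨hw, hwa⟩ huw
      exact absurd huw (hb w (nbr u hp w hw huw) hwa)
  · intro a ha U hU hUne haU hcl
    by_contra hcon
    push Not at hcon
    have hUA : U ⊆ A := fun u hu => (hU hu).resolve_right fun h' => hcon u h' hu
    rcases ha with ha | ha
    · have hc : Conn G (A \ U) := h.conn.diff_of_gate ha haU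
        fun u hu w hw hwU huw => (hcl u hu w (Or.inl hw) huw).resolve_left hwU
      have := h.min (A \ U) sdiff_subset hc (fun x hx => by
        obtain ⟨u, hu, hxu⟩ := h.sees x hx
        refine ⟨u, ⟨hu, fun huU => ?_⟩, hxu⟩
        rcases hcl u huU x (Or.inr hx) hxu.symm with h' | rfl
        · exact hcon x hx h'
        · exact h.out x hx ha)
      obtain ⟨u, hu⟩ := hUne
      exact (this (hUA hu)).2 hu
    · have hUA' : A ⊆ U := by
        intro v hv
        by_contra hvU
        obtain ⟨u, hu⟩ := hUne
        obtain ⟨s, hs, hsU, w, hw, hwU, hsw⟩ := h.conn.cross (hUA hu) hu hv hvU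
        rcases hcl s hsU w (Or.inl hw) hsw with h' | rfl
        · exact hwU h'
        · exact h.out _ ha hw
      obtain ⟨y, hy, hya⟩ := hX a
      obtain ⟨u, hu, hyu⟩ := h.sees y hy
      rcases hcl u (hUA' hu) y (Or.inr hy) hyu.symm with h' | h'
      · exact hcon y hy h'
      · exact hya h'
  · intro x hx n hn m hm hxn hxm
    exact hN x hx n (nbr x hx n hn hxn) m (nbr x hx m hm hxm) hxn hxm

/-- An induced path from a gate into a closed set, ending at the first terminal. -/
theorem CombHyp.path {W X : Set V} (H : CombHyp G W X) {a : V} {U : Set V} (ha : a ∈ W)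
    (hU : U ⊆ W) (hc : Conn G U) (haU : a ∉ U) (hs : Sees G a U) (hcl : Closed G W U a) :
    ∃ l x, IP G (a :: (l ++ [x])) ∧ (∀ u ∈ l, u ∈ U ∧ u ∉ X) ∧ x ∈ U ∧ x ∈ X := by
  obtain ⟨x, hx, hxU⟩ := H.hasX a ha U hU hc.1 haU hcl
  obtain ⟨l, w, hl, h0, hw, hlP, hlU⟩ := (hc.insert hs).path (mem_insert a U)
    (mem_insert_of_mem _ hxU) (P := fun v => v ∈ X ∧ v ∈ U) ⟨hx, hxU⟩
  rcases l with _ | ⟨b, l⟩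
  · simp at h0
    exact absurd (h0 ▸ hw.2) haU
  · simp at h0
    subst h0
    refine ⟨l, w, hl, fun u hu => ?_, hw.2, hw.1⟩
    have huU : u ∈ U := by
      refine (hlU u (by simp [hu])).resolve_left ?_
      rintro rfl
      exact (ip_cons.1 hl).1 (by simp [hu])
    exact ⟨huU, fun h' => hlP u (by simp [hu]) ⟨h', huU⟩⟩

/-- An arm from `h` to a terminal, away from the connected set `T`. -/
theorem CombHyp.arm {W X : Set V} (H : CombHyp G W X) {h : V} (hh : h ∈ W) {T : Set V}
    (hT : Conn G T) (hTW : T ⊆ W) (hhT : h ∉ T) :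
    ∃ (U S : Set V) (x : V), (∀ u ∈ U, u ∉ T) ∧ h ∉ U ∧ Closed G W U h ∧ S ⊆ insert h U ∧
      Conn G S ∧ h ∈ S ∧ x ∈ S ∧ x ∈ X ∧ S ⊆ W ∧ (∀ u ∈ S, u ∈ X → u = x) ∧
      (h ∉ X → Conn G (S \ {h}) ∧ Sees G h (S \ {h})) := by
  by_cases hX : h ∈ X
  · refine ⟨∅, {h}, h, by simp, by simp, by simp [Closed], by simp, Conn.singleton h, rfl, rfl, hX,
      by simpa using hh, by simp, fun h' => absurd hX h'⟩
  · obtain ⟨p, hp⟩ := hT.1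
    obtain ⟨U, hU, hc, hhU, hpU, hs, hcl⟩ := H.leg h hh hX p (hTW hp) (fun e => hhT (e ▸ hp))
    obtain ⟨l, x, hl, hlU, hxU, hx⟩ := H.path hh hU hc hhU hs hcl
    have hmem : ∀ u ∈ l ++ [x], u ∈ U := by
      intro u hu
      rcases List.mem_append.1 hu with hu | hu
      · exact (hlU u hu).1
      · rwa [List.mem_singleton.1 hu]
    have hd : {u | u ∈ h :: (l ++ [x])} \ {h} = {u | u ∈ l ++ [x]} := by
      ext u
      simp only [mem_sdiff, mem_ofPred_eq, List.mem_cons (b := h), mem_singleton_iff]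
      constructor
      · rintro ⟨h1 | h1, h2⟩
        · exact absurd h1 h2
        · exact h1
      · exact fun h1 => ⟨Or.inr h1, fun e => (ip_cons.1 hl).1 (e ▸ h1)⟩
    refine ⟨U, {u | u ∈ h :: (l ++ [x])}, x, hcl.disjoint hT hTW hhT hp hpU, hhU, hcl, ?_,
      hl.conn (by simp), by simp, by simp, hx, ?_, ?_, fun _ => ?_⟩
    · intro u hu
      rcases List.mem_cons.1 hu with rfl | hu
      · exact mem_insert _ _
      · exact mem_insert_of_mem _ (hmem u hu)
    · intro u hu
      rcases List.mem_cons.1 hu with rfl | hu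
      · exact hh
      · exact hU (hmem u hu)
    · intro u hu huX
      rcases List.mem_cons.1 hu with rfl | hu
      · exact absurd huX hX
      rcases List.mem_append.1 hu with hu | hu
      · exact absurd huX (hlU u hu).2
      · exact List.mem_singleton.1 hu
    · rw [hd]
      exact ⟨(ip_cons.1 hl).2.2.conn (by simp), hl.head_adj (by simp)⟩

/-- Arms at the vertices of a family, pairwise adjacent at most at their roots. -/
theorem CombHyp.arms {W X : Set V} (H : CombHyp G W X) {ι : Type} (b : ι → V)
    (hbW : ∀ i, b i ∈ W) (T : ι → Set V)
    (hT : ∀ i, Conn G (T i) ∧ T i ⊆ W ∧ b i ∉ T i) (hbT : ∀ i j, i ≠ j → b j ∈ T i) :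
    ∃ (S : ι → Set V) (x : ι → V),
      (∀ i, Conn G (S i) ∧ b i ∈ S i ∧ x i ∈ S i ∧ x i ∈ X ∧ S i ⊆ W ∧
        (∀ u ∈ S i, u ∈ X → u = x i) ∧ (∀ u ∈ S i, u ∉ T i) ∧
        (∀ u ∈ S i, ∀ v ∈ T i, G.Adj u v → u = b i) ∧
        (b i ∉ X → Conn G (S i \ {b i}) ∧ Sees G (b i) (S i \ {b i}))) ∧
      ∀ i j, i ≠ j → ∀ u ∈ S i, ∀ v ∈ S j, u ≠ v ∧ (G.Adj u v → u = b i ∧ v = b j) := by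
  choose U S x hUT hbU hcl hS hc hbS hxS hxX hSW hSX hSd using
    fun i => H.arm (hbW i) (hT i).1 (hT i).2.1 (hT i).2.2
  have out : ∀ i, ∀ u ∈ S i, u ∉ T i := by
    intro i u hu
    rcases hS i hu with rfl | hu
    · exact (hT i).2.2
    · exact hUT i u hu
  have dis : ∀ i j, i ≠ j → ∀ u ∈ U i, u ∉ S j := by
    intro i j hij
    exact (hcl i).disjoint (hc j) (hSW j) (fun h => out j _ h (hbT j i hij.symm)) (hbS j)
      (fun h => hUT i _ h (hbT i j hij))
  have half : ∀ i j, i ≠ j → ∀ u ∈ S i, ∀ v ∈ S j, G.Adj u v → u = b i := by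
    intro i j hij u hu v hv huv
    refine (hS i hu).resolve_right fun hu' => ?_
    rcases hcl i u hu' v (hSW j hv) huv with h | h
    · exact dis i j hij v h hv
    · exact out j v hv (h ▸ hbT j i hij.symm)
  refine ⟨S, x, fun i => ⟨hc i, hbS i, hxS i, hxX i, hSW i, hSX i, out i, ?_, hSd i⟩, ?_⟩
  · intro u hu v hv huv
    refine (hS i hu).resolve_right fun hu' => ?_
    rcases hcl i u hu' v ((hT i).2.1 hv) huv with h | h
    · exact hUT i v h hv
    · exact (hT i).2.2 (h ▸ hv)
  · intro i j hij u hu v hv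
    refine ⟨?_, fun huv => ⟨half i j hij u hu v hv huv, half j i hij.symm v hv u hu huv.symm⟩⟩
    rintro rfl
    rcases hS i hu with rfl | hu'
    · exact out j _ hv (hbT j i hij.symm)
    · exact dis i j hij u hu' hv

end Minimal

section Combs

variable {V : Type} {G : SimpleGraph V}

/-- An induced path `p :: q` through `U` ending at its only terminal, with `k` legs attached. -/
structure IsComb (G : SimpleGraph V) (X U : Set V) (k : ℕ) (p : V) (q : List V)
    (L : ℕ → List V) (a z : ℕ → V) (s e : ℕ → ℕ) : Prop where
  path : IP G (p :: q)
  sub : ∀ u ∈ q, u ∈ U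
  last : ∃ x ∈ X, q.getLast? = some x
  term : ∀ u ∈ q, u ∈ X → q.getLast? = some u
  leg : ∀ i < k, IP G (L i) ∧ (L i).head? = some (a i) ∧ (L i).getLast? = some (z i) ∧ z i ∈ X ∧
    (∀ u ∈ L i, u ∈ X → u = z i) ∧ ∀ u ∈ L i, u ∈ U ∧ u ∉ q
  pos : ∀ i < k, 1 ≤ e i ∧ e i < q.length ∧ (s i = e i ∨ s i + 1 = e i)
  att : ∀ i < k, ∀ u ∈ L i, ∀ j v, (p :: q)[j]? = some v →
    (G.Adj u v ↔ u = a i ∧ (j = s i ∨ j = e i))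
  mono : ∀ i j, i < j → j < k → e i < e j
  apart : ∀ i j, i < k → j < k → i ≠ j → Apart G {u | u ∈ L i} {u | u ∈ L j}

theorem IsComb.cons {X U K : Set V} {k : ℕ} {p n : V} {q : List V} {L : ℕ → List V}
    {a z : ℕ → V} {s e : ℕ → ℕ} (h : IsComb G X K k n q L a z s e) (hKU : K ⊆ U) (hn : n ∈ U)
    (hp : p ∉ U) (hpn : G.Adj p n) (hpK : ¬ Sees G p K) (hnX : n ∉ X) (hnK : n ∉ K) :
    IsComb G X U k p (n :: q) L a z (fun i => s i + 1) (fun i => e i + 1) := by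
  obtain ⟨x, hx, hq⟩ := h.last
  have hlast : ∀ u, (n :: q).getLast? = some u ↔ q.getLast? = some u := by
    intro u
    rcases q with _ | ⟨b, q⟩
    · simp at hq
    · rw [List.getLast?_cons_cons]
  refine ⟨?_, ?_, ⟨x, hx, (hlast x).2 hq⟩, ?_, ?_, ?_, ?_, ?_, h.apart⟩
  · refine ip_cons.2 ⟨?_, fun b hb => ?_, h.path⟩
    · intro hmem
      rcases List.mem_cons.1 hmem with rfl | hmem
      · exact hp hn
      · exact hp (hKU (h.sub _ hmem))
    · rcases List.mem_cons.1 hb with rfl | hb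
      · simp [hpn]
      · simp only [List.head?_cons, Option.some.injEq]
        refine ⟨fun hpb => absurd ⟨b, h.sub b hb, hpb⟩ hpK, ?_⟩
        rintro rfl
        exact absurd (h.sub _ hb) hnK
  · intro u hu
    rcases List.mem_cons.1 hu with rfl | hu
    · exact hn
    · exact hKU (h.sub u hu)
  · intro u hu huX
    rcases List.mem_cons.1 hu with rfl | hu
    · exact absurd huX hnX
    · exact (hlast u).2 (h.term u hu huX)
  · intro i hi
    obtain ⟨h1, h2, h3, h4, h5, h6⟩ := h.leg i hi
    refine ⟨h1, h2, h3, h4, h5, fun u hu => ⟨hKU (h6 u hu).1, fun hmem => ?_⟩⟩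
    rcases List.mem_cons.1 hmem with rfl | hmem
    · exact hnK (h6 _ hu).1
    · exact (h6 u hu).2 hmem
  · intro i hi
    have := h.pos i hi
    simp only [List.length_cons]
    omega
  · intro i hi u hu j v hj
    rcases j with _ | j
    · simp at hj
      subst hj
      have := (h.pos i hi).1
      refine ⟨fun huv => absurd ⟨u, ((h.leg i hi).2.2.2.2.2 u hu).1, huv.symm⟩ hpK, ?_⟩
      rintro ⟨-, h | h⟩ <;> simp at h
    · rw [List.getElem?_cons_succ] at hj
      rw [h.att i hi u hu j v hj]
      simp
  · intro i j hij hj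
    have := h.mono i j hij hj
    omega

theorem IsComb.addLeg {X U : Set V} {k : ℕ} {p : V} {q : List V} {L : ℕ → List V}
    {a z : ℕ → V} {s e : ℕ → ℕ} (h : IsComb G X U k p q L a z s e) (he : ∀ i < k, 2 ≤ e i)
    (hq : 1 < q.length) {l : List V} {b y : V} {r : ℕ} (hr : r = 0 ∨ r = 1) (hl : IP G l)
    (h0 : l.head? = some b) (h1 : l.getLast? = some y) (hy : y ∈ X)
    (hlX : ∀ u ∈ l, u ∈ X → u = y) (hlU : ∀ u ∈ l, u ∈ U ∧ u ∉ q)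
    (hatt : ∀ u ∈ l, ∀ j v, (p :: q)[j]? = some v → (G.Adj u v ↔ u = b ∧ (j = r ∨ j = 1)))
    (hap : ∀ i < k, Apart G {u | u ∈ l} {u | u ∈ L i}) :
    ∃ L a z s e, IsComb G X U (k + 1) p q L a z s e := by
  refine ⟨fun i => Nat.casesOn i l L, fun i => Nat.casesOn i b a, fun i => Nat.casesOn i y z,
    fun i => Nat.casesOn i r s, fun i => Nat.casesOn i 1 e, h.path, h.sub, h.last, h.term,
    ?_, ?_, ?_, ?_, ?_⟩
  · rintro (_ | i) hi
    · exact ⟨hl, h0, h1, hy, hlX, hlU⟩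
    · exact h.leg i (by omega)
  · rintro (_ | i) hi
    · refine ⟨le_rfl, hq, ?_⟩
      rcases hr with rfl | rfl
      · exact Or.inr rfl
      · exact Or.inl rfl
    · exact h.pos i (by omega)
  · rintro (_ | i) hi
    · exact hatt
    · exact h.att i (by omega)
  · rintro (_ | i) (_ | j) hij hj
    · omega
    · exact he j (by omega)
    · omega
    · exact h.mono i j (by omega) (by omega)
  · rintro (_ | i) (_ | j) hi hj hij
    · omega
    · exact hap j (by omega)
    · exact (hap i (by omega)).symm
    · exact h.apart i j (by omega) (by omega) (by omega)

/-- Neighbours of `p` inside a connected set avoiding `p` are pairwise adjacent. -/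
def Blk (G : SimpleGraph V) (W : Set V) : Prop :=
  ∀ p ∈ W, ∀ U ⊆ W, Conn G U → p ∉ U → ∀ n ∈ U, ∀ m ∈ U, G.Adj p n → G.Adj p m → n ≠ m → G.Adj n m

/-- There are `M` pairwise anticomplete closed connected sets attached to `a`. -/
def Spread (G : SimpleGraph V) (W : Set V) (a : V) (M : ℕ) : Prop :=
  ∃ S : Fin M → Set V, (∀ i, S i ⊆ W ∧ Conn G (S i) ∧ a ∉ S i ∧ Sees G a (S i) ∧
    Closed G W (S i) a) ∧ ∀ i j, i ≠ j → Apart G (S i) (S j)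

/-- A connected set closed with respect to a vertex attached to it. -/
structure Site (G : SimpleGraph V) (W : Set V) (p : V) (U : Set V) : Prop where
  mem : p ∈ W
  sub : U ⊆ W
  conn : Conn G U
  out : p ∉ U
  sees : Sees G p U
  closed : Closed G W U p

theorem Site.step {W X U : Set V} {p u : V} (h : Site G W p U) (H : CombHyp G W X)
    (hb : Blk G W) (hu : u ∈ U \ {n | G.Adj p n}) :
    ∃ n ∈ U, G.Adj p n ∧ n ∉ X ∧ Site G W n (comp G (U \ {n | G.Adj p n}) u) := by
  have hsub := comp_subset (G := G) hu
  have hcW : comp G (U \ {n | G.Adj p n}) u ⊆ W := hsub.trans (sdiff_subset.trans h.sub)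
  have hpC : p ∉ comp G (U \ {n | G.Adj p n}) u := fun h' => h.out (hsub h').1
  obtain ⟨n₀, hn₀, hpn₀⟩ := h.sees
  obtain ⟨k, hk, hkC, n, hn, hnC, hkn⟩ := h.conn.cross hu.1 (mem_comp (G := G) _ u) hn₀
    (fun h' => (hsub h').2 hpn₀)
  have hpn : G.Adj p n := by
    by_contra h'
    exact hnC (comp_closed hu hkC ⟨hn, h'⟩ hkn)
  have uniq : ∀ m ∈ U, G.Adj p m → ∀ v ∈ comp G (U \ {n | G.Adj p n}) u, G.Adj v m → m = n := by
    intro m hm hpm v hv hvm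
    by_contra hmn
    refine (hsub hkC).2 ?_
    refine (hb n (h.sub hn) (insert p (insert m (comp G (U \ {n | G.Adj p n}) u))) ?_ ?_ ?_
      k (by simp [hkC]) p (by simp) hkn.symm hpn.symm ?_).symm
    · exact insert_subset h.mem (insert_subset (h.sub hm) hcW)
    · exact ((comp_conn _ u).insert ⟨v, hv, hvm.symm⟩).insert ⟨m, mem_insert _ _, hpm⟩
    · rintro (rfl | rfl | h')
      · exact h.out hn
      · exact hmn rfl
      · exact hnC h'
    · rintro rfl
      exact hpC hkC
  refine ⟨n, hn, hpn, fun hnX => ?_, h.sub hn, hcW, comp_conn _ _, hnC, ⟨k, hkC, hkn.symm⟩, ?_⟩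
  · exact (hsub hkC).2 (H.simp n hnX p h.mem k (hcW hkC) hpn.symm hkn.symm
      (fun e => hpC (e ▸ hkC)))
  · intro v hv w hw hvw
    rcases h.closed v (hsub hv).1 w hw hvw with hwU | rfl
    · by_cases hpw : G.Adj p w
      · exact Or.inr (uniq w hwU hpw v hv hvw)
      · exact Or.inl (comp_closed hu hv ⟨hwU, hpw⟩ hvw)
    · exact absurd hvw.symm (hsub hv).2

theorem comp_apart {S : Set V} {u v : V} (hu : u ∈ S) (hv : v ∈ S)
    (h : comp G S u ≠ comp G S v) : Apart G (comp G S u) (comp G S v) := by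
  intro a ha b hb
  constructor
  · rintro rfl
    exact h ((comp_eq ha).symm.trans (comp_eq hb))
  · intro hab
    have := comp_closed hu ha (comp_subset hv hb) hab
    exact h ((comp_eq this).symm.trans (comp_eq hb))

/-- With bounded clique number and spread, some component carries many of the terminals. -/
theorem Site.exists_large [Finite V] {W X U : Set V} {p : V} {t M R : ℕ} (h : Site G W p U)
    (H : CombHyp G W X) (hb : Blk G W) (ht : G.CliqueFree t) (hM : ∀ a ∈ W, ¬ Spread G W a M)
    (hX : t + t * M * R < (X ∩ U).ncard) :
    ∃ u ∈ U \ {n | G.Adj p n}, R ≤ (X ∩ comp G (U \ {n | G.Adj p n}) u).ncard := by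
  classical
  have := Fintype.ofFinite V
  by_contra hcon
  push Not at hcon
  set N : Finset V := {n | n ∈ U ∧ G.Adj p n} with hN
  have hmN : ∀ n, n ∈ N ↔ n ∈ U ∧ G.Adj p n := fun n => by simp [hN]
  have hNt : N.card ≤ t := by
    by_contra hlt
    obtain ⟨N', hN', hc⟩ := Finset.exists_subset_card_eq (show t ≤ N.card by omega)
    refine ht N' ⟨fun a ha b hb' hab => ?_, hc⟩
    have h1 := (hmN a).1 (hN' ha)
    have h2 := (hmN b).1 (hN' hb')
    exact hb p h.mem U h.sub h.conn h.out a h1.1 b h2.1 h1.2 h2.2 hab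
  set F : Finset V := {u | u ∈ U \ {n | G.Adj p n}} with hF
  have hmF : ∀ u, u ∈ F ↔ u ∈ U \ {n | G.Adj p n} := fun u => by simp [hF]
  set 𝒦 : Finset (Set V) := F.image (comp G (U \ {n | G.Adj p n})) with h𝒦
  have hKc : 𝒦.card ≤ t * M := by
    have h1 : 𝒦 ⊆ N.biUnion fun n => 𝒦.filter fun K => Site G W n K := by
      intro K hK
      obtain ⟨u, hu, rfl⟩ := Finset.mem_image.1 hK
      obtain ⟨n, hn, hpn, -, hs⟩ := h.step H hb ((hmF u).1 hu)
      exact Finset.mem_biUnion.2 ⟨n, (hmN n).2 ⟨hn, hpn⟩, Finset.mem_filter.2 ⟨hK, hs⟩⟩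
    refine (Finset.card_le_card h1).trans ((Finset.card_biUnion_le_card_mul _ _ M ?_).trans
      (Nat.mul_le_mul_right _ hNt))
    intro n hn
    by_contra hlt
    obtain ⟨𝒦', hs', hc⟩ := Finset.exists_subset_card_eq
      (show M ≤ (𝒦.filter fun K => Site G W n K).card by omega)
    refine hM n (h.sub ((hmN n).1 hn).1) ⟨fun i => ((𝒦'.equivFinOfCardEq hc).symm i : Set V),
      fun i => ?_, fun i j hij => ?_⟩
    · have := (Finset.mem_filter.1 (hs' ((𝒦'.equivFinOfCardEq hc).symm i).2)).2
      exact ⟨this.sub, this.conn, this.out, this.sees, this.closed⟩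
    · obtain ⟨u, hu, hu'⟩ := Finset.mem_image.1
        (Finset.mem_filter.1 (hs' ((𝒦'.equivFinOfCardEq hc).symm i).2)).1
      obtain ⟨v, hv, hv'⟩ := Finset.mem_image.1
        (Finset.mem_filter.1 (hs' ((𝒦'.equivFinOfCardEq hc).symm j).2)).1
      show Apart G ((𝒦'.equivFinOfCardEq hc).symm i : Set V) ((𝒦'.equivFinOfCardEq hc).symm j)
      rw [← hu', ← hv']
      refine comp_apart ((hmF u).1 hu) ((hmF v).1 hv) ?_
      rw [hu', hv']
      intro e
      exact hij ((𝒦'.equivFinOfCardEq hc).symm.injective (Subtype.ext e))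
  have hcov : (X ∩ U).toFinset ⊆ N ∪ 𝒦.biUnion fun K => (X ∩ K).toFinset := by
    intro x hx
    rw [Set.mem_toFinset] at hx
    rw [Finset.mem_union]
    by_cases hpx : G.Adj p x
    · exact Or.inl ((hmN x).2 ⟨hx.2, hpx⟩)
    · refine Or.inr (Finset.mem_biUnion.2 ⟨comp G (U \ {n | G.Adj p n}) x,
        Finset.mem_image_of_mem _ ((hmF x).2 ⟨hx.2, hpx⟩), ?_⟩)
      rw [Set.mem_toFinset]
      exact ⟨hx.1, mem_comp _ _⟩
  have h2 : (𝒦.biUnion fun K => (X ∩ K).toFinset).card ≤ t * M * R := by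
    refine (Finset.card_biUnion_le_card_mul _ _ R ?_).trans (Nat.mul_le_mul_right _ hKc)
    intro K hK
    obtain ⟨u, hu, rfl⟩ := Finset.mem_image.1 hK
    rw [← Set.ncard_eq_toFinset_card']
    exact (hcon u ((hmF u).1 hu)).le
  have h3 := (Finset.card_le_card hcov).trans (Finset.card_union_le _ _)
  rw [← Set.ncard_eq_toFinset_card'] at h3
  omega

/-- The extra leg obtained from a second neighbour of `p`. -/
theorem Site.leg_of_nbr {W X U K : Set V} {p n m : V} (h : Site G W p U) (H : CombHyp G W X)
    (hK : Site G W n K) (hpK : ¬ Sees G p K) (hpn : G.Adj p n)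
    (hm : m ∈ U) (hpm : G.Adj p m) (hmn : m ≠ n) :
    ∃ l y, IP G l ∧ l.head? = some m ∧ l.getLast? = some y ∧ y ∈ X ∧ (∀ u ∈ l, u ∈ X → u = y) ∧
      (∀ u ∈ l, u ∈ U ∧ u ≠ n ∧ u ∉ K ∧ ¬ Sees G u K ∧ (u = m ∨ ¬ G.Adj u p ∧ ¬ G.Adj u n)) := by
  have hmK : m ∉ K := fun h' => hpK ⟨m, h', hpm⟩
  have hmS : ¬ Sees G m K := by
    rintro ⟨v, hv, hmv⟩
    rcases hK.closed v hv m (h.sub hm) hmv.symm with h' | h'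
    · exact hmK h'
    · exact hmn h'
  by_cases hmX : m ∈ X
  · refine ⟨[m], m, ?_, rfl, rfl, hmX, by simp, ?_⟩
    · exact ip_cons.2 ⟨by simp, by simp, trivial⟩
    · intro u hu
      rw [List.mem_singleton] at hu
      subst hu
      exact ⟨hm, hmn, hmK, hmS, Or.inl rfl⟩
  · have hpm' : p ≠ m := hpm.ne
    obtain ⟨D, hD, hDc, hmD, hpD, hs, hcl⟩ := H.leg m (h.sub hm) hmX p h.mem hpm'
    obtain ⟨l, y, hl, hlD, hyD, hy⟩ := H.path (h.sub hm) hD hDc hmD hs hcl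
    have hall : ∀ u ∈ l ++ [y], u ∈ D := by
      intro u hu
      rcases List.mem_append.1 hu with hu | hu
      · exact (hlD u hu).1
      · rwa [List.mem_singleton.1 hu]
    have hnD : n ∉ D := by
      intro hnD
      rcases hcl n hnD p h.mem hpn.symm with h' | h'
      · exact hpD h'
      · exact hpm' h'
    have hnK : ∀ u ∈ D, u ∉ insert n K := by
      refine hcl.disjoint (hK.conn.insert hK.sees) (insert_subset hK.mem hK.sub) ?_
        (mem_insert n K) hnD
      rintro (h' | h')
      · exact hmn h'
      · exact hmK h'
    have hDU : D ⊆ U := by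
      intro d hd
      by_contra hdU
      obtain ⟨u, hu, huU, v, hv, hvU, huv⟩ := (hDc.insert hs).cross (mem_insert m D) hm
        (mem_insert_of_mem _ hd) hdU
      have hvW : v ∈ W := hv.elim (fun e => e ▸ h.sub hm) fun h' => hD h'
      rcases h.closed u huU v hvW huv with h' | rfl
      · exact hvU h'
      · rcases hv with e | h'
        · exact hpm' e
        · exact hpD h'
    refine ⟨m :: (l ++ [y]), y, hl, rfl, ?_, hy, ?_, ?_⟩
    · rw [← List.cons_append, List.getLast?_append]; simp
    · intro u hu huX
      rcases List.mem_cons.1 hu with rfl | hu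
      · exact absurd huX hmX
      rcases List.mem_append.1 hu with hu | hu
      · exact absurd huX (hlD u hu).2
      · exact List.mem_singleton.1 hu
    · intro u hu
      rcases List.mem_cons.1 hu with rfl | hu
      · exact ⟨hm, hmn, hmK, hmS, Or.inl rfl⟩
      · have huD := hall u hu
        have h1 := hnK u huD
        rw [mem_insert_iff, not_or] at h1
        refine ⟨hDU huD, h1.1, h1.2, ?_, Or.inr ⟨fun h2 => ?_, fun h2 => ?_⟩⟩
        · rintro ⟨v, hv, huv⟩
          rcases hcl u huD v (hK.sub hv) huv with h' | rfl
          · exact hnK v h' (mem_insert_of_mem _ hv)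
          · exact hmK hv
        · rcases hcl u huD p h.mem h2 with h' | h'
          · exact hpD h'
          · exact hpm' h'
        · rcases hcl u huD n hK.mem h2 with h' | h'
          · exact hnD h'
          · exact hmn h'.symm

/-- Every large set of terminals in a site supports a comb with `k` legs. -/
theorem exists_comb (t M k : ℕ) : ∃ N, ∀ (V : Type) [Finite V] (G : SimpleGraph V)
    (W X : Set V), CombHyp G W X → Blk G W → G.CliqueFree t → (∀ a ∈ W, ¬ Spread G W a M) →
    ∀ p U, Site G W p U → N ≤ (X ∩ U).ncard →
    ∃ q L a z s e, IsComb G X U k p q L a z s e := by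
  induction k with
  | zero =>
    refine ⟨1, fun V _ G W X H hb ht hM p U h hX => ?_⟩
    obtain ⟨l, x, hl, hlU, hxU, hx⟩ := H.path h.mem h.sub h.conn h.out h.sees h.closed
    refine ⟨l ++ [x], fun _ => [], fun _ => p, fun _ => p, fun _ => 0, fun _ => 0, hl, ?_,
      ⟨x, hx, by simp⟩, ?_, by simp, by simp, by simp, by simp, by simp⟩
    · intro u hu
      rcases List.mem_append.1 hu with hu | hu
      · exact (hlU u hu).1
      · rwa [List.mem_singleton.1 hu]
    · intro u hu huX
      rcases List.mem_append.1 hu with hu | hu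
      · exact absurd huX (hlU u hu).2
      · simp [List.mem_singleton.1 hu]
  | succ k ih =>
    obtain ⟨R, hR⟩ := ih
    refine ⟨t + t * M * R + 1, fun V _ G W X H hb ht hM p U h hX => ?_⟩
    induction hc : U.ncard using Nat.strong_induction_on generalizing p U with
    | _ c ihU =>
    obtain ⟨u, hu, hRu⟩ := h.exists_large H hb ht hM (by omega : t + t * M * R < _)
    obtain ⟨n, hn, hpn, hnX, hK⟩ := h.step H hb hu
    have hsub := comp_subset (G := G) hu
    have hKU : comp G (U \ {n | G.Adj p n}) u ⊆ U := hsub.trans sdiff_subset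
    have hpK : ¬ Sees G p (comp G (U \ {n | G.Adj p n}) u) := fun ⟨v, hv, hpv⟩ => (hsub hv).2 hpv
    by_cases h1 : ∃ m ∈ U, G.Adj p m ∧ m ≠ n
    · obtain ⟨m, hm, hpm, hmn⟩ := h1
      obtain ⟨q, L, a, z, s, e, hcomb⟩ := hR V G W X H hb ht hM n _ hK hRu
      have hcons := hcomb.cons hKU hn h.out hpn hpK hnX hK.out
      obtain ⟨l, y, hl, h0, h1, hy, hlX, hlU⟩ := h.leg_of_nbr H hK hpK hpn hm hpm hmn
      have hq : q ≠ [] := by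
        rintro rfl
        obtain ⟨x, -, hx⟩ := hcomb.last
        simp at hx
      have hnm : G.Adj m n := hb p h.mem U h.sub h.conn h.out m hm n hn hpm hpn hmn
      refine ⟨n :: q, hcons.addLeg (fun i hi => ?_) ?_ (Or.inl rfl) hl h0 h1 hy hlX ?_ ?_ ?_⟩
      · have := (hcomb.pos i hi).1
        omega
      · have := List.length_pos_of_ne_nil hq
        simp only [List.length_cons]
        omega
      · intro w hw
        refine ⟨(hlU w hw).1, fun hmem => ?_⟩
        rcases List.mem_cons.1 hmem with rfl | hmem
        · exact (hlU _ hw).2.1 rfl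
        · exact (hlU w hw).2.2.1 (hcomb.sub w hmem)
      · intro w hw j v hj
        obtain ⟨-, -, -, hwS, hwm⟩ := hlU w hw
        rcases j with _ | _ | j
        · simp at hj
          subst hj
          constructor
          · intro hwp
            exact ⟨hwm.resolve_right fun h' => h'.1 hwp, Or.inl rfl⟩
          · rintro ⟨rfl, -⟩
            exact hpm.symm
        · simp at hj
          subst hj
          constructor
          · intro hwp
            exact ⟨hwm.resolve_right fun h' => h'.2 hwp, Or.inr rfl⟩
          · rintro ⟨rfl, -⟩
            exact hnm
        · simp only [List.getElem?_cons_succ] at hj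
          refine ⟨fun hwv => absurd ⟨v, hcomb.sub v (List.mem_of_getElem? hj), hwv⟩ hwS, ?_⟩
          rintro ⟨-, h' | h'⟩ <;> simp at h'
      · intro i hi w hw v hv
        have hvK := ((hcomb.leg i hi).2.2.2.2.2 v hv).1
        exact ⟨fun e => (hlU w hw).2.2.1 (e ▸ hvK), fun hwv => (hlU w hw).2.2.2.1 ⟨v, hvK, hwv⟩⟩
    · push Not at h1
      by_cases h2 : ∃ u' ∈ U \ {n | G.Adj p n}, u' ∉ comp G (U \ {n | G.Adj p n}) u
      · obtain ⟨u', hu', hu'K⟩ := h2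
        obtain ⟨n', hn', hpn', -, hK'⟩ := h.step H hb hu'
        obtain rfl := h1 n' hn' hpn'
        have hKK : Apart G (comp G (U \ {n | G.Adj p n}) u') (comp G (U \ {n | G.Adj p n}) u) :=
          comp_apart hu' hu fun e => hu'K (e ▸ mem_comp _ _)
        have hsub' := comp_subset (G := G) hu'
        obtain ⟨q, L, a, z, s, e, hcomb⟩ := hR V G W X H hb ht hM n' _ hK hRu
        have hcons := hcomb.cons hKU hn h.out hpn hpK hnX hK.out
        obtain ⟨l, y, hl, hlK, hyK, hy⟩ := H.path hK'.mem hK'.sub hK'.conn hK'.out hK'.sees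
          hK'.closed
        have hall : ∀ w ∈ l ++ [y], w ∈ comp G (U \ {n | G.Adj p n}) u' := by
          intro w hw
          rcases List.mem_append.1 hw with hw | hw
          · exact (hlK w hw).1
          · rwa [List.mem_singleton.1 hw]
        obtain ⟨b, hb0⟩ : ∃ b, (l ++ [y]).head? = some b := by
          rcases l with _ | ⟨b, l⟩ <;> simp
        obtain ⟨hnl, hadj, hl'⟩ := ip_cons.1 hl
        have hq : q ≠ [] := by
          rintro rfl
          obtain ⟨x, -, hx⟩ := hcomb.last
          simp at hx
        refine ⟨n' :: q, hcons.addLeg (fun i hi => ?_) ?_ (Or.inr rfl) hl' hb0 (by simp) hy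
          ?_ ?_ ?_ ?_⟩
        · have := (hcomb.pos i hi).1
          omega
        · have := List.length_pos_of_ne_nil hq
          simp only [List.length_cons]
          omega
        · intro w hw hwX
          rcases List.mem_append.1 hw with hw | hw
          · exact absurd hwX (hlK w hw).2
          · exact List.mem_singleton.1 hw
        · intro w hw
          have hwK := hall w hw
          refine ⟨(hsub' hwK).1, fun hmem => ?_⟩
          rcases List.mem_cons.1 hmem with rfl | hmem
          · exact hK'.out hwK
          · exact (hKK w hwK w (hcomb.sub w hmem)).1 rfl
        · intro w hw j v hj
          have hwK := hall w hw
          rcases j with _ | _ | j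
          · simp at hj
            subst hj
            refine ⟨fun hwp => absurd hwp.symm (hsub' hwK).2, ?_⟩
            rintro ⟨-, h' | h'⟩ <;> simp at h'
          · simp at hj
            subst hj
            rw [SimpleGraph.adj_comm, hadj w hw, hb0]
            simp [eq_comm]
          · simp only [List.getElem?_cons_succ] at hj
            refine ⟨fun hwv => absurd hwv (hKK w hwK v
              (hcomb.sub v (List.mem_of_getElem? hj))).2, ?_⟩
            rintro ⟨-, h' | h'⟩ <;> simp at h'
        · intro i hi w hw v hv
          exact hKK w (hall w hw) v ((hcomb.leg i hi).2.2.2.2.2 v hv).1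
      · push Not at h2
        have hXU : X ∩ U ⊆ X ∩ comp G (U \ {n | G.Adj p n}) u := by
          rintro x ⟨hx, hxU⟩
          refine ⟨hx, h2 x ⟨hxU, fun hpx => ?_⟩⟩
          exact hnX (h1 x hxU hpx ▸ hx)
        have hlt : (comp G (U \ {n | G.Adj p n}) u).ncard < c := by
          rw [← hc]
          exact Set.ncard_lt_ncard ⟨hKU, fun h' => hK.out (h' hn)⟩ (Set.toFinite _)
        obtain ⟨q, L, a, z, s, e, hcomb⟩ := ihU _ hlt n _ hK
          (hX.trans (Set.ncard_le_ncard hXU (Set.toFinite _))) rfl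
        exact ⟨_, _, _, _, _, _, hcomb.cons hKU hn h.out hpn hpK hnX hK.out⟩

end Combs

section TightSide

variable {V : Type} {G : SimpleGraph V}

theorem injective_triple {x y z : V} (hxy : x ≠ y) (hxz : x ≠ z) (hyz : y ≠ z) :
    Function.Injective ![x, y, z] := by
  intro i j h
  fin_cases i <;> fin_cases j <;> simp_all

/-- No triple of distinct terminals spans a claw or a wide path in `A`. -/
def Tight (G : SimpleGraph V) (A X : Set V) : Prop :=
  ∀ x : Fin 3 → V, Function.Injective x → (∀ i, x i ∈ X) → ¬ Loose G A x

theorem Tight.mono {A B X : Set V} (h : Tight G A X) (hBA : B ⊆ A) : Tight G B X := by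
  intro x hx hX hl
  refine h x hx hX ?_
  rcases hl with hl | ⟨i, j, k, h1, h2, h3, l, hl, hlB, hh⟩
  · exact Or.inl (hl.mono hBA)
  · exact Or.inr ⟨i, j, k, h1, h2, h3, l, hl, fun u hu => hBA (hlB u hu), hh⟩

theorem Tight.clique {A X : Set V} (h : Tight G A X) (hA : MinConn G A X) :
    ∀ x ∈ X, ∀ n ∈ A, ∀ m ∈ A, G.Adj x n → G.Adj x m → n ≠ m → G.Adj n m := by
  intro x hx n hn m hm hxn hxm hnm
  by_contra hcon
  obtain ⟨y, hy, z, hz, hxy, hxz, hyz, hw⟩ := hA.wide hn hm hnm hcon hxn hxm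
  refine h ![x, y, z] (injective_triple hxy hxz hyz) (fun i => ?_)
    (Or.inr ⟨0, 1, 2, by simp, by simp, by simp, hw⟩)
  fin_cases i <;> assumption

theorem Tight.blk {A X : Set V} (h : Tight G A X)
    (H : CombHyp G (A ∪ X) X) : Blk G (A ∪ X) := by
  intro p hp U hU hUc hpU n hn m hm hpn hpm hnm
  by_contra hcon
  have hpX : p ∉ X := fun hpX => hcon (H.simp p hpX n (hU hn) m (hU hm) hpn hpm hnm)
  have hpA := hp.resolve_right hpX
  have hpn' := hpn.ne
  have hpm' := hpm.ne
  obtain ⟨S, x, hS, hSS⟩ := H.arms ![p, n, m]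
    (by intro i; fin_cases i; exacts [hp, hU hn, hU hm])
    ![U, {p, m}, {p, n}]
    (by
      intro i
      fin_cases i
      · exact ⟨hUc, hU, hpU⟩
      · exact ⟨(Conn.singleton m).insert ⟨m, rfl, hpm⟩, insert_subset hp (by simpa using hU hm),
          by simp [hpn'.symm, hnm]⟩
      · exact ⟨(Conn.singleton n).insert ⟨n, rfl, hpn⟩, insert_subset hp (by simpa using hU hn),
          by simp [hpm'.symm, hnm.symm]⟩)
    (by
      intro i j hij
      fin_cases i <;> fin_cases j <;> simp_all)
  have hp0 : p ∈ S 0 := (hS 0).2.1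
  have hn1 : n ∈ S 1 := (hS 1).2.1
  have hm2 : m ∈ S 2 := (hS 2).2.1
  have hpS : ∀ i, i ≠ 0 → p ∉ S i := fun i hi hpi => (hSS 0 i hi.symm p hp0 p hpi).1 rfl
  have hSd : ∀ i, i ≠ 0 → S i \ {p} = S i := fun i hi => by
    rw [sdiff_eq_left, disjoint_singleton_right]
    exact hpS i hi
  have hxp : ∀ i, x i ≠ p := fun i e => hpX (e ▸ (hS i).2.2.2.1)
  refine h x (fun i j hij => ?_) (fun i => (hS i).2.2.2.1)
    (Or.inl ⟨p, hpA, fun i => S i \ {p}, fun i => ⟨?_, ⟨(hS i).2.2.1, hxp i⟩, ?_, ?_, ?_⟩, ?_⟩)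
  · by_contra hne
    exact (hSS i j hne _ (hS i).2.2.1 _ (hS j).2.2.1).1 hij
  · by_cases hi : i = 0
    · subst hi
      exact ((hS 0).2.2.2.2.2.2.2.2 hpX).1
    · show Conn G (S i \ {p})
      rw [hSd i hi]
      exact (hS i).1
  · intro u hu
    rcases (hS i).2.2.2.2.1 hu.1 with hu' | hu'
    · exact mem_insert_of_mem _ hu'
    · exact (hS i).2.2.2.2.2.1 u hu.1 hu' ▸ mem_insert _ _
  · exact fun h' => h'.2 rfl
  · fin_cases i
    · exact ((hS 0).2.2.2.2.2.2.2.2 hpX).2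
    · exact ⟨n, ⟨hn1, hpn'.symm⟩, hpn⟩
    · exact ⟨m, ⟨hm2, hpm'.symm⟩, hpm⟩
  · intro i j hij u hu v hv
    obtain ⟨h1, h2⟩ := hSS i j hij u hu.1 v hv.1
    refine ⟨h1, fun huv => ?_⟩
    obtain ⟨rfl, rfl⟩ := h2 huv
    fin_cases i <;> fin_cases j
    · exact hij rfl
    · exact hu.2 rfl
    · exact hu.2 rfl
    · exact hv.2 rfl
    · exact hij rfl
    · exact hcon huv
    · exact hv.2 rfl
    · exact hcon huv.symm
    · exact hij rfl

theorem Tight.spread {A X : Set V} (h : Tight G A X)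
    (H : CombHyp G (A ∪ X) X) : ∀ a ∈ A ∪ X, ¬ Spread G (A ∪ X) a 3 := by
  rintro a ha ⟨S, hS, hap⟩
  by_cases haX : a ∈ X
  · obtain ⟨n, hn, han⟩ := (hS 0).2.2.2.1
    obtain ⟨m, hm, ham⟩ := (hS 1).2.2.2.1
    have := hap 0 1 (by simp) n hn m hm
    exact this.2 (H.simp a haX n ((hS 0).1 hn) m ((hS 1).1 hm) han ham this.1)
  · have := fun i => H.path ha (hS i).1 (hS i).2.1 (hS i).2.2.1 (hS i).2.2.2.1 (hS i).2.2.2.2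
    choose l x hl hlS hxS hx using this
    have hall : ∀ i, ∀ u ∈ l i ++ [x i], u ∈ S i := by
      intro i u hu
      rcases List.mem_append.1 hu with hu | hu
      · exact (hlS i u hu).1
      · rw [List.mem_singleton.1 hu]
        exact hxS i
    refine h x (fun i j hij => ?_) hx (Or.inl ⟨a, ha.resolve_right haX,
      fun i => {u | u ∈ l i ++ [x i]}, fun i => ⟨?_, by simp, ?_, ?_, ?_⟩, ?_⟩)
    · by_contra hne
      exact (hap i j hne _ (hxS i) _ (hxS j)).1 hij
    · exact (ip_cons.1 (hl i)).2.2.conn (by simp)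
    · intro u hu
      rcases List.mem_append.1 hu with hu | hu
      · exact mem_insert_of_mem _ (((hS i).1 (hlS i u hu).1).resolve_right (hlS i u hu).2)
      · rw [List.mem_singleton.1 hu]
        exact mem_insert _ _
    · exact (ip_cons.1 (hl i)).1
    · exact (hl i).head_adj (by simp)
    · exact fun i j hij => (hap i j hij).mono (hall i) (hall j)

theorem list_split {l : List V} {j : ℕ} {c : V} (h : l[j]? = some c) :
    ∃ p r, l = p ++ c :: r ∧ p.length = j := by
  obtain ⟨hj, rfl⟩ := List.getElem?_eq_some_iff.1 h
  exact ⟨l.take j, l.drop (j + 1), by simp, by simp; omega⟩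

/-- In a tight comb rooted at a terminal every leg spans a triangle with the spine. -/
theorem Tight.succ_of_comb {A X U : Set V} (h : Tight G A X) {k : ℕ} {p : V}
    {q : List V} {L : ℕ → List V} {a z : ℕ → V} {s e : ℕ → ℕ} (hc : IsComb G X U k p q L a z s e)
    (hU : U ⊆ A ∪ X) (hp : p ∈ X) (hpU : p ∉ U) : ∀ i < k, s i + 1 = e i := by
  intro i hi
  obtain ⟨h1, h2, h3⟩ := hc.pos i hi
  refine h3.resolve_left fun hse => ?_
  obtain ⟨lip, l0, l1, hz, hzX, hlU⟩ := hc.leg i hi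
  obtain ⟨y, hy, hqy⟩ := hc.last
  have hlt : e i < (p :: q).length := by simp only [List.length_cons]; omega
  obtain ⟨m, r, hmr, hml⟩ := list_split (List.getElem?_eq_getElem hlt)
  set c := (p :: q)[e i] with hcdef
  have hcq : (p :: q)[e i]? = some c := List.getElem?_eq_getElem hlt
  have hr : r ≠ [] := by
    rintro rfl
    have := congrArg List.length hmr
    simp at this
    omega
  obtain ⟨m, rfl⟩ : ∃ m', m = p :: m' := by
    rcases m with _ | ⟨b, m⟩
    · simp at hml; omega
    · simp at hmr
      exact ⟨m, by rw [hmr.1]⟩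
  have hq : q = m ++ c :: r := by simpa using hmr
  have hip := hc.path
  rw [hmr] at hip
  obtain ⟨i1, i2, i3⟩ := ip_append.1 hip
  have hry : r.getLast? = some y := by
    rw [hq, List.getLast?_append, List.getLast?_cons] at hqy
    rcases r with _ | ⟨b, r⟩
    · exact absurd rfl hr
    · simpa [List.getLast?_cons] using hqy
  have hyr : y ∈ r := List.mem_of_getLast? hry
  have notX : ∀ u ∈ q, u ∈ X → u = y := by
    intro u hu huX
    have := hc.term u hu huX
    rw [hqy] at this
    exact (Option.some.inj this).symm
  have hcA : c ∈ A := by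
    have hcm : c ∈ q := by rw [hq]; simp
    refine (hU (hc.sub c hcm)).resolve_right fun hcX => ?_
    exact (ip_cons.1 i2).1 (notX c hcm hcX ▸ hyr)
  have hyp : ∀ u ∈ p :: m, ∀ v ∈ r, u ≠ v ∧ ¬ G.Adj u v := fun u hu v hv => by
    have := i3 u hu v (List.mem_cons_of_mem _ hv)
    refine ⟨this.1, fun huv => ?_⟩
    have := (this.2.1 huv).2
    simp only [List.head?_cons, Option.some.injEq] at this
    exact (ip_cons.1 i2).1 (this ▸ hv)
  have hatt : ∀ u ∈ L i, ∀ v ∈ p :: q, G.Adj u v ↔ u = a i ∧ v = c := by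
    intro u hu v hv
    obtain ⟨j, hj⟩ := List.mem_iff_getElem?.1 hv
    rw [hc.att i hi u hu j v hj, hse, or_self]
    constructor
    · rintro ⟨h, rfl⟩
      exact ⟨h, Option.some.inj (hj.symm.trans hcq)⟩
    · rintro ⟨h, rfl⟩
      exact ⟨h, hc.path.get_inj hj hcq⟩
  have hLq : ∀ u ∈ L i, ∀ v ∈ p :: q, u ≠ v := by
    rintro u hu v hv rfl
    rcases List.mem_cons.1 hv with rfl | hv
    · exact hpU (hlU _ hu).1
    · exact (hlU u hu).2 hv
  have hcL : c ∈ p :: q := by rw [hmr]; simp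
  have hcpm : c ∉ p :: m := fun h' => (i3 c h' c (by simp)).1 rfl
  have hcr : c ∉ r := (ip_cons.1 i2).1
  have hL0 : L i ≠ [] := by
    rintro h'
    rw [h'] at l0
    simp at l0
  have hzL : z i ∈ L i := List.mem_of_getLast? l1
  have haL : a i ∈ L i := List.mem_of_mem_head? l0
  have hpy : p ≠ y := (hyp p (by simp) y hyr).1
  have hpq : ∀ u ∈ p :: m, u ∈ p :: q := fun u hu => by rw [hmr]; simp only [List.mem_append]; tauto
  have hrq : ∀ u ∈ r, u ∈ p :: q := fun u hu => by
    rw [hmr]; simp only [List.mem_append, List.mem_cons]; tauto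
  have hap0 : Apart G {u | u ∈ L i} {u | u ∈ p :: m} := fun u hu v hv => by
    refine ⟨hLq u hu v (hpq v hv), fun huv => ?_⟩
    exact hcpm (((hatt u hu v (hpq v hv)).1 huv).2 ▸ hv)
  have hap1 : Apart G {u | u ∈ L i} {u | u ∈ r} := fun u hu v hv => by
    refine ⟨hLq u hu v (hrq v hv), fun huv => ?_⟩
    exact hcr (((hatt u hu v (hrq v hv)).1 huv).2 ▸ hv)
  refine h ![p, z i, y] (injective_triple ?_ hpy ?_) (fun j => ?_) (Or.inl ⟨c, hcA,
    ![{u | u ∈ p :: m}, {u | u ∈ L i}, {u | u ∈ r}], fun j => ?_, fun j j' hj => ?_⟩)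
  · exact (hLq _ hzL p (by simp)).symm
  · exact hLq _ hzL y (hrq y hyr)
  · fin_cases j
    exacts [hp, hz, hy]
  · fin_cases j
    · refine ⟨i1.conn (by simp), by simp, ?_, hcpm, ?_⟩
      · intro u hu
        rcases List.mem_cons.1 hu with rfl | hu
        · exact mem_insert _ _
        · have huq : u ∈ q := by rw [hq]; simp [hu]
          refine mem_insert_of_mem _ ((hU (hc.sub u huq)).resolve_right fun huX => ?_)
          exact (hyp u (by simp [hu]) y hyr).1 (notX u huq huX)
      · obtain ⟨b, hb⟩ : ∃ b, (p :: m).getLast? = some b := by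
          simp [List.getLast?_cons]
        have hbm : b ∈ p :: m := List.mem_of_getLast? hb
        exact ⟨b, hbm, ((i3 b hbm c (by simp)).2.2 ⟨hb, rfl⟩).symm⟩
    · refine ⟨lip.conn hL0, hzL, ?_, fun hcm => hLq c hcm c hcL rfl, a i, haL,
        ((hatt _ haL c hcL).2 ⟨rfl, rfl⟩).symm⟩
      intro u hu
      rcases hU (hlU u hu).1 with h' | h'
      · exact mem_insert_of_mem _ h'
      · exact hzX u hu h' ▸ mem_insert _ _
    · refine ⟨(ip_cons.1 i2).2.2.conn hr, hyr, ?_, hcr, i2.head_adj hr⟩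
      intro u hu
      have huq : u ∈ q := by rw [hq]; simp [show u ∈ r from hu]
      rcases hU (hc.sub u huq) with h' | h'
      · exact mem_insert_of_mem _ h'
      · exact notX u huq h' ▸ mem_insert _ _
  · fin_cases j <;> fin_cases j'
    · exact absurd rfl hj
    · exact hap0.symm
    · exact hyp
    · exact hap0
    · exact absurd rfl hj
    · exact hap1
    · exact Apart.symm hyp
    · exact hap1.symm
    · exact absurd rfl hj

/-- A large tight family of terminals supports a comb rooted at a terminal. -/
theorem exists_tight_comb (t k : ℕ) : ∃ N, ∀ (V : Type) [Finite V] (G : SimpleGraph V)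
    (A X : Set V), Tight G A X → MinConn G A X → G.CliqueFree t → N ≤ X.ncard →
    ∃ p ∈ X, ∃ q L a z s e, IsComb G X ((A ∪ X) \ {p}) k p q L a z s e ∧
      ∀ i < k, s i + 1 = e i := by
  obtain ⟨N, hN⟩ := exists_comb t 3 k
  refine ⟨N + 2, fun V _ G A X h hA ht hX => ?_⟩
  have hX2 : ∀ x, ∃ y ∈ X, y ≠ x := by
    intro x
    exact (Set.one_lt_ncard_iff_nontrivial.1 (by omega)).exists_ne x
  have H := hA.combHyp hX2 (h.clique hA)
  obtain ⟨p, hp, -⟩ := hX2 (Classical.choice hA.conn.1.to_subtype).1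
  have hpA := hA.out p hp
  have hc : Conn G ((A ∪ X) \ {p}) := by
    obtain ⟨r, hr⟩ := hA.conn.1
    have hAs : A ⊆ (A ∪ X) \ {p} := fun u hu => ⟨Or.inl hu, fun e => hpA (e ▸ hu)⟩
    refine Conn.of_root (hAs hr) fun v hv => ?_
    rcases hv.1 with hv' | hv'
    · exact ⟨A, hAs, hA.conn, hr, hv'⟩
    · exact ⟨insert v A, insert_subset hv hAs, hA.conn.insert (hA.sees v hv'),
        mem_insert_of_mem _ hr, mem_insert _ _⟩
  have hsite : Site G (A ∪ X) p ((A ∪ X) \ {p}) := by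
    refine ⟨Or.inr hp, sdiff_subset, hc, fun h' => h'.2 rfl, ?_, ?_⟩
    · obtain ⟨u, hu, hpu⟩ := hA.sees p hp
      exact ⟨u, ⟨Or.inl hu, hpu.ne'⟩, hpu⟩
    · intro u hu w hw huw
      by_cases e : w = p
      · exact Or.inr e
      · exact Or.inl ⟨hw, e⟩
  have hcard : N ≤ (X ∩ ((A ∪ X) \ {p})).ncard := by
    have : X ∩ ((A ∪ X) \ {p}) = X \ {p} := by
      ext u
      simp only [mem_inter_iff, mem_sdiff, mem_union]
      tauto
    rw [this, Set.ncard_sdiff_singleton_of_mem hp]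
    omega
  obtain ⟨q, L, a, z, s, e, hcomb⟩ := hN V G _ X H (h.blk H) ht (h.spread H) p _ hsite hcard
  exact ⟨p, hp, q, L, a, z, s, e, hcomb, h.succ_of_comb hcomb sdiff_subset hp fun h' => h'.2 rfl⟩

end TightSide

section FrameSection

variable {V : Type} {G : SimpleGraph V}

/-- A spine `v 0, …, v (m - 1)` with legs `S i` from `a i` to `z i`; leg `i` attaches at the spine
positions `e i - 1` and `e i`, and reaches the connected set `B` only through its tip `z i`. -/
structure Frame (G : SimpleGraph V) (B : Set V) (K m : ℕ) (v : ℕ → V) (S : ℕ → Set V)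
    (a z : ℕ → V) (e : ℕ → ℕ) : Prop where
  inj : ∀ i < m, ∀ j < m, v i = v j → i = j
  adj : ∀ i < m, ∀ j < m, (G.Adj (v i) (v j) ↔ i = j + 1 ∨ j = i + 1)
  first : e 0 = 0
  last : e K = m
  mono : ∀ i j, i < j → j ≤ K → e i < e j
  leg : ∀ i ≤ K, Conn G (S i) ∧ a i ∈ S i ∧ z i ∈ S i
  off : ∀ i ≤ K, ∀ u ∈ S i, ∀ j < m, u ≠ v j
  att : ∀ i ≤ K, ∀ u ∈ S i, ∀ j < m, (G.Adj u (v j) ↔ u = a i ∧ (j = e i ∨ j + 1 = e i))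
  apart : ∀ i j, i ≤ K → j ≤ K → i ≠ j → Apart G (S i) (S j)
  conn : Conn G B
  spine : ∀ j < m, v j ∉ B ∧ ¬ Sees G (v j) B
  out : ∀ i ≤ K, ∀ u ∈ S i, u ∉ B ∧ (Sees G u B → u = z i)
  sees : ∀ i ≤ K, Sees G (z i) B
  tip : ∀ i ≤ K, (∃ b ∈ B, ∀ u ∈ B, G.Adj (z i) u → u = b) ∨
    (0 < i ∧ i < K ∧ S i = {z i} ∧ ¬ IsHub G (z i))

variable {B : Set V} {K m : ℕ} {v : ℕ → V} {S : ℕ → Set V} {a z : ℕ → V} {e : ℕ → ℕ}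

theorem Frame.pos_le (h : Frame G B K m v S a z e) {i : ℕ} (hi : i ≤ K) : e i ≤ m := by
  rcases hi.eq_or_lt with rfl | hi
  · exact h.last.le
  · exact h.last ▸ (h.mono i K hi le_rfl).le

/-- The vertices of the frame other than its tips. -/
def inner (K m : ℕ) (v : ℕ → V) (S : ℕ → Set V) (z : ℕ → V) : Set V :=
  {u | ((∃ j < m, u = v j) ∨ ∃ i ≤ K, u ∈ S i) ∧ ∀ i ≤ K, u ≠ z i}

theorem Frame.spine_inner (h : Frame G B K m v S a z e) {j : ℕ} (hj : j < m) :
    v j ∈ inner K m v S z :=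
  ⟨Or.inl ⟨j, hj, rfl⟩, fun i hi e => h.off i hi _ (h.leg i hi).2.2 j hj e.symm⟩

theorem Frame.leg_inner (h : Frame G B K m v S a z e) {i : ℕ} (hi : i ≤ K) {u : V} (hu : u ∈ S i)
    (hz : u ≠ z i) : u ∈ inner K m v S z := by
  refine ⟨Or.inr ⟨i, hi, hu⟩, fun i' hi' e => ?_⟩
  by_cases hii : i = i'
  · exact hz (hii ▸ e)
  · exact (h.apart i i' hi hi' hii u hu _ (h.leg i' hi').2.2).1 e

theorem Frame.inner_apart (h : Frame G B K m v S a z e) : Apart G (inner K m v S z) B := by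
  rintro u ⟨⟨j, hj, rfl⟩ | ⟨i, hi, hu⟩, hz⟩ b hb
  · exact ⟨fun e => (h.spine j hj).1 (e ▸ hb), fun e => (h.spine j hj).2 ⟨b, hb, e⟩⟩
  · exact ⟨fun e => (h.out i hi u hu).1 (e ▸ hb), fun e => hz i hi ((h.out i hi u hu).2 ⟨b, hb, e⟩)⟩

theorem Frame.tip_ne (h : Frame G B K m v S a z e) {i j : ℕ} (hi : i ≤ K) (hj : j ≤ K)
    (hij : i ≠ j) : z i ≠ z j ∧ ¬ G.Adj (z i) (z j) :=
  h.apart i j hi hj hij _ (h.leg i hi).2.2 _ (h.leg j hj).2.2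

theorem Frame.tip_not_mem (h : Frame G B K m v S a z e) {i : ℕ} (hi : i ≤ K) : z i ∉ B :=
  (h.out i hi _ (h.leg i hi).2.2).1

theorem tip_not_inner {i : ℕ} (hi : i ≤ K) :
    z i ∉ inner K m v S z := fun h' => h'.2 i hi rfl

/-- Leg `i` together with the spine positions from `e i` up to `t`. -/
def rightArm (v : ℕ → V) (S : ℕ → Set V) (e : ℕ → ℕ) (i t : ℕ) : Set V :=
  {u | u ∈ S i ∨ ∃ j, e i ≤ j ∧ j < t ∧ u = v j}

/-- Leg `i` together with the spine positions from `t` up to `e i`. -/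
def leftArm (v : ℕ → V) (S : ℕ → Set V) (e : ℕ → ℕ) (i t : ℕ) : Set V :=
  {u | u ∈ S i ∨ ∃ j, t ≤ j ∧ j < e i ∧ u = v j}

theorem Frame.rightArm_conn (h : Frame G B K m v S a z e) {i t : ℕ} (hi : i ≤ K) (ht : e i ≤ t)
    (htm : t ≤ m) : Conn G (rightArm v S e i t) := by
  induction t, ht using Nat.le_induction with
  | base =>
    have : rightArm v S e i (e i) = S i := by
      ext u
      simp only [rightArm, mem_ofPred_eq]
      refine ⟨fun h' => h'.elim id ?_, Or.inl⟩
      rintro ⟨j, h1, h2, -⟩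
      omega
    rw [this]
    exact (h.leg i hi).1
  | succ t ht ih =>
    have : rightArm v S e i (t + 1) = Set.insert (v t) (rightArm v S e i t) := by
      ext u
      simp only [rightArm, mem_ofPred_eq, Set.insert]
      constructor
      · rintro (h' | ⟨j, h1, h2, h3⟩)
        · exact Or.inr (Or.inl h')
        · rcases Nat.lt_succ_iff_lt_or_eq.1 h2 with h4 | rfl
          · exact Or.inr (Or.inr ⟨j, h1, h4, h3⟩)
          · exact Or.inl h3
      · rintro (h' | h' | ⟨j, h1, h2, h3⟩)
        · exact Or.inr ⟨t, ht, by omega, h'⟩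
        · exact Or.inl h'
        · exact Or.inr ⟨j, h1, by omega, h3⟩
    rw [this]
    refine (ih (by omega)).insert ?_
    rcases ht.eq_or_lt with h' | h'
    · exact ⟨a i, Or.inl (h.leg i hi).2.1,
        ((h.att i hi _ (h.leg i hi).2.1 t (by omega)).2 ⟨rfl, by omega⟩).symm⟩
    · exact ⟨v (t - 1), Or.inr ⟨t - 1, by omega, by omega, rfl⟩,
        (h.adj t (by omega) (t - 1) (by omega)).2 (by omega)⟩

theorem Frame.leftArm_conn (h : Frame G B K m v S a z e) {i t : ℕ} (hi : i ≤ K) (ht : t ≤ e i) :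
    Conn G (leftArm v S e i t) := by
  have hm := h.pos_le hi
  obtain ⟨d, hd⟩ : ∃ d, d = e i - t := ⟨_, rfl⟩
  induction d generalizing t with
  | zero =>
    have : leftArm v S e i t = S i := by
      ext u
      simp only [leftArm, mem_ofPred_eq]
      refine ⟨fun h' => h'.elim id ?_, Or.inl⟩
      rintro ⟨j, h1, h2, -⟩
      omega
    rw [this]
    exact (h.leg i hi).1
  | succ d ih =>
    have : leftArm v S e i t = Set.insert (v t) (leftArm v S e i (t + 1)) := by
      ext u
      simp only [leftArm, mem_ofPred_eq, Set.insert]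
      constructor
      · rintro (h' | ⟨j, h1, h2, h3⟩)
        · exact Or.inr (Or.inl h')
        · rcases h1.eq_or_lt with rfl | h4
          · exact Or.inl h3
          · exact Or.inr (Or.inr ⟨j, h4, h2, h3⟩)
      · rintro (h' | h' | ⟨j, h1, h2, h3⟩)
        · exact Or.inr ⟨t, le_rfl, by omega, h'⟩
        · exact Or.inl h'
        · exact Or.inr ⟨j, by omega, h2, h3⟩
    rw [this]
    refine (ih (by omega) (by omega)).insert ?_
    by_cases h' : t + 1 = e i
    · exact ⟨a i, Or.inl (h.leg i hi).2.1,
        ((h.att i hi _ (h.leg i hi).2.1 t (by omega)).2 ⟨rfl, by omega⟩).symm⟩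
    · exact ⟨v (t + 1), Or.inr ⟨t + 1, by omega, by omega, rfl⟩,
        (h.adj t (by omega) (t + 1) (by omega)).2 (by omega)⟩

theorem Frame.arms_adj (h : Frame G B K m v S a z e) {i l t : ℕ} (hl : l ≤ K) (hil : i < l)
    (hit : e i < t) (htl : t < e l) : ∀ u ∈ rightArm v S e i t, ∀ w ∈ leftArm v S e l t,
      u ≠ w ∧ (G.Adj u w ↔ u = v (t - 1) ∧ w = v t) := by
  have hm := h.pos_le hl
  rintro u (hu | ⟨j, h1, h2, rfl⟩) w (hw | ⟨j', h1', h2', rfl⟩)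
  · obtain ⟨h3, h4⟩ := h.apart i l (by omega) hl hil.ne u hu w hw
    exact ⟨h3, fun e => absurd e h4, fun e => absurd e.1 (h.off i (by omega) u hu _ (by omega))⟩
  · refine ⟨h.off i (by omega) u hu _ (by omega), fun e => ?_, fun e => ?_⟩
    · have := ((h.att i (by omega) u hu _ (by omega)).1 e).2
      omega
    · exact absurd e.1 (h.off i (by omega) u hu _ (by omega))
  · refine ⟨(h.off l hl w hw _ (by omega)).symm, fun e => ?_, fun e => ?_⟩
    · have := ((h.att l hl w hw _ (by omega)).1 e.symm).2
      omega
    · exact absurd e.2 (h.off l hl w hw _ (by omega))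
  · refine ⟨fun e => ?_, ?_⟩
    · have := h.inj _ (by omega) _ (by omega) e
      omega
    · rw [h.adj _ (by omega) _ (by omega)]
      constructor
      · intro e
        have : j = t - 1 := by omega
        have : j' = t := by omega
        subst_vars
        exact ⟨rfl, rfl⟩
      · rintro ⟨e1, e2⟩
        have := h.inj _ (by omega) _ (by omega) e1
        have := h.inj _ (by omega) _ (by omega) e2
        omega

theorem Frame.rightArm_sub (h : Frame G B K m v S a z e) {i t : ℕ} (hi : i ≤ K) (ht : t ≤ m) :
    rightArm v S e i t ⊆ Insert.insert (z i) (inner K m v S z) := by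
  rintro u (hu | ⟨j, h1, h2, rfl⟩)
  · by_cases hz : u = z i
    · exact hz ▸ mem_insert _ _
    · exact mem_insert_of_mem _ (h.leg_inner hi hu hz)
  · exact mem_insert_of_mem _ (h.spine_inner (by omega))

theorem Frame.leftArm_sub (h : Frame G B K m v S a z e) {i t : ℕ} (hi : i ≤ K) :
    leftArm v S e i t ⊆ Insert.insert (z i) (inner K m v S z) := by
  have hm := h.pos_le hi
  rintro u (hu | ⟨j, h1, h2, rfl⟩)
  · by_cases hz : u = z i
    · exact hz ▸ mem_insert _ _
    · exact mem_insert_of_mem _ (h.leg_inner hi hu hz)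
  · exact mem_insert_of_mem _ (h.spine_inner (by omega))

theorem Frame.tri (h : Frame G B K m v S a z e) {i j l : ℕ} (hij : i < j) (hjl : j < l)
    (hl : l ≤ K) : HasTri G (inner K m v S z) ![z i, z j, z l] := by
  have h1 := h.mono i j hij (by omega)
  have h2 := h.mono j l hjl hl
  have hm := h.pos_le hl
  have hj := h.leg j (by omega)
  have hR := h.arms_adj hl (hij.trans hjl) h1 h2
  have hjR : ∀ u ∈ S j, ∀ w ∈ rightArm v S e i (e j), u ≠ w ∧
      (G.Adj u w ↔ u = a j ∧ w = v (e j - 1)) := by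
    rintro u hu w (hw | ⟨t, h3, h4, rfl⟩)
    · obtain ⟨h5, h6⟩ := h.apart j i (by omega) (by omega) hij.ne' u hu w hw
      exact ⟨h5, fun e => absurd e h6, fun e => absurd e.2 (h.off i (by omega) w hw _ (by omega))⟩
    · refine ⟨h.off j (by omega) u hu _ (by omega), ?_⟩
      rw [h.att j (by omega) u hu t (by omega)]
      refine and_congr_right fun _ => ⟨fun h' => ?_, fun h' => ?_⟩
      · rw [show t = e j - 1 by omega]
      · have := h.inj _ (by omega) _ (by omega) h'
        omega
  have hjL : ∀ u ∈ S j, ∀ w ∈ leftArm v S e l (e j), u ≠ w ∧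
      (G.Adj u w ↔ u = a j ∧ w = v (e j)) := by
    rintro u hu w (hw | ⟨t, h3, h4, rfl⟩)
    · obtain ⟨h5, h6⟩ := h.apart j l (by omega) (by omega) hjl.ne u hu w hw
      exact ⟨h5, fun e => absurd e h6, fun e => absurd e.2 (h.off l (by omega) w hw _ (by omega))⟩
    · refine ⟨h.off j (by omega) u hu _ (by omega), ?_⟩
      rw [h.att j (by omega) u hu t (by omega)]
      refine and_congr_right fun _ => ⟨fun h' => ?_, fun h' => ?_⟩
      · rw [show t = e j by omega]
      · have := h.inj _ (by omega) _ (by omega) h'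
        omega
  refine ⟨![v (e j - 1), a j, v (e j)], ![rightArm v S e i (e j), S j, leftArm v S e l (e j)],
    fun n => ?_, fun n n' hn => ?_⟩
  · fin_cases n
    · exact ⟨h.rightArm_conn (by omega) h1.le (by omega), Or.inl (h.leg i (by omega)).2.2,
        Or.inr ⟨e j - 1, by omega, by omega, rfl⟩, h.rightArm_sub (by omega) (by omega)⟩
    · refine ⟨hj.1, hj.2.2, hj.2.1, fun u hu => ?_⟩
      by_cases hz : u = z j
      · exact hz ▸ mem_insert _ _
      · exact mem_insert_of_mem _ (h.leg_inner (by omega) hu hz)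
    · exact ⟨h.leftArm_conn (by omega) h2.le, Or.inl (h.leg l (by omega)).2.2,
        Or.inr ⟨e j, by omega, by omega, rfl⟩, h.leftArm_sub (by omega)⟩
  · have sw : ∀ {A C : Set V} {c d : V}, (∀ u ∈ A, ∀ w ∈ C, u ≠ w ∧ (G.Adj u w ↔ u = c ∧ w = d)) →
        ∀ w ∈ C, ∀ u ∈ A, w ≠ u ∧ (G.Adj w u ↔ w = d ∧ u = c) := fun hh w hw u hu =>
      ⟨(hh u hu w hw).1.symm, by rw [G.adj_comm, (hh u hu w hw).2, and_comm]⟩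
    fin_cases n <;> fin_cases n'
    · exact absurd rfl hn
    · exact sw hjR
    · exact hR
    · exact hjR
    · exact absurd rfl hn
    · exact hjL
    · exact sw hR
    · exact sw hjL
    · exact absurd rfl hn

theorem Conn.lk_of_mem {T : Set V} (h : Conn G T) {x y : V} (hx : x ∈ T) (hy : y ∈ T)
    (hxy : x ≠ y) (n : ¬ G.Adj x y) : Lk G (T \ {x, y}) x y := by
  refine h.lk hxy n ?_ ?_
  · obtain ⟨u, hu, -, h'⟩ := h.sees_diff hx fun e => hxy (by rw [e] at hy; exact hy.symm)
    exact ⟨u, hu, h'⟩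
  · obtain ⟨u, hu, -, h'⟩ := h.sees_diff hy fun e => hxy (by rw [e] at hx; exact hx)
    exact ⟨u, hu, h'⟩

theorem Frame.link (h : Frame G B K m v S a z e) {i j : ℕ} (hi : i ≤ K) (hj : j ≤ K)
    (hij : i ≠ j) : Lk G (inner K m v S z) (z i) (z j) := by
  wlog hlt : i < j generalizing i j
  · exact (this hj hi hij.symm (by omega)).symm
  have h1 := h.mono i j hlt hj
  have hm := h.pos_le hj
  have hc : Conn G (rightArm v S e i (e j) ∪ S j) := by
    refine (h.rightArm_conn hi h1.le hm).union (h.leg j hj).1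
      ⟨v (e j - 1), Or.inr ⟨e j - 1, by omega, by omega, rfl⟩, a j, (h.leg j hj).2.1, Or.inr ?_⟩
    exact ((h.att j hj _ (h.leg j hj).2.1 _ (by omega)).2 ⟨rfl, by omega⟩).symm
  have hz := h.tip_ne hi hj hij
  refine (hc.lk_of_mem (Or.inl (Or.inl (h.leg i hi).2.2)) (Or.inr (h.leg j hj).2.2) hz.1
    hz.2).mono ?_
  rintro u ⟨hu | hu, hne⟩
  · rcases h.rightArm_sub hi hm hu with rfl | hu
    · simp at hne
    · exact hu
  · refine h.leg_inner hj hu ?_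
    rintro rfl
    simp at hne

theorem Frame.no_wide [Finite V] (h : Frame G B K m v S a z e) {i j l : ℕ} (hij : i < j)
    (hjl : j < l) (hl : l ≤ K) (hS : S j = {z j}) (hn : ¬ IsHub G (z j)) :
    ¬ HasWide G B (z j) (z i) (z l) := by
  intro hw
  have h1 := h.mono i j hij (by omega)
  have h2 := h.mono j l hjl hl
  have hm := h.pos_le hl
  have haz : z j = a j := by
    have := (h.leg j (by omega)).2.1
    rw [hS] at this
    exact this.symm
  refine hn (hub_of_tri_wide h.inner_apart (h.rightArm_conn (by omega) h1.le (by omega))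
    (h.leftArm_conn hl h2.le) (Or.inl (h.leg i (by omega)).2.2) (Or.inl (h.leg l hl).2.2)
    (h.rightArm_sub (by omega) (by omega)) (h.leftArm_sub hl)
    (Or.inr ⟨e j - 1, by omega, by omega, rfl⟩) (Or.inr ⟨e j, by omega, by omega, rfl⟩)
    (h.arms_adj hl (hij.trans hjl) h1 h2)
    ((h.att j (by omega) _ (h.leg j (by omega)).2.2 _ (by omega)).2 ⟨haz, by omega⟩)
    ((h.att j (by omega) _ (h.leg j (by omega)).2.2 _ (by omega)).2 ⟨haz, by omega⟩)
    (tip_not_inner (by omega)) (h.tip_not_mem (by omega)) (h.tip_not_mem (by omega))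
    (h.tip_not_mem hl) (h.tip_ne (by omega) (by omega) hij.ne').1
    (h.tip_ne (by omega) (by omega) hjl.ne).1 (h.tip_ne (by omega) (by omega) (by omega)).2 hw)

theorem HasTri.swap₁ {D : Set V} {x y w : V} (h : HasTri G D ![x, y, w]) :
    HasTri G D ![y, x, w] := by
  refine HasTri.perm (Equiv.swap 0 1) ?_
  convert h using 1
  funext i
  fin_cases i <;> rfl

theorem HasTri.swap₂ {D : Set V} {x y w : V} (h : HasTri G D ![x, y, w]) :
    HasTri G D ![x, w, y] := by
  refine HasTri.perm (Equiv.swap 1 2) ?_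
  convert h using 1
  funext i
  fin_cases i <;> rfl

theorem Frame.no_tri [Finite V] (hC : MemC G) (h : Frame G B K m v S a z e) {i j l : ℕ}
    (hi : i ≤ K) (hj : j ≤ K) (hl : l ≤ K) (hij : i ≠ j) (hil : i ≠ l) (hjl : j ≠ l) :
    ¬ HasTri G B ![z i, z j, z l] := by
  intro hB
  have hE : HasTri G (inner K m v S z) ![z i, z j, z l] := by
    rcases lt_or_gt_of_ne hij with h1 | h1 <;> rcases lt_or_gt_of_ne hil with h2 | h2 <;>
      rcases lt_or_gt_of_ne hjl with h3 | h3
    · exact h.tri h1 h3 hl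
    · exact (h.tri h2 h3 hj).swap₂
    · omega
    · exact (h.tri h2 h1 hj).swap₁.swap₂
    · exact (h.tri h1 h2 hl).swap₁
    · omega
    · exact (h.tri h3 h2 hi).swap₂.swap₁
    · exact (h.tri h3 h1 hi).swap₂.swap₁.swap₂
  refine false_of_tri_tri hC ⟨h.inner_apart, fun n => ?_, fun n => ?_, fun n n' hn => ?_⟩ hE hB
  · fin_cases n
    exacts [tip_not_inner hi, tip_not_inner hj, tip_not_inner hl]
  · fin_cases n
    exacts [h.tip_not_mem hi, h.tip_not_mem hj, h.tip_not_mem hl]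
  · fin_cases n <;> fin_cases n'
    · exact absurd rfl hn
    · exact h.tip_ne hi hj hij
    · exact h.tip_ne hi hl hil
    · exact h.tip_ne hj hi hij.symm
    · exact absurd rfl hn
    · exact h.tip_ne hj hl hjl
    · exact h.tip_ne hl hi hil.symm
    · exact h.tip_ne hl hj hjl.symm
    · exact absurd rfl hn

end FrameSection
section FrameOfComb

variable {V : Type} {G : SimpleGraph V}

theorem exists_tip {l : List V} {a z : V} (hl : IP G l) (h0 : l.head? = some a)
    (h1 : l.getLast? = some z) : ∃ (S : Set V) (w : V), Conn G S ∧ a ∈ S ∧ w ∈ S ∧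
      (∀ u ∈ S, u ∈ l) ∧ ((S = {w} ∧ w = z) ∨ (z ∉ S ∧ ∀ u ∈ S, (G.Adj u z ↔ u = w))) := by
  obtain ⟨m, rfl⟩ := List.getLast?_eq_some_iff.1 h1
  rcases m.eq_nil_or_concat with rfl | ⟨m', w, hm⟩
  · simp only [List.nil_append, List.head?_cons, Option.some.injEq] at h0
    subst h0
    exact ⟨{z}, z, Conn.singleton z, rfl, rfl, by simp, Or.inl ⟨rfl, rfl⟩⟩
  · rw [List.concat_eq_append] at hm
    have hne : m ≠ [] := by simp [hm]
    have hw : m.getLast? = some w := by simp [hm]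
    obtain ⟨i1, i2, i3⟩ := ip_append.1 hl
    refine ⟨{u | u ∈ m}, w, i1.conn hne, ?_, List.mem_of_getLast? hw, fun u hu => ?_,
      Or.inr ⟨fun hz => (i3 z hz z (by simp)).1 rfl, fun u hu => ?_⟩⟩
    · rw [List.head?_append_of_ne_nil _ hne] at h0
      exact List.mem_of_mem_head? h0
    · exact List.mem_append_left _ hu
    · rw [(i3 u hu z (by simp)).2, hw]
      simp [eq_comm]

theorem frame_of_comb {A D X : Set V} {K : ℕ} {p : V} {q : List V} {L : ℕ → List V}
    {a z : ℕ → V} {s e : ℕ → ℕ} (hA : Apart G A D) (hD : Conn G D) (hXD : ∀ x ∈ X, x ∉ D)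
    (hs : ∀ x ∈ X, Sees G x D) (hn : ∀ x ∈ X, ¬ IsHub G x) (hp : p ∈ X)
    (hc : IsComb G X ((A ∪ X) \ {p}) (K + 2) p q L a z s e)
    (hse : ∀ i < K + 2, s i + 1 = e i) (hK : 1 ≤ K) :
    ∃ B m v S a z e, Frame G B K m v S a z e := by
  have h0 : ∀ i < K + 2, ∃ (S : Set V) (w : V), Conn G S ∧ a i ∈ S ∧ w ∈ S ∧ (∀ u ∈ S, u ∈ L i) ∧
      ((S = {w} ∧ w = z i) ∨ (z i ∉ S ∧ ∀ u ∈ S, (G.Adj u (z i) ↔ u = w))) := fun i hi =>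
    exists_tip (hc.leg i hi).1 (hc.leg i hi).2.1 (hc.leg i hi).2.2.1
  have : Nonempty V := ⟨p⟩
  choose! S w hS haS hwS hSL htip using h0
  set n := q.length with hnq
  obtain ⟨σ, hσ⟩ : ∃ σ : ℕ → V, ∀ j ≤ n, (p :: q)[j]? = some (σ j) := by
    refine ⟨fun j => ((p :: q)[j]?).getD p, fun j hj => ?_⟩
    have : j < (p :: q).length := by simp; omega
    simp [List.getElem?_eq_getElem this]
  have hinj : ∀ i j, i ≤ n → j ≤ n → σ i = σ j → i = j := fun i j hi hj h' =>
    hc.path.get_inj (hσ i hi) (h' ▸ hσ j hj)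
  have hadj : ∀ i j, i ≤ n → j ≤ n → (G.Adj (σ i) (σ j) ↔ i = j + 1 ∨ j = i + 1) :=
    fun i j hi hj => hc.path.adj_get (hσ i hi) (hσ j hj)
  have hσ0 : σ 0 = p := by
    have := hσ 0 (by omega)
    simpa using this.symm
  have hpos : ∀ i < K + 2, i + 1 ≤ e i := by
    intro i
    induction i with
    | zero => exact fun hi => (hc.pos 0 hi).1
    | succ i ih =>
      intro hi
      have := ih (by omega)
      have := hc.mono i (i + 1) (by omega) hi
      omega
  have hup : ∀ i < K + 2, e i < n := fun i hi => (hc.pos i hi).2.1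
  have hup' : ∀ i < K + 1, e i + 2 ≤ n := fun i hi => by
    have := hc.mono i (K + 1) hi (by omega)
    have := hup (K + 1) (by omega)
    omega
  have hn4 : 4 ≤ n := by
    have := hpos (K + 1) (by omega)
    have := hup (K + 1) (by omega)
    omega
  have hσq : ∀ j, 1 ≤ j → j ≤ n → σ j ∈ q := by
    intro j h1 h2
    obtain ⟨j, rfl⟩ := Nat.exists_eq_add_of_le' h1
    have := hσ _ h2
    rw [List.getElem?_cons_succ] at this
    exact List.mem_of_getElem? this
  have hlast : q.getLast? = some (σ n) := by
    have := hσ n le_rfl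
    rw [List.getLast?_eq_getElem?, ← hnq, ← this]
    obtain ⟨j, hj⟩ := Nat.exists_eq_add_of_le' (show 1 ≤ n by omega)
    rw [hj]
    simp
  obtain ⟨x, hx, hqx⟩ := hc.last
  have hσn : σ n ∈ X := by
    rw [hlast] at hqx
    exact Option.some.inj hqx ▸ hx
  have hσA : ∀ j, 1 ≤ j → j < n → σ j ∈ A := by
    intro j h1 h2
    refine (hc.sub _ (hσq j h1 h2.le)).1.resolve_right fun hX => ?_
    have := hc.term _ (hσq j h1 h2.le) hX
    rw [hlast] at this
    exact absurd (hinj _ _ le_rfl h2.le (Option.some.inj this)) (by omega)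
  have hLσ : ∀ i < K + 2, ∀ u ∈ L i, ∀ j ≤ n, u ≠ σ j := by
    rintro i hi u hu j hj rfl
    have hu' := (hc.leg i hi).2.2.2.2.2 _ hu
    rcases Nat.eq_zero_or_pos j with rfl | h1
    · exact hu'.1.2 hσ0
    · exact hu'.2 (hσq j h1 hj)
  have hatt : ∀ i < K + 2, ∀ u ∈ L i, ∀ j ≤ n, (G.Adj u (σ j) ↔ u = a i ∧ (j + 1 = e i ∨ j = e i)) := by
    intro i hi u hu j hj
    rw [hc.att i hi u hu j _ (hσ j hj), ← hse i hi]
    simp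
  have hzL : ∀ i < K + 2, z i ∈ L i := fun i hi => List.mem_of_getLast? (hc.leg i hi).2.2.1
  have hzX : ∀ i < K + 2, z i ∈ X := fun i hi => (hc.leg i hi).2.2.2.1
  have hzσ : ∀ i < K + 2, z i ∉ S i → ∀ j ≤ n, ¬ G.Adj (σ j) (z i) := fun i hi hz j hj h' => by
    have := ((hatt i hi _ (hzL i hi) j hj).1 h'.symm).1
    exact hz (this ▸ haS i hi)
  set B : Set V := {u | u ∈ D ∨ u = σ 0 ∨ u = σ n ∨ ∃ i < K + 2, z i ∉ S i ∧ u = z i} with hB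
  have hσX0 : σ 0 ∈ X := hσ0 ▸ hp
  have hDB : D ⊆ B := fun u hu => Or.inl hu
  have hBc : Conn G B := by
    obtain ⟨r, hr⟩ := hD.1
    have hX : ∀ u ∈ X, u ∈ B → ∃ T ⊆ B, Conn G T ∧ r ∈ T ∧ u ∈ T := fun u hu huB =>
      ⟨Insert.insert u D, insert_subset huB hDB, hD.insert (hs u hu), mem_insert_of_mem _ hr,
        mem_insert _ _⟩
    refine Conn.of_root (hDB hr) fun u hu => ?_
    rcases id hu with h' | rfl | rfl | ⟨i, hi, -, rfl⟩
    · exact ⟨D, hDB, hD, hr, h'⟩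
    · exact hX _ hσX0 hu
    · exact hX _ hσn hu
    · exact hX _ (hzX i hi) hu
  have hσB : ∀ j, 1 ≤ j → j < n → σ j ∉ B := by
    rintro j h1 h2 (h' | h' | h' | ⟨i, hi, -, h'⟩)
    · exact (hA _ (hσA j h1 h2) _ h').1 rfl
    · exact absurd (hinj _ _ h2.le (by omega) h') (by omega)
    · exact absurd (hinj _ _ h2.le le_rfl h') (by omega)
    · exact hLσ i hi _ (hzL i hi) j h2.le h'.symm
  have hσN : ∀ j, 1 ≤ j → j < n → ∀ u ∈ B, G.Adj (σ j) u → (j = 1 ∧ u = σ 0) ∨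
      (j + 1 = n ∧ u = σ n) := by
    rintro j h1 h2 u (h' | rfl | rfl | ⟨i, hi, hz, rfl⟩) hu
    · exact absurd hu (hA _ (hσA j h1 h2) _ h').2
    · rw [hadj _ _ h2.le (by omega)] at hu
      exact Or.inl ⟨by omega, rfl⟩
    · rw [hadj _ _ h2.le le_rfl] at hu
      exact Or.inr ⟨by omega, rfl⟩
    · exact absurd hu (hzσ i hi hz j h2.le)
  have hLap : ∀ i j, i < K + 2 → j < K + 2 → i ≠ j → Apart G (S i) (S j) := fun i j hi hj hij =>
    (hc.apart i j hi hj hij).mono (hSL i hi) (hSL j hj)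
  have hSout : ∀ i, 2 ≤ i → i ≤ K → ∀ u ∈ S i, u ∉ B ∧ ∀ b ∈ B, G.Adj u b → u = w i := by
    intro i h2 hi u hu
    have hiK : i < K + 2 := by omega
    have huL := hSL i hiK u hu
    have hpi := hpos i hiK
    have hui := hup' i (by omega)
    have huU := ((hc.leg i hiK).2.2.2.2.2 u huL).1.1
    have hX1 : u ∈ X → S i = {w i} ∧ w i = z i := fun huX => by
      refine (htip i hiK).resolve_right fun h' => h'.1 ?_
      exact (hc.leg i hiK).2.2.2.2.1 u huL huX ▸ hu
    constructor
    · rintro (h' | rfl | rfl | ⟨j, hj, hz, rfl⟩)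
      · rcases huU with h3 | h3
        · exact (hA _ h3 _ h').1 rfl
        · exact hXD _ h3 h'
      · exact hLσ i hiK _ huL 0 (by omega) rfl
      · exact hLσ i hiK _ huL n le_rfl rfl
      · by_cases hij : i = j
        · exact hz (hij ▸ hu)
        · exact (hc.apart i j hiK hj hij _ huL _ (hzL j hj)).1 rfl
    · rintro b (h' | rfl | rfl | ⟨j, hj, hz, rfl⟩) hub
      · rcases huU with h3 | h3
        · exact absurd hub (hA _ h3 _ h').2
        · have := (hX1 h3).1 ▸ hu
          exact this
      · have := ((hatt i hiK u huL _ (by omega)).1 hub).2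
        omega
      · have := ((hatt i hiK u huL _ le_rfl).1 hub).2
        omega
      · by_cases hij : i = j
        · subst hij
          rcases htip i hiK with h3 | h3
          · have := h3.1 ▸ hu
            exact this
          · exact (h3.2 u hu).1 hub
        · exact absurd hub (hc.apart i j hiK hj hij _ huL _ (hzL j hj)).2
  let c : {α : Type} → α → α → (ℕ → α) → ℕ → α := fun x y f i =>
    if i = 0 then x else if i = K then y else f i
  have c0 : ∀ {α : Type} (x y : α) f, c x y f 0 = x := fun x y f => if_pos rfl
  have cK : ∀ {α : Type} (x y : α) f, c x y f K = y := fun x y f => by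
    simp only [c, if_pos]
    rw [if_neg (by omega)]
  have ci : ∀ {α : Type} (x y : α) f i, 0 < i → i < K → c x y f i = f i := fun x y f i h1 h2 => by
    simp only [c]
    rw [if_neg (by omega), if_neg (by omega)]
  clear_value c
  have hcase : ∀ {P : ℕ → Prop}, P 0 → P K → (∀ i, 0 < i → i < K → P i) → ∀ i ≤ K, P i := by
    intro P p0 pK pi i hi
    rcases Nat.eq_zero_or_pos i with rfl | h1
    · exact p0
    · rcases hi.eq_or_lt with rfl | h2
      · exact pK
      · exact pi i h1 h2
  refine ⟨B, n - 3, fun j => σ (j + 2), c {σ 1} {σ (n - 1)} fun i => S (i + 1),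
    c (σ 1) (σ (n - 1)) fun i => a (i + 1), c (σ 1) (σ (n - 1)) fun i => w (i + 1),
    c 0 (n - 3) fun i => e (i + 1) - 2, ?_, ?_, ?_, ?_, ?_, ?_, ?_, ?_, ?_, hBc, ?_,
    ?_, ?_, ?_⟩
  · intro i hi j hj h'
    have := hinj _ _ (by omega) (by omega) h'
    omega
  · intro i hi j hj
    rw [hadj _ _ (by omega) (by omega)]
    omega
  · exact c0 _ _ _
  · exact cK _ _ _
  · intro i j hij hj
    rcases Nat.eq_zero_or_pos i with rfl | h1
    · rw [c0]
      rcases hj.eq_or_lt with rfl | h2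
      · rw [cK]
        omega
      · rw [ci _ _ _ _ hij h2]
        have := hpos (j + 1) (by omega)
        omega
    · rw [ci _ _ _ i h1 (by omega)]
      have := hpos (i + 1) (by omega)
      rcases hj.eq_or_lt with rfl | h2
      · rw [cK]
        have := hup' (i + 1) (by omega)
        omega
      · rw [ci _ _ _ j (by omega) h2]
        have := hc.mono (i + 1) (j + 1) (by omega) (by omega)
        omega
  · refine hcase ?_ ?_ fun i h1 h2 => ?_
    · rw [c0, c0, c0]
      exact ⟨Conn.singleton _, rfl, rfl⟩
    · rw [cK, cK, cK]
      exact ⟨Conn.singleton _, rfl, rfl⟩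
    · rw [ci _ _ _ i h1 h2, ci _ _ _ i h1 h2, ci _ _ _ i h1 h2]
      exact ⟨hS _ (by omega), haS _ (by omega), hwS _ (by omega)⟩
  · refine hcase ?_ ?_ fun i h1 h2 => ?_
    · rw [c0]
      rintro u rfl j hj h'
      have := hinj _ _ (by omega) (by omega) h'
      omega
    · rw [cK]
      rintro u rfl j hj h'
      have := hinj _ _ (by omega) (by omega) h'
      omega
    · rw [ci _ _ _ i h1 h2]
      exact fun u hu j hj => hLσ (i + 1) (by omega) u (hSL _ (by omega) u hu) _ (by omega)
  · refine hcase ?_ ?_ fun i h1 h2 => ?_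
    · rw [c0, c0, c0]
      rintro u rfl j hj
      rw [hadj _ _ (by omega) (by omega)]
      simp only [true_and]
      omega
    · rw [cK, cK, cK]
      rintro u rfl j hj
      rw [hadj _ _ (by omega) (by omega)]
      simp only [true_and]
      omega
    · rw [ci _ _ _ i h1 h2, ci _ _ _ i h1 h2, ci _ _ _ i h1 h2]
      intro u hu j hj
      rw [hatt (i + 1) (by omega) u (hSL _ (by omega) u hu) _ (by omega)]
      have := hpos (i + 1) (by omega)
      refine and_congr_right fun _ => ?_
      omega
  · intro i j hi hj hij
    wlog hlt : i < j generalizing i j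
    · exact (this j i hj hi hij.symm (by omega)).symm
    have hleg : ∀ t, 1 ≤ t → t ≤ n → (t = 1 ∨ t + 1 = n) → ∀ i, 0 < i → i < K →
        Apart G {σ t} (S (i + 1)) := by
      rintro t h1 h2 h3 i h4 h5 _ rfl u hu
      have huL := hSL (i + 1) (by omega) u hu
      refine ⟨(hLσ (i + 1) (by omega) u huL t h2).symm, fun h' => ?_⟩
      have := ((hatt (i + 1) (by omega) u huL t h2).1 h'.symm).2
      have := hpos (i + 1) (by omega)
      have := hup' (i + 1) (by omega)
      omega
    rcases Nat.eq_zero_or_pos i with rfl | h1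
    · rw [c0]
      rcases hj.eq_or_lt with rfl | h2
      · rw [cK]
        rintro _ rfl _ rfl
        refine ⟨fun h' => ?_, fun h' => ?_⟩
        · have := hinj _ _ (by omega) (by omega) h'
          omega
        · rw [hadj _ _ (by omega) (by omega)] at h'
          omega
      · rw [ci _ _ _ _ hlt h2]
        exact hleg 1 le_rfl (by omega) (Or.inl rfl) j hlt h2
    · rw [ci _ _ _ i h1 (by omega)]
      rcases hj.eq_or_lt with rfl | h2
      · rw [cK]
        exact (hleg _ (by omega) (by omega) (Or.inr (by omega)) i h1 (by omega)).symm
      · rw [ci _ _ _ j (by omega) h2]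
        exact hLap _ _ (by omega) (by omega) (by omega)
  · intro j hj
    refine ⟨hσB _ (by omega) (by omega), ?_⟩
    rintro ⟨b, hb, h'⟩
    have := hσN _ (by omega) (by omega) b hb h'
    omega
  · refine hcase ?_ ?_ fun i h1 h2 => ?_
    · rw [c0, c0]
      rintro u rfl
      exact ⟨hσB _ le_rfl (by omega), fun _ => rfl⟩
    · rw [cK, cK]
      rintro u rfl
      exact ⟨hσB _ (by omega) (by omega), fun _ => rfl⟩
    · rw [ci _ _ _ i h1 h2, ci _ _ _ i h1 h2]
      intro u hu
      obtain ⟨h3, h4⟩ := hSout (i + 1) (by omega) (by omega) u hu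
      exact ⟨h3, fun ⟨b, hb, h'⟩ => h4 b hb h'⟩
  · refine hcase ?_ ?_ fun i h1 h2 => ?_
    · rw [c0]
      exact ⟨σ 0, Or.inr (Or.inl rfl), (hadj _ _ (by omega) (by omega)).2 (by omega)⟩
    · rw [cK]
      exact ⟨σ n, Or.inr (Or.inr (Or.inl rfl)), (hadj _ _ (by omega) (by omega)).2 (by omega)⟩
    · rw [ci _ _ _ i h1 h2]
      rcases htip (i + 1) (by omega) with h3 | h3
      · rw [h3.2]
        exact (hs _ (hzX _ (by omega))).mono hDB
      · exact ⟨z (i + 1), Or.inr (Or.inr (Or.inr ⟨i + 1, by omega, h3.1, rfl⟩)),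
          (h3.2 _ (hwS _ (by omega))).2 rfl⟩
  · refine hcase ?_ ?_ fun i h1 h2 => ?_
    · rw [c0]
      refine Or.inl ⟨σ 0, Or.inr (Or.inl rfl), fun u hu h' => ?_⟩
      rcases hσN _ le_rfl (by omega) u hu h' with h3 | h3
      · exact h3.2
      · omega
    · rw [cK]
      refine Or.inl ⟨σ n, Or.inr (Or.inr (Or.inl rfl)), fun u hu h' => ?_⟩
      rcases hσN _ (by omega) (by omega) u hu h' with h3 | h3
      · omega
      · exact h3.2
    · rw [ci _ _ _ i h1 h2, ci _ _ _ i h1 h2]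
      have hiK : i + 1 < K + 2 := by omega
      rcases htip (i + 1) hiK with h3 | h3
      · exact Or.inr ⟨h1, h2, h3.1, h3.2 ▸ hn _ (hzX _ hiK)⟩
      · refine Or.inl ⟨z (i + 1), Or.inr (Or.inr (Or.inr ⟨i + 1, hiK, h3.1, rfl⟩)), ?_⟩
        rintro u (h' | rfl | rfl | ⟨j, hj, hz, rfl⟩) hu
        · exfalso
          have hwL := hSL _ hiK _ (hwS _ hiK)
          rcases ((hc.leg _ hiK).2.2.2.2.2 _ hwL).1.1 with h5 | h5
          · exact (hA _ h5 _ h').2 hu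
          · exact h3.1 ((hc.leg _ hiK).2.2.2.2.1 _ hwL h5 ▸ hwS _ hiK)
        · have := ((hatt _ hiK _ (hSL _ hiK _ (hwS _ hiK)) _ (by omega)).1 hu).2
          have := hpos _ hiK
          omega
        · have := ((hatt _ hiK _ (hSL _ hiK _ (hwS _ hiK)) _ le_rfl).1 hu).2
          have := hup' (i + 1) (by omega)
          omega
        · by_cases hij : i + 1 = j
          · rw [hij]
          · exact absurd hu (hc.apart _ j hiK hj hij _ (hSL _ hiK _ (hwS _ hiK)) _ (hzL j hj)).2

/-- A large family of terminals tight on one side yields a frame. -/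
theorem exists_frame (t K : ℕ) (hK : 1 ≤ K) : ∃ N, ∀ (V : Type) [Finite V] (G : SimpleGraph V)
    (D₁ D₂ X : Set V), Sides G D₁ D₂ X → Tight G D₁ X → G.CliqueFree t → N ≤ X.ncard →
    ∃ B m v S a z e, Frame G B K m v S a z e := by
  obtain ⟨N, hN⟩ := exists_tight_comb t (K + 2)
  refine ⟨N, fun V _ G D₁ D₂ X h hT ht hX => ?_⟩
  obtain ⟨A, hAD, hA⟩ := exists_minConn h.conn₁ h.sees₁ h.out₁ h.stable
  obtain ⟨p, hp, q, L, a, z, s, e, hc, hse⟩ := hN V G A X (hT.mono hAD) hA ht hX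
  exact frame_of_comb (h.apart.mono hAD subset_rfl) h.conn₂ h.out₂ h.sees₂ h.nonhub hp hc hse hK

end FrameOfComb
section UniqueContact

variable {V : Type} {G : SimpleGraph V}

theorem path_unique {A : Set V} {x y w : V} {l : List V} (hl : IP G (y :: (l ++ [w])))
    (hlA : ∀ u ∈ l, u ∈ A) (hy : x ≠ y ∧ ¬ G.Adj x y) (hw : x ≠ w ∧ ¬ G.Adj x w) (hxA : x ∉ A)
    (hs : ∃ u ∈ l, G.Adj x u) (hnw : ¬ HasWide G A x y w) (hnt : ¬ HasTri G A ![x, y, w]) :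
    ∃ p c s, l = p ++ c :: s ∧ G.Adj x c ∧ (∀ u ∈ p, ¬ G.Adj x u) ∧ ∀ u ∈ s, ¬ G.Adj x u := by
  rcases list_ends hs with h | ⟨p, c, m, d, s, rfl, hc, hd, hp, hs'⟩
  · exact h
  exfalso
  have hcd : G.Adj c d := by
    by_contra hcd
    refine hnw ⟨_, hl, hlA, c, by simp, d, by simp, ?_, hcd, hc, hd⟩
    have := (ip_cons.1 hl).2.2.left.nodup
    rintro rfl
    simp [List.nodup_append] at this
  have hl' : IP G ((y :: (p ++ [c])) ++ (m ++ d :: (s ++ [w]))) := by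
    convert hl using 1
    simp
  obtain ⟨i1, i2, i3⟩ := ip_append.1 hl'
  have hcl : (y :: (p ++ [c])).getLast? = some c := by
    rw [← List.cons_append, List.getLast?_append]; simp
  have hm : m = [] := by
    have hh := ((i3 c (by simp) d (by simp)).2.1 hcd).2
    rcases m with _ | ⟨b, m⟩
    · rfl
    · simp only [List.cons_append, List.head?_cons, Option.some.injEq] at hh
      have := i2.nodup
      subst hh
      simp at this
  subst hm
  have hcn : y :: (p ++ [c]) ≠ [] := by simp
  have hdn : d :: (s ++ [w]) ≠ [] := by simp
  have h1 : ∀ u ∈ y :: (p ++ [c]), x ≠ u ∧ (G.Adj x u ↔ u = c) := by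
    intro u hu
    simp only [List.mem_cons, List.mem_append, List.not_mem_nil, or_false] at hu
    rcases hu with rfl | hu | rfl
    · refine ⟨hy.1, fun e => absurd e hy.2, fun e => absurd (e ▸ hc) hy.2⟩
    · have huA := hlA u (by simp [hu])
      exact ⟨fun e => hxA (e ▸ huA), fun e => absurd e (hp u hu), fun e => e ▸ hc⟩
    · have huA := hlA u (by simp)
      exact ⟨fun e => hxA (e ▸ huA), fun _ => rfl, fun _ => hc⟩
  have h2 : ∀ u ∈ d :: (s ++ [w]), x ≠ u ∧ (G.Adj x u ↔ u = d) := by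
    intro u hu
    simp only [List.mem_cons, List.mem_append, List.not_mem_nil, or_false] at hu
    rcases hu with rfl | hu | rfl
    · have huA := hlA u (by simp)
      exact ⟨fun e => hxA (e ▸ huA), fun _ => rfl, fun _ => hd⟩
    · have huA := hlA u (by simp [hu])
      exact ⟨fun e => hxA (e ▸ huA), fun e => absurd e (hs' u hu), fun e => e ▸ hd⟩
    · refine ⟨hw.1, fun e => absurd e hw.2, fun e => absurd (e ▸ hd) hw.2⟩
  have h3 : ∀ u ∈ y :: (p ++ [c]), ∀ v ∈ d :: (s ++ [w]), u ≠ v ∧ (G.Adj u v ↔ u = c ∧ v = d) := by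
    intro u hu v hv
    refine ⟨(i3 u hu v hv).1, ?_⟩
    rw [(i3 u hu v hv).2, hcl]
    simp [eq_comm]
  have sw : ∀ {P Q : List V} {c d : V}, (∀ u ∈ P, ∀ w ∈ Q, u ≠ w ∧ (G.Adj u w ↔ u = c ∧ w = d)) →
      ∀ w ∈ Q, ∀ u ∈ P, w ≠ u ∧ (G.Adj w u ↔ w = d ∧ u = c) := fun hh w hw u hu =>
    ⟨(hh u hu w hw).1.symm, by rw [G.adj_comm, (hh u hu w hw).2, and_comm]⟩
  have hx1 : ∀ u ∈ [x], ∀ v ∈ y :: (p ++ [c]), u ≠ v ∧ (G.Adj u v ↔ u = x ∧ v = c) := by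
    intro u hu v hv
    simp only [List.mem_singleton] at hu
    subst hu
    simpa using h1 v hv
  have hx2 : ∀ u ∈ [x], ∀ v ∈ d :: (s ++ [w]), u ≠ v ∧ (G.Adj u v ↔ u = x ∧ v = d) := by
    intro u hu v hv
    simp only [List.mem_singleton] at hu
    subst hu
    simpa using h2 v hv
  refine hnt ⟨![x, c, d], ![{u | u ∈ [x]}, {u | u ∈ y :: (p ++ [c])}, {u | u ∈ d :: (s ++ [w])}],
    fun i => ?_, fun i j hij => ?_⟩
  · fin_cases i
    · exact ⟨IP.conn (ip_singleton x) (by simp), by simp, by simp, by intro u hu; simpa using Or.inl hu⟩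
    · refine ⟨i1.conn hcn, by simp, by simp, fun u hu => ?_⟩
      simp only [List.mem_cons, List.mem_append, List.not_mem_nil, or_false] at hu
      rcases hu with rfl | hu | rfl
      · exact mem_insert _ _
      · exact mem_insert_of_mem _ (hlA u (by simp [hu]))
      · exact mem_insert_of_mem _ (hlA u (by simp))
    · refine ⟨i2.conn hdn, by simp, by simp, fun u hu => ?_⟩
      simp only [List.mem_cons, List.mem_append, List.not_mem_nil, or_false] at hu
      rcases hu with rfl | hu | rfl
      · exact mem_insert_of_mem _ (hlA u (by simp))
      · exact mem_insert_of_mem _ (hlA u (by simp [hu]))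
      · exact mem_insert _ _
  · fin_cases i <;> fin_cases j
    · exact absurd rfl hij
    · exact hx1
    · exact hx2
    · exact sw hx1
    · exact absurd rfl hij
    · exact h3
    · exact sw hx2
    · exact sw h3
    · exact absurd rfl hij

theorem Leg.avoid {A L T : Set V} {a b y W : V} (h : Leg G A a b L y) (hT : Conn G T)
    (hW : W ∈ T) (hTA : T ⊆ Insert.insert W A) (hWA : W ∉ A) (hWL : ¬ Sees G W L) (ha : a ∉ T) :
    ∀ u ∈ T, u ∉ L := by
  intro u hu huL
  obtain ⟨c, hc, hcL, d, hd, hdL, hcd⟩ := hT.cross hu huL hW fun hWL' => hWA (h.sub hWL')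
  rcases hTA hd with rfl | hdA
  · exact hWL ⟨c, hcL, hcd.symm⟩
  · exact ha (h.gate c hcL d hdA hdL hcd ▸ hc)

theorem Leg.approach {A La Lb : Set V} {a b y z W w x : V} (ha : Leg G A a b La y)
    (hb : Leg G A b a Lb z) (hA : Conn G A) (hWA : W ∉ A) (hw : w ∈ A)
    (hWw : ∀ u ∈ A, G.Adj W u ↔ u = w) (hwa : w ∉ La) (hwb : w ∉ Lb) (hxa : G.Adj x a)
    (hxb : G.Adj x b) (hz : z ∉ A) (hWz : W ≠ z ∧ ¬ G.Adj W z) (hxA : x ∉ A)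
    (hxW : x ≠ W ∧ ¬ G.Adj x W) (hxz : x ≠ z ∧ ¬ G.Adj x z) (hnw : ¬ HasWide G A x W z)
    (hnt : ¬ HasTri G A ![x, W, z]) :
    ∃ Z, Conn G Z ∧ Z ⊆ A ∧ w ∈ Z ∧ Sees G b Z ∧ ∀ u ∈ Z, u ∉ La ∧ u ∉ Lb ∧ ¬ G.Adj x u := by
  have hWa : ¬ Sees G W La := fun ⟨u, hu, h⟩ => hwa ((hWw u (ha.sub hu)).1 h ▸ hu)
  have hWb : ¬ Sees G W Lb := fun ⟨u, hu, h⟩ => hwb ((hWw u (hb.sub hu)).1 h ▸ hu)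
  obtain ⟨l, hl, hlA'⟩ := hA.lk hWz.1 hWz.2 ⟨w, hw, (hWw w hw).2 rfl⟩ (hb.sees.mono hb.sub)
  have hlA : ∀ u ∈ l, u ∈ A := fun u hu => (hlA' u hu).1
  have hbA := hb.sub hb.mem
  have hbl : b ∈ l := by
    have := hb.mem_of_conn (w := W) (hl.conn (by simp)) (by simp) (by simp)
      (fun h => hWA (hb.sub h)) hWz.1 fun u hu => ?_
    · simp only [mem_ofPred_eq, List.mem_cons, List.mem_append, List.not_mem_nil, or_false] at this
      rcases this with h | h | h
      · exact absurd (h ▸ hbA) hWA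
      · exact h
      · exact absurd (h ▸ hbA) hz
    · simp only [mem_ofPred_eq, List.mem_cons, List.mem_append, List.not_mem_nil, or_false] at hu
      rcases hu with rfl | h | h
      · exact Or.inr (Or.inr ⟨hWb, hWz.2⟩)
      · exact Or.inr (Or.inl (hlA u h))
      · exact Or.inl h
  obtain ⟨p, c, s, rfl, hc, hp, hs⟩ := path_unique hl hlA hxW hxz hxA ⟨b, hbl, hxb⟩ hnw hnt
  have hbc : b = c := by
    simp only [List.mem_append, List.mem_cons] at hbl
    rcases hbl with h | h | h
    · exact absurd hxb (hp b h)
    · exact h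
    · exact absurd hxb (hs b h)
  subst hbc
  obtain ⟨i1, i2, i3⟩ := ip_cons.1 hl
  have hbw : b ≠ w := fun e => hwb (e ▸ hb.mem)
  rcases p with _ | ⟨d, p⟩
  · exact absurd ((hWw b hbA).1 ((i2 b (by simp)).2 (by simp))) hbw
  have hdw : d = w := (hWw d (hlA d (by simp))).1 ((i2 d (by simp)).2 (by simp))
  subst hdw
  have hl2 : IP G ((W :: d :: p) ++ (b :: (s ++ [z]))) := by
    convert hl using 1
    simp
  have hT := hl2.left.conn (by simp)
  have hTA : {u | u ∈ W :: d :: p} ⊆ Insert.insert W A := by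
    intro u hu
    rcases List.mem_cons.1 hu with h | h
    · exact Or.inl h
    · exact Or.inr (hlA u (by rw [List.mem_append]; exact Or.inl h))
  have hmiss : ∀ u, G.Adj x u → u ∉ W :: d :: p := by
    intro u hxu hu
    rcases List.mem_cons.1 hu with h | h
    · exact hxW.2 (h ▸ hxu)
    · exact hp u h hxu
  have h1 := ha.avoid hT (by simp) hTA hWA hWa (hmiss a hxa)
  have h2 := hb.avoid hT (by simp) hTA hWA hWb (hmiss b hxb)
  have hl3 : IP G ((d :: p) ++ [b]) := by
    have h3 : IP G (((d :: p) ++ [b]) ++ (s ++ [z])) := by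
      convert i3 using 1
      simp
    exact h3.left
  refine ⟨{u | u ∈ d :: p}, hl3.left.conn (by simp), fun u hu => hlA u ?_, by simp,
    hl3.last_adj (by simp), fun u hu => ⟨h1 u (List.mem_cons_of_mem _ hu),
      h2 u (List.mem_cons_of_mem _ hu), hp u hu⟩⟩
  rw [List.mem_append]
  exact Or.inl hu

/-- A wide path at the gate `a` between `W` and the opposite gate extends through the opposite
leg, and then a common neighbour `x` of both gates has a wide path as well. -/
theorem Leg.wide_through {A Z Lb : Set V} {a b z W x : V} (hb : Leg G A b a Lb z) (ha : a ∈ A)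
    (hZA : Z ⊆ A) (hZb : ∀ u ∈ Z, u ∉ Lb) (hWA : W ∉ A) (hWb : ¬ Sees G W Lb) (hz : z ∉ A)
    (hWz : W ≠ z ∧ ¬ G.Adj W z) (hab : a ≠ b ∧ ¬ G.Adj a b) (hxa : G.Adj x a) (hxb : G.Adj x b)
    (hw : HasWide G Z a W b) : HasWide G A x W z := by
  obtain ⟨T₁, T₂, c1, c2, hW, hbT, s1, s2, a1, a2, hap⟩ := hw.split
  have hbA := hb.sub hb.mem
  have hcL : Conn G (Insert.insert z Lb) := hb.conn.insert hb.sees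
  have c3 : Conn G (T₂ ∪ Insert.insert z Lb) :=
    c2.union hcL ⟨b, hbT, b, Or.inr hb.mem, Or.inl rfl⟩
  have c4 : Conn G (T₁ ∪ Insert.insert a (T₂ ∪ Insert.insert z Lb)) := by
    refine c1.union (c3.insert (a2.mono subset_union_left)) ?_
    obtain ⟨u, hu, hau⟩ := a1
    exact ⟨u, hu, a, mem_insert _ _, Or.inr hau.symm⟩
  set T := T₁ ∪ Insert.insert a (T₂ ∪ Insert.insert z Lb) with hT
  have hWT : W ∈ T := Or.inl hW
  have hzT : z ∈ T := Or.inr (Or.inr (Or.inr (Or.inl rfl)))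
  obtain ⟨l, hl, hlT⟩ := c4.lk_of_mem hWT hzT hWz.1 hWz.2
  have hTA : ∀ u ∈ T, u = W ∨ u = z ∨ u ∈ A := by
    rintro u (hu | rfl | hu | rfl | hu)
    · rcases s1 hu with h | h
      · exact Or.inl h
      · exact Or.inr (Or.inr (hZA h))
    · exact Or.inr (Or.inr ha)
    · rcases s2 hu with h | h
      · exact Or.inr (Or.inr (h ▸ hbA))
      · exact Or.inr (Or.inr (hZA h))
    · exact Or.inr (Or.inl rfl)
    · exact Or.inr (Or.inr (hb.sub hu))
  have hlA : ∀ u ∈ l, u ∈ A := by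
    intro u hu
    obtain ⟨h1, h2⟩ := hlT u hu
    simp only [mem_insert_iff, mem_singleton_iff, not_or] at h2
    exact (((hTA u h1).resolve_left h2.1).resolve_left h2.2)
  have hlc := hl.conn (by simp)
  have hml : ∀ u, u ∈ W :: (l ++ [z]) → u ∈ A → u ∈ l := by
    intro u hu huA
    simp only [List.mem_cons, List.mem_append, List.not_mem_nil, or_false] at hu
    rcases hu with rfl | h | rfl
    · exact absurd huA hWA
    · exact h
    · exact absurd huA hz
  have hlT' : ∀ u, u ∈ W :: (l ++ [z]) → u ∈ T := by
    intro u hu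
    simp only [List.mem_cons, List.mem_append, List.not_mem_nil, or_false] at hu
    rcases hu with rfl | h | rfl
    · exact hWT
    · exact (hlT u h).1
    · exact hzT
  have hbl : b ∈ l := by
    refine hml b (hb.mem_of_conn (w := W) hlc (by simp) (by simp) (fun h => hWA (hb.sub h)) hWz.1
      fun u hu => ?_) hbA
    rcases hTA u (hlT' u hu) with rfl | h | h
    · exact Or.inr (Or.inr ⟨hWb, hWz.2⟩)
    · exact Or.inl h
    · exact Or.inr (Or.inl h)
  have hT1z : z ∉ T₁ := fun h => by
    rcases s1 h with h | h
    · exact hWz.1 h.symm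
    · exact hz (hZA h)
  have hal : a ∈ l := by
    obtain ⟨u, hu, hu1, v, hv, hv1, huv⟩ := hlc.cross (T := T₁) (u := W) (by simp) hW
      (v := z) (by simp) hT1z
    rcases hlT' v hv with h | rfl | h | rfl | h
    · exact absurd h hv1
    · exact hml _ hv ha
    · exact absurd huv (hap u hu1 v h).2
    · rcases s1 hu1 with rfl | h
      · exact absurd huv hWz.2
      · exact absurd ⟨u, ⟨hZA h, hZb u h⟩, huv.symm⟩ hb.priv
    · rcases s1 hu1 with rfl | h'
      · exact absurd ⟨v, h, huv⟩ hWb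
      · have := hb.gate v h u (hZA h') (hZb u h') huv.symm
        subst this
        exact absurd huv (hap u hu1 v hbT).2
  exact ⟨l, hl, hlA, a, hal, b, hbl, hab.1, hab.2, hxa, hxb⟩

end UniqueContact
section ContactPair

variable {V : Type} {G : SimpleGraph V}

theorem Leg.miss {A La Lb : Set V} {a b y z W w : V} (ha : Leg G A a b La y)
    (hb : Leg G A b a Lb z) (hyA : y ∉ A) (hzA : z ∉ A) (hWA : W ∉ A)
    (hWw : ∀ u ∈ A, G.Adj W u ↔ u = w) (hwa : w ∉ La) (hyz : y ≠ z ∧ ¬ G.Adj y z)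
    (hWy : W ≠ y ∧ ¬ G.Adj W y) :
    ∀ v ∈ Insert.insert y La, v = a ∨
      ∀ u ∈ Insert.insert W (Insert.insert z (A \ La)), u ≠ v ∧ ¬ G.Adj u v := by
  rintro v (rfl | hv)
  · right
    rintro u (rfl | rfl | hu)
    · exact hWy
    · exact ⟨hyz.1.symm, fun e => hyz.2 e.symm⟩
    · exact ⟨fun e => hyA (e ▸ hu.1), fun e => ha.priv ⟨u, hu, e.symm⟩⟩
  · by_cases hva : v = a
    · exact Or.inl hva
    right
    rintro u (rfl | rfl | hu)
    · exact ⟨fun e => hWA (e ▸ ha.sub hv), fun e => hwa ((hWw v (ha.sub hv)).1 e ▸ hv)⟩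
    · exact ⟨fun e => hzA (e ▸ ha.sub hv), fun e =>
        hb.priv ⟨v, ⟨ha.sub hv, ha.disjoint hb v hv⟩, e⟩⟩
    · exact ⟨fun e => hu.2 (e ▸ hv), fun e => hva (ha.gate v hv u hu.1 hu.2 e.symm)⟩

theorem tri_extend {A Z La Lb : Set V} {a b y z W w : V} (ha : Leg G A a b La y)
    (hb : Leg G A b a Lb z) (hyA : y ∉ A) (hzA : z ∉ A) (hWA : W ∉ A)
    (hWw : ∀ u ∈ A, G.Adj W u ↔ u = w) (hwa : w ∉ La) (hwb : w ∉ Lb)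
    (hyz : y ≠ z ∧ ¬ G.Adj y z) (hWy : W ≠ y ∧ ¬ G.Adj W y) (hWz : W ≠ z ∧ ¬ G.Adj W z)
    (hZA : Z ⊆ A) (hZ : ∀ u ∈ Z, u ∉ La ∧ u ∉ Lb) (h : HasTri G Z ![W, a, b]) :
    HasTri G A ![W, y, z] := by
  obtain ⟨α, S, h1, h2⟩ := h
  have hP := ha.miss hb hyA hzA hWA hWw hwa hyz hWy
  have hQ := hb.miss ha hzA hyA hWA hWw hwb ⟨hyz.1.symm, fun e => hyz.2 e.symm⟩ hWz
  have s0 : S 0 ⊆ Insert.insert W Z := (h1 0).2.2.2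
  have s1 : S 1 ⊆ Insert.insert a Z := (h1 1).2.2.2
  have s2 : S 2 ⊆ Insert.insert b Z := (h1 2).2.2.2
  have m1 : a ∈ S 1 := (h1 1).2.1
  have m2 : b ∈ S 2 := (h1 2).2.1
  have haA := ha.sub ha.mem
  have hbA := hb.sub hb.mem
  have p1 : ∀ v ∈ Insert.insert y La, v ∈ S 1 → v = a := by
    intro v hv hv1
    rcases s1 hv1 with h | h
    · exact h
    · rcases hv with rfl | hv
      · exact absurd (hZA h) hyA
      · exact absurd hv (hZ v h).1
  have p2 : ∀ v ∈ Insert.insert z Lb, v ∈ S 2 → v = b := by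
    intro v hv hv1
    rcases s2 hv1 with h | h
    · exact h
    · rcases hv with rfl | hv
      · exact absurd (hZA h) hzA
      · exact absurd hv (hZ v h).2
  have t0a : S 0 ⊆ Insert.insert W (Insert.insert z (A \ La)) := by
    intro u hu
    rcases s0 hu with h | h
    · exact Or.inl h
    · exact Or.inr (Or.inr ⟨hZA h, (hZ u h).1⟩)
  have t0b : S 0 ⊆ Insert.insert W (Insert.insert y (A \ Lb)) := by
    intro u hu
    rcases s0 hu with h | h
    · exact Or.inl h
    · exact Or.inr (Or.inr ⟨hZA h, (hZ u h).2⟩)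
  have t1 : S 1 ∪ Insert.insert y La ⊆ Insert.insert W (Insert.insert y (A \ Lb)) := by
    rintro u (hu | rfl | hu)
    · rcases s1 hu with h | h
      · exact Or.inr (Or.inr ⟨h ▸ haA, h ▸ hb.away⟩)
      · exact Or.inr (Or.inr ⟨hZA h, (hZ u h).2⟩)
    · exact Or.inr (Or.inl rfl)
    · exact Or.inr (Or.inr ⟨ha.sub hu, ha.disjoint hb u hu⟩)
  have t2 : S 2 ⊆ Insert.insert W (Insert.insert z (A \ La)) := by
    intro u hu
    rcases s2 hu with h | h
    · exact Or.inr (Or.inr ⟨h ▸ hbA, h ▸ ha.away⟩)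
    · exact Or.inr (Or.inr ⟨hZA h, (hZ u h).1⟩)
  have c01 : ∀ u ∈ S 0, ∀ v ∈ S 1 ∪ Insert.insert y La, u ≠ v ∧ (G.Adj u v ↔ u = α 0 ∧ v = α 1) := by
    intro u hu v hv
    by_cases hv1 : v ∈ S 1
    · exact h2 0 1 (by decide) u hu v hv1
    rcases hP v (hv.resolve_left hv1) with rfl | hv'
    · exact absurd m1 hv1
    · obtain ⟨n1, n2⟩ := hv' u (t0a hu)
      exact ⟨n1, fun e => absurd e n2, fun e => absurd (e.2 ▸ (h1 1).2.2.1) hv1⟩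
  have c02 : ∀ u ∈ S 0, ∀ v ∈ S 2 ∪ Insert.insert z Lb, u ≠ v ∧ (G.Adj u v ↔ u = α 0 ∧ v = α 2) := by
    intro u hu v hv
    by_cases hv1 : v ∈ S 2
    · exact h2 0 2 (by decide) u hu v hv1
    rcases hQ v (hv.resolve_left hv1) with rfl | hv'
    · exact absurd m2 hv1
    · obtain ⟨n1, n2⟩ := hv' u (t0b hu)
      exact ⟨n1, fun e => absurd e n2, fun e => absurd (e.2 ▸ (h1 2).2.2.1) hv1⟩
  have c12 : ∀ u ∈ S 1 ∪ Insert.insert y La, ∀ v ∈ S 2 ∪ Insert.insert z Lb,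
      u ≠ v ∧ (G.Adj u v ↔ u = α 1 ∧ v = α 2) := by
    intro u hu v hv
    by_cases hv1 : v ∈ S 2
    · by_cases hu1 : u ∈ S 1
      · exact h2 1 2 (by decide) u hu1 v hv1
      · rcases hP u (hu.resolve_left hu1) with rfl | hu'
        · exact absurd m1 hu1
        · obtain ⟨n1, n2⟩ := hu' v (t2 hv1)
          exact ⟨n1.symm, fun e => absurd e.symm n2, fun e => absurd (e.1 ▸ (h1 1).2.2.1) hu1⟩
    rcases hQ v (hv.resolve_left hv1) with rfl | hv'
    · exact absurd m2 hv1
    · obtain ⟨n1, n2⟩ := hv' u (t1 hu)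
      exact ⟨n1, fun e => absurd e n2, fun e => absurd (e.2 ▸ (h1 2).2.2.1) hv1⟩
  have sw : ∀ {P Q : Set V} {c d : V}, (∀ u ∈ P, ∀ w ∈ Q, u ≠ w ∧ (G.Adj u w ↔ u = c ∧ w = d)) →
      ∀ w ∈ Q, ∀ u ∈ P, w ≠ u ∧ (G.Adj w u ↔ w = d ∧ u = c) := fun hh w hw u hu =>
    ⟨(hh u hu w hw).1.symm, by rw [G.adj_comm, (hh u hu w hw).2, and_comm]⟩
  refine ⟨α, ![S 0, S 1 ∪ Insert.insert y La, S 2 ∪ Insert.insert z Lb], fun i => ?_,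
    fun i j hij => ?_⟩
  · fin_cases i
    · exact ⟨(h1 0).1, (h1 0).2.1, (h1 0).2.2.1, s0.trans (insert_subset_insert hZA)⟩
    · refine ⟨(h1 1).1.union (ha.conn.insert ha.sees) ⟨a, m1, a, Or.inr ha.mem, Or.inl rfl⟩,
        Or.inr (Or.inl rfl), Or.inl (h1 1).2.2.1, ?_⟩
      rintro u (hu | hu | hu)
      · rcases s1 hu with h | h
        · exact Or.inr (h ▸ haA)
        · exact Or.inr (hZA h)
      · exact Or.inl hu
      · exact Or.inr (ha.sub hu)
    · refine ⟨(h1 2).1.union (hb.conn.insert hb.sees) ⟨b, m2, b, Or.inr hb.mem, Or.inl rfl⟩,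
        Or.inr (Or.inl rfl), Or.inl (h1 2).2.2.1, ?_⟩
      rintro u (hu | hu | hu)
      · rcases s2 hu with h | h
        · exact Or.inr (h ▸ hbA)
        · exact Or.inr (hZA h)
      · exact Or.inl hu
      · exact Or.inr (hb.sub hu)
  · fin_cases i <;> fin_cases j
    · exact absurd rfl hij
    · exact c01
    · exact c02
    · exact sw c01
    · exact absurd rfl hij
    · exact c12
    · exact sw c02
    · exact sw c12
    · exact absurd rfl hij

theorem theta_of_claw_link {A Z E : Set V} {a b W x : V} (hZA : Z ⊆ A) (hEA : Apart G E A)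
    (haA : a ∈ A) (hbA : b ∈ A) (hxa : G.Adj x a) (hxb : G.Adj x b) (hxA : x ∉ A)
    (hZx : ∀ u ∈ Z, ¬ G.Adj x u) (hlk : Lk G E W x) (h : HasClaw G Z ![W, a, b]) :
    HasTheta G := by
  obtain ⟨c, hc, S, hS, hap⟩ := h
  obtain ⟨l, hl, hlE⟩ := hlk
  have s1 : S 1 ⊆ A := fun u hu => by
    rcases (hS 1).2.2.1 hu with h | h
    · exact h ▸ haA
    · exact hZA h
  have s2 : S 2 ⊆ A := fun u hu => by
    rcases (hS 2).2.2.1 hu with h | h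
    · exact h ▸ hbA
    · exact hZA h
  have hcx : c ≠ x := fun e => hxA (e ▸ hZA hc)
  have ncx : ¬ G.Adj c x := fun e => hZx c hc e.symm
  have hW : W ∈ S 0 := (hS 0).2.1
  have hl2 : IP G ((W :: l) ++ [x]) := hl
  have c0 : Conn G (S 0 ∪ {u | u ∈ W :: l}) :=
    (hS 0).1.union (hl2.left.conn (by simp)) ⟨W, hW, W, by simp, Or.inl rfl⟩
  have ap : ∀ {T : Set V}, T ⊆ A → Apart G (S 0) T → Apart G (S 0 ∪ {u | u ∈ W :: l}) T := by
    intro T hT h0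
    refine h0.union_left fun u hu v hv => ?_
    rcases List.mem_cons.1 hu with h | h
    · exact h0 u (h ▸ hW) v hv
    · exact hEA u (hlE u h) v (hT hv)
  refine theta3 hcx ncx ((ap s1 (hap 0 1 (by decide))).mono sdiff_subset sdiff_subset)
    ((ap s2 (hap 0 2 (by decide))).mono sdiff_subset sdiff_subset)
    ((hap 1 2 (by decide)).mono sdiff_subset sdiff_subset)
    (c0.lk hcx ncx ((hS 0).2.2.2.2.mono subset_union_left)
      ((hl2.last_adj (by simp)).mono subset_union_right))
    ((hS 1).1.lk hcx ncx (hS 1).2.2.2.2 ⟨a, (hS 1).2.1, hxa⟩)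
    ((hS 2).1.lk hcx ncx (hS 2).2.2.2.2 ⟨b, (hS 2).2.1, hxb⟩)

theorem false_of_contacts [Finite V] (hC : MemC G) {A E La Lb : Set V} {a b y z W w x : V}
    (hA : Conn G A) (hEA : Apart G E A) (ha : Leg G A a b La y) (hb : Leg G A b a Lb z)
    (hab : a ≠ b ∧ ¬ G.Adj a b) (hxa : G.Adj x a) (hxb : G.Adj x b) (hxA : x ∉ A) (hWA : W ∉ A)
    (hyA : y ∉ A) (hzA : z ∉ A) (hxW : x ≠ W ∧ ¬ G.Adj x W) (hxy : x ≠ y ∧ ¬ G.Adj x y)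
    (hxz : x ≠ z ∧ ¬ G.Adj x z) (hWy : W ≠ y ∧ ¬ G.Adj W y) (hWz : W ≠ z ∧ ¬ G.Adj W z)
    (hyz : y ≠ z ∧ ¬ G.Adj y z) (hw : w ∈ A) (hWw : ∀ u ∈ A, G.Adj W u ↔ u = w)
    (hwy : ¬ HasWide G A x W y) (hwz : ¬ HasWide G A x W z) (hty : ¬ HasTri G A ![x, W, y])
    (htz : ¬ HasTri G A ![x, W, z]) (ht : ¬ HasTri G A ![W, y, z]) (hlk : Lk G E W x) : False := by
  have haA := ha.sub ha.mem
  have hbA := hb.sub hb.mem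
  have hWsee : Sees G W A := ⟨w, hw, (hWw w hw).2 rfl⟩
  by_cases hwa : w ∈ La
  · have hl' : Leg G A a b La W := ⟨ha.sub, ha.conn, ha.mem, ha.away, ha.rest, ha.gate,
      ⟨w, hwa, (hWw w hw).2 rfl⟩, fun ⟨u, hu, h⟩ => hu.2 ((hWw u hu.1).1 h ▸ hwa)⟩
    obtain ⟨l, hl, hlA⟩ := hA.lk hWz.1 hWz.2 hWsee (hb.sees.mono hb.sub)
    have hlA' : ∀ u ∈ l, u ∈ A := fun u hu => (hlA u hu).1
    obtain ⟨h1, h2⟩ := hl'.path hb hWz.2 hzA hl hlA' hWA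
    exact hwz ⟨l, hl, hlA', a, h1, b, h2, hab.1, hab.2, hxa, hxb⟩
  by_cases hwb : w ∈ Lb
  · have hl' : Leg G A b a Lb W := ⟨hb.sub, hb.conn, hb.mem, hb.away, hb.rest, hb.gate,
      ⟨w, hwb, (hWw w hw).2 rfl⟩, fun ⟨u, hu, h⟩ => hu.2 ((hWw u hu.1).1 h ▸ hwb)⟩
    obtain ⟨l, hl, hlA⟩ := hA.lk hWy.1 hWy.2 hWsee (ha.sees.mono ha.sub)
    have hlA' : ∀ u ∈ l, u ∈ A := fun u hu => (hlA u hu).1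
    obtain ⟨h1, h2⟩ := hl'.path ha hWy.2 hyA hl hlA' hWA
    exact hwy ⟨l, hl, hlA', b, h1, a, h2, hab.1.symm, fun e => hab.2 e.symm, hxb, hxa⟩
  obtain ⟨Z₁, c1, s1, w1, e1, n1⟩ := ha.approach hb hA hWA hw hWw hwa hwb hxa hxb hzA hWz hxA hxW
    hxz hwz htz
  obtain ⟨Z₂, c2, s2, w2, e2, n2⟩ := hb.approach ha hA hWA hw hWw hwb hwa hxb hxa hyA hWy hxA hxW
    hxy hwy hty
  have c : Conn G (Z₁ ∪ Z₂) := c1.union c2 ⟨w, w1, w, w2, Or.inl rfl⟩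
  have hZA : Z₁ ∪ Z₂ ⊆ A := union_subset s1 s2
  have hZ : ∀ u ∈ Z₁ ∪ Z₂, u ∉ La ∧ u ∉ Lb ∧ ¬ G.Adj x u := by
    rintro u (hu | hu)
    · exact n1 u hu
    · exact ⟨(n2 u hu).2.1, (n2 u hu).1, (n2 u hu).2.2⟩
  set Z := Z₁ ∪ Z₂
  have hWa : W ≠ a ∧ ¬ G.Adj W a := ⟨fun e => hWA (e ▸ haA), fun e =>
    hwa ((hWw a haA).1 e ▸ ha.mem)⟩
  have hWb : W ≠ b ∧ ¬ G.Adj W b := ⟨fun e => hWA (e ▸ hbA), fun e =>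
    hwb ((hWw b hbA).1 e ▸ hb.mem)⟩
  have hWLa : ¬ Sees G W La := fun ⟨u, hu, h⟩ => hwa ((hWw u (ha.sub hu)).1 h ▸ hu)
  have hWLb : ¬ Sees G W Lb := fun ⟨u, hu, h⟩ => hwb ((hWw u (hb.sub hu)).1 h ▸ hu)
  have hwide0 : ∀ p q, ¬ HasWide G Z W p q := by
    rintro p q ⟨l, -, hlZ, c, hc, d, hd, hcd, -, h1, h2⟩
    exact hcd (((hWw c (hZA (hlZ c hc))).1 h1).trans ((hWw d (hZA (hlZ d hd))).1 h2).symm)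
  have hwide1 : ¬ HasWide G Z a W b := fun h =>
    hwz (hb.wide_through haA hZA (fun u hu => (hZ u hu).2.1) hWA hWLb hzA hWz hab hxa hxb h)
  have hwide2 : ¬ HasWide G Z b W a := fun h =>
    hwy (ha.wide_through hbA hZA (fun u hu => (hZ u hu).1) hWA hWLa hyA hWy
      ⟨hab.1.symm, fun e => hab.2 e.symm⟩ hxb hxa h)
  have hout : ∀ i, (![W, a, b] : Fin 3 → V) i ∉ Z := by
    intro i
    fin_cases i
    · exact fun h => hWA (hZA h)
    · exact fun h => (hZ _ h).1 ha.mem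
    · exact fun h => (hZ _ h).2.1 hb.mem
  have hst : ∀ i j, i ≠ j → (![W, a, b] : Fin 3 → V) i ≠ (![W, a, b] : Fin 3 → V) j ∧
      ¬ G.Adj ((![W, a, b] : Fin 3 → V) i) ((![W, a, b] : Fin 3 → V) j) := by
    intro i j hij
    fin_cases i <;> fin_cases j
    · exact absurd rfl hij
    · exact hWa
    · exact hWb
    · exact ⟨hWa.1.symm, fun e => hWa.2 e.symm⟩
    · exact absurd rfl hij
    · exact hab
    · exact ⟨hWb.1.symm, fun e => hWb.2 e.symm⟩
    · exact ⟨hab.1.symm, fun e => hab.2 e.symm⟩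
    · exact absurd rfl hij
  have hsee : ∀ i, Sees G ((![W, a, b] : Fin 3 → V) i) Z := by
    intro i
    fin_cases i
    · exact ⟨w, Or.inl w1, (hWw w hw).2 rfl⟩
    · exact e2.mono subset_union_right
    · exact e1.mono subset_union_left
  rcases types_of_conn c hout hst hsee with h | h | ⟨i, j, k, hij, hik, hjk, h⟩
  · exact hC.2.1 (theta_of_claw_link hZA hEA haA hbA hxa hxb hxA (fun u hu => (hZ u hu).2.2) hlk h)
  · exact ht (tri_extend ha hb hyA hzA hWA hWw hwa hwb hyz hWy hWz hZA
      (fun u hu => ⟨(hZ u hu).1, (hZ u hu).2.1⟩) h)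
  · fin_cases i <;> fin_cases j <;> fin_cases k <;> first
      | exact absurd rfl hij
      | exact absurd rfl hik
      | exact absurd rfl hjk
      | exact hwide0 _ _ h
      | exact hwide1 h
      | exact hwide2 h
      | exact hwide1 h.symm
      | exact hwide2 h.symm

end ContactPair
section FrameContacts

variable {V : Type} {G : SimpleGraph V}
variable {B : Set V} {K m : ℕ} {v : ℕ → V} {S : ℕ → Set V} {a z : ℕ → V} {e : ℕ → ℕ}

theorem Frame.mono_set (h : Frame G B K m v S a z e) {A : Set V} (hAB : A ⊆ B) (hA : Conn G A)
    (hs : ∀ i ≤ K, Sees G (z i) A) : Frame G A K m v S a z e where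
  inj := h.inj
  adj := h.adj
  first := h.first
  last := h.last
  mono := h.mono
  leg := h.leg
  off := h.off
  att := h.att
  apart := h.apart
  conn := hA
  spine j hj := ⟨fun h' => (h.spine j hj).1 (hAB h'), fun h' => (h.spine j hj).2 (h'.mono hAB)⟩
  out i hi u hu := ⟨fun h' => (h.out i hi u hu).1 (hAB h'),
    fun h' => (h.out i hi u hu).2 (h'.mono hAB)⟩
  sees := hs
  tip i hi := by
    rcases h.tip i hi with ⟨b, -, hb⟩ | h'
    · obtain ⟨c, hc, hzc⟩ := hs i hi
      exact Or.inl ⟨c, hc, fun u hu hzu => (hb u (hAB hu) hzu).trans (hb c (hAB hc) hzc).symm⟩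
    · exact Or.inr h'

/-- Relative to a minimal connected set, every tip of a frame has a unique neighbour. -/
theorem Frame.unique_contact [Finite V] (hC : MemC G) {A : Set V} (h : Frame G A K m v S a z e)
    (hM : MinConn G A {u | ∃ i ≤ K, u = z i}) {j : ℕ} (hj : j ≤ K) :
    ∃ b ∈ A, ∀ u ∈ A, G.Adj (z j) u ↔ u = b := by
  have uniq : ∀ i ≤ K, (∃ b ∈ A, ∀ u ∈ A, G.Adj (z i) u → u = b) →
      ∃ b ∈ A, ∀ u ∈ A, G.Adj (z i) u ↔ u = b := by
    rintro i hi ⟨b, hb, hb'⟩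
    obtain ⟨c, hc, hzc⟩ := h.sees i hi
    exact ⟨c, hc, fun u hu => ⟨fun hzu => (hb' u hu hzu).trans (hb' c hc hzc).symm,
      fun e => e ▸ hzc⟩⟩
  rcases h.tip j hj with h' | ⟨h0, hK, hS, hn⟩
  · exact uniq j hj h'
  by_contra hcon
  obtain ⟨b₀, hb₀, hxb₀⟩ := h.sees j hj
  have hex : ∃ c ∈ A, G.Adj (z j) c ∧ c ≠ b₀ := by
    by_contra! hh
    exact hcon ⟨b₀, hb₀, fun u hu => ⟨hh u hu, fun e => e ▸ hxb₀⟩⟩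
  have hout : ∀ i ≤ K, z i ∉ A := fun i hi => h.tip_not_mem hi
  have legs : ∀ a b, a ∈ A → b ∈ A → a ≠ b → G.Adj (z j) a → G.Adj (z j) b →
      ∃ La Lb, ∃ α ≤ K, ∃ β ≤ K, Leg G A a b La (z α) ∧ Leg G A b a Lb (z β) ∧ j ≠ α ∧ j ≠ β ∧
        α ≠ β := by
    intro a b ha hb hab hxa hxb
    obtain ⟨La, _, ⟨α, hα, rfl⟩, h1⟩ := hM.leg ha hb hab
    obtain ⟨Lb, _, ⟨β, hβ, rfl⟩, h2⟩ := hM.leg hb ha hab.symm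
    refine ⟨La, Lb, α, hα, β, hβ, h1, h2, ?_, ?_, fun e => h1.ne h2 (e ▸ rfl)⟩
    · rintro rfl
      exact h1.priv ⟨b, ⟨hb, h1.away⟩, hxb⟩
    · rintro rfl
      exact h2.priv ⟨a, ⟨ha, h2.away⟩, hxa⟩
  by_cases hcl : ∃ a ∈ A, ∃ b ∈ A, a ≠ b ∧ ¬ G.Adj a b ∧ G.Adj (z j) a ∧ G.Adj (z j) b
  · obtain ⟨a', ha, b', hb, hab, nab, hxa, hxb⟩ := hcl
    obtain ⟨La, Lb, α, hα, β, hβ, h1, h2, hjα, hjβ, hαβ⟩ := legs a' b' ha hb hab hxa hxb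
    have hyz := h.tip_ne hα hβ hαβ
    obtain ⟨l, hl, hlA⟩ := hM.conn.lk hyz.1 hyz.2 (h.sees α hα) (h.sees β hβ)
    have hlA' : ∀ u ∈ l, u ∈ A := fun u hu => (hlA u hu).1
    obtain ⟨p1, p2⟩ := h1.path h2 hyz.2 (hout β hβ) hl hlA' (hout α hα)
    have hw : HasWide G A (z j) (z α) (z β) :=
      ⟨l, hl, hlA', a', p1, b', p2, hab, nab, hxa, hxb⟩
    have opp : ∀ i l, i ≤ K → l ≤ K → (i < j ∧ j < l ∨ l < j ∧ j < i) →
        ¬ HasWide G A (z j) (z i) (z l) := by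
      rintro i l hi hl (⟨h3, h4⟩ | ⟨h3, h4⟩) hh
      · exact h.no_wide h3 h4 hl hS hn hh
      · exact h.no_wide h3 h4 hi hS hn hh.symm
    have hside : ¬ (α < j ∧ j < β ∨ β < j ∧ j < α) := fun hh => opp α β hα hβ hh hw
    obtain ⟨ω, hω, hωα, hωβ, hωt⟩ : ∃ ω ≤ K, (ω < j ∧ j < α ∨ α < j ∧ j < ω) ∧
        (ω < j ∧ j < β ∨ β < j ∧ j < ω) ∧ (ω = 0 ∨ ω = K) := by
      rcases lt_or_gt_of_ne hjα with h3 | h3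
      · exact ⟨0, by omega, by omega, by omega, Or.inl rfl⟩
      · exact ⟨K, le_rfl, by omega, by omega, Or.inr rfl⟩
    obtain ⟨w, hw', hWw⟩ := uniq ω hω <| by
      rcases h.tip ω hω with h' | h'
      · exact h'
      · omega
    have hA := h.inner_apart
    have ne : ∀ {i l}, i ≤ K → l ≤ K → i ≠ l → z i ≠ z l ∧ ¬ G.Adj (z i) (z l) := h.tip_ne
    exact false_of_contacts hC hM.conn hA h1 h2 ⟨hab, nab⟩ hxa hxb (hout j hj) (hout ω hω)
      (hout α hα) (hout β hβ) (ne hj hω (by omega)) (ne hj hα hjα) (ne hj hβ hjβ)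
      (ne hω hα (by omega)) (ne hω hβ (by omega)) hyz hw' hWw (opp ω α hω hα hωα)
      (opp ω β hω hβ hωβ) (h.no_tri hC hj hω hα (by omega) hjα (by omega))
      (h.no_tri hC hj hω hβ (by omega) hjβ (by omega))
      (h.no_tri hC hω hα hβ (by omega) (by omega) hαβ) (h.link hω hj (by omega))
  · push Not at hcl
    obtain ⟨a', ha, hxa, hab⟩ := hex
    obtain ⟨La, Lb, α, hα, β, hβ, h1, h2, hjα, hjβ, hαβ⟩ := legs a' b₀ ha hb₀ hab hxa hxb₀
    refine h.no_tri hC hj hα hβ hjα hjβ hαβ ⟨![z j, a', b₀],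
      ![{z j}, Insert.insert (z α) La, Insert.insert (z β) Lb], fun i => ?_, fun i l hil => ?_⟩
    · fin_cases i
      · exact ⟨Conn.singleton _, rfl, rfl, fun u hu => Or.inl hu⟩
      · exact ⟨h1.conn.insert h1.sees, Or.inl rfl, Or.inr h1.mem, insert_subset_insert h1.sub⟩
      · exact ⟨h2.conn.insert h2.sees, Or.inl rfl, Or.inr h2.mem, insert_subset_insert h2.sub⟩
    have gate : ∀ {a b L β'}, Leg G A a b L β' → b ∈ A → G.Adj (z j) b → ∀ c ∈ L,
        G.Adj (z j) c → c = a := by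
      intro a b L β' hl hb hxb c hc hxc
      have hcb : c ≠ b := fun e => hl.away (e ▸ hc)
      have : G.Adj c b := by
        by_contra hn
        exact hcl c (hl.sub hc) b hb hcb hn hxc hxb
      exact hl.gate c hc b hb hl.away this
    have zne := h.tip_ne hj hα hjα
    have zne' := h.tip_ne hj hβ hjβ
    have zz := h.tip_ne hα hβ hαβ
    have c1 : ∀ u ∈ ({z j} : Set V), ∀ w ∈ Insert.insert (z α) La,
        u ≠ w ∧ (G.Adj u w ↔ u = z j ∧ w = a') := by
      rintro u rfl w (rfl | hw)
      · exact ⟨zne.1, fun e => absurd e zne.2, fun e => absurd (e.2 ▸ ha) (hout α hα)⟩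
      · exact ⟨fun e => hout j hj (e ▸ h1.sub hw), fun e => ⟨rfl, gate h1 hb₀ hxb₀ w hw e⟩,
          fun e => e.2 ▸ hxa⟩
    have c2 : ∀ u ∈ ({z j} : Set V), ∀ w ∈ Insert.insert (z β) Lb,
        u ≠ w ∧ (G.Adj u w ↔ u = z j ∧ w = b₀) := by
      rintro u rfl w (rfl | hw)
      · exact ⟨zne'.1, fun e => absurd e zne'.2, fun e => absurd (e.2 ▸ hb₀) (hout β hβ)⟩
      · exact ⟨fun e => hout j hj (e ▸ h2.sub hw), fun e => ⟨rfl, gate h2 ha hxa w hw e⟩,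
          fun e => e.2 ▸ hxb₀⟩
    have hadj : G.Adj a' b₀ := by
      by_contra hn
      exact hcl a' ha b₀ hb₀ hab hn hxa hxb₀
    have c3 : ∀ u ∈ Insert.insert (z α) La, ∀ w ∈ Insert.insert (z β) Lb,
        u ≠ w ∧ (G.Adj u w ↔ u = a' ∧ w = b₀) := by
      rintro u (rfl | hu) w (rfl | hw)
      · exact ⟨zz.1, fun e => absurd e zz.2, fun e => absurd (e.1 ▸ ha) (hout α hα)⟩
      · refine ⟨fun e => hout α hα (e ▸ h2.sub hw), fun e => ?_,
          fun e => absurd (e.1 ▸ ha) (hout α hα)⟩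
        exact absurd ⟨w, ⟨h2.sub hw, fun h' => h1.disjoint h2 w h' hw⟩, e⟩ h1.priv
      · refine ⟨fun e => hout β hβ (e ▸ h1.sub hu), fun e => ?_,
          fun e => absurd (e.2 ▸ hb₀) (hout β hβ)⟩
        exact absurd ⟨u, ⟨h1.sub hu, h1.disjoint h2 u hu⟩, e.symm⟩ h2.priv
      · obtain ⟨q1, q2⟩ := h1.adj h2 u hu w hw
        exact ⟨q1, q2, fun e => by rw [e.1, e.2]; exact hadj⟩
    have sw : ∀ {P Q : Set V} {c d : V}, (∀ u ∈ P, ∀ w ∈ Q, u ≠ w ∧ (G.Adj u w ↔ u = c ∧ w = d)) →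
        ∀ w ∈ Q, ∀ u ∈ P, w ≠ u ∧ (G.Adj w u ↔ w = d ∧ u = c) := fun hh w hw u hu =>
      ⟨(hh u hu w hw).1.symm, by rw [G.adj_comm, (hh u hu w hw).2, and_comm]⟩
    fin_cases i <;> fin_cases l
    · exact absurd rfl hil
    · exact c1
    · exact c2
    · exact sw c1
    · exact absurd rfl hil
    · exact c3
    · exact sw c2
    · exact sw c3
    · exact absurd rfl hil

end FrameContacts
section PinnedSide

variable {V : Type} {G : SimpleGraph V}

/-- A minimal connected set whose terminals have unique contacts and are linked outside it. -/
structure Pinned (G : SimpleGraph V) (E A X : Set V) : Prop where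
  min : MinConn G A X
  uniq : ∀ x ∈ X, ∃ b ∈ A, ∀ u ∈ A, G.Adj x u ↔ u = b
  noTri : ∀ x : Fin 3 → V, Function.Injective x → (∀ i, x i ∈ X) → ¬ HasTri G A x
  link : ∀ x ∈ X, ∀ y ∈ X, x ≠ y → Lk G E x y
  apart : Apart G E A
  noTheta : ¬ HasTheta G

theorem Pinned.eq_of_adj {E A X : Set V} (h : Pinned G E A X) {x u w : V} (hx : x ∈ X)
    (hu : u ∈ A ∪ X) (hw : w ∈ A ∪ X) (hxu : G.Adj x u) (hxw : G.Adj x w) : u = w := by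
  obtain ⟨b, -, hb⟩ := h.uniq x hx
  have hA : ∀ u ∈ A ∪ X, G.Adj x u → u = b := by
    rintro u (hu | hu) hxu
    · exact (hb u hu).1 hxu
    · exact absurd hxu (h.min.stable x hx u hu)
  rw [hA u hu hxu, hA w hw hxw]

theorem Pinned.combHyp {E A X : Set V} (h : Pinned G E A X) (hX : ∀ x, ∃ y ∈ X, y ≠ x) :
    CombHyp G (A ∪ X) X :=
  h.min.combHyp hX fun _ hx _ hn _ hm hxn hxm hne =>
    absurd (h.eq_of_adj hx (Or.inl hn) (Or.inl hm) hxn hxm) hne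

/-- Two nonadjacent neighbours of `p` in a connected set yield a triangle or a hole at `p`. -/
theorem triangle_or_hole {U : Set V} {p n m : V} (hU : Conn G U) (hn : n ∈ U) (hm : m ∈ U)
    (hpn : G.Adj p n) (hpm : G.Adj p m) (hnm : n ≠ m) (hadj : ¬ G.Adj n m) :
    (∃ n' ∈ U, ∃ m' ∈ U, G.Adj n' m' ∧ G.Adj p n' ∧ G.Adj p m') ∨
      ∃ n' m' l, IP G (n' :: (l ++ [m'])) ∧ (∀ u ∈ n' :: (l ++ [m']), u ∈ U) ∧ l ≠ [] ∧
        G.Adj p n' ∧ G.Adj p m' ∧ ∀ u ∈ l, ¬ G.Adj p u := by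
  by_cases htri : ∃ n' ∈ U, ∃ m' ∈ U, G.Adj n' m' ∧ G.Adj p n' ∧ G.Adj p m'
  · exact Or.inl htri
  right
  obtain ⟨l, hl, hlU⟩ := hU.lk_of_mem hn hm hnm hadj
  have hlU' : ∀ u ∈ n :: (l ++ [m]), u ∈ U := by
    intro u hu
    simp only [List.mem_cons, List.mem_append, List.not_mem_nil, or_false] at hu
    rcases hu with rfl | h | rfl
    · exact hn
    · exact (hlU u h).1
    · exact hm
  clear hlU
  induction hk : l.length using Nat.strong_induction_on generalizing n m l with
  | _ k ih =>
    by_cases hfree : ∀ u ∈ l, ¬ G.Adj p u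
    · refine ⟨n, m, l, hl, hlU', ?_, hpn, hpm, hfree⟩
      rintro rfl
      exact hadj (((ip_cons.1 hl).2.1 m (by simp)).2 (by simp))
    push Not at hfree
    obtain ⟨c, hc, hpc⟩ := hfree
    obtain ⟨l₁, l₂, rfl⟩ := List.append_of_mem hc
    have hcU : c ∈ U := hlU' c (by simp)
    have hnc : ¬ G.Adj n c := fun h => htri ⟨n, hn, c, hcU, h, hpn, hpc⟩
    have hcn : n ≠ c := by
      rintro rfl
      exact (ip_cons.1 hl).1 (by simp)
    have hl' : IP G ((n :: (l₁ ++ [c])) ++ (l₂ ++ [m])) := by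
      convert hl using 1
      simp
    refine ih l₁.length ?_ hn hcU hpn hpc hcn hnc l₁ hl'.left (fun u hu => hlU' u ?_) rfl
    · simp at hk
      omega
    · simp only [List.mem_cons, List.mem_append, List.not_mem_nil, or_false] at hu ⊢
      tauto

theorem Pinned.no_triangle {E A X : Set V} (h : Pinned G E A X) (H : CombHyp G (A ∪ X) X)
    {p n m : V} (hp : p ∈ A ∪ X) (hn : n ∈ A ∪ X) (hm : m ∈ A ∪ X) (hpn : G.Adj p n)
    (hpm : G.Adj p m) (hnm : G.Adj n m) : False := by
  obtain ⟨S, x, hS, hSS⟩ := H.arms ![p, n, m]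
    (by intro i; fin_cases i; exacts [hp, hn, hm])
    ![{n, m}, {p, m}, {p, n}]
    (by
      intro i
      fin_cases i
      · exact ⟨(Conn.singleton m).insert ⟨m, rfl, hnm⟩, insert_subset hn (by simpa using hm),
          by simp [hpn.ne, hpm.ne]⟩
      · exact ⟨(Conn.singleton m).insert ⟨m, rfl, hpm⟩, insert_subset hp (by simpa using hm),
          by simp [hpn.ne', hnm.ne]⟩
      · exact ⟨(Conn.singleton n).insert ⟨n, rfl, hpn⟩, insert_subset hp (by simpa using hn),
          by simp [hpm.ne', hnm.ne']⟩)
    (by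
      intro i j hij
      fin_cases i <;> fin_cases j <;> simp_all)
  refine h.noTri x (fun i j hij => ?_) (fun i => (hS i).2.2.2.1) ⟨![p, n, m], S, fun i => ?_,
    fun i j hij u hu v hv => ?_⟩
  · by_contra hne
    exact (hSS i j hne _ (hS i).2.2.1 _ (hS j).2.2.1).1 hij
  · refine ⟨(hS i).1, (hS i).2.2.1, (hS i).2.1, fun u hu => ?_⟩
    rcases (hS i).2.2.2.2.1 hu with hu' | hu'
    · exact mem_insert_of_mem _ hu'
    · exact (hS i).2.2.2.2.2.1 u hu hu' ▸ mem_insert _ _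
  · refine ⟨(hSS i j hij u hu v hv).1, (hSS i j hij u hu v hv).2, ?_⟩
    rintro ⟨rfl, rfl⟩
    fin_cases i <;> fin_cases j
    · exact absurd rfl hij
    · exact hpn
    · exact hpm
    · exact hpn.symm
    · exact absurd rfl hij
    · exact hnm
    · exact hpm.symm
    · exact hnm.symm
    · exact absurd rfl hij

theorem Pinned.no_hole {E A X : Set V} (h : Pinned G E A X) (H : CombHyp G (A ∪ X) X)
    {p n m : V} {l : List V} (hp : p ∈ A ∪ X) (hl : IP G (n :: (l ++ [m])))
    (hlW : ∀ u ∈ n :: (l ++ [m]), u ∈ A ∪ X) (hl0 : l ≠ []) (hpl : p ∉ n :: (l ++ [m]))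
    (hpn : G.Adj p n) (hpm : G.Adj p m) (hfree : ∀ u ∈ l, ¬ G.Adj p u) : False := by
  rcases l with _ | ⟨d, l⟩
  · exact hl0 rfl
  obtain ⟨i1, i2, i3⟩ := ip_cons.1 hl
  have i3' : IP G (d :: (l ++ [m])) := i3
  obtain ⟨j1, j2, j3⟩ := ip_cons.1 i3'
  have hnd : G.Adj n d := (i2 d (by simp)).2 (by simp)
  have nR : ∀ u ∈ l ++ [m], n ≠ u ∧ ¬ G.Adj n u := by
    intro u hu
    refine ⟨fun e => i1 (by rw [e, List.cons_append]; exact List.mem_cons_of_mem _ hu), fun e => ?_⟩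
    have := (i2 u (by rw [List.cons_append]; exact List.mem_cons_of_mem _ hu)).1 e
    simp only [List.cons_append, List.head?_cons, Option.some.injEq] at this
    exact j1 (this ▸ hu)
  have hRc : Conn G {u | u ∈ l ++ [m]} := j3.conn (by simp)
  have hdR : Sees G d {u | u ∈ l ++ [m]} := i3'.head_adj (by simp)
  have hpR : Sees G p {u | u ∈ l ++ [m]} := ⟨m, by simp, hpm⟩
  have hpd : p ≠ d := fun e => hpl (by simp [e])
  have npd : ¬ G.Adj p d := hfree d (by simp)
  have hnW := hlW n (by simp)
  have hdW := hlW d (by simp)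
  have hRW : ∀ u ∈ l ++ [m], u ∈ A ∪ X := fun u hu => hlW u (by
    rw [List.cons_append]; exact List.mem_cons_of_mem _ (List.mem_cons_of_mem _ hu))
  have hpR' : p ∉ l ++ [m] := fun h' => hpl (by
    rw [List.cons_append]; exact List.mem_cons_of_mem _ (List.mem_cons_of_mem _ h'))
  have hpn' : p ≠ n := hpn.ne
  obtain ⟨S, x, hS, hSS⟩ := H.arms ![p, d]
    (by intro i; fin_cases i; exacts [hp, hdW])
    ![Insert.insert n (Insert.insert d {u | u ∈ l ++ [m]}),
      Insert.insert n (Insert.insert p {u | u ∈ l ++ [m]})]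
    (by
      intro i
      fin_cases i
      · refine ⟨(hRc.insert hdR).insert ⟨d, Or.inl rfl, hnd⟩,
          insert_subset hnW (insert_subset hdW hRW), ?_⟩
        rintro (h' | h' | h')
        exacts [hpn' h', hpd h', hpR' h']
      · refine ⟨(hRc.insert hpR).insert ⟨p, Or.inl rfl, hpn.symm⟩,
          insert_subset hnW (insert_subset hp hRW), ?_⟩
        rintro (h' | h' | h')
        exacts [hnd.ne h'.symm, hpd h'.symm, j1 h'])
    (by
      intro i j hij
      fin_cases i <;> fin_cases j
      · exact absurd rfl hij
      · exact Or.inr (Or.inl rfl)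
      · exact Or.inr (Or.inl rfl)
      · exact absurd rfl hij)
  have hx01 : x 0 ≠ x 1 := (hSS 0 1 (by decide) _ (hS 0).2.2.1 _ (hS 1).2.2.1).1
  obtain ⟨k, hk, hkE⟩ := h.link _ (hS 0).2.2.2.1 _ (hS 1).2.2.2.1 hx01
  have inA : ∀ u ∈ A ∪ X, (∃ c ∈ A ∪ X, ∃ c' ∈ A ∪ X, c ≠ c' ∧ G.Adj u c ∧ G.Adj u c') → u ∈ A := by
    rintro u hu ⟨c, hc, c', hc', hne, h1, h2⟩
    exact hu.resolve_right fun hX => hne (h.eq_of_adj hX hc hc' h1 h2)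
  have hnA : n ∈ A := inA n hnW ⟨p, hp, d, hdW, hpd, hpn.symm, hnd⟩
  have hRA : ∀ u ∈ l ++ [m], u ∈ A := by
    intro u hu
    obtain ⟨L₁, L₂, hL⟩ := List.append_of_mem hu
    have hip : IP G (d :: (L₁ ++ u :: L₂)) := hL ▸ i3'
    obtain ⟨c, hc, huc⟩ : ∃ c ∈ d :: L₁, G.Adj u c := by
      have hq : IP G ((d :: L₁) ++ [u]) := by
        have : IP G (((d :: L₁) ++ [u]) ++ L₂) := by
          convert hip using 1
          simp
        exact this.left
      exact hq.last_adj (by simp)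
    have hcW : c ∈ A ∪ X := by
      rcases List.mem_cons.1 hc with rfl | hc
      · exact hdW
      · exact hRW c (by rw [hL]; simp [hc])
    rcases L₂ with _ | ⟨b, L₂⟩
    · have hum : u = m := by
        have := congrArg List.getLast? hL
        simpa using this.symm
      subst hum
      refine inA u (hRW u hu) ⟨p, hp, c, hcW, ?_, hpm.symm, huc⟩
      rintro rfl
      rcases List.mem_cons.1 hc with h' | h'
      · exact hpd h'
      · exact hpR' (by rw [hL]; simp [h'])
    · refine inA u (hRW u hu) ⟨c, hcW, b, hRW b (by rw [hL]; simp), ?_, huc, ?_⟩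
      · rintro rfl
        have := hip.nodup
        rcases List.mem_cons.1 hc with rfl | h'
        · simp at this
        · simp [List.nodup_append] at this
          exact (this.2.2.2 c h').2.1 rfl
      · have : IP G (u :: b :: L₂) := by
          have h2 : IP G ((d :: L₁) ++ (u :: b :: L₂)) := hip
          exact h2.right
        exact ((ip_cons.1 this).2.1 b (by simp)).2 (by simp)
  set T := S 0 ∪ {u | u ∈ x 0 :: (k ++ [x 1])} ∪ S 1 with hT
  have hTc : Conn G T := by
    refine ((hS 0).1.union (hk.conn (by simp)) ⟨x 0, (hS 0).2.2.1, x 0, by simp, Or.inl rfl⟩).union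
      (hS 1).1 ⟨x 1, Or.inr (by simp), x 1, (hS 1).2.2.1, Or.inl rfl⟩
  have hpT : p ∈ T := Or.inl (Or.inl (hS 0).2.1)
  have hdT : d ∈ T := Or.inr (hS 1).2.1
  have hap : ∀ Z : Set V, Z ⊆ A → (∀ u ∈ Z, u = n ∨ u ∈ l ++ [m]) → Apart G (T \ {p, d}) Z := by
    intro Z hZA hZ u hu w hw
    have hw0 : w ∈ Insert.insert n (Insert.insert d {u | u ∈ l ++ [m]}) := by
      rcases hZ w hw with h' | h'
      · exact Or.inl h'
      · exact Or.inr (Or.inr h')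
    have hw1 : w ∈ Insert.insert n (Insert.insert p {u | u ∈ l ++ [m]}) := by
      rcases hZ w hw with h' | h'
      · exact Or.inl h'
      · exact Or.inr (Or.inr h')
    have hup : u ≠ p := fun e => hu.2 (Or.inl e)
    have hud : u ≠ d := fun e => hu.2 (Or.inr e)
    have g0 : u ∈ S 0 → u ≠ w ∧ ¬ G.Adj u w := fun h0 =>
      ⟨fun e => (hS 0).2.2.2.2.2.2.1 u h0 (e ▸ hw0),
        fun e => hup ((hS 0).2.2.2.2.2.2.2.1 u h0 w hw0 e)⟩
    have g1 : u ∈ S 1 → u ≠ w ∧ ¬ G.Adj u w := fun h0 =>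
      ⟨fun e => (hS 1).2.2.2.2.2.2.1 u h0 (e ▸ hw1),
        fun e => hud ((hS 1).2.2.2.2.2.2.2.1 u h0 w hw1 e)⟩
    rcases hu.1 with (h' | h') | h'
    · exact g0 h'
    · simp only [mem_ofPred_eq, List.mem_cons, List.mem_append, List.not_mem_nil, or_false] at h'
      rcases h' with h' | h' | h'
      · exact g0 (h' ▸ (hS 0).2.2.1)
      · exact h.apart u (hkE u h') w (hZA hw)
      · exact g1 (h' ▸ (hS 1).2.2.1)
    · exact g1 h'
  have a1 := hap {n} (by simpa using hnA) (fun u hu => Or.inl hu)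
  have a2 := hap {u | u ∈ l ++ [m]} hRA (fun u hu => Or.inr hu)
  have a3 : Apart G {n} {u | u ∈ l ++ [m]} := by
    rintro u rfl w hw
    exact nR w hw
  refine h.noTheta (theta3 hpd npd (a1.mono subset_rfl sdiff_subset)
    (a2.mono subset_rfl sdiff_subset) (a3.mono sdiff_subset sdiff_subset)
    (hTc.lk_of_mem hpT hdT hpd npd)
    ((Conn.singleton n).lk hpd npd ⟨n, rfl, hpn⟩ ⟨n, rfl, hnd.symm⟩)
    (hRc.lk hpd npd hpR hdR))

theorem Pinned.blk {E A X : Set V} (h : Pinned G E A X) (H : CombHyp G (A ∪ X) X) :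
    Blk G (A ∪ X) := by
  intro p hp U hUW hU hpU n hn m hm hpn hpm hnm
  by_contra hadj
  rcases triangle_or_hole hU hn hm hpn hpm hnm hadj with
    ⟨n', hn', m', hm', h1, h2, h3⟩ | ⟨n', m', l, hl, hlU, hl0, h2, h3, hfree⟩
  · exact h.no_triangle H hp (hUW hn') (hUW hm') h2 h3 h1
  · exact h.no_hole H hp hl (fun u hu => hUW (hlU u hu)) hl0 (fun h' => hpU (hlU p h')) h2 h3 hfree

end PinnedSide
section RailSide

variable {V : Type} {G : SimpleGraph V}

/-- An induced path `q` in `A` with `k` pairwise anticomplete legs, each attached to `q` at one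
vertex and each ending at a terminal. -/
structure Rail (G : SimpleGraph V) (A X : Set V) (k n : ℕ) (q : ℕ → V) (T : ℕ → Set V)
    (b y : ℕ → V) (f : ℕ → ℕ) : Prop where
  inj : ∀ i j, i < n → j < n → q i = q j → i = j
  adj : ∀ i j, i < n → j < n → (G.Adj (q i) (q j) ↔ i = j + 1 ∨ j = i + 1)
  mem : ∀ j < n, q j ∈ A
  leg : ∀ i < k, Conn G (T i) ∧ b i ∈ T i ∧ y i ∈ T i ∧ y i ∈ X ∧ T i ⊆ Insert.insert (y i) A
  off : ∀ i < k, ∀ u ∈ T i, ∀ j < n, u ≠ q j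
  att : ∀ i < k, ∀ u ∈ T i, ∀ j < n, (G.Adj u (q j) ↔ u = b i ∧ j = f i)
  pos : ∀ i < k, f i < n
  mono : ∀ i j, i ≤ j → j < k → f i ≤ f j
  apart : ∀ i j, i < k → j < k → i ≠ j → Apart G (T i) (T j)

/-- In a comb rooted at a terminal of a pinned set no leg spans a triangle with the spine. -/
theorem Pinned.eq_of_comb {E A X U : Set V} (h : Pinned G E A X) {k : ℕ} {p : V}
    {q : List V} {L : ℕ → List V} {a z : ℕ → V} {s e : ℕ → ℕ} (hc : IsComb G X U k p q L a z s e)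
    (hU : U ⊆ A ∪ X) (hp : p ∈ X) (hpU : p ∉ U) : ∀ i < k, s i = e i := by
  intro i hi
  obtain ⟨h1, h2, h3⟩ := hc.pos i hi
  refine h3.resolve_right fun hse => ?_
  obtain ⟨lip, l0, l1, hz, hzX, hlU⟩ := hc.leg i hi
  obtain ⟨y, hy, hqy⟩ := hc.last
  have hlt : e i < (p :: q).length := by simp only [List.length_cons]; omega
  obtain ⟨m, r, hmr, hml⟩ := list_split (List.getElem?_eq_getElem hlt)
  set c := (p :: q)[e i] with hcdef
  have hcq : (p :: q)[e i]? = some c := List.getElem?_eq_getElem hlt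
  obtain ⟨m, rfl⟩ : ∃ m', m = p :: m' := by
    rcases m with _ | ⟨b, m⟩
    · simp at hml; omega
    · simp at hmr
      exact ⟨m, by rw [hmr.1]⟩
  have hq : q = m ++ c :: r := by simpa using hmr
  have hip := hc.path
  rw [hmr] at hip
  obtain ⟨i1, i2, i3⟩ := ip_append.1 hip
  have hry : (c :: r).getLast? = some y := by
    rw [hq, List.getLast?_append, List.getLast?_cons] at hqy
    rw [List.getLast?_cons]
    simpa using hqy
  have hyr : y ∈ c :: r := List.mem_of_getLast? hry
  have notX : ∀ u ∈ q, u ∈ X → u = y := by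
    intro u hu huX
    have := hc.term u hu huX
    rw [hqy] at this
    exact (Option.some.inj this).symm
  obtain ⟨d, hd⟩ : ∃ d, (p :: m).getLast? = some d := by simp [List.getLast?_cons]
  have hdm : d ∈ p :: m := List.mem_of_getLast? hd
  have hdq : (p :: q)[s i]? = some d := by
    rw [hmr, List.getElem?_append_left (by rw [hml]; omega), ← hd, List.getLast?_eq_getElem?, hml]
    congr 1
    omega
  have hmem : ∀ u, u ∈ p :: q ↔ u ∈ p :: m ∨ u ∈ c :: r := fun u => by
    rw [hmr, List.mem_append]
  have hatt : ∀ u ∈ L i, ∀ v ∈ p :: q, G.Adj u v ↔ u = a i ∧ (v = d ∨ v = c) := by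
    intro u hu v hv
    obtain ⟨j, hj⟩ := List.mem_iff_getElem?.1 hv
    rw [hc.att i hi u hu j v hj]
    constructor
    · rintro ⟨h, rfl | rfl⟩
      · exact ⟨h, Or.inl (Option.some.inj (hj.symm.trans hdq))⟩
      · exact ⟨h, Or.inr (Option.some.inj (hj.symm.trans hcq))⟩
    · rintro ⟨h, rfl | rfl⟩
      · exact ⟨h, Or.inl (hc.path.get_inj hj hdq)⟩
      · exact ⟨h, Or.inr (hc.path.get_inj hj hcq)⟩
  have hLq : ∀ u ∈ L i, ∀ v ∈ p :: q, u ≠ v := by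
    rintro u hu v hv rfl
    rcases List.mem_cons.1 hv with rfl | hv
    · exact hpU (hlU _ hu).1
    · exact (hlU u hu).2 hv
  have hL0 : L i ≠ [] := by
    rintro h'
    rw [h'] at l0
    simp at l0
  have hzL : z i ∈ L i := List.mem_of_getLast? l1
  have haL : a i ∈ L i := List.mem_of_mem_head? l0
  have hap : ∀ u ∈ p :: m, ∀ v ∈ c :: r, u ≠ v ∧ (G.Adj u v ↔ u = d ∧ v = c) := by
    intro u hu v hv
    refine ⟨(i3 u hu v hv).1, ?_⟩
    rw [(i3 u hu v hv).2, hd]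
    simp [eq_comm]
  have hlm : ∀ u ∈ L i, ∀ v ∈ p :: m, u ≠ v ∧ (G.Adj u v ↔ u = a i ∧ v = d) := by
    intro u hu v hv
    refine ⟨hLq u hu v ((hmem v).2 (Or.inl hv)), ?_⟩
    rw [hatt u hu v ((hmem v).2 (Or.inl hv))]
    have : v ≠ c := (hap v hv c (by simp)).1
    tauto
  have hlr : ∀ u ∈ L i, ∀ v ∈ c :: r, u ≠ v ∧ (G.Adj u v ↔ u = a i ∧ v = c) := by
    intro u hu v hv
    refine ⟨hLq u hu v ((hmem v).2 (Or.inr hv)), ?_⟩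
    rw [hatt u hu v ((hmem v).2 (Or.inr hv))]
    have : v ≠ d := (hap d hdm v hv).1.symm
    tauto
  have hswap : ∀ {B C : List V} {b c : V}, (∀ u ∈ B, ∀ v ∈ C, u ≠ v ∧
      (G.Adj u v ↔ u = b ∧ v = c)) → ∀ u ∈ C, ∀ v ∈ B, u ≠ v ∧ (G.Adj u v ↔ u = c ∧ v = b) := by
    intro B C b c h u hu v hv
    refine ⟨(h v hv u hu).1.symm, ?_⟩
    rw [G.adj_comm, (h v hv u hu).2, and_comm]
  refine h.noTri ![p, z i, y] (injective_triple ?_ ?_ ?_) (fun j => ?_) ⟨![d, a i, c],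
    ![{u | u ∈ p :: m}, {u | u ∈ L i}, {u | u ∈ c :: r}], fun j => ?_, fun j j' hj => ?_⟩
  · exact (hLq _ hzL p (by simp)).symm
  · exact (hap p (by simp) y hyr).1
  · exact hLq _ hzL y ((hmem y).2 (Or.inr hyr))
  · fin_cases j
    exacts [hp, hz, hy]
  · fin_cases j
    · refine ⟨i1.conn (by simp), by simp, hdm, ?_⟩
      intro u hu
      rcases List.mem_cons.1 hu with rfl | hu
      · exact mem_insert _ _
      · have huq : u ∈ q := by rw [hq]; simp [hu]
        refine mem_insert_of_mem _ ((hU (hc.sub u huq)).resolve_right fun huX => ?_)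
        exact (hap u (by simp [hu]) y hyr).1 (notX u huq huX)
    · refine ⟨lip.conn hL0, hzL, haL, ?_⟩
      intro u hu
      rcases hU (hlU u hu).1 with h' | h'
      · exact mem_insert_of_mem _ h'
      · exact hzX u hu h' ▸ mem_insert _ _
    · refine ⟨i2.conn (by simp), hyr, by simp, ?_⟩
      intro u hu
      have huq : u ∈ q := by
        rw [hq]
        exact List.mem_append_right _ hu
      rcases hU (hc.sub u huq) with h' | h'
      · exact mem_insert_of_mem _ h'
      · exact notX u huq h' ▸ mem_insert _ _
  · fin_cases j <;> fin_cases j'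
    · exact absurd rfl hj
    · exact hswap hlm
    · exact hap
    · exact hlm
    · exact absurd rfl hj
    · exact hlr
    · exact hswap hap
    · exact hswap hlr
    · exact absurd rfl hj

theorem CombHyp.rail_of_spread {A X : Set V}
    (H : CombHyp G (A ∪ X) X) {k : ℕ} (hk : 2 ≤ k) {a : V} (ha : a ∈ A ∪ X)
    (hsp : Spread G (A ∪ X) a k) : ∃ n q T b y f, Rail G A X k n q T b y f := by
  obtain ⟨S, hS, hap⟩ := hsp
  have haX : a ∉ X := by
    intro haX
    obtain ⟨n, hn, han⟩ := (hS ⟨0, by omega⟩).2.2.2.1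
    obtain ⟨m, hm, ham⟩ := (hS ⟨1, by omega⟩).2.2.2.1
    have := hap ⟨0, by omega⟩ ⟨1, by omega⟩ (by simp) n hn m hm
    exact this.2 (H.simp a haX n ((hS _).1 hn) m ((hS _).1 hm) han ham this.1)
  have := fun i => H.path ha (hS i).1 (hS i).2.1 (hS i).2.2.1 (hS i).2.2.2.1 (hS i).2.2.2.2
  choose l x hl hlS hxS hx using this
  have hall : ∀ i, ∀ u ∈ l i ++ [x i], u ∈ S i := by
    intro i u hu
    rcases List.mem_append.1 hu with hu | hu
    · exact (hlS i u hu).1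
    · rw [List.mem_singleton.1 hu]
      exact hxS i
  have hh : ∀ i, ∃ c, (l i ++ [x i]).head? = some c := by
    intro i
    rcases l i with _ | ⟨c, l⟩ <;> simp
  choose c hc using hh
  have key : ∀ i, ∀ u ∈ l i ++ [x i], u ≠ a ∧ (G.Adj u a ↔ u = c i) := by
    intro i u hu
    obtain ⟨h1, h2, -⟩ := ip_cons.1 (hl i)
    refine ⟨fun h' => h1 (h' ▸ hu), ?_⟩
    rw [G.adj_comm, h2 u hu, hc i]
    simp [eq_comm]
  let g : ℕ → Fin k := fun i => if hi : i < k then ⟨i, hi⟩ else ⟨0, by omega⟩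
  have hg : ∀ i j, i < k → j < k → i ≠ j → g i ≠ g j := by
    intro i j hi hj hij
    simp [g, hi, hj, hij]
  refine ⟨1, fun _ => a, fun i => {u | u ∈ l (g i) ++ [x (g i)]}, fun i => c (g i),
    fun i => x (g i), fun _ => 0, ?_, ?_, ?_, ?_, ?_, ?_, ?_, ?_, ?_⟩
  · intro i j hi hj _
    omega
  · intro i j hi hj
    obtain rfl : i = 0 := by omega
    obtain rfl : j = 0 := by omega
    simp
  · exact fun _ _ => ha.resolve_right haX
  · intro i _
    refine ⟨(ip_cons.1 (hl (g i))).2.2.conn (by simp), List.mem_of_mem_head? (hc (g i)), by simp,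
      hx _, ?_⟩
    intro u hu
    rcases List.mem_append.1 hu with hu | hu
    · exact mem_insert_of_mem _
        (((hS (g i)).1 (hlS (g i) u hu).1).resolve_right (hlS (g i) u hu).2)
    · rw [List.mem_singleton.1 hu]
      exact mem_insert _ _
  · exact fun i _ u hu j _ => (key (g i) u hu).1
  · intro i _ u hu j hj
    rw [(key (g i) u hu).2]
    have : j = 0 := by omega
    tauto
  · exact fun _ _ => one_pos
  · exact fun _ _ _ _ => le_rfl
  · exact fun i j hi hj hij => (hap _ _ (hg i j hi hj hij)).mono (hall _) (hall _)

theorem Pinned.rail_of_comb {E A X U : Set V} (h : Pinned G E A X) {k : ℕ} {p : V}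
    {q : List V} {L : ℕ → List V} {a z : ℕ → V} {s e : ℕ → ℕ} (hc : IsComb G X U k p q L a z s e)
    (hU : U ⊆ A ∪ X) (hp : p ∈ X) (hpU : p ∉ U) : ∃ n q T b y f, Rail G A X k n q T b y f := by
  have hse := h.eq_of_comb hc hU hp hpU
  obtain ⟨y, hy, hqy⟩ := hc.last
  have hq0 : q ≠ [] := by
    rintro rfl
    simp at hqy
  have hget : ∀ j < q.length - 1, ∃ v, q[j]? = some v ∧ (p :: q)[j + 1]? = some v ∧ v ∈ q := by
    intro j hj
    have : j < q.length := by omega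
    exact ⟨q[j], List.getElem?_eq_getElem this, by simp [this], List.getElem_mem this⟩
  have : Nonempty V := ⟨p⟩
  choose! v hv hv' hvq using hget
  have hip := (ip_cons.1 hc.path).2.2
  have mono' : ∀ i j, i ≤ j → j < k → e i ≤ e j := by
    intro i j hij hj
    rcases hij.eq_or_lt with rfl | hij
    · exact le_rfl
    · exact (hc.mono i j hij hj).le
  refine ⟨q.length - 1, v, fun i => {u | u ∈ L i}, a, z, fun i => e i - 1, ?_, ?_, ?_, ?_, ?_, ?_,
    ?_, ?_, ?_⟩
  · intro i j hi hj hij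
    exact hip.get_inj (hv i hi) (hij ▸ hv j hj)
  · exact fun i j hi hj => hip.adj_get (hv i hi) (hv j hj)
  · intro j hj
    refine (hU (hc.sub _ (hvq j hj))).resolve_right fun hX => ?_
    have := hc.term _ (hvq j hj) hX
    rw [List.getLast?_eq_getElem?] at this
    have := hip.get_inj this (hv j hj)
    omega
  · intro i hi
    obtain ⟨lip, l0, l1, hz, hzX, hlU⟩ := hc.leg i hi
    refine ⟨lip.conn ?_, List.mem_of_mem_head? l0, List.mem_of_getLast? l1, hz, ?_⟩
    · rintro h'
      rw [h'] at l0
      simp at l0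
    · intro u hu
      rcases hU (hlU u hu).1 with h' | h'
      · exact mem_insert_of_mem _ h'
      · exact hzX u hu h' ▸ mem_insert _ _
  · rintro i hi u hu j hj rfl
    exact ((hc.leg i hi).2.2.2.2.2 _ hu).2 (hvq j hj)
  · intro i hi u hu j hj
    rw [hc.att i hi u hu (j + 1) (v j) (hv' j hj), hse i hi, or_self]
    have := (hc.pos i hi).1
    constructor
    · rintro ⟨h1, h2⟩
      exact ⟨h1, by omega⟩
    · rintro ⟨h1, h2⟩
      exact ⟨h1, by omega⟩
  · intro i hi
    have := hc.pos i hi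
    show e i - 1 < _
    omega
  · intro i j hij hj
    have := mono' i j hij hj
    show e i - 1 ≤ e j - 1
    omega
  · exact fun i j hi hj hij => hc.apart i j hi hj hij

theorem exists_rail (t k : ℕ) (hk : 2 ≤ k) : ∃ N, ∀ (V : Type) [Finite V] (G : SimpleGraph V)
    (E A X : Set V), Pinned G E A X → G.CliqueFree t → N ≤ X.ncard →
    ∃ n q T b y f, Rail G A X k n q T b y f := by
  obtain ⟨N, hN⟩ := exists_comb t k k
  refine ⟨N + 2, fun V _ G E A X h ht hX => ?_⟩
  have hX2 : ∀ x, ∃ y ∈ X, y ≠ x := by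
    intro x
    exact (Set.one_lt_ncard_iff_nontrivial.1 (by omega)).exists_ne x
  have H := h.combHyp hX2
  by_cases hsp : ∃ a ∈ A ∪ X, Spread G (A ∪ X) a k
  · obtain ⟨a, ha, hs⟩ := hsp
    exact H.rail_of_spread hk ha hs
  push Not at hsp
  have hA := h.min
  obtain ⟨p, hp, -⟩ := hX2 (Classical.choice hA.conn.1.to_subtype).1
  have hpA := hA.out p hp
  have hc : Conn G ((A ∪ X) \ {p}) := by
    obtain ⟨r, hr⟩ := hA.conn.1
    have hAs : A ⊆ (A ∪ X) \ {p} := fun u hu => ⟨Or.inl hu, fun e => hpA (e ▸ hu)⟩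
    refine Conn.of_root (hAs hr) fun v hv => ?_
    rcases hv.1 with hv' | hv'
    · exact ⟨A, hAs, hA.conn, hr, hv'⟩
    · exact ⟨insert v A, insert_subset hv hAs, hA.conn.insert (hA.sees v hv'),
        mem_insert_of_mem _ hr, mem_insert _ _⟩
  have hsite : Site G (A ∪ X) p ((A ∪ X) \ {p}) := by
    refine ⟨Or.inr hp, sdiff_subset, hc, fun h' => h'.2 rfl, ?_, ?_⟩
    · obtain ⟨u, hu, hpu⟩ := hA.sees p hp
      exact ⟨u, ⟨Or.inl hu, hpu.ne'⟩, hpu⟩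
    · intro u hu w hw huw
      by_cases e : w = p
      · exact Or.inr e
      · exact Or.inl ⟨hw, e⟩
  have hcard : N ≤ (X ∩ ((A ∪ X) \ {p})).ncard := by
    have : X ∩ ((A ∪ X) \ {p}) = X \ {p} := by
      ext u
      simp only [mem_inter_iff, mem_sdiff, mem_union]
      tauto
    rw [this, Set.ncard_sdiff_singleton_of_mem hp]
    omega
  obtain ⟨q, L, a, z, s, e, hcomb⟩ := hN V G _ X H (h.blk H) ht hsp p _ hsite hcard
  exact h.rail_of_comb hcomb sdiff_subset hp fun h' => h'.2 rfl

end RailSide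

section LadderSection

variable {V : Type} {G : SimpleGraph V}

/-- Two anticomplete induced paths joined by `K` pairwise anticomplete connected rungs in the same
order; each rung attaches to two consecutive vertices of `v` and to one vertex of `q`. -/
structure Ladder (G : SimpleGraph V) (K m : ℕ) (v : ℕ → V) (n : ℕ) (q : ℕ → V) (R : ℕ → Set V)
    (a b : ℕ → V) (e f : ℕ → ℕ) : Prop where
  vinj : ∀ i j, i < m → j < m → v i = v j → i = j
  vadj : ∀ i j, i < m → j < m → (G.Adj (v i) (v j) ↔ i = j + 1 ∨ j = i + 1)
  qinj : ∀ i j, i < n → j < n → q i = q j → i = j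
  qadj : ∀ i j, i < n → j < n → (G.Adj (q i) (q j) ↔ i = j + 1 ∨ j = i + 1)
  far : ∀ i j, i < m → j < n → v i ≠ q j ∧ ¬ G.Adj (v i) (q j)
  rung : ∀ i < K, Conn G (R i) ∧ a i ∈ R i ∧ b i ∈ R i
  offv : ∀ i < K, ∀ u ∈ R i, ∀ j < m, u ≠ v j
  offq : ∀ i < K, ∀ u ∈ R i, ∀ j < n, u ≠ q j
  attv : ∀ i < K, ∀ u ∈ R i, ∀ j < m, (G.Adj u (v j) ↔ u = a i ∧ (j = e i ∨ j + 1 = e i))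
  attq : ∀ i < K, ∀ u ∈ R i, ∀ j < n, (G.Adj u (q j) ↔ u = b i ∧ j = f i)
  posv : ∀ i < K, e i ≤ m
  posq : ∀ i < K, f i < n
  gap : ∀ i j, i < j → j < K → e i + 2 ≤ e j
  mono : ∀ i j, i ≤ j → j < K → f i ≤ f j
  apart : ∀ i j, i < K → j < K → i ≠ j → Apart G (R i) (R j)

theorem ip_range {c : ℕ} {g : ℕ → V} (hinj : ∀ i j, i < c → j < c → g i = g j → i = j)
    (hadj : ∀ i j, i < c → j < c → (G.Adj (g i) (g j) ↔ i = j + 1 ∨ j = i + 1)) :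
    IP G ((List.range c).map g) := by
  refine ip_of_get ?_ fun i j a b hi hj hij => ?_
  · refine List.Nodup.map_on (fun i hi j hj hij => ?_) List.nodup_range
    exact hinj i j (List.mem_range.1 hi) (List.mem_range.1 hj) hij
  · have key : ∀ i a, ((List.range c).map g)[i]? = some a → i < c ∧ a = g i := by
      intro i a hi
      obtain ⟨h1, h2⟩ := List.getElem?_eq_some_iff.1 hi
      simp only [List.length_map, List.length_range] at h1
      simp at h2
      exact ⟨h1, h2.symm⟩
    obtain ⟨hi', rfl⟩ := key i a hi
    obtain ⟨hj', rfl⟩ := key j b hj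
    rw [hadj _ _ hi' hj']
    omega

theorem Ladder.containsGenPyramid {k m n : ℕ} {v q : ℕ → V} {R : ℕ → Set V} {a b : ℕ → V}
    {e f : ℕ → ℕ} (h : Ladder G (k + 2) m v n q R a b e f) : ContainsGenPyramid G k := by
  have hpath : ∀ i < k + 2, ∃ l, IP G l ∧ l.head? = some (a i) ∧ l.getLast? = some (b i) ∧
      ∀ x ∈ l, x ∈ R i := fun i hi => (h.rung i hi).1.path' (h.rung i hi).2.1 (h.rung i hi).2.2
  choose! L hL hLa hLb hLR using hpath
  have hlen : ∀ i < k + 2, 1 ≤ (L i).length := by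
    intro i hi
    rw [Nat.one_le_iff_ne_zero]
    intro h0
    have := hLa i hi
    simp [List.length_eq_zero_iff.1 h0] at this
  have haL : ∀ i < k + 2, a i ∈ L i := fun i hi => List.mem_of_mem_head? (hLa i hi)
  have hbL : ∀ i < k + 2, b i ∈ L i := fun i hi => List.mem_of_getLast? (hLb i hi)
  have hK : k + 1 < k + 2 := by omega
  have h0 : 0 < k + 2 := by omega
  have hgap := h.gap 0 (k + 1) (by omega) hK
  have hfm := h.mono 0 (k + 1) (by omega) hK
  have hem := h.posv (k + 1) hK
  have hfn := h.posq (k + 1) hK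
  have hff : ∀ i < k + 2, f 0 ≤ f i ∧ f i ≤ f (k + 1) := fun i hi =>
    ⟨h.mono 0 i (by omega) hi, h.mono i (k + 1) (by omega) hK⟩
  set M := (List.range (f (k + 1) - f 0 + 1)).map (fun j => q (f 0 + j)) with hM
  have hMget : ∀ j, j < f (k + 1) - f 0 + 1 → M[j]? = some (q (f 0 + j)) := by
    intro j hj
    simp [hM, hj]
  have hMmem : ∀ u, u ∈ M ↔ ∃ j, f 0 ≤ j ∧ j ≤ f (k + 1) ∧ u = q j := by
    intro u
    simp only [hM, List.mem_map, List.mem_range]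
    constructor
    · rintro ⟨j, hj, rfl⟩
      exact ⟨f 0 + j, by omega, by omega, rfl⟩
    · rintro ⟨j, h1, h2, rfl⟩
      exact ⟨j - f 0, by omega, by congr 1; omega⟩
  have hMlen : M.length = f (k + 1) - f 0 + 1 := by simp [hM]
  have hMip : IP G M := by
    refine ip_range (fun i j hi hj hij => ?_) fun i j hi hj => ?_
    · have := h.qinj _ _ (by omega) (by omega) hij
      omega
    · rw [h.qadj _ _ (by omega) (by omega)]
      omega
  have hMhead : M.head? = some (q (f 0)) := by
    rw [List.head?_eq_getElem?]
    simpa using hMget 0 (by omega)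
  have hMlast : M.getLast? = some (q (f (k + 1))) := by
    rw [List.getLast?_eq_getElem?, hMget _ (by omega)]
    congr 2
    omega
  clear_value M
  have hap : ∀ i j, i < k + 2 → j < k + 2 → i ≠ j → Apart G {u | u ∈ L i} {u | u ∈ L j} :=
    fun i j hi hj hij => (h.apart i j hi hj hij).mono (hLR i hi) (hLR j hj)
  have hLM : ∀ i < k + 2, ∀ u ∈ L i, ∀ w ∈ M, u ≠ w ∧ (G.Adj u w ↔ u = b i ∧ w = q (f i)) := by
    intro i hi u hu w hw
    obtain ⟨j, -, h2, rfl⟩ := (hMmem w).1 hw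
    have hj : j < n := by omega
    refine ⟨h.offq i hi u (hLR i hi u hu) j hj, ?_⟩
    rw [h.attq i hi u (hLR i hi u hu) j hj]
    refine and_congr_right fun _ => ⟨fun e => e ▸ rfl, fun e => ?_⟩
    exact h.qinj _ _ hj (h.posq i hi) e
  have hQ1 : IP G (L 0 ++ M) := by
    refine ip_append.2 ⟨hL 0 h0, hMip, fun u hu w hw => ⟨(hLM 0 h0 u hu w hw).1, ?_⟩⟩
    rw [(hLM 0 h0 u hu w hw).2, hLb 0 h0, hMhead]
    simp [eq_comm]
  have hQ : IP G ((L 0 ++ M) ++ (L (k + 1)).reverse) := by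
    refine ip_append.2 ⟨hQ1, ip_reverse.2 (hL _ hK), fun u hu w hw => ?_⟩
    rw [List.mem_reverse] at hw
    have hlast : (L 0 ++ M).getLast? = some (q (f (k + 1))) := by
      rw [List.getLast?_append, hMlast]
      rfl
    rw [hlast, List.head?_reverse, hLb _ hK]
    rcases List.mem_append.1 hu with hu | hu
    · have := hap 0 (k + 1) h0 hK (by omega) u hu w hw
      refine ⟨this.1, iff_of_false this.2 ?_⟩
      rintro ⟨h1, -⟩
      have hqM : q (f (k + 1)) ∈ M := List.mem_of_getLast? hMlast
      exact (hLM 0 h0 u hu _ hqM).1 (Option.some.inj h1).symm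
    · refine ⟨(hLM _ hK w hw u hu).1.symm, ?_⟩
      rw [G.adj_comm, (hLM _ hK w hw u hu).2]
      simp only [Option.some.injEq]
      constructor
      · rintro ⟨rfl, rfl⟩
        exact ⟨rfl, rfl⟩
      · rintro ⟨rfl, rfl⟩
        exact ⟨rfl, rfl⟩
  set Q := (L 0 ++ M) ++ (L (k + 1)).reverse with hQdef
  have hQlen : Q.length = (L 0).length + (f (k + 1) - f 0 + 1) + (L (k + 1)).length := by
    simp [hQdef, hMlen, Nat.add_assoc]
  have hQmem : ∀ u, u ∈ Q ↔ u ∈ L 0 ∨ u ∈ M ∨ u ∈ L (k + 1) := by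
    intro u
    simp [hQdef]
  have hQ0 : Q[0]? = some (a 0) := by
    rw [← List.head?_eq_getElem?, hQdef, List.append_assoc, List.head?_append, hLa 0 h0]
    rfl
  have hQl : Q[Q.length - 1]? = some (a (k + 1)) := by
    rw [← List.getLast?_eq_getElem?, hQdef, List.getLast?_append, List.getLast?_reverse, hLa _ hK]
    rfl
  have hQM : ∀ j, j < f (k + 1) - f 0 + 1 → Q[(L 0).length + j]? = some (q (f 0 + j)) := by
    intro j hj
    rw [hQdef, List.append_assoc, List.getElem?_append_right (by omega), Nat.add_sub_cancel_left,
      List.getElem?_append_left (by omega), hMget j hj]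
  clear_value Q
  have hQget : ∀ (j : Fin Q.length), Q[j.val]? = some (Q.get j) := fun j => by simp
  have hQin : ∀ (j : Fin Q.length), Q.get j ∈ Q := fun j => List.get_mem Q j
  have hind : ∀ (j : Fin Q.length) (i : ℕ) (w : V), Q[i]? = some w → (Q.get j = w ↔ j.val = i) := by
    intro j i w hw
    constructor
    · rintro rfl
      exact hQ.get_inj (hQget j) hw
    · rintro rfl
      exact Option.some.inj ((hQget j).symm.trans hw)
  have hLind : ∀ i < k + 2, ∀ u : Fin (L i).length, ((L i).get u = a i ↔ u.val = 0) ∧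
      ((L i).get u = b i ↔ u.val = (L i).length - 1) := by
    intro i hi u
    have hu : (L i)[u.val]? = some ((L i).get u) := by simp
    have h1 : (L i)[0]? = some (a i) := by rw [← List.head?_eq_getElem?, hLa i hi]
    have h2 : (L i)[(L i).length - 1]? = some (b i) := by
      rw [← List.getLast?_eq_getElem?, hLb i hi]
    refine ⟨⟨fun e => (hL i hi).get_inj hu (e ▸ h1), fun e => ?_⟩,
      ⟨fun e => (hL i hi).get_inj hu (e ▸ h2), fun e => ?_⟩⟩
    · rw [e] at hu
      exact Option.some.inj (hu.symm.trans h1)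
    · rw [e] at hu
      exact Option.some.inj (hu.symm.trans h2)
  have hLv : ∀ i < k + 2, ∀ u ∈ L i, ∀ j < m, u ≠ v j ∧
      (G.Adj u (v j) ↔ u = a i ∧ (j = e i ∨ j + 1 = e i)) := fun i hi u hu j hj =>
    ⟨h.offv i hi u (hLR i hi u hu) j hj, h.attv i hi u (hLR i hi u hu) j hj⟩
  have hMv : ∀ u ∈ M, ∀ j < m, u ≠ v j ∧ ¬ G.Adj (v j) u := by
    intro u hu j hj
    obtain ⟨j', -, h2, rfl⟩ := (hMmem u).1 hu
    have := h.far j j' hj (by omega)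
    exact ⟨this.1.symm, this.2⟩
  have hi1 : ∀ i : Fin k, i.val + 1 < k + 2 := fun i => by omega
  have hine : ∀ i : Fin k, i.val + 1 ≠ 0 ∧ i.val + 1 ≠ k + 1 := fun i => by omega
  refine ⟨e (k + 1) - e 0, Q.length, fun j => v (e 0 + j), Q.get, fun i => (L (i + 1)).length,
    fun i => (L (i + 1)).get, fun i => e (i + 1) - 1 - e 0,
    fun i => (L 0).length + (f (i + 1) - f 0), ?_, by omega, ?_, ⟨?_, ?_⟩, hQ.emb, ?_, ?_,
    fun i => hlen _ (hi1 i), fun i => (hL _ (hi1 i)).emb, ?_, ?_, ?_, ?_, ?_, ?_, ?_, ?_, ?_⟩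
  · have := hlen 0 h0
    have := hlen _ hK
    omega
  · have := hlen 0 h0
    omega
  · intro i j hij
    have := h.vinj _ _ (by omega) (by omega) hij
    exact Fin.ext (by omega)
  · intro i j
    show G.Adj (v _) (v _) ↔ _
    rw [h.vadj _ _ (by omega) (by omega)]
    omega
  · intro i j
    show v _ ≠ _
    have hi : e 0 + i.val < m := by omega
    rcases (hQmem _).1 (hQin j) with hj | hj | hj
    · exact (hLv 0 h0 _ hj _ hi).1.symm
    · exact (hMv _ hj _ hi).1.symm
    · exact (hLv _ hK _ hj _ hi).1.symm
  · intro i j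
    show G.Adj (v _) _ ↔ _
    have hi : e 0 + i.val < m := by omega
    rw [← hind j 0 _ hQ0, ← hind j (Q.length - 1) _ hQl]
    have haa : a 0 ≠ a (k + 1) :=
      (hap 0 (k + 1) h0 hK (by omega) _ (haL 0 h0) _ (haL _ hK)).1
    rcases (hQmem _).1 (hQin j) with hj | hj | hj
    · rw [G.adj_comm, (hLv 0 h0 _ hj _ hi).2]
      have : Q.get j ≠ a (k + 1) := (hap 0 (k + 1) h0 hK (by omega) _ hj _ (haL _ hK)).1
      constructor
      · rintro ⟨h1, h2⟩
        exact Or.inl ⟨by omega, h1⟩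
      · rintro (⟨h1, h2⟩ | ⟨h1, h2⟩)
        · exact ⟨h2, by omega⟩
        · exact absurd h2 this
    · refine iff_of_false (hMv _ hj _ hi).2 ?_
      rintro (⟨-, h2⟩ | ⟨-, h2⟩)
      · exact (hLM 0 h0 _ (haL 0 h0) _ hj).1 h2.symm
      · exact (hLM _ hK _ (haL _ hK) _ hj).1 h2.symm
    · rw [G.adj_comm, (hLv _ hK _ hj _ hi).2]
      have : Q.get j ≠ a 0 := (hap 0 (k + 1) h0 hK (by omega) _ (haL _ h0) _ hj).1.symm
      constructor
      · rintro ⟨h1, h2⟩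
        exact Or.inr ⟨by omega, h1⟩
      · rintro (⟨h1, h2⟩ | ⟨h1, h2⟩)
        · exact absurd h2 this
        · exact ⟨h2, by omega⟩
  · intro i u j
    exact (hLv _ (hi1 i) _ (List.get_mem _ u) _ (by omega)).1
  · intro i u j
    rcases (hQmem _).1 (hQin j) with hj | hj | hj
    · exact (hap _ 0 (hi1 i) h0 (hine i).1 _ (List.get_mem _ u) _ hj).1
    · exact (hLM _ (hi1 i) _ (List.get_mem _ u) _ hj).1
    · exact (hap _ _ (hi1 i) hK (hine i).2 _ (List.get_mem _ u) _ hj).1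
  · intro i i' hne u u'
    exact hap _ _ (hi1 i) (hi1 i') (fun h' => hne (Fin.ext (by omega))) _ (List.get_mem _ u) _
      (List.get_mem _ u')
  · intro i
    have h1 := h.gap 0 (i + 1) (by omega) (hi1 i)
    have h2 := h.gap (i + 1) (k + 1) (by omega) hK
    dsimp only
    omega
  · intro i u j
    have h1 := h.gap 0 (i + 1) (by omega) (hi1 i)
    show G.Adj _ (v _) ↔ _
    rw [(hLv _ (hi1 i) _ (List.get_mem _ u) _ (by omega)).2, (hLind _ (hi1 i) u).1]
    dsimp only
    omega
  · intro i
    have := hff _ (hi1 i)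
    have := hlen _ hK
    show (L 0).length + (f (i + 1) - f 0) < _
    omega
  · intro i u j
    have hf := hff _ (hi1 i)
    have hq := hQM (f (i + 1) - f 0) (by omega)
    rw [show f 0 + (f (i + 1) - f 0) = f (i + 1) by omega] at hq
    rw [← (hLind _ (hi1 i) u).2, ← hind j _ _ hq]
    have hqM : q (f (i + 1)) ∈ M := (hMmem _).2 ⟨_, hf.1, hf.2, rfl⟩
    rcases (hQmem _).1 (hQin j) with hj | hj | hj
    · refine iff_of_false (hap _ 0 (hi1 i) h0 (hine i).1 _ (List.get_mem _ u) _ hj).2 ?_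
      rintro ⟨-, h2⟩
      exact (hLM 0 h0 _ hj _ hqM).1 h2
    · exact (hLM _ (hi1 i) _ (List.get_mem _ u) _ hj).2
    · refine iff_of_false (hap _ _ (hi1 i) hK (hine i).2 _ (List.get_mem _ u) _ hj).2 ?_
      rintro ⟨-, h2⟩
      exact (hLM _ hK _ hj _ hqM).1 h2
  · intro i i' hii
    have h1 := h.gap 0 (i + 1) (by omega) (hi1 i)
    have h2 := h.gap (i + 1) (i' + 1) (by have : i.val < i'.val := hii; omega) (hi1 i')
    show e (i + 1) - 1 - e 0 + 1 < e (i' + 1) - 1 - e 0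
    omega
  · intro i i' hii
    have := h.mono (i + 1) (i' + 1) (by have : i.val ≤ i'.val := hii; omega) (hi1 i')
    show (L 0).length + (f (i + 1) - f 0) ≤ (L 0).length + (f (i' + 1) - f 0)
    omega

end LadderSection

section LadderOfRail

variable {V : Type} {G : SimpleGraph V}

theorem Rail.restrict {A X : Set V} {k k' n : ℕ} {q : ℕ → V} {T : ℕ → Set V} {b y : ℕ → V}
    {f : ℕ → ℕ} (h : Rail G A X k n q T b y f) {σ : ℕ → ℕ} (hσ : ∀ i < k', σ i < k)
    (hm : ∀ i j, i < j → j < k' → σ i < σ j) :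
    Rail G A X k' n q (T ∘ σ) (b ∘ σ) (y ∘ σ) (f ∘ σ) where
  inj := h.inj
  adj := h.adj
  mem := h.mem
  leg i hi := h.leg _ (hσ i hi)
  off i hi := h.off _ (hσ i hi)
  att i hi := h.att _ (hσ i hi)
  pos i hi := h.pos _ (hσ i hi)
  mono i j hij hj := by
    rcases hij.eq_or_lt with rfl | hij
    · exact le_rfl
    · exact h.mono _ _ (hm i j hij hj).le (hσ j hj)
  apart i j hi hj hij := by
    refine h.apart _ _ (hσ i hi) (hσ j hj) ?_
    rcases Nat.lt_or_gt_of_ne hij with h' | h'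
    · exact (hm i j h' hj).ne
    · exact (hm j i h' hi).ne'

theorem Rail.reverse {A X : Set V} {k n : ℕ} {q : ℕ → V} {T : ℕ → Set V} {b y : ℕ → V}
    {f : ℕ → ℕ} (h : Rail G A X k n q T b y f) :
    Rail G A X k n (fun j => q (n - 1 - j)) (fun i => T (k - 1 - i)) (fun i => b (k - 1 - i))
      (fun i => y (k - 1 - i)) (fun i => n - 1 - f (k - 1 - i)) where
  inj i j hi hj hij := by
    have := h.inj _ _ (by omega) (by omega) hij
    omega
  adj i j hi hj := by
    rw [h.adj _ _ (by omega) (by omega)]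
    omega
  mem j hj := h.mem _ (by omega)
  leg i hi := h.leg _ (by omega)
  off i hi u hu j hj := h.off _ (by omega) u hu _ (by omega)
  att i hi u hu j hj := by
    rw [h.att _ (by omega) u hu _ (by omega)]
    have := h.pos (k - 1 - i) (by omega)
    refine and_congr_right fun _ => ?_
    omega
  pos i hi := by
    have := h.pos (k - 1 - i) (by omega)
    omega
  mono i j hij hj := by
    have := h.mono (k - 1 - j) (k - 1 - i) (by omega) (by omega)
    omega
  apart i j hi hj hij := h.apart _ _ (by omega) (by omega) (by omega)

/-- A long sequence of distinct naturals has a long monotone subsequence. -/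
theorem exists_monotone_subsequence (M : ℕ) : ∃ N, ∀ g : ℕ → ℕ,
    (∀ i j, i < N → j < N → g i = g j → i = j) → ∃ σ : ℕ → ℕ, (∀ i < M, σ i < N) ∧
      (∀ i j, i < j → j < M → σ i < σ j) ∧
      ((∀ i j, i < j → j < M → g (σ i) < g (σ j)) ∨
        ∀ i j, i < j → j < M → g (σ j) < g (σ i)) := by
  classical
  obtain ⟨N, hN⟩ := ramsey 2 M M
  refine ⟨N, fun g hg => ?_⟩
  have key : ∀ Y ⊆ Finset.range N, M ≤ Y.card → ∃ σ : ℕ → ℕ, (∀ i < M, σ i ∈ Y) ∧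
      ∀ i j, i < j → j < M → σ i < σ j := by
    intro Y hY hM
    have : ∀ i : ℕ, ∃ s, ∀ hi : i < Y.card, s = Y.orderEmbOfFin rfl ⟨i, hi⟩ := fun i => by
      by_cases hi : i < Y.card
      · exact ⟨Y.orderEmbOfFin rfl ⟨i, hi⟩, fun _ => rfl⟩
      · exact ⟨0, fun h => absurd h hi⟩
    choose σ hσ using this
    refine ⟨σ, fun i hi => ?_, fun i j hij hj => ?_⟩
    · rw [hσ i (by omega)]
      exact Y.orderEmbOfFin_mem rfl _
    · rw [hσ i (by omega), hσ j (by omega)]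
      exact (Y.orderEmbOfFin rfl).strictMono hij
  rcases hN ℕ (Finset.range N) {T | ∀ i ∈ T, ∀ j ∈ T, i < j → g i < g j} (by simp) with
    ⟨Y, hY, hM, hT⟩ | ⟨Y, hY, hM, hT⟩
  all_goals
    obtain ⟨σ, h1, h2⟩ := key Y hY hM
    refine ⟨σ, fun i hi => Finset.mem_range.1 (hY (h1 i hi)), h2, ?_⟩
    have hpair : ∀ i j, i < j → j < M → {σ i, σ j} ⊆ Y ∧ ({σ i, σ j} : Finset ℕ).card = 2 :=
      fun i j hij hj => ⟨by
        intro u hu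
        rcases Finset.mem_insert.1 hu with rfl | hu
        · exact h1 i (by omega)
        · exact Finset.mem_singleton.1 hu ▸ h1 j hj, Finset.card_pair (h2 i j hij hj).ne⟩
  · refine Or.inl fun i j hij hj => ?_
    exact hT _ (hpair i j hij hj).1 (hpair i j hij hj).2 _ (by simp) _ (by simp) (h2 i j hij hj)
  · refine Or.inr fun i j hij hj => ?_
    have hlt := h2 i j hij hj
    have := hT _ (hpair i j hij hj).1 (hpair i j hij hj).2
    have hne : g (σ i) ≠ g (σ j) := fun he =>
      hlt.ne (hg _ _ (Finset.mem_range.1 (hY (h1 i (by omega))))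
        (Finset.mem_range.1 (hY (h1 j hj))) he)
    by_contra hle
    refine this fun u hu w hw huw => ?_
    simp only [Finset.mem_insert, Finset.mem_singleton] at hu hw
    rcases hu with rfl | rfl <;> rcases hw with rfl | rfl <;> omega

theorem Frame.ladder {B A X : Set V} {K m : ℕ} {v : ℕ → V} {S : ℕ → Set V} {a z : ℕ → V}
    {e : ℕ → ℕ} (h : Frame G B K m v S a z e) (hAB : A ⊆ B) {k n : ℕ} {q : ℕ → V}
    {T : ℕ → Set V} {b y : ℕ → V} {f : ℕ → ℕ} (hR : Rail G A X k n q T b y f) {g : ℕ → ℕ}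
    (hg : ∀ i < k, g i ≤ K ∧ y i = z (g i)) (hgap : ∀ i j, i < j → j < k → g i + 2 ≤ g j) :
    Ladder G k m v n q (fun i => S (g i) ∪ T i) (a ∘ g) b (e ∘ g) f := by
  have hgle : ∀ i < k, g i ≤ K := fun i hi => (hg i hi).1
  have hyS : ∀ i < k, y i ∈ S (g i) := fun i hi => by
    rw [(hg i hi).2]
    exact (h.leg _ (hgle i hi)).2.2
  have hT : ∀ i < k, ∀ u ∈ T i, u ∈ S (g i) ∨ u ∈ B := by
    intro i hi u hu
    rcases (hR.leg i hi).2.2.2.2 hu with rfl | hu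
    · exact Or.inl (hyS i hi)
    · exact Or.inr (hAB hu)
  have hST : ∀ i < k, ∀ u ∈ S (g i), u ∉ B ∧ (Sees G u B → u ∈ T i) := by
    intro i hi u hu
    refine ⟨(h.out _ (hgle i hi) u hu).1, fun hs => ?_⟩
    rw [(h.out _ (hgle i hi) u hu).2 hs, ← (hg i hi).2]
    exact (hR.leg i hi).2.2.1
  have hne : ∀ i j, i < k → j < k → i ≠ j → g i ≠ g j := by
    intro i j hi hj hij
    rcases Nat.lt_or_gt_of_ne hij with h' | h'
    · have := hgap i j h' hj
      omega
    · have := hgap j i h' hi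
      omega
  have hcross : ∀ i j, i < k → j < k → i ≠ j → Apart G (S (g i)) (T j) := by
    intro i j hi hj hij u hu w hw
    rcases hT j hj w hw with hw' | hw'
    · exact h.apart _ _ (hgle i hi) (hgle j hj) (hne i j hi hj hij) u hu w hw'
    · refine ⟨fun h' => (hST i hi u hu).1 (h' ▸ hw'), fun huw => ?_⟩
      exact (hR.apart i j hi hj hij u ((hST i hi u hu).2 ⟨w, hw', huw⟩) w hw).2 huw
  refine ⟨fun i j hi hj => h.inj i hi j hj, fun i j hi hj => h.adj i hi j hj, hR.inj, hR.adj,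
    ?_, ?_, ?_, ?_, ?_, ?_, ?_, hR.pos, ?_, hR.mono, ?_⟩
  · intro i j hi hj
    have hq := hAB (hR.mem j hj)
    exact ⟨fun h' => (h.spine i hi).1 (h' ▸ hq), fun h' => (h.spine i hi).2 ⟨_, hq, h'⟩⟩
  · intro i hi
    have h1 := h.leg _ (hgle i hi)
    have h2 := hR.leg i hi
    exact ⟨h1.1.union h2.1 ⟨_, hyS i hi, _, h2.2.2.1, Or.inl rfl⟩, Or.inl h1.2.1, Or.inr h2.2.1⟩
  · rintro i hi u (hu | hu) j hj
    · exact h.off _ (hgle i hi) u hu j hj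
    · rcases hT i hi u hu with hu' | hu'
      · exact h.off _ (hgle i hi) u hu' j hj
      · rintro rfl
        exact (h.spine j hj).1 hu'
  · rintro i hi u (hu | hu) j hj
    · rintro rfl
      exact (hST i hi _ hu).1 (hAB (hR.mem j hj))
    · exact hR.off i hi u hu j hj
  · have key : ∀ i < k, ∀ u ∈ S (g i), ∀ j < m,
        (G.Adj u (v j) ↔ u = a (g i) ∧ (j = e (g i) ∨ j + 1 = e (g i))) :=
      fun i hi => h.att _ (hgle i hi)
    rintro i hi u (hu | hu) j hj
    · exact key i hi u hu j hj
    · rcases hT i hi u hu with hu' | hu'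
      · exact key i hi u hu' j hj
      · refine iff_of_false (fun h' => (h.spine j hj).2 ⟨u, hu', h'.symm⟩) ?_
        rintro ⟨rfl, -⟩
        exact (hST i hi _ (h.leg _ (hgle i hi)).2.1).1 hu'
  · rintro i hi u (hu | hu) j hj
    · by_cases huT : u ∈ T i
      · exact hR.att i hi u huT j hj
      · refine iff_of_false (fun h' => huT ((hST i hi u hu).2 ⟨_, hAB (hR.mem j hj), h'⟩)) ?_
        rintro ⟨rfl, -⟩
        exact huT (hR.leg i hi).2.1
    · exact hR.att i hi u hu j hj
  · exact fun i hi => h.pos_le (hgle i hi)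
  · intro i j hij hj
    have h1 := hgap i j hij hj
    have h2 := h.mono (g i) (g i + 1) (by omega) (by have := hgle j hj; omega)
    have h3 := h.mono (g i + 1) (g j) (by omega) (hgle j hj)
    show e (g i) + 2 ≤ e (g j)
    omega
  · intro i j hi hj hij
    exact ((h.apart _ _ (hgle i hi) (hgle j hj) (hne i j hi hj hij)).union_left
      (hcross j i hj hi hij.symm).symm).union_right
        ((hcross i j hi hj hij).union_left (hR.apart i j hi hj hij))

theorem Frame.containsGenPyramid (k : ℕ) : ∃ N, ∀ (V : Type) (G : SimpleGraph V) (B A X : Set V)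
    (K m : ℕ) (v : ℕ → V) (S : ℕ → Set V) (a z : ℕ → V) (e : ℕ → ℕ),
    Frame G B K m v S a z e → A ⊆ B → (∀ x ∈ X, ∃ i ≤ K, x = z i) →
    (∃ n q T b y f, Rail G A X N n q T b y f) → ContainsGenPyramid G k := by
  obtain ⟨N, hN⟩ := exists_monotone_subsequence (2 * (k + 2))
  refine ⟨N, fun V G B A X K m v S a z e h hAB hX => ?_⟩
  rintro ⟨n, q, T, b, y, f, hR⟩
  have : ∀ i < N, ∃ g ≤ K, y i = z g := fun i hi => hX _ (hR.leg i hi).2.2.2.1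
  choose! g hgK hyg using this
  obtain ⟨σ, h1, h2, h3⟩ := hN g (fun i j hi hj hij => by
    by_contra hne
    refine (hR.apart i j hi hj hne _ (hR.leg i hi).2.2.1 _ (hR.leg j hj).2.2.1).1 ?_
    rw [hyg i hi, hyg j hj, hij])
  have hR' := hR.restrict h1 h2
  have step : ∀ (q : ℕ → V) (T : ℕ → Set V) (b y : ℕ → V) (f g : ℕ → ℕ),
      Rail G A X (2 * (k + 2)) n q T b y f → (∀ i < 2 * (k + 2), g i ≤ K ∧ y i = z (g i)) →
      (∀ i j, i < j → j < 2 * (k + 2) → g i < g j) → ContainsGenPyramid G k := by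
    intro q T b y f g hR hg hmono
    have hR2 : Rail G A X (k + 2) n q _ _ _ _ := hR.restrict (σ := fun i => 2 * i)
      (fun i hi => by show 2 * i < _; omega) (fun i j hij hj => by show 2 * i < 2 * j; omega)
    refine (h.ladder hAB hR2 (g := fun i => g (2 * i)) (fun i hi => hg _ (by omega))
      fun i j hij hj => ?_).containsGenPyramid
    have h1 := hmono (2 * i) (2 * i + 1) (by omega) (by omega)
    have h2 := hmono (2 * i + 1) (2 * j) (by omega) (by omega)
    show g (2 * i) + 2 ≤ g (2 * j)
    omega
  rcases h3 with h3 | h3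
  · exact step _ _ _ _ _ (g ∘ σ) hR' (fun i hi => ⟨hgK _ (h1 i hi), hyg _ (h1 i hi)⟩) h3
  · refine step _ _ _ _ _ (fun i => g (σ (2 * (k + 2) - 1 - i))) hR'.reverse
      (fun i hi => ⟨hgK _ (h1 _ (by omega)), hyg _ (h1 _ (by omega))⟩) fun i j hij hj => ?_
    exact h3 _ _ (by omega) (by omega)

end LadderOfRail

section SidesBound

variable {V : Type} {G : SimpleGraph V}

theorem Frame.pinned [Finite V] (hC : MemC G) {B A : Set V} {K m : ℕ} {v : ℕ → V} {S : ℕ → Set V}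
    {a z : ℕ → V} {e : ℕ → ℕ} (h : Frame G B K m v S a z e) (hAB : A ⊆ B)
    (hA : MinConn G A {u | ∃ i ≤ K, u = z i}) :
    Pinned G (inner K m v S z) A {u | ∃ i ≤ K, u = z i} := by
  have hF := h.mono_set hAB hA.conn fun i hi => hA.sees _ ⟨i, hi, rfl⟩
  refine ⟨hA, ?_, ?_, ?_, hF.inner_apart, hC.2.1⟩
  · rintro _ ⟨i, hi, rfl⟩
    exact hF.unique_contact hC hA hi
  · intro x hx hX
    choose g hg hxg using hX
    have hne : ∀ i j, i ≠ j → g i ≠ g j := fun i j hij h' =>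
      hij (hx (by rw [hxg i, hxg j, h']))
    have hx3 : x = ![z (g 0), z (g 1), z (g 2)] := by
      funext i
      fin_cases i
      exacts [hxg 0, hxg 1, hxg 2]
    rw [hx3]
    exact hF.no_tri hC (hg 0) (hg 1) (hg 2) (hne 0 1 (by simp)) (hne 0 2 (by simp))
      (hne 1 2 (by simp))
  · rintro _ ⟨i, hi, rfl⟩ _ ⟨j, hj, rfl⟩ hij
    exact hF.link hi hj fun h' => hij (by rw [h'])

/-- The number of non-hubs attached to two anticomplete connected sets is bounded. -/
theorem exists_sides_bound (t : ℕ) : ∃ N, ∀ (V : Type) [Finite V] (G : SimpleGraph V)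
    (D₁ D₂ X : Set V), MemCtt t G → Sides G D₁ D₂ X → X.ncard < N := by
  obtain ⟨N₁, h₁⟩ := Frame.containsGenPyramid t
  obtain ⟨N₂, h₂⟩ := exists_rail t (N₁ + 2) (by omega)
  obtain ⟨N₃, h₃⟩ := exists_frame t (N₂ + 1) (by omega)
  obtain ⟨N₄, h₄⟩ := exists_tight N₃
  refine ⟨N₄, fun V _ G D₁ D₂ X hG hS => ?_⟩
  by_contra hX
  have hC := hG.1.1
  obtain ⟨E₁, E₂, Y, hSY, hY, hT⟩ := h₄ V G D₁ D₂ X hC hS (by omega)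
  obtain ⟨B, m, v, S, a, z, e, hF⟩ := h₃ V G E₁ E₂ Y hSY hT hG.1.2 hY
  obtain ⟨A, hAB, hA⟩ := exists_minConn (X := {u | ∃ i ≤ N₂ + 1, u = z i}) hF.conn
    (by rintro _ ⟨i, hi, rfl⟩; exact hF.sees i hi)
    (by rintro _ ⟨i, hi, rfl⟩; exact hF.tip_not_mem hi)
    (by
      rintro _ ⟨i, hi, rfl⟩ _ ⟨j, hj, rfl⟩
      by_cases hij : i = j
      · exact hij ▸ G.irrefl
      · exact (hF.tip_ne hi hj hij).2)
  have hcard : N₂ ≤ {u | ∃ i ≤ N₂ + 1, u = z i}.ncard := by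
    have himg : {u | ∃ i ≤ N₂ + 1, u = z i} = z '' Set.Iic (N₂ + 1) := by
      ext u
      simp [eq_comm]
    have hinj : Set.InjOn z (Set.Iic (N₂ + 1)) := fun i hi j hj hij => by
      by_contra hne
      exact (hF.tip_ne hi hj hne).1 hij
    rw [himg, hinj.ncard_image, ← Finset.coe_Iic, Set.ncard_coe_finset, Nat.card_Iic]
    omega
  obtain ⟨n, q, T, b, y, f, hR⟩ := h₂ V G _ A _ (hF.pinned hC hAB hA) hG.1.2 hcard
  refine hG.2 (h₁ V G B A _ _ m v S a z e hF hAB (fun x hx => hx) ⟨n, q, T, b, y, f, ?_⟩)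
  exact hR.restrict (σ := id) (fun i hi => by show i < _; omega) fun i j hij _ => hij

end SidesBound

section PotentialMaximalCliques

variable {V : Type} {G G' : SimpleGraph V}

theorem exists_between_neither {p r : ℕ → Prop} {a b : ℕ} (hab : a < b) (ha : p a) (hb : r b)
    (hpr : ¬ p b) (h : ∀ k, p k → ¬ r (k + 1)) : ∃ k, a < k ∧ k < b ∧ ¬ p k ∧ ¬ r k := by
  classical
  have hex : ∃ k, a < k ∧ ¬ p k := ⟨b, hab, hpr⟩
  obtain ⟨h1, h2⟩ := Nat.find_spec hex
  have h3 := Nat.find_min' hex ⟨hab, hpr⟩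
  have h4 : p (Nat.find hex - 1) := by
    by_contra hc
    have h5 : a < Nat.find hex - 1 := by
      by_contra h6
      have h7 : Nat.find hex - 1 = a := by omega
      exact hc (by rwa [h7])
    have := Nat.find_min' hex ⟨h5, hc⟩
    omega
  have h5 : ¬ r (Nat.find hex) := by
    have := h _ h4
    rwa [Nat.sub_add_cancel (by omega)] at this
  refine ⟨_, h1, lt_of_le_of_ne h3 fun h6 => h5 (h6 ▸ hb), h2, h5⟩

/-- Deleting the edges of `G'` between `C` and the complement of `C ∪ Q`. -/
def cutGraph (G' : SimpleGraph V) (C Q : Set V) : SimpleGraph V where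
  Adj x y := G'.Adj x y ∧ ¬ (x ∈ C ∧ y ∉ C ∪ Q) ∧ ¬ (y ∈ C ∧ x ∉ C ∪ Q)
  symm := ⟨fun _ _ h => ⟨h.1.symm, h.2.2, h.2.1⟩⟩
  loopless := ⟨fun _ h => G'.irrefl h.1⟩

theorem cutGraph_chordal {C Q : Set V} (h : ChordalG G') (hQ : G'.IsClique Q) :
    ChordalG (cutGraph G' C Q) := by
  rintro H ⟨n, f, hn, hf, rfl⟩
  have agree : (∀ i j, G'.Adj (f i) (f j) → (cutGraph G' C Q).Adj (f i) (f j)) → False := by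
    intro hag
    refine h _ ⟨n, f, hn, ⟨hf.1, fun i j => ?_⟩, rfl⟩
    rw [← hf.2]
    exact ⟨hag i j, fun h => h.1⟩
  have hi : ∃ i, f i ∈ C := by
    by_contra hc
    push Not at hc
    exact agree fun i j hij => ⟨hij, fun h => hc _ h.1, fun h => hc _ h.1⟩
  have hj : ∃ j, f j ∉ C ∪ Q := by
    by_contra hc
    push Not at hc
    exact agree fun i j hij => ⟨hij, fun h => h.2 (hc _), fun h => h.2 (hc _)⟩
  obtain ⟨i, hi⟩ := hi
  obtain ⟨j, hj⟩ := hj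
  have : NeZero n := ⟨by omega⟩
  have hJ : f (i + ((j - i).val : ℕ)) = f j := by
    rw [ZMod.natCast_zmod_val, add_sub_cancel]
  have hJ0 : 0 < (j - i).val := by
    rcases Nat.eq_zero_or_pos (j - i).val with h0 | h0
    · rw [h0, Nat.cast_zero, add_zero] at hJ
      exact (hj (hJ ▸ Or.inl hi)).elim
    · exact h0
  have hJn : (j - i).val < n := ZMod.val_lt _
  have hstep : ∀ k : ℕ, (cutGraph G' C Q).Adj (f (i + (k : ℕ))) (f (i + ((k + 1 : ℕ)))) :=
    fun k => (hf.2 _ _).2 (Or.inr (by push_cast; ring))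
  obtain ⟨k, hk1, hk2, hk3, hk4⟩ := exists_between_neither
    (p := fun k => f (i + (k : ℕ)) ∈ C) (r := fun k => f (i + (k : ℕ)) ∉ C ∪ Q) hJ0
    (by simpa using hi) (by simpa only [hJ] using hj)
    (by simpa only [hJ] using fun h => hj (Or.inl h)) (fun k h1 h2 => (hstep k).2.1 ⟨h1, h2⟩)
  obtain ⟨m, hm1, hm2, hm3, hm4⟩ := exists_between_neither
    (r := fun k => f (i + (k : ℕ)) ∈ C) (p := fun k => f (i + (k : ℕ)) ∉ C ∪ Q) hJn
    (by simpa only [hJ] using hj) (by simpa using hi)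
    (by simpa using fun h => (h hi).elim) (fun k h1 h2 => (hstep k).2.2 ⟨h2, h1⟩)
  have hkQ : f (i + (k : ℕ)) ∈ Q := by
    by_contra hc
    exact hk4 fun h => h.elim hk3 hc
  have hmQ : f (i + (m : ℕ)) ∈ Q := by
    by_contra hc
    exact hm3 fun h => h.elim hm4 hc
  have hinj : ∀ a b : ℕ, (a : ZMod n) = b → a % n = b % n := fun a b h =>
    (ZMod.natCast_eq_natCast_iff' a b n).1 h
  have hne : f (i + (k : ℕ)) ≠ f (i + (m : ℕ)) := by
    intro he
    have := hinj _ _ (add_left_cancel (hf.1 he))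
    rw [Nat.mod_eq_of_lt (by omega), Nat.mod_eq_of_lt hm2] at this
    omega
  have hadj : (cutGraph G' C Q).Adj (f (i + (k : ℕ))) (f (i + (m : ℕ))) :=
    ⟨hQ hkQ hmQ hne, fun h => hk3 h.1, fun h => hm4 h.1⟩
  rcases (hf.2 _ _).1 hadj with h | h
  · have := hinj k (m + 1) (by
      rw [add_assoc] at h
      exact_mod_cast add_left_cancel h)
    rw [Nat.mod_eq_of_lt (by omega)] at this
    rcases Nat.lt_or_ge (m + 1) n with h' | h'
    · rw [Nat.mod_eq_of_lt h'] at this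
      omega
    · rw [show m + 1 = n by omega, Nat.mod_self] at this
      omega
  · have := hinj m (k + 1) (by
      rw [add_assoc] at h
      exact_mod_cast add_left_cancel h)
    rw [Nat.mod_eq_of_lt hm2, Nat.mod_eq_of_lt (by omega)] at this
    omega

theorem not_adj_of_not_reach (h : IsMinChordalCompletion G G') {Q : Set V} (hQ : G'.IsClique Q)
    {u v : V} (hu : u ∉ Q) (hv : v ∉ Q) (huv : ¬ Reach G Qᶜ u v) : ¬ G'.Adj u v := by
  have hle : G ≤ cutGraph G' (comp G Qᶜ u) Q := by
    intro x y hxy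
    refine ⟨h.1 hxy, fun h' => ?_, fun h' => ?_⟩
    · exact h'.2 (Or.inl (comp_closed hu h'.1 (fun hy => h'.2 (Or.inr hy)) hxy))
    · exact h'.2 (Or.inl (comp_closed hu h'.1 (fun hy => h'.2 (Or.inr hy)) hxy.symm))
  have heq := h.2.2 _ hle (fun x y hxy => hxy.1) (cutGraph_chordal h.2.1 hQ)
  intro hadj
  rw [← heq] at hadj
  exact hadj.2.1 ⟨mem_comp _ _, fun h => h.elim huv hv⟩

theorem exists_cover_of_isPMC {Ω : Set V} (h : IsPMC G Ω) {u v : V} (hu : u ∈ Ω) (hv : v ∈ Ω) (huv : u ≠ v)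
    (hn : ¬ G.Adj u v) : ∃ D, Conn G D ∧ D ⊆ Ωᶜ ∧ Sees G u D ∧ Sees G v D := by
  obtain ⟨G', hmin, hcl, -⟩ := h
  have hr : Reach G (Ω \ {u, v})ᶜ u v := by
    by_contra hc
    exact not_adj_of_not_reach hmin (hcl.subset sdiff_subset) (by simp) (by simp) hc
      (hcl hu hv huv)
  obtain ⟨l, w, h1, h2, rfl, h3, h4⟩ := hr.path (by simp) (P := fun x => x = v) rfl
  rcases l with _ | ⟨a, l⟩
  · simp at h2
    exact (huv h2.symm).elim
  simp only [List.cons_append, List.head?_cons, Option.some.injEq] at h2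
  subst h2
  rcases List.eq_nil_or_concat l with rfl | ⟨m, z, rfl⟩
  · exact (hn (by simpa [IP] using h1 : _ ∧ _).2).elim
  rw [List.concat_eq_append] at h1 h3 h4
  have hl : m ++ [z] ≠ [] := by simp
  have hP := ip_cons.1 h1
  refine ⟨{x | x ∈ m ++ [z]}, ?_, ?_, ?_, ?_⟩
  · exact (IP.left hP.2.2 : IP G (m ++ [z])).conn hl
  · intro x hx hxΩ
    have hxl : x ∈ a :: (m ++ [z]) ++ [w] := by
      have : x ∈ m ++ [z] := hx
      simp at this ⊢
      tauto
    refine h4 x hxl ⟨hxΩ, ?_⟩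
    rintro (rfl | rfl)
    · exact hP.1 (by have : x ∈ m ++ [z] := hx; simp at this ⊢; tauto)
    · exact h3 x (by have : x ∈ m ++ [z] := hx; simp at this ⊢; tauto) rfl
  · obtain ⟨y, hy⟩ : ∃ y, (m ++ [z]).head? = some y := by
      cases m <;> simp
    refine ⟨y, List.mem_of_head? hy, (hP.2.1 y ?_).2 ?_⟩
    · have := List.mem_of_head? hy
      simp at this ⊢
      tauto
    · cases m <;> simp_all
  · refine ⟨z, by simp, ?_⟩
    have h5 : IP G (m ++ ([z] ++ [w])) := by
      rw [← List.append_assoc]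
      exact hP.2.2
    have : IP G [z, w] := h5.right
    exact (by simpa [IP] using this : _ ∧ G.Adj z w).2.symm

end PotentialMaximalCliques

section PotentialMaximalCliques

variable {V : Type} {G G' : SimpleGraph V}

theorem Conn.mono_graph {S : Set V} (h : Conn G S) (hG : G ≤ G') : Conn G' S :=
  ⟨h.1, fun u hu v hv =>
    Relation.ReflTransGen.mono (fun _ _ h => ⟨hG h.1, h.2⟩) _ _ (h.2 u hu v hv)⟩

theorem exists_not_sees_of_chordalG [Finite V] (hG : ChordalG G) {Ω D : Set V} (hcl : G.IsClique Ω)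
    (hmax : ∀ Ω', G.IsClique Ω' → Ω ⊆ Ω' → Ω' = Ω) (hD : Conn G D) (hDΩ : D ⊆ Ωᶜ) :
    ∃ w ∈ Ω, ¬ Sees G w D := by
  by_contra hc
  push Not at hc
  obtain ⟨d, hd, hdmax⟩ := (Set.toFinite D).exists_maximalFor
    (fun d => {x ∈ Ω | G.Adj d x}.ncard) D hD.1
  obtain ⟨x, hx, hdx⟩ : ∃ x ∈ Ω, ¬ G.Adj d x := by
    by_contra h
    push Not at h
    have h1 := hmax (insert d Ω) (hcl.insert fun b hb _ => h b hb) (subset_insert _ _)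
    exact hDΩ hd (h1 ▸ mem_insert d Ω)
  obtain ⟨v, hv, hxv⟩ := hc x hx
  obtain ⟨l, w', h1, h2, ⟨w, ⟨hw, hdw⟩, hw'⟩, h3, h4⟩ := hD.path hd hv
    (P := fun v => ∃ x, (x ∈ Ω ∧ ¬ G.Adj d x) ∧ G.Adj v x) ⟨x, ⟨hx, hdx⟩, hxv.symm⟩
  have hdl : d ∈ l := by
    rcases l with _ | ⟨a, l⟩
    · simp only [List.nil_append, List.head?_cons, Option.some.injEq] at h2
      exact (hdw (h2 ▸ hw')).elim
    · simp only [List.cons_append, List.head?_cons, Option.some.injEq] at h2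
      simp [h2]
  obtain ⟨u, hu, hdu, hw'u⟩ : ∃ u ∈ Ω, G.Adj d u ∧ ¬ G.Adj w' u := by
    by_contra h
    push Not at h
    have hss : {x ∈ Ω | G.Adj d x} ⊂ {x ∈ Ω | G.Adj w' x} :=
      ⟨fun y hy => ⟨hy.1, h y hy.1 hy.2⟩, fun h' => hdw (h' ⟨hw, hw'⟩).2⟩
    have hlt := Set.ncard_lt_ncard hss (Set.toFinite _)
    have hw'D : w' ∈ D := h4 w' (by simp)
    exact absurd (hdmax hw'D hlt.le) (not_le.2 hlt)
  obtain ⟨p, c, s, rfl, hcu, hs⟩ := list_last (P := fun y => G.Adj y u) ⟨d, hdl, hdu⟩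
  have huw : u ≠ w := by
    rintro rfl
    exact hdw hdu
  have hP : IP G (c :: (s ++ [w'])) := by
    have : IP G (p ++ (c :: (s ++ [w']))) := by simpa using h1
    exact this.right
  have hout : ∀ y ∈ c :: (s ++ [w']), y ∈ D := fun y hy => h4 y (by simp at hy ⊢; tauto)
  have hcw' : c ≠ w' := by
    rintro rfl
    exact hw'u hcu
  refine hG _ (isHole_of_paths hP (L₂ := [u, w]) (by simp [IP, huw, hcl hu hw huw]) (by simp)
    (by simp) (by simp) ?_)
  intro y hy z hz
  refine ⟨fun h => hDΩ (hout y hy) ?_, ?_⟩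
  · rw [h]
    simp only [List.mem_cons, List.not_mem_nil, or_false] at hz
    rcases hz with rfl | rfl <;> assumption
  · simp only [List.mem_cons, List.not_mem_nil, or_false] at hz
    have hlast : (c :: (s ++ [w'])).getLast? = some w' := by
      rw [← List.cons_append, List.getLast?_append]
      simp
    rw [hlast]
    simp only [List.head?_cons, List.getLast?_cons_cons, List.getLast?_singleton,
      Option.some.injEq]
    rcases hz with rfl | rfl
    · simp only [and_true, huw.symm, and_false, or_false]
      constructor
      · intro h
        simp only [List.mem_cons, List.mem_append, List.not_mem_nil, or_false] at hy
        rcases hy with rfl | hy | rfl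
        · rfl
        · exact (hs y hy h).elim
        · exact (hw'u h).elim
      · rintro rfl
        exact hcu
    · simp only [and_true, huw, and_false, false_or]
      constructor
      · intro h
        simp only [List.mem_cons, List.mem_append, List.not_mem_nil, or_false] at hy
        rcases hy with rfl | hy | rfl
        · exact (h3 y (by simp) ⟨z, ⟨hw, hdw⟩, h⟩).elim
        · exact (h3 y (by simp [hy]) ⟨z, ⟨hw, hdw⟩, h⟩).elim
        · rfl
      · rintro rfl
        exact hw'

theorem exists_not_sees_of_isPMC [Finite V] {Ω D : Set V} (h : IsPMC G Ω) (hD : Conn G D)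
    (hDΩ : D ⊆ Ωᶜ) : ∃ w ∈ Ω, ¬ Sees G w D := by
  obtain ⟨G', hmin, hcl, hmax⟩ := h
  obtain ⟨w, hw, hn⟩ := exists_not_sees_of_chordalG hmin.2.1 hcl hmax (hD.mono_graph hmin.1) hDΩ
  exact ⟨w, hw, fun ⟨a, ha, hwa⟩ => hn ⟨a, ha, hmin.1 hwa⟩⟩

theorem exists_sides_of_isPMC [Finite V] {Ω Y : Set V} (h : IsPMC G Ω) (hY : Y ⊆ Ω) (hs : StableSet G Y)
    (hub : ∀ y ∈ Y, ¬ IsHub G y) {d : V} (hd : d ∉ Ω) :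
    ∃ D₁ D₂, Sides G D₁ D₂ {y ∈ Y | Sees G y (comp G Ωᶜ d)} := by
  set D := comp G Ωᶜ d with hDdef
  have hDΩ : D ⊆ Ωᶜ := comp_subset hd
  have hDc : Conn G D := comp_conn _ _
  obtain ⟨w, hw, hwD⟩ := exists_not_sees_of_isPMC h hDc hDΩ
  set S : Set V := D ∪ {s ∈ Ω | Sees G s D} with hS
  have hwS : w ∈ Sᶜ := by
    rintro (h1 | h1)
    · exact hDΩ h1 hw
    · exact hwD h1.2
  have hsub : comp G Sᶜ w ⊆ Sᶜ := comp_subset hwS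
  refine ⟨D, comp G Sᶜ w, ?_, hDc, comp_conn _ _, ?_, ?_, fun x hx => hx.2, ?_, ?_, ?_⟩
  · intro a ha b hb
    refine ⟨?_, fun hab => ?_⟩
    · rintro rfl
      exact hsub hb (Or.inl ha)
    · by_cases hbΩ : b ∈ Ω
      · exact hsub hb (Or.inr ⟨hbΩ, a, ha, hab.symm⟩)
      · exact hsub hb (Or.inl (comp_closed hd ha hbΩ hab))
  · exact fun x hx hxD => hDΩ hxD (hY hx.1)
  · exact fun x hx hxD => hsub hxD (Or.inr ⟨hY hx.1, hx.2⟩)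
  · intro x hx
    by_cases hxw : G.Adj x w
    · exact ⟨w, mem_comp _ _, hxw⟩
    have hne : x ≠ w := by
      rintro rfl
      exact hwD hx.2
    obtain ⟨D', hc, hD', hxD', w', hw', hww'⟩ := exists_cover_of_isPMC h (hY hx.1) hw hne hxw
    have hdis : D' ⊆ Sᶜ := by
      rintro z hz (h1 | h1)
      · refine hwD ⟨w', ?_, hww'⟩
        have := hc.subset_comp hD' hz
        rw [comp_eq h1] at this
        exact this hw'
      · exact hD' hz h1.1
    refine hxD'.mono fun z hz => ?_
    have h1 : w' ∈ comp G Sᶜ w := comp_closed hwS (mem_comp _ _) (hdis hw') hww'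
    have := hc.subset_comp hdis hw' hz
    rwa [comp_eq h1] at this
  · intro x hx y hy hxy
    exact hs x hx.1 y hy.1 hxy.ne hxy
  · exact fun x hx => hub x hx.1

end PotentialMaximalCliques

section LargeComponent

variable {V : Type} {G : SimpleGraph V}

/-- Some component of the complement of `Ω` is seen by each of `a`, `b`, `c`. -/
def Meet (G : SimpleGraph V) (Ω : Set V) (a b c : V) : Prop :=
  ∃ d ∉ Ω, Sees G a (comp G Ωᶜ d) ∧ Sees G b (comp G Ωᶜ d) ∧ Sees G c (comp G Ωᶜ d)

theorem ncard_meet_le [Finite V] (hth : ¬ HasTheta G) {Ω Y : Set V} {L : ℕ}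
    (hL : ∀ d ∉ Ω, {y ∈ Y | Sees G y (comp G Ωᶜ d)}.ncard ≤ L) {a b : V} (hab : a ≠ b)
    (hn : ¬ G.Adj a b) : {c ∈ Y | Meet G Ω a b c}.ncard ≤ 2 * L := by
  have hlk : ∀ d, Sees G a (comp G Ωᶜ d) → Sees G b (comp G Ωᶜ d) → Lk G (comp G Ωᶜ d) a b :=
    fun d h1 h2 => ((comp_conn _ d).lk hab hn h1 h2).mono sdiff_subset
  by_cases h1 : ∃ d ∉ Ω, Sees G a (comp G Ωᶜ d) ∧ Sees G b (comp G Ωᶜ d)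
  swap
  · have : {c ∈ Y | Meet G Ω a b c} = ∅ := by
      ext c
      simp only [mem_ofPred_eq, mem_empty_iff_false, iff_false]
      rintro ⟨-, d, hd, h2, h3, -⟩
      exact h1 ⟨d, hd, h2, h3⟩
    simp [this]
  obtain ⟨d, hd, had, hbd⟩ := h1
  obtain ⟨e, he, hall⟩ : ∃ e ∉ Ω, ∀ x ∉ Ω, Sees G a (comp G Ωᶜ x) → Sees G b (comp G Ωᶜ x) →
      comp G Ωᶜ x = comp G Ωᶜ d ∨ comp G Ωᶜ x = comp G Ωᶜ e := by
    by_contra hc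
    push Not at hc
    obtain ⟨e, he, hae, hbe, hde, -⟩ := hc d hd
    obtain ⟨x, hx, hax, hbx, hdx, hex⟩ := hc e he
    exact hth (theta3 hab hn (comp_apart he hd hde) (comp_apart he hx hex.symm)
      (comp_apart hd hx hdx.symm) (hlk e hae hbe) (hlk d had hbd) (hlk x hax hbx))
  have hsub : {c ∈ Y | Meet G Ω a b c} ⊆
      {y ∈ Y | Sees G y (comp G Ωᶜ d)} ∪ {y ∈ Y | Sees G y (comp G Ωᶜ e)} := by
    rintro c ⟨hc, x, hx, h1, h2, h3⟩
    rcases hall x hx h1 h2 with h | h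
    · exact Or.inl ⟨hc, h ▸ h3⟩
    · exact Or.inr ⟨hc, h ▸ h3⟩
  have := Set.ncard_le_ncard hsub (Set.toFinite _)
  have := Set.ncard_union_le {y ∈ Y | Sees G y (comp G Ωᶜ d)} {y ∈ Y | Sees G y (comp G Ωᶜ e)}
  have := hL d hd
  have := hL e he
  omega

/-- A connection from `a` to `b` through `c` whose interior otherwise avoids `Ω`. -/
structure Detour (G : SimpleGraph V) (Ω : Set V) (a b c p q : V) : Prop where
  mem : c ∈ Ω
  fst_out : p ∉ Ω
  snd_out : q ∉ Ω
  fst_end : Sees G a (comp G Ωᶜ p)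
  fst_mid : Sees G c (comp G Ωᶜ p)
  snd_end : Sees G b (comp G Ωᶜ q)
  snd_mid : Sees G c (comp G Ωᶜ q)
  not_meet : ¬ Meet G Ω a b c

theorem Detour.lk {Ω : Set V} {a b c p q : V} (h : Detour G Ω a b c p q) (hab : a ≠ b)
    (hn : ¬ G.Adj a b) : Lk G (insert c (comp G Ωᶜ p ∪ comp G Ωᶜ q)) a b := by
  have h1 := ((comp_conn Ωᶜ p).insert h.fst_mid).union_sees (comp_conn Ωᶜ q)
    ⟨c, mem_insert _ _, h.snd_mid⟩
  rw [insert_union] at h1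
  refine (h1.lk hab hn ?_ ?_).mono sdiff_subset
  · exact h.fst_end.mono (subset_union_left.trans (subset_insert _ _))
  · exact h.snd_end.mono (subset_union_right.trans (subset_insert _ _))

theorem apart_comp_of_not_sees {Ω : Set V} {c d : V} (hc : c ∈ Ω) (hd : d ∉ Ω)
    (h : ¬ Sees G c (comp G Ωᶜ d)) : Apart G {c} (comp G Ωᶜ d) := by
  rintro _ rfl b hb
  refine ⟨fun hcb => ?_, fun hcb => h ⟨b, hb, hcb⟩⟩
  exact comp_subset (S := Ωᶜ) hd hb (hcb ▸ hc)

theorem Detour.apart {Ω : Set V} {a b c c' p q p' q' : V} (h : Detour G Ω a b c p q)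
    (h' : Detour G Ω a b c' p' q') (hne : c ≠ c') (hn : ¬ G.Adj c c')
    (ha : ¬ Meet G Ω a c c') (hb : ¬ Meet G Ω b c c') :
    Apart G (insert c (comp G Ωᶜ p ∪ comp G Ωᶜ q)) (insert c' (comp G Ωᶜ p' ∪ comp G Ωᶜ q')) := by
  have key : Apart G ({c} ∪ (comp G Ωᶜ p ∪ comp G Ωᶜ q))
      ({c'} ∪ (comp G Ωᶜ p' ∪ comp G Ωᶜ q')) := by
    refine Apart.union_left (Apart.union_right ?_ (Apart.union_right ?_ ?_))
      (Apart.union_left (Apart.union_right ?_ (Apart.union_right ?_ ?_))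
        (Apart.union_right ?_ (Apart.union_right ?_ ?_)))
    · rintro _ rfl _ rfl
      exact ⟨hne, hn⟩
    · exact apart_comp_of_not_sees h.mem h'.fst_out fun hs =>
        ha ⟨p', h'.fst_out, h'.fst_end, hs, h'.fst_mid⟩
    · exact apart_comp_of_not_sees h.mem h'.snd_out fun hs =>
        hb ⟨q', h'.snd_out, h'.snd_end, hs, h'.snd_mid⟩
    · exact (apart_comp_of_not_sees h'.mem h.fst_out fun hs =>
        ha ⟨p, h.fst_out, h.fst_end, h.fst_mid, hs⟩).symm
    · exact comp_apart h.fst_out h'.fst_out fun he =>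
        ha ⟨p, h.fst_out, h.fst_end, h.fst_mid, he ▸ h'.fst_mid⟩
    · exact comp_apart h.fst_out h'.snd_out fun he =>
        h.not_meet ⟨p, h.fst_out, h.fst_end, he ▸ h'.snd_end, h.fst_mid⟩
    · exact (apart_comp_of_not_sees h'.mem h.snd_out fun hs =>
        hb ⟨q, h.snd_out, h.snd_end, h.snd_mid, hs⟩).symm
    · exact comp_apart h.snd_out h'.fst_out fun he =>
        h.not_meet ⟨q, h.snd_out, he ▸ h'.fst_end, h.snd_end, h.snd_mid⟩
    · exact comp_apart h.snd_out h'.snd_out fun he =>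
        hb ⟨q, h.snd_out, h.snd_end, h.snd_mid, he ▸ h'.snd_mid⟩
  rwa [← insert_eq, ← insert_eq] at key

theorem exists_comp_of_isPMC {Ω : Set V} (h : IsPMC G Ω) {u v : V} (hu : u ∈ Ω) (hv : v ∈ Ω)
    (huv : u ≠ v) (hn : ¬ G.Adj u v) :
    ∃ d ∉ Ω, Sees G u (comp G Ωᶜ d) ∧ Sees G v (comp G Ωᶜ d) := by
  obtain ⟨D, hD, hDΩ, h1, h2⟩ := exists_cover_of_isPMC h hu hv huv hn
  obtain ⟨d, hd⟩ := hD.1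
  exact ⟨d, hDΩ hd, h1.mono (hD.subset_comp hDΩ hd), h2.mono (hD.subset_comp hDΩ hd)⟩

theorem ncard_le_of_isPMC [Finite V] (hth : ¬ HasTheta G) {Ω Y : Set V} (h : IsPMC G Ω)
    (hY : Y ⊆ Ω) (hs : StableSet G Y) {L : ℕ}
    (hL : ∀ d ∉ Ω, {y ∈ Y | Sees G y (comp G Ωᶜ d)}.ncard ≤ L) : Y.ncard ≤ 10 * L + 4 := by
  by_contra hlt
  push Not at hlt
  have pick : ∀ B : Set V, B.ncard < Y.ncard → ∃ c ∈ Y, c ∉ B := fun B hB =>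
    Set.exists_mem_notMem_of_ncard_lt_ncard hB
  have hM : ∀ a ∈ Y, ∀ b ∈ Y, a ≠ b → {c ∈ Y | Meet G Ω a b c}.ncard ≤ 2 * L :=
    fun a ha b hb hab => ncard_meet_le hth hL hab (hs a ha b hb hab)
  obtain ⟨a, ha, -⟩ := pick ∅ (by simp; omega)
  obtain ⟨b, hb, hba⟩ := pick {a} (by simp; omega)
  have hab : a ≠ b := fun h => hba (by simp [h])
  have hn := hs a ha b hb hab
  have branch : ∀ B : Set V, B.ncard ≤ 8 * L + 2 → ∃ c ∈ Y, c ∉ B ∧ a ≠ c ∧ b ≠ c ∧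
      ∃ p q, Detour G Ω a b c p q := by
    intro B hB
    obtain ⟨c, hc, hcB⟩ := pick ({a, b} ∪ {c ∈ Y | Meet G Ω a b c} ∪ B) (by
      have h1 := Set.ncard_union_le ({a, b} ∪ {c ∈ Y | Meet G Ω a b c}) B
      have h2 := Set.ncard_union_le {a, b} {c ∈ Y | Meet G Ω a b c}
      have h3 := hM a ha b hb hab
      have h4 := Set.ncard_pair hab
      omega)
    simp only [mem_union, mem_insert_iff, mem_singleton_iff, mem_ofPred_eq, not_or] at hcB
    have hac : a ≠ c := fun h => hcB.1.1.1 h.symm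
    have hbc : b ≠ c := fun h => hcB.1.1.2 h.symm
    obtain ⟨p, hp, hp1, hp2⟩ := exists_comp_of_isPMC h (hY ha) (hY hc) hac (hs a ha c hc hac)
    obtain ⟨q, hq, hq1, hq2⟩ := exists_comp_of_isPMC h (hY hb) (hY hc) hbc (hs b hb c hc hbc)
    exact ⟨c, hc, hcB.2, hac, hbc, p, q, hY hc, hp, hq, hp1, hp2, hq1, hq2,
      fun hm => hcB.1.2 ⟨hc, hm⟩⟩
  let bad : V → Set V := fun c =>
    {c} ∪ ({x ∈ Y | Meet G Ω a c x} ∪ {x ∈ Y | Meet G Ω b c x})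
  have hbad : ∀ c ∈ Y, a ≠ c → b ≠ c → (bad c).ncard ≤ 4 * L + 1 := by
    intro c hc hac hbc
    have h1 := Set.ncard_union_le {c} ({x ∈ Y | Meet G Ω a c x} ∪ {x ∈ Y | Meet G Ω b c x})
    have h2 := Set.ncard_union_le {x ∈ Y | Meet G Ω a c x} {x ∈ Y | Meet G Ω b c x}
    have h3 := hM a ha c hc hac
    have h4 := hM b hb c hc hbc
    have h5 := Set.ncard_singleton c
    show ({c} ∪ ({x ∈ Y | Meet G Ω a c x} ∪ {x ∈ Y | Meet G Ω b c x})).ncard ≤ _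
    omega
  have apart : ∀ {c c' p q p' q'}, c ∈ Y → c' ∈ Y → c' ∉ bad c → Detour G Ω a b c p q →
      Detour G Ω a b c' p' q' → Apart G (insert c (comp G Ωᶜ p ∪ comp G Ωᶜ q))
        (insert c' (comp G Ωᶜ p' ∪ comp G Ωᶜ q')) := by
    intro c c' p q p' q' hc hc' hb hD hD'
    have hne : c ≠ c' := fun h => hb (Or.inl h.symm)
    exact hD.apart hD' hne (hs c hc c' hc' hne) (fun hm => hb (Or.inr (Or.inl ⟨hc', hm⟩)))
      fun hm => hb (Or.inr (Or.inr ⟨hc', hm⟩))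
  obtain ⟨c₀, hc₀, -, ha₀, hb₀, p₀, q₀, hD₀⟩ := branch ∅ (by simp)
  obtain ⟨c₁, hc₁, h01, ha₁, hb₁, p₁, q₁, hD₁⟩ := branch (bad c₀) (by
    have := hbad c₀ hc₀ ha₀ hb₀
    omega)
  obtain ⟨c₂, hc₂, h2, -, -, p₂, q₂, hD₂⟩ := branch (bad c₀ ∪ bad c₁) (by
    have := hbad c₀ hc₀ ha₀ hb₀
    have := hbad c₁ hc₁ ha₁ hb₁
    have := Set.ncard_union_le (bad c₀) (bad c₁)
    omega)
  exact hth (theta3 hab hn (apart hc₀ hc₁ h01 hD₀ hD₁)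
    (apart hc₀ hc₂ (fun h => h2 (Or.inl h)) hD₀ hD₂)
    (apart hc₁ hc₂ (fun h => h2 (Or.inr h)) hD₁ hD₂) (hD₀.lk hab hn) (hD₁.lk hab hn)
    (hD₂.lk hab hn))

end LargeComponent

end NonHub

/-- stable sets of non-hubs in bags of structured tree decompositions of
graphs in `𝒞ₜₜ` have bounded size. -/
theorem stmt_17 (t : ℕ) :
    ∃ Ψ : ℕ, ∀ (V ι : Type) [Fintype V] (G : SimpleGraph V),
      MemCtt t G → ∀ (T : SimpleGraph ι) (χ : ι → Set V), StructuredTD G T χ →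
      ∀ (v : ι) (Y : Set V), Y ⊆ χ v → (∀ y ∈ Y, ¬ IsHub G y) → StableSet G Y →
      Y.ncard ≤ Ψ := by
  obtain ⟨N, hN⟩ := NonHub.exists_sides_bound t
  refine ⟨10 * N + 4, fun V ι _ G hG T χ hT v Y hY hub hs => ?_⟩
  refine NonHub.ncard_le_of_isPMC hG.1.1.2.1 (hT.2 v) hY hs fun d hd => ?_
  obtain ⟨D₁, D₂, h⟩ := NonHub.exists_sides_of_isPMC (hT.2 v) hY hs hub hd
  exact (hN V G D₁ D₂ _ hG h).le
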